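/- There exist absolute constants δ₀ > 0 and C > 0 such that: for every centrally symmetric convex body K ⊂ ℝ³ and every δ ∈ (0, δ₀) with |K|·|K°| ≤ (1+δ)·(32/3), one has min{d_BM(K, B∞³), d_BM(K, B₁³)} ≤ 1 + Cδ. -/

import Mathlib

open MeasureTheory Pointwise
open scoped RealInnerProductSpace

/-- The Banach–Mazur distance between symmetric convex bodies. -/
noncomputable def dBM {E : Type*} [NormedAddCommGroup E] [NormedSpace ℝ E]
    (K L : Set E) : ℝ :=
  sInf {d : ℝ | 1 ≤ d ∧ ∃ T : E ≃ₗ[ℝ] E, L ⊆ T '' K ∧ T '' K ⊆ d • L}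

set_option linter.all false

namespace Mah

/-! ### TOP lemma: combinatorial core -/

theorem comb_core (N : ℕ) (mXY mXZ mYZ s : ℕ → ℕ → ℕ → ℤ)
    (cube : ∀ a < 4*N, ∀ b < N, ∀ k < N, (mXY a b (k+1) - mXY a b k) - (mXZ a (b+1) k - mXZ a b k)
      + (mYZ (a+1) b k - mYZ a b k) = 0)
    (cXY : ∀ a < 4*N, ∀ b < N, ∀ k < N, s a b k * mXY a b (k+1) = s a b (k+1) * mXY a b (k+1))
    (cXZ : ∀ a < 4*N, ∀ b < N, ∀ k < N, s a b k * mXZ a (b+1) k = s a (b+1) k * mXZ a (b+1) k)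
    (cYZ : ∀ a < 4*N, ∀ b < N, ∀ k < N, s a b k * mYZ (a+1) b k = s (a+1) b k * mYZ (a+1) b k)
    (flip : ∀ a < 4*N, ∀ b < N, s a b N * mXY a b N = (1 - s a b 0) * mXY a b 0)
    (zero : ∀ a, ∀ k < N, mXZ a 0 k = 0)
    (refl : ∀ a < 2*N, ∀ k < N, s (a+2*N) N (N-1-k) * mXZ (a+2*N) N (N-1-k) = s a N k * mXZ a N k)
    (per : ∀ b < N, ∀ k < N, s (4*N) b k * mYZ (4*N) b k = s 0 b k * mYZ 0 b k) :
    Even (∑ a ∈ Finset.range (4*N), ∑ b ∈ Finset.range N, mXY a b 0) := by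
  have tot : ∑ a ∈ Finset.range (4*N), ∑ b ∈ Finset.range N, ∑ k ∈ Finset.range N,
      ((s a b (k+1) * mXY a b (k+1) - s a b k * mXY a b k)
        - (s a (b+1) k * mXZ a (b+1) k - s a b k * mXZ a b k)
        + (s (a+1) b k * mYZ (a+1) b k - s a b k * mYZ a b k)) = 0 := by
    refine Finset.sum_eq_zero fun a ha => Finset.sum_eq_zero fun b hb => Finset.sum_eq_zero fun k hk => ?_
    rw [Finset.mem_range] at ha hb hk
    rw [← cXY a ha b hb k hk, ← cXZ a ha b hb k hk, ← cYZ a ha b hb k hk]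
    linear_combination s a b k * cube a ha b hb k hk
  simp only [Finset.sum_add_distrib, Finset.sum_sub_distrib (f := fun x => s _ _ (x+1) * mXY _ _ (x+1) - _)] at tot
  have h1 : ∑ a ∈ Finset.range (4*N), ∑ b ∈ Finset.range N, ∑ k ∈ Finset.range N,
      (s a b (k+1) * mXY a b (k+1) - s a b k * mXY a b k)
      = ∑ a ∈ Finset.range (4*N), ∑ b ∈ Finset.range N, (1 - 2 * s a b 0) * mXY a b 0 := by
    refine Finset.sum_congr rfl fun a ha => Finset.sum_congr rfl fun b hb => ?_
    rw [Finset.sum_range_sub (fun k => s a b k * mXY a b k), flip a (Finset.mem_range.1 ha) b (Finset.mem_range.1 hb)]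
    ring
  have h2 : ∑ a ∈ Finset.range (4*N), ∑ b ∈ Finset.range N, ∑ k ∈ Finset.range N,
      (s a (b+1) k * mXZ a (b+1) k - s a b k * mXZ a b k)
      = ∑ a ∈ Finset.range (4*N), ∑ k ∈ Finset.range N, s a N k * mXZ a N k := by
    refine Finset.sum_congr rfl fun a _ => ?_
    rw [Finset.sum_comm]
    refine Finset.sum_congr rfl fun k hk => ?_
    rw [Finset.sum_range_sub (fun b => s a b k * mXZ a b k), zero a k (Finset.mem_range.1 hk)]
    ring
  have h3 : ∑ a ∈ Finset.range (4*N), ∑ b ∈ Finset.range N, ∑ k ∈ Finset.range N,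
      (s (a+1) b k * mYZ (a+1) b k - s a b k * mYZ a b k) = 0 := by
    rw [Finset.sum_comm]
    refine Finset.sum_eq_zero fun b hb => ?_
    rw [Finset.sum_comm]
    refine Finset.sum_eq_zero fun k hk => ?_
    rw [Finset.sum_range_sub (fun a => s a b k * mYZ a b k),
      per b (Finset.mem_range.1 hb) k (Finset.mem_range.1 hk), sub_self]
  have h4 : ∑ a ∈ Finset.range (4*N), ∑ k ∈ Finset.range N, s a N k * mXZ a N k
      = 2 * ∑ a ∈ Finset.range (2*N), ∑ k ∈ Finset.range N, s a N k * mXZ a N k := by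
    rw [show 4*N = 2*N + 2*N by ring, Finset.sum_range_add]
    suffices h : ∑ a ∈ Finset.range (2*N), ∑ k ∈ Finset.range N, s (2*N+a) N k * mXZ (2*N+a) N k
      = ∑ a ∈ Finset.range (2*N), ∑ k ∈ Finset.range N, s a N k * mXZ a N k by linarith
    refine Finset.sum_congr rfl fun a ha => ?_
    rw [← Finset.sum_range_reflect (fun k => s (2*N+a) N k * mXZ (2*N+a) N k)]
    refine Finset.sum_congr rfl fun k hk => ?_
    rw [add_comm (2*N) a]
    exact refl a (Finset.mem_range.1 ha) k (Finset.mem_range.1 hk)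
  simp only [Finset.sum_sub_distrib] at h1 h2 h3 tot
  have h5 : ∑ a ∈ Finset.range (4*N), ∑ b ∈ Finset.range N, (1 - 2 * s a b 0) * mXY a b 0
     = ∑ a ∈ Finset.range (4*N), ∑ b ∈ Finset.range N, mXY a b 0
      - 2 * ∑ a ∈ Finset.range (4*N), ∑ b ∈ Finset.range N, s a b 0 * mXY a b 0 := by
    simp only [Finset.mul_sum, ← Finset.sum_sub_distrib]
    refine Finset.sum_congr rfl fun a _ => Finset.sum_congr rfl fun b _ => by ring
  rw [even_iff_two_dvd]
  refine ⟨∑ a ∈ Finset.range (4*N), ∑ b ∈ Finset.range N, s a b 0 * mXY a b 0 +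
    ∑ a ∈ Finset.range (2*N), ∑ k ∈ Finset.range N, s a N k * mXZ a N k, ?_⟩
  linarith


open Classical in
noncomputable def inc (fl : Prop) (x y : ℂ) : ℝ :=
  if fl then -(Complex.arg ((starRingEnd ℂ) (y / x))) else Complex.arg (y / x)

theorem inc_I (fl : Prop) (x y : ℂ) : inc fl (Complex.I * x) (Complex.I * y) = inc fl x y := by
  unfold inc
  rw [mul_div_mul_left _ _ Complex.I_ne_zero]

theorem inc_angle (fl : Prop) {x y : ℂ} (hx : x ≠ 0) (hy : y ≠ 0) :
    ((inc fl x y : ℝ) : Real.Angle) = (y.arg : Real.Angle) - (x.arg : Real.Angle) := by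
  unfold inc
  split_ifs
  · rw [Real.Angle.coe_neg, Complex.arg_conj_coe_angle, neg_neg, Complex.arg_div_coe_angle hy hx]
  · exact Complex.arg_div_coe_angle hy hx

theorem arg_div_of_re_pos {x y : ℂ} (hx : 0 < x.re) (hy : 0 < y.re) :
    (y / x).arg = y.arg - x.arg := by
  have hx0 : x ≠ 0 := by rintro rfl; simp at hx
  have hy0 : y ≠ 0 := by rintro rfl; simp at hy
  have h1 := Complex.abs_arg_lt_pi_div_two_iff.2 (Or.inl hx)
  have h2 := Complex.abs_arg_lt_pi_div_two_iff.2 (Or.inl hy)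
  rw [abs_lt] at h1 h2
  have h := Complex.arg_div_coe_angle hy0 hx0
  rw [← Real.Angle.coe_sub] at h
  have := congrArg Real.Angle.toReal h
  rw [Real.Angle.toReal_coe_eq_self_iff.2 ⟨Complex.neg_pi_lt_arg _, Complex.arg_le_pi _⟩,
    Real.Angle.toReal_coe_eq_self_iff.2 ⟨by linarith, by linarith⟩] at this
  exact this

theorem inc_of_good (fl : Prop) {c x y : ℂ} (hc : c ≠ 0) (hx : 0 < (x / c).re) (hy : 0 < (y / c).re) :
    inc fl x y = (y / c).arg - (x / c).arg := by
  have e : y / x = (y / c) / (x / c) := by field_simp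
  have h := arg_div_of_re_pos hx hy
  unfold inc
  split_ifs
  · rw [Complex.arg_conj, if_neg, neg_neg, e, h]
    have h1 := Complex.abs_arg_lt_pi_div_two_iff.2 (Or.inl hx)
    have h2 := Complex.abs_arg_lt_pi_div_two_iff.2 (Or.inl hy)
    rw [abs_lt] at h1 h2
    rw [e, h]
    intro h3
    linarith
  · rw [e, h]

theorem square_int (f1 f2 f3 f4 : Prop) {x y z w : ℂ} (hx : x ≠ 0) (hy : y ≠ 0) (hz : z ≠ 0) (hw : w ≠ 0) :
    ∃ m : ℤ, inc f1 x y + inc f2 y w - inc f3 z w - inc f4 x z = m * (2 * Real.pi) := by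
  have : ((inc f1 x y + inc f2 y w - inc f3 z w - inc f4 x z : ℝ) : Real.Angle) = 0 := by
    rw [Real.Angle.coe_sub, Real.Angle.coe_sub, Real.Angle.coe_add, inc_angle _ hx hy, inc_angle _ hy hw,
      inc_angle _ hz hw, inc_angle _ hx hz]
    abel
  obtain ⟨m, hm⟩ := Real.Angle.coe_eq_zero_iff.1 this
  exact ⟨m, by rw [← hm]; simp⟩

theorem top_disc (N : ℕ) (hN : 0 < N) (L : ℕ → ℕ → ℕ → ℂ) (s : ℕ → ℕ → ℕ → ℤ) (hL : ∀ a b k, L a b k ≠ 0)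
    (hper : ∀ a b k, L (a + 4*N) b k = L a b k) (sper : ∀ a b k, s (a + 4*N) b k = s a b k)
    (hI : ∀ a b, L a b N = Complex.I * L a b 0)
    (M : ℕ → ℂ) (h0 : ∀ a k, L a 0 k = M (a + k))
    (h1 : ∀ a, ∀ k ≤ N, L (a+2*N) N (N-k) = -Complex.I * (starRingEnd ℂ) (L a N k))
    (s1 : ∀ a, ∀ k ≤ N, s (a+2*N) N (N-k) = s a N k)
    (dich : ∀ a < 4*N, ∀ b < N, ∀ k < N,
      (∃ c : ℂ, c ≠ 0 ∧ ∀ i ≤ 1, ∀ j ≤ 1, ∀ l ≤ 1, 0 < (L (a+i) (b+j) (k+l) / c).re) ∨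
      ((∀ i ≤ 1, ∀ j ≤ 1, ∀ l ≤ 1, s (a+i) (b+j) (k+l) = s a b k) ∧ (k = 0 → s a b N = 1 - s a b 0))) :
    False := by
  have hpi := Real.pi_pos
  set X : ℕ → ℕ → ℕ → ℝ := fun a b k => inc (b = N ∧ 2*N ≤ a % (4*N)) (L a b k) (L (a+1) b k) with hX
  set Y : ℕ → ℕ → ℕ → ℝ := fun a b k => inc False (L a b k) (L a (b+1) k) with hY
  set Z : ℕ → ℕ → ℕ → ℝ := fun a b k => inc False (L a b k) (L a b (k+1)) with hZ
  have eXY : ∀ a b k, ∃ m : ℤ, X a b k + Y (a+1) b k - X a (b+1) k - Y a b k = m * (2*Real.pi) :=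
    fun a b k => square_int _ _ _ _ (hL _ _ _) (hL _ _ _) (hL _ _ _) (hL _ _ _)
  have eXZ : ∀ a b k, ∃ m : ℤ, X a b k + Z (a+1) b k - X a b (k+1) - Z a b k = m * (2*Real.pi) :=
    fun a b k => square_int _ _ _ _ (hL _ _ _) (hL _ _ _) (hL _ _ _) (hL _ _ _)
  have eYZ : ∀ a b k, ∃ m : ℤ, Y a b k + Z a (b+1) k - Y a b (k+1) - Z a b k = m * (2*Real.pi) :=
    fun a b k => square_int _ _ _ _ (hL _ _ _) (hL _ _ _) (hL _ _ _) (hL _ _ _)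
  choose mXY hXY using eXY
  choose mXZ hXZ using eXZ
  choose mYZ hYZ using eYZ
  have cancel : ∀ m n : ℤ, (m:ℝ) * (2*Real.pi) = n * (2*Real.pi) → m = n := fun m n h => by
    have := mul_right_cancel₀ (by positivity) h
    exact_mod_cast this
  have cancel0 : ∀ m : ℤ, (m:ℝ) * (2*Real.pi) = 0 → m = 0 := fun m h => by
    apply cancel; rw [h]; simp
  -- I-invariance
  have XI : ∀ a b, X a b N = X a b 0 := fun a b => by
    simp only [hX, hI, inc_I]
  have YI : ∀ a b, Y a b N = Y a b 0 := fun a b => by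
    simp only [hY, hI, inc_I]
  have Yper : ∀ a b k, Y (a+4*N) b k = Y a b k := fun a b k => by simp only [hY, hper]
  have Zper : ∀ a b k, Z (a+4*N) b k = Z a b k := fun a b k => by simp only [hZ, hper]
  have Xref : ∀ a, ∀ k ≤ N, X (a+2*N) N (N-k) = - X a N k := fun a k hk => by
    have e : L (a+2*N+1) N (N-k) / L (a+2*N) N (N-k) = (starRingEnd ℂ) (L (a+1) N k / L a N k) := by
      rw [show a+2*N+1 = (a+1)+2*N by ring, h1 _ _ hk, h1 _ _ hk, mul_div_mul_left _ _ (by simp), map_div₀]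
    simp only [hX, inc, true_and, e, Complex.conj_conj]
    have hlt : a % (4*N) < 4*N := Nat.mod_lt _ (by omega)
    have hm : (a+2*N) % (4*N) = if a % (4*N) < 2*N then a % (4*N) + 2*N else a % (4*N) - 2*N := by
      rw [Nat.add_mod, Nat.mod_eq_of_lt (show 2*N < 4*N by omega)]
      split_ifs with h
      · exact Nat.mod_eq_of_lt (by omega)
      · rw [Nat.mod_eq_sub_mod (by omega), Nat.mod_eq_of_lt (by omega)]; omega
    rw [hm]
    by_cases h : a % (4*N) < 2*N
    · rw [if_pos h, if_pos (by omega), if_neg (by omega)]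
    · rw [if_neg h, if_neg (by omega), if_pos (by omega), neg_neg]
  have Zref : ∀ a, ∀ k < N, Z (a+2*N) N (N-1-k) = Z a N k := fun a k hk => by
    simp only [hZ, inc, if_false]
    have e : L (a+2*N) N (N-1-k+1) / L (a+2*N) N (N-1-k) =
        (starRingEnd ℂ) (L a N k / L a N (k+1)) := by
      rw [show N-1-k+1 = N-k by omega, show N-1-k = N-(k+1) by omega, h1 _ _ hk.le, h1 _ _ (by omega),
        mul_div_mul_left _ _ (by simp), map_div₀]
    rw [e, Complex.arg_conj, ← Complex.arg_inv, inv_div]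
  -- goodness
  have good : ∀ a < 4*N, ∀ b < N, ∀ k < N, (mXY a b k = 0 ∧ mXY a b (k+1) = 0 ∧ mXZ a (b+1) k = 0 ∧ mYZ (a+1) b k = 0) ∨
      ((∀ i ≤ 1, ∀ j ≤ 1, ∀ l ≤ 1, s (a+i) (b+j) (k+l) = s a b k) ∧ (k = 0 → s a b N = 1 - s a b 0)) := by
    intro a ha b hb k hk
    rcases dich a ha b hb k hk with ⟨c, hc, h⟩ | h
    · left
      have p000 := h 0 (by simp) 0 (by simp) 0 (by simp)
      have p001 := h 0 (by simp) 0 (by simp) 1 (by simp)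
      have p010 := h 0 (by simp) 1 (by simp) 0 (by simp)
      have p011 := h 0 (by simp) 1 (by simp) 1 (by simp)
      have p100 := h 1 (by simp) 0 (by simp) 0 (by simp)
      have p101 := h 1 (by simp) 0 (by simp) 1 (by simp)
      have p110 := h 1 (by simp) 1 (by simp) 0 (by simp)
      have p111 := h 1 (by simp) 1 (by simp) 1 (by simp)
      simp only [add_zero] at p000 p001 p010 p011 p100 p101 p110 p111
      refine ⟨?_, ?_, ?_, ?_⟩
      · apply cancel0
        rw [← hXY]
        simp only [hX, hY]
        rw [inc_of_good _ hc p000 p100, inc_of_good _ hc p100 p110, inc_of_good _ hc p010 p110, inc_of_good _ hc p000 p010]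
        ring
      · apply cancel0
        rw [← hXY]
        simp only [hX, hY]
        rw [inc_of_good _ hc p001 p101, inc_of_good _ hc p101 p111, inc_of_good _ hc p011 p111, inc_of_good _ hc p001 p011]
        ring
      · apply cancel0
        rw [← hXZ]
        simp only [hX, hZ]
        rw [inc_of_good _ hc p010 p110, inc_of_good _ hc p110 p111, inc_of_good _ hc p011 p111, inc_of_good _ hc p010 p011]
        ring
      · apply cancel0
        rw [← hYZ]
        simp only [hY, hZ]
        rw [inc_of_good _ hc p100 p110, inc_of_good _ hc p110 p111, inc_of_good _ hc p101 p111, inc_of_good _ hc p100 p101]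
        ring
    · exact Or.inr h
  have mXYI : ∀ a b, mXY a b N = mXY a b 0 := fun a b => by
    apply cancel; rw [← hXY, ← hXY, XI, XI, YI, YI]
  have ev : Even (∑ a ∈ Finset.range (4*N), ∑ b ∈ Finset.range N, mXY a b 0) := by
    refine comb_core N mXY mXZ mYZ s ?_ ?_ ?_ ?_ ?_ ?_ ?_ ?_
    · intro a ha b hb k hk
      apply cancel0
      push_cast
      have := hXY a b (k+1); have := hXY a b k; have := hXZ a (b+1) k; have := hXZ a b k
      have := hYZ (a+1) b k; have := hYZ a b k
      linarith
    · intro a ha b hb k hk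
      rcases good a ha b hb k hk with h | h
      · rw [h.2.1]; simp
      · rw [← h.1 0 (by simp) 0 (by simp) 1 (by simp)]; simp
    · intro a ha b hb k hk
      rcases good a ha b hb k hk with h | h
      · rw [h.2.2.1]; simp
      · rw [← h.1 0 (by simp) 1 (by simp) 0 (by simp)]; simp
    · intro a ha b hb k hk
      rcases good a ha b hb k hk with h | h
      · rw [h.2.2.2]; simp
      · rw [← h.1 1 (by simp) 0 (by simp) 0 (by simp)]; simp
    · intro a ha b hb
      rw [mXYI]
      rcases good a ha b hb 0 hN with h | h
      · rw [h.1]; simp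
      · rw [h.2 rfl]
    · intro a k hk
      apply cancel0
      rw [← hXZ]
      simp only [hX, hZ, h0, hN.ne, false_and]
      rw [show a + 1 + k = a + (k+1) by ring, show a + 1 + (k+1) = a + (k+1) + 1 by ring]
      have : a + k + 1 = a + (k+1) := by ring
      ring
    · intro a ha k hk
      have e1 : mXZ (a+2*N) N (N-1-k) = mXZ a N k := by
        apply cancel
        rw [← hXZ, ← hXZ, Zref a k hk, show a+2*N+1 = (a+1)+2*N by ring, Zref (a+1) k hk,
          show N-1-k+1 = N-k by omega, show N-1-k = N-(k+1) by omega, Xref _ _ hk.le, Xref _ _ (by omega)]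
        ring
      rw [e1, show N-1-k = N-(k+1) by omega, s1 a (k+1) (by omega)]
      obtain ⟨b, rfl⟩ : ∃ b, N = b + 1 := ⟨N-1, by omega⟩
      rcases good a (by omega) b (by omega) k hk with h | h
      · rw [h.2.2.1]; simp
      · have t1 := h.1 0 (by simp) 1 (by simp) 1 (by simp)
        have t2 := h.1 0 (by simp) 1 (by simp) 0 (by simp)
        simp only [add_zero] at t1 t2
        rw [t1, t2]
    · intro b hb k hk
      have e1 : mYZ (4*N) b k = mYZ 0 b k := by
        apply cancel
        rw [← hYZ, ← hYZ]
        have y0 := Yper 0; have z0 := Zper 0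
        simp only [zero_add] at y0 z0
        rw [y0, z0, y0, z0]
      have := sper 0 b k
      rw [zero_add] at this
      rw [e1, this]
  -- value of the sum
  have sumval : (∑ a ∈ Finset.range (4*N), ∑ b ∈ Finset.range N, (mXY a b 0 : ℝ)) * (2*Real.pi)
      = ∑ a ∈ Finset.range (4*N), X a 0 0 - ∑ a ∈ Finset.range (4*N), X a N 0 := by
    rw [Finset.sum_mul]
    have : ∀ a ∈ Finset.range (4*N), (∑ b ∈ Finset.range N, (mXY a b 0 : ℝ)) * (2*Real.pi)
        = (X a 0 0 - X a N 0) + (∑ b ∈ Finset.range N, Y (a+1) b 0 - ∑ b ∈ Finset.range N, Y a b 0) := by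
      intro a _
      rw [Finset.sum_mul, ← Finset.sum_range_sub' (fun b => X a b 0), ← Finset.sum_sub_distrib, ← Finset.sum_add_distrib]
      refine Finset.sum_congr rfl fun b _ => ?_
      rw [← hXY]; ring
    rw [Finset.sum_congr rfl this, Finset.sum_add_distrib, Finset.sum_range_sub (fun a => ∑ b ∈ Finset.range N, Y a b 0),
      Finset.sum_sub_distrib]
    have := Yper 0
    simp only [zero_add] at this
    simp only [this, sub_self, add_zero]
  have sumN : ∑ a ∈ Finset.range (4*N), X a N 0 = 0 := by
    rw [show 4*N = 2*N+2*N by ring, Finset.sum_range_add, ← Finset.sum_add_distrib]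
    refine Finset.sum_eq_zero fun a _ => ?_
    have := Xref a N le_rfl
    rw [Nat.sub_self, XI] at this
    rw [add_comm (2*N) a, this]; ring
  have hX0 : ∀ a, X a 0 0 = inc False (M a) (M (a+1)) := fun a => by
    simp only [hX, h0, hN.ne, false_and, add_zero]
  have hM : ∀ a, M a ≠ 0 := fun a => by have := hL a 0 0; rwa [h0] at this
  have hMI : ∀ a, M (a+N) = Complex.I * M a := fun a => by
    have := hI a 0; rwa [h0, h0] at this
  have hXN : ∀ a, X (a+N) 0 0 = X a 0 0 := fun a => by
    rw [hX0, hX0]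
    simp only [inc]
    rw [show a+N+1 = (a+1)+N by ring, hMI, hMI, mul_div_mul_left _ _ Complex.I_ne_zero]
  have sum0 : ∑ a ∈ Finset.range (4*N), X a 0 0 = 4 * ∑ a ∈ Finset.range N, X a 0 0 := by
    rw [show 4*N = N+N+N+N by ring, Finset.sum_range_add, Finset.sum_range_add, Finset.sum_range_add]
    have e1 : ∀ a, X (N+a) 0 0 = X a 0 0 := fun a => by rw [add_comm, hXN]
    have e2 : ∀ a, X (N+N+a) 0 0 = X a 0 0 := fun a => by rw [add_assoc, e1, e1]
    have e3 : ∀ a, X (N+N+N+a) 0 0 = X a 0 0 := fun a => by rw [add_assoc, e2, e1]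
    simp only [e1, e2, e3]
    ring
  have hang : ((∑ a ∈ Finset.range N, X a 0 0 : ℝ) : Real.Angle) = ((Real.pi/2 : ℝ) : Real.Angle) := by
    have : ∀ n, ((∑ a ∈ Finset.range n, X a 0 0 : ℝ) : Real.Angle) = ((M n).arg : Real.Angle) - ((M 0).arg : Real.Angle) := by
      intro n
      induction n with
      | zero => simp
      | succ n ih =>
        rw [Finset.sum_range_succ, Real.Angle.coe_add, ih, hX0, inc_angle _ (hM _) (hM _)]
        abel
    rw [this, ← Complex.arg_div_coe_angle (hM _) (hM _)]
    have := hMI 0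
    rw [zero_add] at this
    rw [this, mul_div_assoc, div_self (hM 0), mul_one, Complex.arg_I]
  obtain ⟨n, hn⟩ := Real.Angle.angle_eq_iff_two_pi_dvd_sub.1 hang
  obtain ⟨q, hq⟩ := ev
  have hq' : (∑ a ∈ Finset.range (4*N), ∑ b ∈ Finset.range N, (mXY a b 0 : ℝ)) = q + q := by
    exact_mod_cast hq
  rw [hq', sumN, sum0] at sumval
  have : (((q + q : ℤ)) : ℝ) * (2*Real.pi) = ((1 + 4*n : ℤ) : ℝ) * (2*Real.pi) := by
    push_cast
    linarith
  have := cancel _ _ this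
  omega


open Classical in
theorem top_lemma (f : ℝ → ℝ → ℝ → ℝ) (c : ℝ → ℝ → ℝ → ℂ)
    (hf : Continuous fun p : ℝ × ℝ × ℝ => f p.1 p.2.1 p.2.2)
    (hc : Continuous fun p : ℝ × ℝ × ℝ => c p.1 p.2.1 p.2.2)
    (fper : ∀ t β ψ, f (t+4) β ψ = f t β ψ) (cper : ∀ t β ψ, c (t+4) β ψ = c t β ψ)
    (fI : ∀ t β, f t β 1 = - f t β 0) (cI : ∀ t β, c t β 1 = Complex.I * c t β 0)
    (f0 : ∀ t ψ, f t 0 ψ = f 0 0 (t+ψ)) (c0 : ∀ t ψ, c t 0 ψ = c 0 0 (t+ψ))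
    (f1 : ∀ t ψ, f (t+2) 1 (1-ψ) = f t 1 ψ)
    (c1 : ∀ t ψ, c (t+2) 1 (1-ψ) = -Complex.I * (starRingEnd ℂ) (c t 1 ψ)) :
    ∃ t β ψ, f t β ψ = 0 ∧ c t β ψ = 0 := by
  by_contra hno
  push Not at hno
  set F : ℝ × ℝ × ℝ → ℝ := fun p => f p.1 p.2.1 p.2.2 with hF
  set G : ℝ × ℝ × ℝ → ℂ := fun p => c p.1 p.2.1 p.2.2 with hG
  set S : Set (ℝ × ℝ × ℝ) := Set.Icc 0 5 ×ˢ Set.Icc 0 1 ×ˢ Set.Icc 0 1 with hS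
  have hSc : IsCompact S := isCompact_Icc.prod (isCompact_Icc.prod isCompact_Icc)
  have hSn : S.Nonempty := ⟨(0,0,0), by simp [hS]⟩
  obtain ⟨p0, hp0, hmin⟩ := hSc.exists_isMinOn hSn
    (f := fun p => max |F p| ‖G p‖) (by fun_prop)
  set ε := max |F p0| ‖G p0‖ with hε
  have hε0 : 0 < ε := by
    by_cases h : F p0 = 0
    · have := hno _ _ _ h
      exact lt_max_of_lt_right (norm_pos_iff.2 this)
    · exact lt_max_of_lt_left (abs_pos.2 h)
  have huF := Metric.uniformContinuousOn_iff.1 (hSc.uniformContinuousOn_of_continuous hf.continuousOn) (ε/2) (by positivity)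
  have huG := Metric.uniformContinuousOn_iff.1 (hSc.uniformContinuousOn_of_continuous hc.continuousOn) (ε/2) (by positivity)
  obtain ⟨d1, hd1, huF⟩ := huF
  obtain ⟨d2, hd2, huG⟩ := huG
  obtain ⟨n, hn⟩ := exists_nat_one_div_lt (lt_min hd1 hd2)
  set N := n + 1 with hNdef
  have hN : 0 < N := Nat.succ_pos n
  have hNR : (0:ℝ) < N := by exact_mod_cast hN
  have hNn : (N:ℝ) ≠ 0 := hNR.ne'
  have hNC : (N:ℂ) ≠ 0 := by exact_mod_cast hN.ne'
  have hn' : 1 / (N:ℝ) < min d1 d2 := by rw [hNdef]; push_cast; exact hn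
  set η : ℕ → ℕ → ℕ → ℂ := fun a b k =>
    Complex.I * Complex.exp (Complex.I * (Real.pi/2) * (((if b = 0 then a else 0) + k : ℕ) : ℂ) / N) with hη
  set P : ℕ → ℕ → ℕ → ℂ := fun a b k => c (a/N) (b/N) (k/N) with hP
  set M : ℕ → ℂ := fun j => if c 0 0 (j/N) = 0 then
    Complex.I * Complex.exp (Complex.I * (Real.pi/2) * (j : ℂ) / N) else c 0 0 (j/N) with hM
  set L : ℕ → ℕ → ℕ → ℂ := fun a b k => if P a b k = 0 then η a b k else P a b k with hL
  set s : ℕ → ℕ → ℕ → ℤ := fun a b k => if 0 < f (a/N) (b/N) (k/N) then 1 else 0 with hs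
  have e4 : ∀ a : ℕ, ((a + 4*N : ℕ):ℝ)/N = a/N + 4 := fun a => by push_cast; field_simp
  have e2 : ∀ a : ℕ, ((a + 2*N : ℕ):ℝ)/N = a/N + 2 := fun a => by push_cast; field_simp
  have ek : ∀ k ≤ N, ((N - k : ℕ):ℝ)/N = 1 - k/N := fun k hk => by rw [Nat.cast_sub hk]; field_simp
  have expI : Complex.exp (Complex.I * (Real.pi/2)) = Complex.I := by
    rw [mul_comm]; exact Complex.exp_pi_div_two_mul_I
  have etaI : ∀ m : ℕ, Complex.exp (Complex.I * (Real.pi/2) * ((m + N : ℕ) : ℂ) / N)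
      = Complex.I * Complex.exp (Complex.I * (Real.pi/2) * (m : ℂ) / N) := fun m => by
    rw [← expI, ← Complex.exp_add, expI]
    congr 1
    push_cast
    field_simp
    ring
  have eta4 : ∀ m : ℕ, Complex.exp (Complex.I * (Real.pi/2) * ((m + 4*N : ℕ) : ℂ) / N)
      = Complex.exp (Complex.I * (Real.pi/2) * (m : ℂ) / N) := fun m => by
    rw [show m + 4*N = m+N+N+N+N by ring, etaI, etaI, etaI, etaI, ← mul_assoc, ← mul_assoc, ← mul_assoc]
    simp
  refine top_disc N hN L s ?_ ?_ ?_ ?_ M ?_ ?_ ?_ ?_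
  · intro a b k
    simp only [hL]
    split_ifs with h
    · exact mul_ne_zero Complex.I_ne_zero (Complex.exp_ne_zero _)
    · exact h
  · intro a b k
    have hp : P (a+4*N) b k = P a b k := by simp only [hP, e4, cper]
    have he : η (a+4*N) b k = η a b k := by
      simp only [hη]
      split_ifs
      · rw [show a + 4*N + k = (a+k) + 4*N by ring, eta4]
      · rfl
    simp only [hL, hp, he]
  · intro a b k
    simp only [hs, e4, fper]
  · intro a b
    have hp : P a b N = Complex.I * P a b 0 := by
      simp only [hP, div_self hNn, cI, Nat.cast_zero, zero_div]
    have he : η a b N = Complex.I * η a b 0 := by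
      simp only [hη]
      rw [etaI, add_zero]
    simp only [hL, hp, he, mul_eq_zero, Complex.I_ne_zero, false_or]
    split_ifs <;> rfl
  · intro a k
    have hp : P a 0 k = c 0 0 ((a+k:ℕ)/N) := by
      simp only [hP, Nat.cast_zero, zero_div]; rw [c0]; congr 1; push_cast; ring
    simp only [hL, hM, hp, hη, if_true]
  · intro a k hk
    have hp : P (a+2*N) N (N-k) = -Complex.I * (starRingEnd ℂ) (P a N k) := by
      simp only [hP, e2, ek k hk, div_self hNn, c1]
    have he : η (a+2*N) N (N-k) = -Complex.I * (starRingEnd ℂ) (η a N k) := by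
      simp only [hη, hN.ne', if_false, zero_add]
      rw [map_mul, Complex.conj_I, ← Complex.exp_conj]
      have e : (starRingEnd ℂ) (Complex.I * (Real.pi/2) * (k:ℂ) / N) = -(Complex.I * (Real.pi/2) * (k:ℂ) / N) := by
        simp [Complex.conj_ofNat, neg_div]
      rw [e]
      have : Complex.exp (Complex.I * (Real.pi/2) * ((N - k : ℕ) : ℂ) / N) =
          Complex.I * Complex.exp (-(Complex.I * (Real.pi/2) * (k:ℂ) / N)) := by
        rw [← expI, ← Complex.exp_add, expI]
        congr 1
        rw [Nat.cast_sub hk]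
        field_simp
        ring
      rw [this]
      linear_combination (0:ℂ)
    have hz : -Complex.I * (starRingEnd ℂ) (P a N k) = 0 ↔ P a N k = 0 := by simp
    simp only [hL, hp, he, hz]
    split_ifs <;> rfl
  · intro a k hk
    simp only [hs, e2, ek k hk, div_self hNn, f1]
  · intro a ha b hb k hk
    have hmem : ∀ i ≤ 1, ∀ j ≤ 1, ∀ l ≤ 1, ((((a+i:ℕ):ℝ)/N, ((b+j:ℕ):ℝ)/N, ((k+l:ℕ):ℝ)/N) : ℝ×ℝ×ℝ) ∈ S := by
      intro i hi j hj l hl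
      have h1 : a + i ≤ 5*N := by omega
      have h2 : b + j ≤ N := by omega
      have h3 : k + l ≤ N := by omega
      have h1' : ((a+i:ℕ):ℝ) ≤ 5*N := by exact_mod_cast h1
      have h2' : ((b+j:ℕ):ℝ) ≤ N := by exact_mod_cast h2
      have h3' : ((k+l:ℕ):ℝ) ≤ N := by exact_mod_cast h3
      refine ⟨⟨by positivity, ?_⟩, ⟨by positivity, ?_⟩, ⟨by positivity, ?_⟩⟩
      · exact (div_le_iff₀ hNR).2 h1'
      · exact (div_le_iff₀ hNR).2 (by simpa using h2')
      · exact (div_le_iff₀ hNR).2 (by simpa using h3')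
    have hd1' : ∀ a i : ℕ, i ≤ 1 → dist (((a+i:ℕ):ℝ)/N) ((a:ℝ)/N) ≤ 1/N := by
      intro a i hi
      rw [Real.dist_eq, ← sub_div, abs_div, abs_of_pos hNR]
      gcongr
      push_cast
      rw [add_sub_cancel_left, abs_of_nonneg (by positivity)]
      exact_mod_cast hi
    have hdist : ∀ i ≤ 1, ∀ j ≤ 1, ∀ l ≤ 1, dist ((((a+i:ℕ):ℝ)/N, ((b+j:ℕ):ℝ)/N, ((k+l:ℕ):ℝ)/N) : ℝ×ℝ×ℝ)
        ((a:ℝ)/N, (b:ℝ)/N, (k:ℝ)/N) < min d1 d2 := by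
      intro i hi j hj l hl
      refine lt_of_le_of_lt ?_ hn'
      rw [Prod.dist_eq, Prod.dist_eq]
      exact max_le (hd1' _ _ hi) (max_le (hd1' _ _ hj) (hd1' _ _ hl))
    have hbase : (((a:ℝ)/N, (b:ℝ)/N, (k:ℝ)/N) : ℝ×ℝ×ℝ) ∈ S := by
      simpa using hmem 0 (by simp) 0 (by simp) 0 (by simp)
    have hm := hmin hbase
    have hm : ε ≤ max |F ((a:ℝ)/N, (b:ℝ)/N, (k:ℝ)/N)| ‖G ((a:ℝ)/N, (b:ℝ)/N, (k:ℝ)/N)‖ := hm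
    rcases le_max_iff.1 hm with h | h
    · right
      constructor
      · intro i hi j hj l hl
        have := huF _ (hmem i hi j hj l hl) _ hbase (lt_of_lt_of_le (hdist i hi j hj l hl) (min_le_left _ _))
        rw [Real.dist_eq, abs_lt] at this
        simp only [hF] at this h
        simp only [hs]
        have : (0 < f (((a+i:ℕ):ℝ)/N) (((b+j:ℕ):ℝ)/N) (((k+l:ℕ):ℝ)/N)) ↔ 0 < f ((a:ℝ)/N) ((b:ℝ)/N) ((k:ℝ)/N) := by
          rcases le_abs.1 h with h | h
          · constructor <;> intro <;> linarith
          · constructor <;> intro <;> linarith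
        simp only [this]
      · rintro rfl
        simp only [hs, div_self hNn, fI, Nat.cast_zero, zero_div]
        simp only [hF, Nat.cast_zero, zero_div] at h
        rcases le_abs.1 h with h | h
        · rw [if_neg (by linarith), if_pos (by linarith)]; norm_num
        · rw [if_pos (by linarith), if_neg (by linarith)]; norm_num
    · left
      have hb0 : G ((a:ℝ)/N, (b:ℝ)/N, (k:ℝ)/N) ≠ 0 := by
        intro h0; rw [h0, norm_zero] at h; linarith
      refine ⟨_, hb0, ?_⟩
      intro i hi j hj l hl
      have := huG _ (hmem i hi j hj l hl) _ hbase (lt_of_lt_of_le (hdist i hi j hj l hl) (min_le_right _ _))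
      rw [dist_eq_norm] at this
      set w := G ((a:ℝ)/N, (b:ℝ)/N, (k:ℝ)/N)
      set z := G (((a+i:ℕ):ℝ)/N, ((b+j:ℕ):ℝ)/N, ((k+l:ℕ):ℝ)/N) with hz
      have hz0 : z ≠ 0 := by
        intro h0
        rw [h0, zero_sub, norm_neg] at this
        linarith
      have hLz : L (a+i) (b+j) (k+l) = z := by
        have : P (a+i) (b+j) (k+l) = z := rfl
        simp only [hL, this, if_neg hz0]
      rw [hLz]
      have e : z / w = 1 + (z - w)/w := by field_simp; ring
      have hb1 : ‖(z-w)/w‖ < 1 := by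
        rw [norm_div, div_lt_one (norm_pos_iff.2 hb0)]
        linarith
      have := (abs_le.1 (Complex.abs_re_le_norm ((z-w)/w))).1
      rw [e, Complex.add_re, Complex.one_re]
      linarith

end Mah

namespace Mah
open Topology

structure Body {n : ℕ} (K : Set (Fin n → ℝ)) : Prop where
  compact : IsCompact K
  convex : Convex ℝ K
  symm : ∀ x ∈ K, -x ∈ K
  nhds : K ∈ 𝓝 (0 : Fin n → ℝ)

def pol {n : ℕ} (K : Set (Fin n → ℝ)) : Set (Fin n → ℝ) := {y | ∀ x ∈ K, x ⬝ᵥ y ≤ 1}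

noncomputable def vol {n : ℕ} (K : Set (Fin n → ℝ)) : ℝ := (volume K).toReal

noncomputable def vp {n : ℕ} (K : Set (Fin n → ℝ)) : ℝ := vol K * vol (pol K)

theorem exists_dot {n : ℕ} (f : (Fin n → ℝ) →ₗ[ℝ] ℝ) : ∃ l : Fin n → ℝ, ∀ x, f x = x ⬝ᵥ l := by
  refine ⟨fun i => f (Pi.single i 1), fun x => ?_⟩
  rw [LinearMap.pi_apply_eq_sum_univ f x]
  simp only [dotProduct, smul_eq_mul]
  refine Finset.sum_congr rfl fun i _ => ?_
  congr 2
  ext j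
  simp [Pi.single_apply, eq_comm]

theorem dot_le_norm {n : ℕ} (x y : Fin n → ℝ) : x ⬝ᵥ y ≤ n * ‖x‖ * ‖y‖ := by
  calc x ⬝ᵥ y = ∑ i, x i * y i := rfl
    _ ≤ ∑ i : Fin n, ‖x‖ * ‖y‖ := by
        refine Finset.sum_le_sum fun i _ => ?_
        have h1 := norm_le_pi_norm x i
        have h2 := norm_le_pi_norm y i
        calc x i * y i ≤ ‖x i * y i‖ := le_abs_self _
          _ = ‖x i‖ * ‖y i‖ := norm_mul _ _
          _ ≤ _ := by gcongr
    _ = _ := by simp; ring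

theorem continuous_dot {n : ℕ} : Continuous fun p : (Fin n → ℝ) × (Fin n → ℝ) => p.1 ⬝ᵥ p.2 := by
  unfold dotProduct; fun_prop

theorem continuous_dot_left {n : ℕ} (y : Fin n → ℝ) : Continuous fun x : (Fin n → ℝ) => x ⬝ᵥ y := by
  unfold dotProduct; fun_prop

theorem continuous_dot_right {n : ℕ} (y : Fin n → ℝ) : Continuous fun x : (Fin n → ℝ) => y ⬝ᵥ x := by
  unfold dotProduct; fun_prop

namespace Body
variable {n : ℕ} {K : Set (Fin n → ℝ)}

theorem zero_mem (h : Body K) : (0 : Fin n → ℝ) ∈ K := mem_of_mem_nhds h.nhds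

theorem isClosed (h : Body K) : IsClosed K := h.compact.isClosed

theorem absorbent (h : Body K) : Absorbent ℝ K := absorbent_nhds_zero h.nhds

theorem neg_mem_iff (h : Body K) {x} : -x ∈ K ↔ x ∈ K :=
  ⟨fun hx => by simpa using h.symm _ hx, h.symm x⟩

theorem balanced (h : Body K) : ∀ x ∈ K, -x ∈ K := h.symm

theorem gauge_neg (h : Body K) (x) : gauge K (-x) = gauge K x := _root_.gauge_neg h.symm x

theorem cont_gauge (h : Body K) : Continuous (gauge K) := continuous_gauge h.convex h.nhds

theorem gauge_le_one (h : Body K) {x} : gauge K x ≤ 1 ↔ x ∈ K :=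
  gauge_le_one_iff_mem_closure h.convex h.nhds |>.trans (by rw [h.isClosed.closure_eq])

theorem gauge_add (h : Body K) (x y) : gauge K (x + y) ≤ gauge K x + gauge K y :=
  gauge_add_le h.convex h.absorbent x y

theorem gauge_smul' {r : ℝ} (hr : 0 ≤ r) (x : Fin n → ℝ) : gauge K (r • x) = r * gauge K x := by
  rw [gauge_smul_of_nonneg hr, smul_eq_mul]

theorem gauge_pos (h : Body K) {x} : 0 < gauge K x ↔ x ≠ 0 :=
  _root_.gauge_pos h.absorbent ((NormedSpace.isVonNBounded_iff ℝ).2 h.compact.isBounded)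

theorem gauge_le_iff (h : Body K) {r : ℝ} (hr : 0 < r) {x} : gauge K x ≤ r ↔ r⁻¹ • x ∈ K := by
  rw [← h.gauge_le_one, gauge_smul' (by positivity), inv_mul_le_iff₀ hr, mul_one]

theorem gauge_inv_mem (h : Body K) {x} (hx : x ≠ 0) : gauge K ((gauge K x)⁻¹ • x) = 1 := by
  have := h.gauge_pos.2 hx
  rw [gauge_smul' (by positivity), inv_mul_cancel₀ this.ne']

theorem ball_sub (h : Body K) : ∃ r > 0, Metric.closedBall (0 : Fin n → ℝ) r ⊆ K :=
  Metric.nhds_basis_closedBall.mem_iff.1 h.nhds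

theorem bdd (h : Body K) : ∃ R > 0, ∀ x ∈ K, ‖x‖ ≤ R := by
  obtain ⟨R, hR⟩ := h.compact.isBounded.exists_norm_le
  exact ⟨max R 1, by positivity, fun x hx => (hR x hx).trans (le_max_left _ _)⟩

theorem pol_body (h : Body K) : Body (pol K) where
  compact := by
    have hc : IsClosed (pol K) := by
      have : pol K = ⋂ x ∈ K, {y | x ⬝ᵥ y ≤ 1} := by ext; simp [pol]
      rw [this]
      exact isClosed_biInter fun x _ => isClosed_le (continuous_dot_right x) continuous_const
    obtain ⟨r, hr, hb⟩ := h.ball_sub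
    refine (isCompact_closedBall (0 : Fin n → ℝ) (1/r)).of_isClosed_subset hc fun y hy => ?_
    rw [mem_closedBall_zero_iff, pi_norm_le_iff_of_nonneg (by positivity)]
    intro i
    have key : ∀ s : ℝ, |s| = r → s * y i ≤ 1 := fun s hs => by
      have := hy (Pi.single i s) (hb (by
        rw [mem_closedBall_zero_iff, pi_norm_le_iff_of_nonneg hr.le]
        intro j
        by_cases hj : j = i
        · subst hj; simp [hs]
        · simp [hj, hr.le]))
      simpa using this
    rw [Real.norm_eq_abs, le_div_iff₀ hr]
    rcases abs_cases (y i) with ⟨h1, _⟩ | ⟨h1, _⟩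
    · rw [h1, mul_comm]; exact key r (abs_of_pos hr)
    · rw [h1, neg_mul, mul_comm, ← neg_mul]; exact key (-r) (by rw [abs_neg, abs_of_pos hr])
  convex := by
    intro x hx y hy a b ha hb hab z hz
    rw [dotProduct_add, dotProduct_smul, dotProduct_smul, smul_eq_mul, smul_eq_mul]
    nlinarith [hx z hz, hy z hz]
  symm := by
    intro y hy x hx
    have := hy (-x) (h.symm x hx)
    simpa using this
  nhds := by
    obtain ⟨R, hR, hb⟩ := h.bdd
    refine Filter.mem_of_superset (Metric.closedBall_mem_nhds 0 (show 0 < 1/((n+1)*R) by positivity)) fun y hy x hx => ?_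
    rw [mem_closedBall_zero_iff] at hy
    refine (dot_le_norm x y).trans ?_
    calc n * ‖x‖ * ‖y‖ ≤ (n+1) * R * (1/((n+1)*R)) := by
          gcongr
          · linarith
          · exact hb x hx
      _ = 1 := by field_simp

theorem dot_le_gauge (h : Body K) {x l} (hl : l ∈ pol K) : x ⬝ᵥ l ≤ gauge K x := by
  by_cases hx : x = 0
  · subst hx; simp
  have hg := h.gauge_pos.2 hx
  have := hl ((gauge K x)⁻¹ • x) (h.gauge_le_one.1 (h.gauge_inv_mem hx).le)
  rw [smul_dotProduct, smul_eq_mul, inv_mul_le_iff₀ hg] at this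
  linarith

theorem exists_pol_gt (h : Body K) {x} (hx : 1 < gauge K x) : ∃ l ∈ pol K, 1 < x ⬝ᵥ l := by
  have hx' : x ∉ K := fun h' => by have := h.gauge_le_one.2 h'; linarith
  obtain ⟨f, u, hf, hu⟩ := geometric_hahn_banach_closed_point h.convex h.isClosed hx'
  obtain ⟨l, hl⟩ := exists_dot (f : (Fin n → ℝ) →ₗ[ℝ] ℝ)
  have hl' : ∀ x, f x = x ⬝ᵥ l := hl
  have h0 : 0 < u := by simpa using hf 0 h.zero_mem
  refine ⟨u⁻¹ • l, fun y hy => ?_, ?_⟩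
  · rw [dotProduct_smul, smul_eq_mul, inv_mul_le_iff₀ h0, ← hl']
    linarith [hf y hy]
  · rw [dotProduct_smul, smul_eq_mul, lt_inv_mul_iff₀ h0, ← hl']
    linarith

theorem exists_pol_eq (h : Body K) (x) : ∃ l ∈ pol K, x ⬝ᵥ l = gauge K x := by
  obtain ⟨l, hl, hmax⟩ := h.pol_body.compact.exists_isMaxOn ⟨0, h.pol_body.zero_mem⟩
    (continuous_dot_right x).continuousOn
  refine ⟨l, hl, le_antisymm (h.dot_le_gauge hl) ?_⟩
  by_contra hlt
  push Not at hlt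
  have h0 : 0 ≤ x ⬝ᵥ l := by simpa using hmax h.pol_body.zero_mem
  obtain ⟨r, hr1, hr2⟩ := exists_between hlt
  have hr : 0 < r := by linarith
  obtain ⟨m, hm, hm1⟩ := h.exists_pol_gt (x := r⁻¹ • x) (by
    rw [gauge_smul' (by positivity), lt_inv_mul_iff₀ hr]; linarith)
  rw [smul_dotProduct, smul_eq_mul, lt_inv_mul_iff₀ hr] at hm1
  have : x ⬝ᵥ m ≤ x ⬝ᵥ l := hmax hm
  linarith

theorem gauge_le_of (h : Body K) {x : Fin n → ℝ} {r : ℝ} (hr : ∀ l ∈ pol K, x ⬝ᵥ l ≤ r) : gauge K x ≤ r := by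
  obtain ⟨l, hl, e⟩ := h.exists_pol_eq x
  rw [← e]; exact hr l hl

theorem mem_of (h : Body K) {x : Fin n → ℝ} (hr : ∀ l ∈ pol K, x ⬝ᵥ l ≤ 1) : x ∈ K :=
  h.gauge_le_one.1 (h.gauge_le_of hr)

theorem bipolar (h : Body K) : pol (pol K) = K := by
  ext x
  constructor
  · intro hx
    exact h.mem_of fun l hl => by rw [dotProduct_comm]; exact hx l hl
  · intro hx l hl
    rw [dotProduct_comm]; exact hl x hx

/-- the gauge of the polar is the support function -/
theorem exists_supp (h : Body K) (y) : ∃ x ∈ K, x ⬝ᵥ y = gauge (pol K) y := by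
  obtain ⟨x, hx, e⟩ := h.pol_body.exists_pol_eq y
  rw [h.bipolar] at hx
  exact ⟨x, hx, by rw [dotProduct_comm, e]⟩

theorem dot_le_supp (h : Body K) {x y} (hx : x ∈ K) : x ⬝ᵥ y ≤ gauge (pol K) y := by
  rw [dotProduct_comm]
  exact h.pol_body.dot_le_gauge (by rw [h.bipolar]; exact hx)

theorem meas (h : Body K) : MeasurableSet K := h.isClosed.measurableSet

theorem vol_ne_top (h : Body K) : volume K ≠ ⊤ := h.compact.measure_lt_top.ne

theorem vol_pos (h : Body K) : 0 < vol K :=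
  ENNReal.toReal_pos (Measure.measure_pos_of_mem_nhds _ h.nhds).ne' h.vol_ne_top

theorem smul_sub (h : Body K) {r : ℝ} (h0 : 0 ≤ r) (h1 : r ≤ 1) {x} (hx : x ∈ K) : r • x ∈ K := by
  have := h.convex hx h.zero_mem h0 (sub_nonneg.2 h1) (by ring)
  simpa using this

end Body

theorem pol_anti {n : ℕ} {K L : Set (Fin n → ℝ)} (h : K ⊆ L) : pol L ⊆ pol K := fun y hy x hx => hy x (h hx)

theorem vol_mono {n : ℕ} {K L : Set (Fin n → ℝ)} (h : K ⊆ L) (hL : volume L ≠ ⊤) : vol K ≤ vol L :=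
  ENNReal.toReal_mono hL (measure_mono h)

theorem vol_nonneg {n : ℕ} (K : Set (Fin n → ℝ)) : 0 ≤ vol K := ENNReal.toReal_nonneg

theorem vol_smul {n : ℕ} (K : Set (Fin n → ℝ)) {r : ℝ} (hr : 0 ≤ r) : vol (r • K) = r ^ n * vol K := by
  unfold vol
  rw [Measure.addHaar_smul]
  simp [abs_of_nonneg (pow_nonneg hr n), ENNReal.toReal_mul, pow_nonneg hr n]

end Mah

namespace Mah
open Topology

/-- insert `t` at coordinate `i` -/
def ins {n : ℕ} (i : Fin (n+1)) (t : ℝ) (y : Fin n → ℝ) : Fin (n+1) → ℝ := Fin.insertNth (α := fun _ => ℝ) i t y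
def rem {n : ℕ} (i : Fin (n+1)) (x : Fin (n+1) → ℝ) : Fin n → ℝ := Fin.removeNth (α := fun _ => ℝ) i x

def sec {n : ℕ} (i : Fin (n+1)) (K : Set (Fin (n+1) → ℝ)) : Set (Fin n → ℝ) := {y | ins i 0 y ∈ K}
def proj {n : ℕ} (i : Fin (n+1)) (K : Set (Fin (n+1) → ℝ)) : Set (Fin n → ℝ) := rem i '' K

section
variable {n : ℕ} (i : Fin (n+1))

@[simp] theorem ins_same (t : ℝ) (y : Fin n → ℝ) : ins i t y i = t := by simp [ins]
@[simp] theorem ins_succ (t : ℝ) (y : Fin n → ℝ) (j : Fin n) : ins i t y (i.succAbove j) = y j := by simp [ins]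
@[simp] theorem rem_apply (x : Fin (n+1) → ℝ) (j : Fin n) : rem i x j = x (i.succAbove j) := rfl
@[simp] theorem rem_ins (t : ℝ) (y : Fin n → ℝ) : rem i (ins i t y) = y := by ext; simp
@[simp] theorem ins_rem (x : Fin (n+1) → ℝ) : ins i (x i) (rem i x) = x := by
  ext j; refine Fin.succAboveCases i ?_ (fun k => ?_) j <;> simp

theorem ext_succ {x y : Fin (n+1) → ℝ} (h : x i = y i) (h' : ∀ j, x (i.succAbove j) = y (i.succAbove j)) : x = y := by
  ext j; refine Fin.succAboveCases i h h' j

theorem dot_ins (t : ℝ) (y : Fin n → ℝ) (z : Fin (n+1) → ℝ) : ins i t y ⬝ᵥ z = t * z i + y ⬝ᵥ rem i z := by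
  simp [dotProduct, Fin.sum_univ_succAbove _ i]

theorem dot_split (x z : Fin (n+1) → ℝ) : x ⬝ᵥ z = x i * z i + rem i x ⬝ᵥ rem i z := by
  simp [dotProduct, Fin.sum_univ_succAbove _ i]

theorem ins_add (s t : ℝ) (x y : Fin n → ℝ) : ins i (s+t) (x+y) = ins i s x + ins i t y :=
  ext_succ i (by simp) (by simp)
theorem ins_smul (r t : ℝ) (x : Fin n → ℝ) : ins i (r*t) (r•x) = r • ins i t x :=
  ext_succ i (by simp) (by simp)
theorem ins_neg (t : ℝ) (x : Fin n → ℝ) : ins i (-t) (-x) = - ins i t x :=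
  ext_succ i (by simp) (by simp)
theorem rem_add (x y : Fin (n+1) → ℝ) : rem i (x+y) = rem i x + rem i y := rfl
theorem rem_smul (r : ℝ) (x : Fin (n+1) → ℝ) : rem i (r•x) = r • rem i x := rfl
theorem ins0_zero : ins i 0 (0 : Fin n → ℝ) = 0 := ext_succ i (by simp) (by simp)

theorem cont_ins : Continuous fun p : ℝ × (Fin n → ℝ) => ins i p.1 p.2 := by
  refine continuous_pi fun j => ?_
  refine Fin.succAboveCases i ?_ (fun k => ?_) j
  · simp only [ins_same]; fun_prop
  · simp only [ins_succ]; fun_prop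
theorem cont_rem : Continuous (rem i) := by
  refine continuous_pi fun j => ?_
  simp only [rem_apply]; fun_prop

theorem norm_ins_le {t : ℝ} {y : Fin n → ℝ} {r : ℝ} (hr : 0 ≤ r) (ht : |t| ≤ r) (hy : ‖y‖ ≤ r) : ‖ins i t y‖ ≤ r := by
  rw [pi_norm_le_iff_of_nonneg hr]
  intro j
  refine Fin.succAboveCases i ?_ (fun k => ?_) j
  · simpa using ht
  · simpa using (norm_le_pi_norm y k).trans hy

theorem Body.sec_body {K : Set (Fin (n+1) → ℝ)} (h : Body K) : Body (sec i K) where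
  compact := by
    have hc : IsClosed (sec i K) := h.isClosed.preimage ((cont_ins i).comp (by fun_prop : Continuous fun y : Fin n → ℝ => ((0:ℝ), y)))
    have : sec i K ⊆ rem i '' K := fun y hy => ⟨_, hy, by simp⟩
    exact (h.compact.image (cont_rem i)).of_isClosed_subset hc this
  convex := by
    intro x hx y hy a b ha hb hab
    have := h.convex hx hy ha hb hab
    rw [← ins_smul, ← ins_smul, ← ins_add] at this
    simpa [sec] using this
  symm := by
    intro x hx
    have := h.symm _ hx
    rw [← ins_neg] at this
    simpa [sec] using this
  nhds := by
    have : ContinuousAt (fun y : Fin n → ℝ => ins i 0 y) 0 :=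
      ((cont_ins i).comp (by fun_prop : Continuous fun y : Fin n → ℝ => ((0:ℝ), y))).continuousAt
    refine this ?_
    show K ∈ 𝓝 (ins i 0 0)
    rw [ins0_zero]; exact h.nhds

theorem Body.proj_body {K : Set (Fin (n+1) → ℝ)} (h : Body K) : Body (proj i K) where
  compact := h.compact.image (cont_rem i)
  convex := by
    rintro _ ⟨x, hx, rfl⟩ _ ⟨y, hy, rfl⟩ a b ha hb hab
    exact ⟨_, h.convex hx hy ha hb hab, rfl⟩
  symm := by
    rintro _ ⟨x, hx, rfl⟩
    exact ⟨_, h.symm x hx, rfl⟩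
  nhds := Filter.mem_of_superset (h.sec_body i).nhds fun y hy => ⟨_, hy, by simp⟩

theorem pol_sec_sub {K : Set (Fin (n+1) → ℝ)} (h : Body K) : pol (sec i K) ⊆ proj i (pol K) := by
  intro l hl
  refine (h.pol_body.proj_body i).mem_of fun y hy => ?_
  rw [dotProduct_comm]
  refine hl y ?_
  show ins i 0 y ∈ K
  rw [← h.bipolar]
  intro z hz
  rw [dotProduct_comm, dot_ins, zero_mul, zero_add, dotProduct_comm]
  exact hy _ ⟨z, hz, rfl⟩

/-! ### volumes -/

theorem mp_ins : MeasurePreserving (fun p : ℝ × (Fin n → ℝ) => ins i p.1 p.2) (volume.prod volume) volume := by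
  have := (volume_preserving_piFinSuccAbove (fun _ : Fin (n+1) => ℝ) i).symm
  exact this

theorem volume_eq_prod (S : Set (Fin (n+1) → ℝ)) (hS : MeasurableSet S) :
    volume S = ∫⁻ y : Fin n → ℝ, volume {t : ℝ | ins i t y ∈ S} := by
  rw [← (mp_ins i).measure_preimage hS.nullMeasurableSet, Measure.prod_apply_symm ((mp_ins i).measurable hS)]
  rfl

theorem volume_box (T : Set ℝ) (Y : Set (Fin n → ℝ)) :
    volume {x : Fin (n+1) → ℝ | x i ∈ T ∧ rem i x ∈ Y} = volume T * volume Y := by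
  have := (volume_preserving_piFinSuccAbove (fun _ : Fin (n+1) => ℝ) i).measure_preimage_equiv (T ×ˢ Y)
  have h2 := Measure.prod_prod (μ := (volume : Measure ℝ)) (ν := (volume : Measure (Fin n → ℝ))) T Y
  rw [← h2, ← Measure.volume_eq_prod, ← this]
  rfl

theorem segment_volume {M : Set (Fin (n+1) → ℝ)} (hM : IsCompact M) (hc : Convex ℝ M) {s : ℝ} (hs : 0 ≤ s)
    {M' : Set (Fin (n+1) → ℝ)} (hM' : MeasurableSet M')
    (h : ∀ x ∈ M, ∀ u : ℝ, |u| ≤ s → x + u • Pi.single i 1 ∈ M') :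
    volume M + ENNReal.ofReal (2*s) * volume (proj i M) ≤ volume M' := by
  have hP : MeasurableSet (proj i M) := (hM.image (cont_rem i)).isClosed.measurableSet
  rw [volume_eq_prod i M hM.isClosed.measurableSet, volume_eq_prod i M' hM']
  have e : ENNReal.ofReal (2*s) * volume (proj i M) = ∫⁻ y, (proj i M).indicator (fun _ => ENNReal.ofReal (2*s)) y := by
    rw [lintegral_indicator hP]; simp
  rw [e, ← lintegral_add_right _ (measurable_const.indicator hP)]
  refine lintegral_mono fun y => ?_
  show volume {t : ℝ | ins i t y ∈ M} + (proj i M).indicator (fun _ => ENNReal.ofReal (2*s)) y ≤ volume {t : ℝ | ins i t y ∈ M'}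
  by_cases hy : y ∈ proj i M
  · rw [Set.indicator_of_mem hy]
    set F := {t : ℝ | ins i t y ∈ M} with hF
    have hFne : F.Nonempty := by
      obtain ⟨x, hx, rfl⟩ := hy
      exact ⟨x i, by simp [hF, hx]⟩
    have hFc : IsCompact F := by
      have hcl : IsClosed F := hM.isClosed.preimage ((cont_ins i).comp (by fun_prop : Continuous fun t : ℝ => (t, y)))
      have : F ⊆ (fun x : Fin (n+1) → ℝ => x i) '' M := fun t ht => ⟨_, ht, by simp⟩
      exact (hM.image (continuous_apply i)).of_isClosed_subset hcl this
    have hF1 : F ⊆ Set.Icc (sInf F) (sSup F) := fun t ht => ⟨csInf_le hFc.bddBelow ht, le_csSup hFc.bddAbove ht⟩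
    have ha := hFc.sInf_mem hFne
    have hb := hFc.sSup_mem hFne
    have hab : sInf F ≤ sSup F := (hF1 ha).2
    have hadd : ∀ t u, ins i t y + u • Pi.single i (1:ℝ) = ins i (t+u) y := fun t u =>
      ext_succ i (by simp) (by simp)
    have hF2 : Set.Icc (sInf F - s) (sSup F + s) ⊆ {t : ℝ | ins i t y ∈ M'} := by
      intro t ht
      have hconv : ∀ t, sInf F ≤ t → t ≤ sSup F → t ∈ F := by
        have hcF : Convex ℝ F := by
          intro a ha b hb p q hp hq hpq
          have := hc ha hb hp hq hpq
          rw [← ins_smul, ← ins_smul, ← ins_add, ← add_smul, hpq, one_smul] at this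
          exact this
        intro t h1 h2
        exact hcF.ordConnected.out ha hb ⟨h1, h2⟩
      have : ∃ t0 ∈ F, |t - t0| ≤ s := by
        rcases lt_or_ge t (sInf F) with h1 | h1
        · exact ⟨_, ha, by rw [abs_le]; constructor <;> linarith [ht.1]⟩
        rcases lt_or_ge (sSup F) t with h2 | h2
        · exact ⟨_, hb, by rw [abs_le]; constructor <;> linarith [ht.2]⟩
        · exact ⟨t, hconv t h1 h2, by simpa using hs⟩
      obtain ⟨t0, ht0, h3⟩ := this
      have := h _ ht0 _ h3
      rw [hadd] at this
      simpa using this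
    calc volume F + ENNReal.ofReal (2*s) ≤ volume (Set.Icc (sInf F) (sSup F)) + ENNReal.ofReal (2*s) := by gcongr
      _ = volume (Set.Icc (sInf F - s) (sSup F + s)) := by
          rw [Real.volume_Icc, Real.volume_Icc, ← ENNReal.ofReal_add (by linarith) (by linarith)]
          congr 1; ring
      _ ≤ _ := measure_mono hF2
  · rw [Set.indicator_of_notMem hy]
    have : {t : ℝ | ins i t y ∈ M} = ∅ := by
      ext t
      simp only [Set.mem_setOf_eq, Set.mem_empty_iff_false, iff_false]
      intro ht
      exact hy ⟨_, ht, by simp⟩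
    rw [this]; simp

end

/-- the box with half-sides `c` restricted to coordinates in `S` -/
def boxS {n : ℕ} (c : Fin n → ℝ) (S : Finset (Fin n)) : Set (Fin n → ℝ) :=
  {x | (∀ i ∈ S, |x i| ≤ c i) ∧ ∀ i ∉ S, x i = 0}

theorem boxS_compact {n : ℕ} (c : Fin n → ℝ) (S : Finset (Fin n)) : IsCompact (boxS c S) := by
  classical
  have : boxS c S = Set.pi Set.univ fun i => if i ∈ S then Set.Icc (-c i) (c i) else {0} := by
    ext x
    simp only [boxS, Set.mem_setOf_eq, Set.mem_pi, Set.mem_univ, true_imp_iff]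
    constructor
    · rintro ⟨h1, h2⟩ i
      by_cases hi : i ∈ S
      · rw [if_pos hi]; exact abs_le.1 (h1 i hi)
      · rw [if_neg hi]; exact h2 i hi
    · intro h
      refine ⟨fun i hi => ?_, fun i hi => ?_⟩
      · have := h i; rw [if_pos hi] at this; exact abs_le.2 this
      · have := h i; rw [if_neg hi] at this; exact this
  rw [this]
  refine isCompact_univ_pi fun i => ?_
  split_ifs
  · exact isCompact_Icc
  · exact isCompact_singleton

theorem boxS_convex {n : ℕ} (c : Fin n → ℝ) (S : Finset (Fin n)) : Convex ℝ (boxS c S) := by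
  intro x hx y hy a b ha hb hab
  refine ⟨fun i hi => ?_, fun i hi => ?_⟩
  · have h1 := abs_le.1 (hx.1 i hi)
    have h2 := abs_le.1 (hy.1 i hi)
    simp only [Pi.add_apply, Pi.smul_apply, smul_eq_mul]
    rw [abs_le]
    have hb' : b = 1 - a := by linarith
    subst hb'
    constructor <;> nlinarith
  · simp [hx.2 i hi, hy.2 i hi]

theorem box_volume {n : ℕ} {L : Set (Fin (n+1) → ℝ)} (hL : IsCompact L) (hc : Convex ℝ L)
    (c : Fin (n+1) → ℝ) (h0 : ∀ i, 0 ≤ c i) (S : Finset (Fin (n+1))) :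
    volume L + ∑ i ∈ S, ENNReal.ofReal (2 * c i) * volume (proj i L) ≤ volume (L + boxS c S) := by
  classical
  induction S using Finset.induction_on with
  | empty =>
    have : boxS c ∅ = {0} := by
      ext x; simp [boxS, funext_iff]
    simp [this]
  | insert i S hi ih =>
    rw [Finset.sum_insert hi]
    have h1 : IsCompact (L + boxS c S) := hL.add (boxS_compact c S)
    have := segment_volume i h1 (hc.add (boxS_convex c S)) (h0 i)
      (M' := L + boxS c (insert i S)) (hL.add (boxS_compact c _)).isClosed.measurableSet (by
        rintro _ ⟨x, hx, y, hy, rfl⟩ u hu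
        refine ⟨x, hx, y + u • Pi.single i 1, ⟨fun j hj => ?_, fun j hj => ?_⟩, by simp [add_assoc]⟩
        · by_cases hji : j = i
          · subst hji; simpa [hy.2 j hi] using hu
          · simpa [hji] using hy.1 j (by simpa [hji] using hj)
        · simp only [Finset.mem_insert, not_or] at hj
          simp [hj.1, hy.2 j hj.2])
    have hsub : proj i L ⊆ proj i (L + boxS c S) := by
      refine Set.image_mono fun x hx => ⟨x, hx, 0, ⟨fun i _ => by simpa using h0 i, fun _ _ => rfl⟩, by simp⟩
    calc _ = volume L + ∑ i ∈ S, ENNReal.ofReal (2 * c i) * volume (proj i L)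
          + ENNReal.ofReal (2 * c i) * volume (proj i L) := by ring
      _ ≤ volume (L + boxS c S) + ENNReal.ofReal (2 * c i) * volume (proj i (L + boxS c S)) := by gcongr
      _ ≤ _ := this

end Mah

namespace Mah
open Topology

theorem deriv_compare {f g : ℝ → ℝ} {f' g' t0 : ℝ} (ht : 0 < t0) (hf : HasDerivAt f f' 0) (hg : HasDerivAt g g' 0)
    (h0 : f 0 = g 0) (h : ∀ t, 0 < t → t < t0 → f t ≤ g t) : f' ≤ g' := by
  have h1 := (hasDerivAt_iff_tendsto_slope.1 hf).mono_left (nhdsWithin_mono 0 (fun x (hx : x ∈ Set.Ioi 0) => ne_of_gt hx))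
  have h2 := (hasDerivAt_iff_tendsto_slope.1 hg).mono_left (nhdsWithin_mono 0 (fun x (hx : x ∈ Set.Ioi 0) => ne_of_gt hx))
  refine le_of_tendsto_of_tendsto h1 h2 ?_
  filter_upwards [Ioo_mem_nhdsGT ht] with t hts
  rw [slope_def_field, slope_def_field, h0]
  have := h t hts.1 hts.2
  have h3 : 0 < t - 0 := by simpa using hts.1
  gcongr

def coneU {n : ℕ} (K : Set (Fin n → ℝ)) (y : Fin n → ℝ) (γ : ℝ) : Set (Fin n → ℝ) :=
  {z | gauge K (z - gauge K z • y) < γ * gauge K z}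

theorem coneU_open {n : ℕ} {K : Set (Fin n → ℝ)} (h : Body K) (y : Fin n → ℝ) (γ : ℝ) : IsOpen (coneU K y γ) := by
  have := h.cont_gauge
  exact isOpen_lt (by fun_prop) (by fun_prop)

theorem coneU_smul {n : ℕ} {K : Set (Fin n → ℝ)} {y : Fin n → ℝ} {γ : ℝ} {z : Fin n → ℝ} {r : ℝ} (hr : 0 < r) :
    r • z ∈ coneU K y γ ↔ z ∈ coneU K y γ := by
  unfold coneU
  simp only [Set.mem_setOf_eq]
  rw [Body.gauge_smul' hr.le, show r • z - (r * gauge K z) • y = r • (z - gauge K z • y) by rw [smul_sub, smul_smul],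
    Body.gauge_smul' hr.le, show γ * (r * gauge K z) = r * (γ * gauge K z) by ring]
  exact mul_lt_mul_iff_right₀ hr

theorem up_lemma {n : ℕ} {K : Set (Fin n → ℝ)} (h : Body K) {O : Set (Fin n → ℝ)}
    (hO : ∀ z ∈ O, ∀ r : ℝ, 0 < r → r • z ∈ O) {y : Fin n → ℝ} {γ : ℝ} (hγ : 0 ≤ γ) (hγ1 : γ ≤ 2/3)
    {t : ℝ} (ht : 0 < t) (ht1 : t < 1) {A : Set (Fin n → ℝ)}
    (hA : ∀ z ∈ A, z ∈ O ∧ ∃ k ∈ K, ∃ b ∈ K, z = k + t • b ∧ gauge K (b + y) ≤ 2 - 3*γ) :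
    vol A ≤ (1+t)^n * vol ((K ∩ O) \ coneU K y γ) + (1+t*(1-2*γ))^n * vol (K ∩ O ∩ coneU K y γ) := by
  have hp : 0 < 1+t*(1-2*γ) := by nlinarith
  have hsub : A ⊆ (1+t) • ((K ∩ O) \ coneU K y γ) ∪ (1+t*(1-2*γ)) • (K ∩ O ∩ coneU K y γ) := by
    intro z hz
    obtain ⟨hzO, k, hk, b, hb, rfl, hby⟩ := hA z hz
    by_cases hU : k + t • b ∈ coneU K y γ
    · right
      rw [Set.mem_smul_set_iff_inv_smul_mem₀ hp.ne']
      refine ⟨⟨?_, hO _ hzO _ (inv_pos.2 hp)⟩, (coneU_smul (inv_pos.2 hp)).2 hU⟩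
      rw [← h.gauge_le_iff hp]
      set z := k + t • b with hzdef
      obtain ⟨l, hl, hlz⟩ := h.exists_pol_eq z
      by_cases hz0 : gauge K z = 0
      · rw [hz0]; exact hp.le
      have hg : 0 < gauge K z := lt_of_le_of_ne (gauge_nonneg _) (Ne.symm hz0)
      have h1 : gauge K z = k ⬝ᵥ l + t * (b ⬝ᵥ l) := by
        rw [← hlz, hzdef, add_dotProduct, smul_dotProduct, smul_eq_mul]
      have h2 := hl k hk
      have h3 := (h.dot_le_gauge (x := b + y) hl).trans hby
      rw [add_dotProduct] at h3
      have h4 : gauge K z - gauge K z * (y ⬝ᵥ l) ≤ γ * gauge K z := by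
        have := (h.dot_le_gauge (x := z - gauge K z • y) hl).trans hU.le
        rwa [sub_dotProduct, smul_dotProduct, smul_eq_mul, hlz] at this
      have h5 : 1 - γ ≤ y ⬝ᵥ l := by
        have : gauge K z * (1 - γ) ≤ gauge K z * (y ⬝ᵥ l) := by linarith
        exact le_of_mul_le_mul_left this hg
      rw [h1]
      nlinarith
    · left
      have hp' : 0 < 1 + t := by linarith
      rw [Set.mem_smul_set_iff_inv_smul_mem₀ hp'.ne']
      refine ⟨⟨?_, hO _ hzO _ (inv_pos.2 hp')⟩, fun h' => hU ((coneU_smul (inv_pos.2 hp')).1 h')⟩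
      rw [← h.gauge_le_iff hp']
      refine (h.gauge_add _ _).trans ?_
      rw [Body.gauge_smul' ht.le]
      have := h.gauge_le_one.2 hk
      have := h.gauge_le_one.2 hb
      nlinarith
  have hfin : ∀ S : Set (Fin n → ℝ), S ⊆ K → ∀ r : ℝ, volume (r • S) ≠ ⊤ := fun S hS r => by
    rw [Measure.addHaar_smul]
    exact ENNReal.mul_ne_top ENNReal.ofReal_ne_top (measure_ne_top_of_subset hS h.vol_ne_top)
  have f1 := hfin ((K ∩ O) \ coneU K y γ) (fun x hx => hx.1.1) (1+t)
  have f2 := hfin (K ∩ O ∩ coneU K y γ) (fun x hx => hx.1.1) (1+t*(1-2*γ))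
  calc vol A ≤ vol ((1+t) • ((K ∩ O) \ coneU K y γ)) + vol ((1+t*(1-2*γ)) • (K ∩ O ∩ coneU K y γ)) := by
        unfold vol
        rw [← ENNReal.toReal_add f1 f2]
        exact ENNReal.toReal_mono (ENNReal.add_ne_top.2 ⟨f1, f2⟩) ((measure_mono hsub).trans (measure_union_le _ _))
    _ = _ := by rw [vol_smul _ (by linarith), vol_smul _ hp.le]

theorem vol_split {n : ℕ} {K : Set (Fin n → ℝ)} (h : Body K) (O : Set (Fin n → ℝ)) (y : Fin n → ℝ) (γ : ℝ) :
    vol ((K ∩ O) \ coneU K y γ) + vol (K ∩ O ∩ coneU K y γ) = vol (K ∩ O) := by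
  have hf : volume (K ∩ O) ≠ ⊤ := measure_ne_top_of_subset Set.inter_subset_left h.vol_ne_top
  unfold vol
  rw [← ENNReal.toReal_add (measure_ne_top_of_subset Set.diff_subset hf) (measure_ne_top_of_subset Set.inter_subset_left hf),
    measure_diff_add_inter _ (coneU_open h y γ).measurableSet]

theorem vol_cone_pos {n : ℕ} {K : Set (Fin n → ℝ)} (h : Body K) {O : Set (Fin n → ℝ)} (hOo : IsOpen O)
    (hO : ∀ z ∈ O, ∀ r : ℝ, 0 < r → r • z ∈ O) {y : Fin n → ℝ} (hy : y ∈ O) (hg : gauge K y = 1) {γ : ℝ} (hγ : 0 < γ) :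
    0 < vol (K ∩ O ∩ coneU K y γ) := by
  have hf : volume (K ∩ O ∩ coneU K y γ) ≠ ⊤ := measure_ne_top_of_subset (fun x hx => hx.1.1) h.vol_ne_top
  refine ENNReal.toReal_pos ?_ hf
  have ho : IsOpen ({z | gauge K z < 1} ∩ O ∩ coneU K y γ) :=
    ((isOpen_lt h.cont_gauge continuous_const).inter hOo).inter (coneU_open h y γ)
  have hsub : {z | gauge K z < 1} ∩ O ∩ coneU K y γ ⊆ K ∩ O ∩ coneU K y γ :=
    fun z hz => ⟨⟨h.gauge_le_one.1 (le_of_lt hz.1.1), hz.1.2⟩, hz.2⟩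
  refine ((ho.measure_pos volume ⟨(1/2:ℝ) • y, ⟨?_, hO y hy _ (by norm_num)⟩, ?_⟩).trans_le (measure_mono hsub)).ne'
  · show gauge K _ < 1
    rw [Body.gauge_smul' (by norm_num), hg]; norm_num
  · rw [coneU_smul (by norm_num)]
    show gauge K _ < _
    rw [hg, one_smul, sub_self, gauge_zero]; linarith

/-! ### the octant inequality -/

def IsSign {n : ℕ} (ε : Fin n → ℝ) : Prop := ∀ i, ε i = 1 ∨ ε i = -1

def oct {n : ℕ} (ε : Fin n → ℝ) : Set (Fin n → ℝ) := {x | ∀ i, 0 < ε i * x i}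

theorem oct_open {n : ℕ} (ε : Fin n → ℝ) : IsOpen (oct ε) := by
  have : oct ε = ⋂ i, {x : Fin n → ℝ | 0 < ε i * x i} := by ext; simp [oct]
  rw [this]
  exact isOpen_iInter_of_finite fun i => isOpen_lt continuous_const (by fun_prop)

theorem oct_smul {n : ℕ} {ε : Fin n → ℝ} : ∀ z ∈ oct ε, ∀ r : ℝ, 0 < r → r • z ∈ oct ε := by
  intro z hz r hr i
  have := mul_pos hr (hz i)
  simp only [Pi.smul_apply, smul_eq_mul]
  linarith

theorem IsSign.rem {n : ℕ} {ε : Fin (n+1) → ℝ} (h : IsSign ε) (i) : IsSign (rem i ε) := fun j => h _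

/-- lower bound for the volume of the enlarged octant -/
theorem slab_lower {n : ℕ} {K : Set (Fin (n+1) → ℝ)} (h : Body K) {ε : Fin (n+1) → ℝ} (hε : IsSign ε)
    {r : ℝ} (hr : 0 < r) (hb : Metric.closedBall 0 r ⊆ K) {x : Fin (n+1) → ℝ} (hx : ∀ i, 0 ≤ ε i * x i)
    {t : ℝ} (ht : 0 < t) (htx : ∀ i, t * (ε i * x i) < r) :
    vol (K ∩ oct ε) + ∑ i, t * (ε i * x i) * ((1 - t * (ε i * x i) / r)^n * vol (sec i K ∩ oct (rem i ε)))
      ≤ vol {y ∈ K | ∀ i, 0 < ε i * (y i + t * x i)} := by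
  classical
  set a : Fin (n+1) → ℝ := fun i => t * (ε i * x i) with ha
  have ha0 : ∀ i, 0 ≤ a i := fun i => mul_nonneg ht.le (hx i)
  have hεsq : ∀ i, ε i * ε i = 1 := fun i => by rcases hε i with h | h <;> rw [h] <;> norm_num
  set T : Fin (n+1) → Set ℝ := fun i => {s | - a i < ε i * s ∧ ε i * s ≤ 0} with hT
  have hTvol : ∀ i, volume (T i) = ENNReal.ofReal (a i) := by
    intro i
    rcases hε i with h1 | h1
    · have : T i = Set.Ioc (-a i) 0 := by ext s; simp [hT, h1]
      rw [this, Real.volume_Ioc]; simp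
    · have : T i = Set.Ico 0 (a i) := by
        ext s; simp only [hT, h1, Set.mem_setOf_eq, Set.mem_Ico]
        constructor <;> rintro ⟨h1, h2⟩ <;> constructor <;> linarith
      rw [this, Real.volume_Ico]; simp
  set Y : Fin (n+1) → Set (Fin n → ℝ) := fun i => (1 - a i / r) • (sec i K ∩ oct (rem i ε)) with hY
  set D : Fin (n+1) → Set (Fin (n+1) → ℝ) := fun i => {y | y i ∈ T i ∧ rem i y ∈ Y i} with hD
  have hl : ∀ i, 0 < 1 - a i / r := fun i => by
    rw [sub_pos, div_lt_one hr]; exact htx i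
  have hYo : ∀ i y, y ∈ Y i → y ∈ oct (rem i ε) := by
    intro i y hy
    obtain ⟨w, hw, rfl⟩ := hy
    exact oct_smul _ hw.2 _ (hl i)
  have hDm : ∀ i, MeasurableSet (D i) := by
    intro i
    have m1 : MeasurableSet (T i) := by
      have e1 : MeasurableSet {s : ℝ | - a i < ε i * s} := (isOpen_lt continuous_const (by fun_prop)).measurableSet
      have e2 : MeasurableSet {s : ℝ | ε i * s ≤ 0} := (isClosed_le (by fun_prop) continuous_const).measurableSet
      exact e1.inter e2
    have m2 : MeasurableSet (Y i) :=
      ((h.sec_body i).meas.inter (oct_open _).measurableSet).const_smul₀ _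
    exact (m1.preimage (measurable_pi_apply i)).inter (m2.preimage (cont_rem i).measurable)
  have hDK : ∀ i, D i ⊆ K := by
    intro i y hy
    obtain ⟨h1, w, hw, h2⟩ := hy
    by_cases hai : a i = 0
    · have : y i = 0 := by
        have := h1.1; rw [hai] at this
        have := h1.2
        have h0 : ε i * y i = 0 := by linarith
        rcases hε i with h | h <;> rw [h] at h0 <;> linarith
      have h2' : rem i y = w := by
        rw [← h2, hai]; simp
      have e : y = ins i 0 w := by
        rw [← ins_rem i y, this, h2']
      rw [e]; exact hw.1
    · have hai' : 0 < a i := lt_of_le_of_ne (ha0 i) (Ne.symm hai)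
      have e : y = (1 - a i / r) • ins i 0 w + (a i / r) • (Pi.single i (r * (y i / a i))) := by
        refine ext_succ i ?_ fun j => ?_
        · simp; field_simp
        · have := congrFun h2 j
          simp only [Pi.smul_apply, rem_apply] at this
          simp [← this]
      rw [e]
      refine h.convex hw.1 (hb ?_) (hl i).le (by positivity) (by ring)
      rw [mem_closedBall_zero_iff, pi_norm_le_iff_of_nonneg hr.le]
      intro j
      by_cases hj : j = i
      · subst hj
        have : |y j| ≤ a j := by
          have h3 := h1.1; have h4 := h1.2
          rw [abs_le]
          rcases hε j with h | h <;> rw [h] at h3 h4 <;> constructor <;> linarith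
        simp only [Pi.single_eq_same, norm_mul, norm_div, Real.norm_eq_abs, abs_of_pos hr, abs_of_pos hai']
        have : |y j| / a j ≤ 1 := (div_le_one hai').2 this
        nlinarith
      · simp [hj, hr.le]
  have hDo : ∀ i, ∀ y ∈ D i, ∀ j, j ≠ i → 0 < ε j * y j := by
    intro i y hy j hj
    obtain ⟨k, rfl⟩ := Fin.exists_succAbove_eq hj
    exact hYo i _ hy.2 k
  have hDa : ∀ i, ∀ y ∈ D i, ∀ j, 0 < ε j * (y j + t * x j) := by
    intro i y hy j
    by_cases hj : j = i
    · subst hj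
      have := hy.1.1
      simp only [ha] at this
      linarith
    · have h1 := hDo i y hy j hj
      have h2 : 0 ≤ t * (ε j * x j) := mul_nonneg ht.le (hx j)
      linarith
  have hdisj : ((Finset.univ : Finset (Fin (n+1))) : Set (Fin (n+1))).PairwiseDisjoint D := by
    intro i _ j _ hij
    rw [Function.onFun, Set.disjoint_left]
    intro y h1 h2
    have := h1.1.2
    have := hDo j y h2 i hij
    linarith
  have hdisj2 : Disjoint (K ∩ oct ε) (⋃ i ∈ (Finset.univ : Finset (Fin (n+1))), D i) := by
    rw [Set.disjoint_left]
    intro y h1 h2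
    simp only [Finset.mem_univ, Set.iUnion_true, Set.mem_iUnion] at h2
    obtain ⟨i, hi⟩ := h2
    have := hi.1.2
    have := h1.2 i
    linarith
  have hsub : (K ∩ oct ε) ∪ (⋃ i ∈ (Finset.univ : Finset (Fin (n+1))), D i) ⊆ {y ∈ K | ∀ i, 0 < ε i * (y i + t * x i)} := by
    rintro y (hy | hy)
    · refine ⟨hy.1, fun i => ?_⟩
      have h1 := hy.2 i
      have h2 : 0 ≤ t * (ε i * x i) := mul_nonneg ht.le (hx i)
      linarith
    · simp only [Finset.mem_univ, Set.iUnion_true, Set.mem_iUnion] at hy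
      obtain ⟨i, hi⟩ := hy
      exact ⟨hDK i hi, hDa i y hi⟩
  have hfin : volume {y ∈ K | ∀ i, 0 < ε i * (y i + t * x i)} ≠ ⊤ := measure_ne_top_of_subset (fun y hy => hy.1) h.vol_ne_top
  have key := measure_mono (μ := volume) hsub
  rw [measure_union hdisj2 (Finset.measurableSet_biUnion _ fun i _ => hDm i), measure_biUnion_finset hdisj (fun i _ => hDm i)] at key
  have hDv : ∀ i, (volume (D i)).toReal = a i * ((1 - a i / r)^n * vol (sec i K ∩ oct (rem i ε))) := by
    intro i
    rw [volume_box, hTvol, ENNReal.toReal_mul, ENNReal.toReal_ofReal (ha0 i)]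
    congr 1
    exact vol_smul _ (hl i).le
  have hDf : ∀ i, volume (D i) ≠ ⊤ := fun i => measure_ne_top_of_subset (hDK i) h.vol_ne_top
  have hKf : volume (K ∩ oct ε) ≠ ⊤ := measure_ne_top_of_subset Set.inter_subset_left h.vol_ne_top
  have := ENNReal.toReal_mono hfin key
  rw [ENNReal.toReal_add hKf (ENNReal.sum_ne_top.2 fun i _ => hDf i), ENNReal.toReal_sum fun i _ => hDf i] at this
  simp only [hDv] at this
  exact this

theorem s1_ineq {n : ℕ} {K : Set (Fin (n+1) → ℝ)} (h : Body K) {ε : Fin (n+1) → ℝ} (hε : IsSign ε)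
    {x : Fin (n+1) → ℝ} (hxK : x ∈ K) (hx : ∀ i, 0 ≤ ε i * x i) {y : Fin (n+1) → ℝ} {γ : ℝ} (hγ : 0 ≤ γ)
    (hxy : gauge K (x + y) ≤ 2 - 3 * γ) :
    ∑ i, (ε i * x i) * vol (sec i K ∩ oct (rem i ε)) ≤
      (n+1) * (vol (K ∩ oct ε) - 2 * γ * vol (K ∩ oct ε ∩ coneU K y γ)) := by
  obtain ⟨r, hr, hb⟩ := h.ball_sub
  set p := vol ((K ∩ oct ε) \ coneU K y γ)
  set q := vol (K ∩ oct ε ∩ coneU K y γ)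
  have hpq : p + q = vol (K ∩ oct ε) := vol_split h _ y γ
  rw [← hpq]
  set M := ∑ i, (ε i * x i) with hM
  have hMi : ∀ i, ε i * x i ≤ M := fun i => Finset.single_le_sum (f := fun i => ε i * x i) (fun i _ => hx i) (Finset.mem_univ i)
  have hM0 : 0 ≤ M := Finset.sum_nonneg fun i _ => hx i
  have hmain : ∀ t, 0 < t → t < min 1 (r / (M + 1)) →
      p + q + ∑ i, t * (ε i * x i) * ((1 - t * (ε i * x i) / r)^n * vol (sec i K ∩ oct (rem i ε))) ≤
      (1+t)^(n+1) * p + (1+t*(1-2*γ))^(n+1) * q := by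
    intro t ht ht1
    have h1 : t < 1 := lt_of_lt_of_le ht1 (min_le_left _ _)
    have h2 : t * (M + 1) < r := by
      have := lt_of_lt_of_le ht1 (min_le_right _ _)
      rwa [lt_div_iff₀ (by linarith)] at this
    rw [hpq]
    refine (slab_lower h hε hr hb hx ht (fun i => ?_)).trans ?_
    · nlinarith [hMi i]
    have hpre : vol {y ∈ K | ∀ i, 0 < ε i * (y i + t * x i)} = vol ((fun z => t • x + z) '' {y ∈ K | ∀ i, 0 < ε i * (y i + t * x i)}) := by
      unfold vol
      rw [Set.image_add_left, measure_preimage_add]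
    rw [hpre]
    refine up_lemma h oct_smul hγ (by have := gauge_nonneg (s := K) (x + y); linarith) ht h1 ?_
    rintro _ ⟨z, ⟨hzK, hz⟩, rfl⟩
    refine ⟨fun i => ?_, z, hzK, x, hxK, add_comm _ _, hxy⟩
    have := hz i
    simp only [Pi.add_apply, Pi.smul_apply, smul_eq_mul]
    rwa [add_comm]
  have hd1 : HasDerivAt (fun t : ℝ => p + q + ∑ i, t * (ε i * x i) * ((1 - t * (ε i * x i) / r)^n * vol (sec i K ∩ oct (rem i ε))))
      (∑ i, (ε i * x i) * vol (sec i K ∩ oct (rem i ε))) 0 := by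
    refine HasDerivAt.const_add _ ?_
    refine HasDerivAt.fun_sum fun i _ => ?_
    have ha : HasDerivAt (fun t : ℝ => t * (ε i * x i)) (ε i * x i) 0 := by
      simpa using (hasDerivAt_id (0:ℝ)).mul_const (ε i * x i)
    have hb : HasDerivAt (fun t : ℝ => (1 - t * (ε i * x i) / r)^n * vol (sec i K ∩ oct (rem i ε)))
      (((n:ℝ) * (1 - 0 * (ε i * x i) / r)^(n-1) * (-((ε i * x i)/r))) * vol (sec i K ∩ oct (rem i ε))) 0 := by
      exact (((ha.div_const r).const_sub 1).fun_pow n).mul_const _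
    have := ha.fun_mul hb
    simpa using this
  have hd2 : HasDerivAt (fun t : ℝ => (1+t)^(n+1) * p + (1+t*(1-2*γ))^(n+1) * q)
      ((n+1) * (p + q - 2 * γ * q)) 0 := by
    have ha : HasDerivAt (fun t : ℝ => (1+t)^(n+1) * p) ((n+1:ℝ) * p) 0 := by
      have := ((((hasDerivAt_id (0:ℝ)).const_add 1).fun_pow (n+1)).mul_const p)
      simpa using this
    have hb : HasDerivAt (fun t : ℝ => (1+t*(1-2*γ))^(n+1) * q) ((n+1:ℝ) * (1-2*γ) * q) 0 := by
      have := (((((hasDerivAt_id (0:ℝ)).mul_const (1-2*γ)).const_add 1).fun_pow (n+1)).mul_const q)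
      simpa using this
    have hab := ha.fun_add hb
    have e : (n+1:ℝ) * (p + q - 2 * γ * q) = (n+1:ℝ) * p + (n+1:ℝ) * (1-2*γ) * q := by ring
    rw [e]; exact hab
  refine deriv_compare (t0 := min 1 (r / (M+1))) (by positivity) hd1 hd2 (by simp) hmain

theorem s3_ineq {n : ℕ} {L : Set (Fin (n+1) → ℝ)} (h : Body L) {c : Fin (n+1) → ℝ} (hc : ∀ i, 0 ≤ c i)
    (hcL : ∀ b : Fin (n+1) → ℝ, (∀ i, |b i| ≤ c i) → b ∈ L) {y : Fin (n+1) → ℝ} {γ : ℝ} (hγ : 0 ≤ γ)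
    (hby : ∀ b : Fin (n+1) → ℝ, (∀ i, |b i| ≤ c i) → gauge L (b + y) ≤ 2 - 3*γ) :
    2 * ∑ i, c i * vol (proj i L) ≤ (n+1) * (vol L - 2 * γ * vol (L ∩ Set.univ ∩ coneU L y γ)) := by
  set p := vol ((L ∩ Set.univ) \ coneU L y γ)
  set q := vol (L ∩ Set.univ ∩ coneU L y γ)
  have hpq : p + q = vol L := by
    have := vol_split h Set.univ y γ
    exact this.trans (by rw [Set.inter_univ])
  rw [← hpq]
  have hmain : ∀ t, 0 < t → t < 1 →
      p + q + t * (2 * ∑ i, c i * vol (proj i L)) ≤ (1+t)^(n+1) * p + (1+t*(1-2*γ))^(n+1) * q := by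
    intro t ht ht1
    rw [hpq]
    have hb := box_volume h.compact h.convex (fun i => t * c i) (fun i => mul_nonneg ht.le (hc i)) Finset.univ
    have hfin : volume (L + boxS (fun i => t * c i) Finset.univ) ≠ ⊤ :=
      (h.compact.add (boxS_compact _ _)).measure_lt_top.ne
    have hpf : ∀ i, volume (proj i L) ≠ ⊤ := fun i => (h.proj_body i).vol_ne_top
    have hb' := ENNReal.toReal_mono hfin hb
    rw [ENNReal.toReal_add h.vol_ne_top (ENNReal.sum_ne_top.2 fun i _ => ENNReal.mul_ne_top ENNReal.ofReal_ne_top (hpf i)),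
      ENNReal.toReal_sum fun i _ => ENNReal.mul_ne_top ENNReal.ofReal_ne_top (hpf i)] at hb'
    have e : ∀ i, (ENNReal.ofReal (2 * (t * c i)) * volume (proj i L)).toReal = t * (2 * (c i * vol (proj i L))) := by
      intro i
      have := hc i
      rw [ENNReal.toReal_mul, ENNReal.toReal_ofReal (by positivity)]
      unfold vol; ring
    simp only [e, ← Finset.mul_sum] at hb'
    refine le_trans hb' ?_
    refine up_lemma h (fun z _ r _ => Set.mem_univ _) hγ (by have := gauge_nonneg (s := L) (0 + y); have := hby 0 (by simpa using hc); linarith) ht ht1 ?_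
    rintro _ ⟨k, hk, b, hb, rfl⟩
    have hb1 : ∀ i, |(t⁻¹ • b) i| ≤ c i := fun i => by
      have := hb.1 i (Finset.mem_univ i)
      rw [Pi.smul_apply, smul_eq_mul, abs_mul, abs_of_pos (inv_pos.2 ht), inv_mul_le_iff₀ ht]
      exact this
    refine ⟨Set.mem_univ _, k, hk, t⁻¹ • b, hcL _ hb1, ?_, hby _ hb1⟩
    rw [smul_smul, mul_inv_cancel₀ ht.ne', one_smul]
  have hd1 : HasDerivAt (fun t : ℝ => p + q + t * (2 * ∑ i, c i * vol (proj i L))) (2 * ∑ i, c i * vol (proj i L)) 0 := by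
    simpa using ((hasDerivAt_id (0:ℝ)).mul_const (2 * ∑ i, c i * vol (proj i L))).const_add (p+q)
  have hd2 : HasDerivAt (fun t : ℝ => (1+t)^(n+1) * p + (1+t*(1-2*γ))^(n+1) * q)
      ((n+1) * (p + q - 2 * γ * q)) 0 := by
    have ha : HasDerivAt (fun t : ℝ => (1+t)^(n+1) * p) ((n+1:ℝ) * p) 0 := by
      have := ((((hasDerivAt_id (0:ℝ)).const_add 1).fun_pow (n+1)).mul_const p)
      simpa using this
    have hb : HasDerivAt (fun t : ℝ => (1+t*(1-2*γ))^(n+1) * q) ((n+1:ℝ) * (1-2*γ) * q) 0 := by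
      have := (((((hasDerivAt_id (0:ℝ)).mul_const (1-2*γ)).const_add 1).fun_pow (n+1)).mul_const q)
      simpa using this
    have hab := ha.fun_add hb
    have e : (n+1:ℝ) * (p + q - 2 * γ * q) = (n+1:ℝ) * p + (n+1:ℝ) * (1-2*γ) * q := by ring
    rw [e]; exact hab
  exact deriv_compare (t0 := 1) one_pos hd1 hd2 (by simp) hmain

end Mah

namespace Mah
open Topology

def EqOct {n : ℕ} (K : Set (Fin n → ℝ)) : Prop := ∀ ε : Fin n → ℝ, IsSign ε → 2^n * vol (K ∩ oct ε) = vol K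

noncomputable def cc {n : ℕ} (K : Set (Fin (n+1) → ℝ)) (i : Fin (n+1)) : ℝ := 2 * vol (sec i K) / ((n+1) * vol K)

/-- equipartitioned body -/
structure Equi {n : ℕ} (K : Set (Fin (n+1) → ℝ)) : Prop where
  body : Body K
  eq : EqOct K
  eqs : ∀ i, EqOct (sec i K)

variable {n : ℕ} {K : Set (Fin (n+1) → ℝ)}

theorem Equi.cc_pos (h : Equi K) (i) : 0 < cc K i := by
  have h1 := h.body.vol_pos
  have h2 := (h.body.sec_body i).vol_pos
  unfold cc; positivity

theorem exists_sign (x y : Fin n → ℝ) (h : ∀ i, 0 ≤ x i * y i) :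
    ∃ ε : Fin n → ℝ, IsSign ε ∧ (∀ i, 0 ≤ ε i * x i) ∧ (∀ i, 0 ≤ ε i * y i) := by
  refine ⟨fun i => if 0 ≤ x i ∧ 0 ≤ y i then 1 else -1, fun i => ?_, fun i => ?_, fun i => ?_⟩
  · dsimp only; split_ifs <;> simp
  · dsimp only; split_ifs with h1
    · linarith [h1.1]
    · have := h i
      by_contra! h2
      exact h1 ⟨by linarith, by by_contra! h3; nlinarith⟩
  · dsimp only; split_ifs with h1
    · linarith [h1.2]
    · have := h i
      by_contra! h2
      exact h1 ⟨by by_contra! h3; nlinarith, by linarith⟩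

theorem sign_abs {ε x : ℝ} (h : ε = 1 ∨ ε = -1) (hx : 0 ≤ ε * x) : ε * x = |x| := by
  rcases h with rfl | rfl
  · rw [abs_of_nonneg (by linarith)]; ring
  · rw [abs_of_nonpos (by linarith)]; ring

theorem Equi.sum_eq (h : Equi K) {ε : Fin (n+1) → ℝ} (hε : IsSign ε) {x : Fin (n+1) → ℝ} (hx : ∀ i, 0 ≤ ε i * x i) :
    ∑ i, (ε i * x i) * vol (sec i K ∩ oct (rem i ε)) = (∑ i, cc K i * |x i|) * ((n+1) * vol (K ∩ oct ε)) := by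
  rw [Finset.sum_mul]
  refine Finset.sum_congr rfl fun i _ => ?_
  rw [sign_abs (hε i) (hx i)]
  have h1 := h.eqs i _ (hε.rem i)
  have h2 := h.eq ε hε
  have h3 := h.body.vol_pos
  unfold cc
  rw [← h1]
  rw [← h2] at h3 ⊢
  have : vol (K ∩ oct ε) ≠ 0 := by rintro e; rw [e] at h3; simp at h3
  field_simp
  ring

theorem Equi.sum_le (h : Equi K) {x : Fin (n+1) → ℝ} (hx : x ∈ K) : ∑ i, cc K i * |x i| ≤ 1 := by
  obtain ⟨ε, hε, hx1, -⟩ := exists_sign x x (fun i => mul_self_nonneg _)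
  have := s1_ineq h.body hε hx hx1 (y := 0) (γ := 0) le_rfl (by
    simp only [add_zero, mul_zero, sub_zero]; exact (h.body.gauge_le_one.2 hx).trans (by norm_num))
  rw [h.sum_eq hε hx1] at this
  have h2 := h.eq ε hε
  have h3 := h.body.vol_pos
  have h4 : 0 < vol (K ∩ oct ε) := by rw [← h2] at h3; exact (pos_iff_pos_of_mul_pos h3).1 (by positivity)
  have h5 : 0 < (n+1) * vol (K ∩ oct ε) := by positivity
  by_contra! h6
  nlinarith

theorem Equi.touch_face (h : Equi K) {x y : Fin (n+1) → ℝ} (hx : x ∈ K) (hs : ∑ i, cc K i * |x i| = 1)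
    (hy : gauge K y = 1) (hxy : ∀ i, 0 ≤ x i * y i) : gauge K (x + y) = 2 := by
  have hle : ∀ y, gauge K y = 1 → gauge K (x+y) ≤ 2 := fun y hy => by
    have := h.body.gauge_add x y
    have := h.body.gauge_le_one.2 hx
    linarith
  obtain ⟨ε, hε, hx1, hy1⟩ := exists_sign x y hxy
  have hopen : ∀ y, gauge K y = 1 → y ∈ oct ε → gauge K (x + y) = 2 := by
    intro y hy hyo
    refine le_antisymm (hle y hy) ?_
    by_contra! hlt
    set γ := (2 - gauge K (x+y))/3 with hγ
    have hγ0 : 0 < γ := by rw [hγ]; linarith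
    have := s1_ineq h.body hε hx hx1 (y := y) (γ := γ) hγ0.le (by rw [hγ]; linarith)
    rw [h.sum_eq hε hx1, hs] at this
    have hq := vol_cone_pos h.body (oct_open ε) oct_smul hyo hy hγ0
    have : 0 < (n+1:ℝ) * (2 * γ * vol (K ∩ oct ε ∩ coneU K y γ)) := by positivity
    linarith
  have hcont := h.body.cont_gauge
  set g : ℝ → ℝ := fun δ => gauge K (y + δ • ε)
  have hg : Continuous g := by fun_prop
  have hF : Continuous fun δ => gauge K (g δ • x + (y + δ • ε)) - 2 * g δ := by fun_prop
  have h0 : ∀ δ : ℝ, 0 < δ → gauge K (g δ • x + (y + δ • ε)) - 2 * g δ = 0 := by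
    intro δ hδ
    have ho : y + δ • ε ∈ oct ε := fun i => by
      have := hy1 i
      have e : ε i * ε i = 1 := by rcases hε i with h | h <;> rw [h] <;> norm_num
      simp only [Pi.add_apply, Pi.smul_apply, smul_eq_mul]
      nlinarith
    have hne : y + δ • ε ≠ 0 := by
      intro e; have := ho 0; rw [e] at this; simp at this
    have hgp : 0 < g δ := h.body.gauge_pos.2 hne
    have := hopen ((g δ)⁻¹ • (y + δ • ε)) (by
      rw [Body.gauge_smul' (inv_nonneg.2 hgp.le)]; exact inv_mul_cancel₀ hgp.ne') (oct_smul _ ho _ (inv_pos.2 hgp))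
    have e : g δ • x + (y + δ • ε) = g δ • (x + (g δ)⁻¹ • (y + δ • ε)) := by
      rw [smul_add (g δ), smul_smul, mul_inv_cancel₀ hgp.ne', one_smul]
    rw [e, Body.gauge_smul' hgp.le, this]; ring
  have ht := (hF.tendsto 0).mono_left (nhdsWithin_le_nhds (s := Set.Ioi 0))
  have ht2 : Filter.Tendsto (fun δ => gauge K (g δ • x + (y + δ • ε)) - 2 * g δ) (𝓝[>] 0) (𝓝 0) := by
    refine tendsto_const_nhds.congr' ?_
    filter_upwards [self_mem_nhdsWithin] with δ hδ
    exact (h0 δ hδ).symm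
  have := tendsto_nhds_unique ht ht2
  simp only [g, zero_smul, add_zero, hy, one_smul] at this
  linarith

theorem Equi.box_sub (h : Equi K) (b : Fin (n+1) → ℝ) (hb : ∀ i, |b i| ≤ cc K i) : b ∈ pol K := by
  intro x hx
  refine le_trans ?_ (h.sum_le hx)
  refine Finset.sum_le_sum fun i _ => ?_
  calc x i * b i ≤ |x i * b i| := le_abs_self _
    _ = |b i| * |x i| := by rw [abs_mul, mul_comm]
    _ ≤ _ := by gcongr; exact hb i

theorem Equi.proj_sum (h : Equi K) : 4 * ∑ i, vp (sec i K) ≤ (n+1) * vol K * (2 * ∑ i, cc K i * vol (proj i (pol K))) := by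
  have h3 := h.body.vol_pos
  rw [Finset.mul_sum, Finset.mul_sum, Finset.mul_sum]
  refine Finset.sum_le_sum fun i _ => ?_
  have h1 : vol (pol (sec i K)) ≤ vol (proj i (pol K)) :=
    vol_mono (pol_sec_sub i h.body) (h.body.pol_body.proj_body i).vol_ne_top
  have h2 := (h.body.sec_body i).vol_pos
  unfold vp cc
  calc 4 * (vol (sec i K) * vol (pol (sec i K))) ≤ 4 * (vol (sec i K) * vol (proj i (pol K))) := by gcongr
    _ = _ := by field_simp; ring

theorem Equi.vp_ge (h : Equi K) : 4 * ∑ i, vp (sec i K) ≤ (n+1)^2 * vp K := by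
  refine h.proj_sum.trans ?_
  have := s3_ineq h.body.pol_body (c := cc K) (fun i => (h.cc_pos i).le) h.box_sub (y := 0) (γ := 0) le_rfl
    (fun b hb => by
      have := h.body.pol_body.gauge_le_one.2 (h.box_sub b hb)
      rw [add_zero]; linarith)
  simp only [mul_zero, zero_mul, sub_zero] at this
  have h3 := h.body.vol_pos
  calc (n+1) * vol K * (2 * ∑ i, cc K i * vol (proj i (pol K))) ≤ (n+1) * vol K * ((n+1) * vol (pol K)) := by gcongr
    _ = _ := by unfold vp; ring

theorem Equi.exists_touch (h : Equi K) (hm : (n+1)^2 * vp K ≤ 4 * ∑ i, vp (sec i K)) {y : Fin (n+1) → ℝ} (hy : y ≠ 0) :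
    ∃ x ∈ K, x ⬝ᵥ y = gauge (pol K) y ∧ ∑ i, cc K i * |x i| = 1 := by
  have hP := h.body.pol_body
  have hgp := hP.gauge_pos.2 hy
  set y' := (gauge (pol K) y)⁻¹ • y with hy'
  have hg1 : gauge (pol K) y' = 1 := by
    rw [hy', Body.gauge_smul' (inv_nonneg.2 hgp.le), inv_mul_cancel₀ hgp.ne']
  have hdl : ∀ x ∈ K, ∀ z, x ⬝ᵥ z ≤ gauge (pol K) z := fun x hx z => by
    rw [dotProduct_comm]
    exact hP.dot_le_gauge (by rw [h.body.bipolar]; exact hx)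
  have hFc : ContinuousOn (fun x : Fin (n+1) → ℝ => x ⬝ᵥ y' + ∑ i, cc K i * |x i|) K := by
    refine Continuous.continuousOn ?_
    refine (continuous_dot_left _).add ?_
    fun_prop
  obtain ⟨x, hx, hmax⟩ := h.body.compact.exists_isMaxOn ⟨0, h.body.zero_mem⟩ hFc
  have h1 := hdl x hx y'
  rw [hg1] at h1
  have h2 := h.sum_le hx
  by_cases hlt : x ⬝ᵥ y' + ∑ i, cc K i * |x i| < 2
  · exfalso
    set γ := (2 - (x ⬝ᵥ y' + ∑ i, cc K i * |x i|))/3 with hγ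
    have hγ0 : 0 < γ := by rw [hγ]; linarith
    have := s3_ineq hP (c := cc K) (fun i => (h.cc_pos i).le) h.box_sub (y := y') (γ := γ) hγ0.le
      (fun b hb => by
        refine hP.gauge_le_of ?_
        intro z hz
        rw [h.body.bipolar] at hz
        have hzm : z ⬝ᵥ y' + ∑ i, cc K i * |z i| ≤ x ⬝ᵥ y' + ∑ i, cc K i * |x i| := hmax hz
        have : z ⬝ᵥ b ≤ ∑ i, cc K i * |z i| := by
          refine Finset.sum_le_sum fun i _ => ?_
          calc z i * b i ≤ |z i * b i| := le_abs_self _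
            _ = |b i| * |z i| := by rw [abs_mul, mul_comm]
            _ ≤ _ := by gcongr; exact hb i
        rw [add_dotProduct, dotProduct_comm b, dotProduct_comm y', hγ]
        linarith)
    have hq := vol_cone_pos hP isOpen_univ (fun z _ r _ => Set.mem_univ _) (Set.mem_univ y') hg1 hγ0
    have h5 := h.proj_sum
    have h3 := h.body.vol_pos
    have h6 : (n+1) * vol K * (2 * ∑ i, cc K i * vol (proj i (pol K))) < (n+1)^2 * vp K := by
      calc _ ≤ (n+1) * vol K * ((n+1) * (vol (pol K) - 2 * γ * vol (pol K ∩ Set.univ ∩ coneU (pol K) y' γ))) := by gcongr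
        _ < (n+1) * vol K * ((n+1) * vol (pol K)) := by
          have : 0 < γ * vol (pol K ∩ Set.univ ∩ coneU (pol K) y' γ) := by positivity
          gcongr; linarith
        _ = _ := by unfold vp; ring
    linarith
  · refine ⟨x, hx, ?_, by linarith⟩
    have h3 : x ⬝ᵥ y' = 1 := by linarith
    rw [hy', dotProduct_smul, smul_eq_mul] at h3
    field_simp at h3
    exact h3

end Mah

namespace Mah
open Topology

section comap
variable {n : ℕ} (e : (Fin n → ℝ) ≃ₗ[ℝ] (Fin n → ℝ)) {K : Set (Fin n → ℝ)}

theorem cont_e : Continuous e := LinearMap.continuous_on_pi (e : (Fin n → ℝ) →ₗ[ℝ] (Fin n → ℝ))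

theorem Body.comap (h : Body K) : Body (e ⁻¹' K) where
  compact := (e.toContinuousLinearEquiv.toHomeomorph.isCompact_preimage).2 h.compact
  convex := h.convex.linear_preimage (e : (Fin n → ℝ) →ₗ[ℝ] (Fin n → ℝ))
  symm := fun x hx => by
    show e (-x) ∈ K
    rw [map_neg]; exact h.symm _ hx
  nhds := by
    refine (cont_e e).continuousAt.preimage_mem_nhds ?_
    rw [map_zero]; exact h.nhds

theorem det_ne : LinearMap.det (e : (Fin n → ℝ) →ₗ[ℝ] (Fin n → ℝ)) ≠ 0 := (LinearEquiv.isUnit_det' e).ne_zero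

theorem vol_comap (S : Set (Fin n → ℝ)) :
    vol (e ⁻¹' S) = |LinearMap.det (e : (Fin n → ℝ) →ₗ[ℝ] (Fin n → ℝ))|⁻¹ * vol S := by
  unfold vol
  have := Measure.addHaar_preimage_linearMap (volume : Measure (Fin n → ℝ)) (det_ne e) S
  have h2 : (⇑e ⁻¹' S) = (⇑(e : (Fin n → ℝ) →ₗ[ℝ] (Fin n → ℝ)) ⁻¹' S) := rfl
  rw [h2, this, ENNReal.toReal_mul, ENNReal.toReal_ofReal (abs_nonneg _), abs_inv]

/-- transpose -/
noncomputable def tr : (Fin n → ℝ) ≃ₗ[ℝ] (Fin n → ℝ) :=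
  Matrix.toLinearEquiv' (LinearMap.toMatrix' (e : (Fin n → ℝ) →ₗ[ℝ] (Fin n → ℝ))).transpose
    (Matrix.invertibleOfIsUnitDet _ (by
      rw [Matrix.det_transpose, LinearMap.det_toMatrix']; exact isUnit_iff_ne_zero.2 (det_ne e)))

theorem tr_apply (x : Fin n → ℝ) : tr e x = (LinearMap.toMatrix' (e : (Fin n → ℝ) →ₗ[ℝ] (Fin n → ℝ))).transpose.mulVec x := rfl

theorem det_tr : LinearMap.det (tr e : (Fin n → ℝ) →ₗ[ℝ] (Fin n → ℝ)) = LinearMap.det (e : (Fin n → ℝ) →ₗ[ℝ] (Fin n → ℝ)) := by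
  have : (tr e : (Fin n → ℝ) →ₗ[ℝ] (Fin n → ℝ)) = Matrix.toLin' (LinearMap.toMatrix' (e : (Fin n → ℝ) →ₗ[ℝ] (Fin n → ℝ))).transpose := rfl
  rw [this, LinearMap.det_toLin', Matrix.det_transpose, LinearMap.det_toMatrix']

theorem dot_tr (x y : Fin n → ℝ) : e x ⬝ᵥ y = x ⬝ᵥ tr e y := by
  rw [tr_apply, Matrix.mulVec_transpose, dotProduct_comm x, ← Matrix.dotProduct_mulVec, dotProduct_comm]
  congr 1
  rw [← Matrix.toLin'_apply, Matrix.toLin'_toMatrix']; rfl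

theorem pol_comap : pol (e ⁻¹' K) = tr e.symm ⁻¹' (pol K) := by
  ext y
  constructor
  · intro hy x hx
    rw [← dot_tr]
    exact hy _ (by simpa using hx)
  · intro hy x hx
    have := hy (e x) hx
    rw [← dot_tr] at this
    simpa using this

theorem vp_comap : vp (e ⁻¹' K) = vp K := by
  unfold vp
  rw [pol_comap, vol_comap, vol_comap, det_tr]
  have h1 := det_ne e
  have h2 : LinearMap.det (e.symm : (Fin n → ℝ) →ₗ[ℝ] (Fin n → ℝ)) * LinearMap.det (e : (Fin n → ℝ) →ₗ[ℝ] (Fin n → ℝ)) = 1 := by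
    rw [← LinearMap.det_comp]; simp
  have h3 : |LinearMap.det (e.symm : (Fin n → ℝ) →ₗ[ℝ] (Fin n → ℝ))| * |LinearMap.det (e : (Fin n → ℝ) →ₗ[ℝ] (Fin n → ℝ))| = 1 := by
    rw [← abs_mul, h2, abs_one]
  have h4 := det_ne e.symm
  calc _ = (|LinearMap.det (e.symm : (Fin n → ℝ) →ₗ[ℝ] (Fin n → ℝ))| * |LinearMap.det (e : (Fin n → ℝ) →ₗ[ℝ] (Fin n → ℝ))|)⁻¹ * (vol K * vol (pol K)) := by
        rw [mul_inv]; ring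
    _ = _ := by rw [h3]; simp

end comap

/-- diagonal maps -/
noncomputable def dg {n : ℕ} (d : Fin n → ℝ) (hd : ∀ i, d i ≠ 0) : (Fin n → ℝ) ≃ₗ[ℝ] (Fin n → ℝ) :=
  LinearEquiv.piCongrRight fun i => LinearEquiv.smulOfNeZero ℝ ℝ (d i) (hd i)

@[simp] theorem dg_apply {n : ℕ} (d : Fin n → ℝ) (hd : ∀ i, d i ≠ 0) (x : Fin n → ℝ) (i) : dg d hd x i = d i * x i := rfl

theorem EqOct.dg {n : ℕ} {K : Set (Fin n → ℝ)} (h : EqOct K) (d : Fin n → ℝ) (hd : ∀ i, 0 < d i) :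
    EqOct (dg d (fun i => (hd i).ne') ⁻¹' K) := by
  intro ε hε
  have : (Mah.dg d (fun i => (hd i).ne') ⁻¹' K) ∩ oct ε = Mah.dg d (fun i => (hd i).ne') ⁻¹' (K ∩ oct ε) := by
    ext x
    simp only [Set.mem_inter_iff, Set.mem_preimage, oct, Set.mem_setOf_eq, dg_apply]
    refine and_congr_right fun _ => forall_congr' fun i => ?_
    rw [show ε i * (d i * x i) = d i * (ε i * x i) by ring, mul_pos_iff_of_pos_left (hd i)]
  rw [this, vol_comap, vol_comap, ← h ε hε]; ring

theorem sec_dg {n : ℕ} {K : Set (Fin (n+1) → ℝ)} (d : Fin (n+1) → ℝ) (hd : ∀ i, d i ≠ 0) (i) :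
    sec i (dg d hd ⁻¹' K) = dg (rem i d) (fun j => hd _) ⁻¹' (sec i K) := by
  ext y
  show dg d hd (ins i 0 y) ∈ K ↔ ins i 0 (dg (rem i d) (fun j => hd _) y) ∈ K
  have : dg d hd (ins i 0 y) = ins i 0 (dg (rem i d) (fun j => hd _) y) := by
    refine ext_succ i (by simp) fun j => ?_
    rw [dg_apply, ins_succ, ins_succ]; rfl
  rw [this]

theorem Equi.dg {n : ℕ} {K : Set (Fin (n+1) → ℝ)} (h : Equi K) (d : Fin (n+1) → ℝ) (hd : ∀ i, 0 < d i) :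
    Equi (dg d (fun i => (hd i).ne') ⁻¹' K) where
  body := h.body.comap _
  eq := h.eq.dg d hd
  eqs := fun i => by
    rw [sec_dg]
    exact (h.eqs i).dg (rem i d) fun j => hd _

/-! ### dimension one -/

theorem one_form {K : Set (Fin 1 → ℝ)} (h : Body K) : ∃ a > 0, K = {x | |x 0| ≤ a} := by
  have hg : 0 < gauge K 1 := h.gauge_pos.2 one_ne_zero
  refine ⟨(gauge K 1)⁻¹, inv_pos.2 hg, ?_⟩
  ext x
  have e : gauge K x = |x 0| * gauge K 1 := by
    rcases abs_cases (x 0) with ⟨h1, h2⟩ | ⟨h1, h2⟩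
    · rw [h1, ← Body.gauge_smul' h2]; congr 1; ext i; fin_cases i; simp
    · rw [h1, ← Body.gauge_smul' (by linarith), ← h.gauge_neg]; congr 1; ext i; fin_cases i; simp
  rw [← h.gauge_le_one, e, Set.mem_setOf_eq, ← one_div, le_div_iff₀ hg]

theorem one_vol (a : ℝ) (ha : 0 ≤ a) : vol {x : Fin 1 → ℝ | |x 0| ≤ a} = 2 * a := by
  have : {x : Fin 1 → ℝ | |x 0| ≤ a} = Set.Icc (fun _ => -a) (fun _ => a) := by
    ext x; simp [abs_le, Pi.le_def]
  unfold vol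
  rw [this, Real.volume_Icc_pi_toReal (fun _ => by simp; linarith)]
  simp; ring

theorem one_pol (a : ℝ) (ha : 0 < a) : pol {x : Fin 1 → ℝ | |x 0| ≤ a} = {x | |x 0| ≤ a⁻¹} := by
  ext y
  simp only [pol, Set.mem_setOf_eq, dotProduct, Fin.sum_univ_one, Finset.univ_unique, Fin.default_eq_zero, Finset.sum_singleton]
  constructor
  · intro h
    have h1 := h (fun _ => a) (by simp [abs_of_pos ha])
    have h2 := h (fun _ => -a) (by simp [abs_of_pos ha])
    rw [← one_div, le_div_iff₀ ha]
    rcases abs_cases (y 0) with ⟨h3, _⟩ | ⟨h3, _⟩ <;> rw [h3] <;> linarith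
  · intro h x hx
    calc x 0 * y 0 ≤ |x 0 * y 0| := le_abs_self _
      _ = |x 0| * |y 0| := abs_mul _ _
      _ ≤ a * a⁻¹ := by gcongr
      _ = 1 := mul_inv_cancel₀ ha.ne'

theorem one_vp {K : Set (Fin 1 → ℝ)} (h : Body K) : vp K = 4 := by
  obtain ⟨a, ha, rfl⟩ := one_form h
  unfold vp
  rw [one_pol a ha, one_vol a ha.le, one_vol _ (by positivity)]
  field_simp; norm_num

theorem one_eq {K : Set (Fin 1 → ℝ)} (h : Body K) : EqOct K := by
  obtain ⟨a, ha, rfl⟩ := one_form h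
  intro ε hε
  rw [one_vol a ha.le]
  have : vol ({x : Fin 1 → ℝ | |x 0| ≤ a} ∩ oct ε) = a := by
    rcases hε 0 with h1 | h1
    · have : ({x : Fin 1 → ℝ | |x 0| ≤ a} ∩ oct ε) = Set.pi Set.univ fun _ => Set.Ioc 0 a := by
        ext x
        simp only [oct, Set.mem_inter_iff, Set.mem_setOf_eq, Set.mem_pi, Set.mem_univ, Fin.forall_fin_one, h1, abs_le, Set.mem_Ioc, true_imp_iff]
        constructor
        · rintro ⟨⟨_, _⟩, _⟩; constructor <;> linarith
        · rintro ⟨_, _⟩; exact ⟨⟨by linarith, by linarith⟩, by linarith⟩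
      unfold vol
      rw [this, Real.volume_pi_Ioc_toReal (a := fun _ => 0) (b := fun _ => a) (fun _ => ha.le)]; simp
    · have : ({x : Fin 1 → ℝ | |x 0| ≤ a} ∩ oct ε) = Set.pi Set.univ fun _ => Set.Ico (-a) 0 := by
        ext x
        simp only [oct, Set.mem_inter_iff, Set.mem_setOf_eq, Set.mem_pi, Set.mem_univ, Fin.forall_fin_one, h1, abs_le, Set.mem_Ico, true_imp_iff]
        constructor
        · rintro ⟨⟨_, _⟩, _⟩; constructor <;> linarith
        · rintro ⟨_, _⟩; exact ⟨⟨by linarith, by linarith⟩, by linarith⟩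
      unfold vol
      rw [this, Real.volume_pi_Ico_toReal (a := fun _ => -a) (b := fun _ => 0) (fun _ => by simp; linarith)]; simp
  rw [this]; ring

theorem equi_two {Q : Set (Fin 2 → ℝ)} (h : Body Q) (he : EqOct Q) : Equi Q :=
  ⟨h, he, fun i => one_eq (h.sec_body i)⟩

theorem two_vp {Q : Set (Fin 2 → ℝ)} (h : Body Q) (he : EqOct Q) : 8 ≤ vp Q := by
  have := (equi_two h he).vp_ge
  simp only [one_vp (h.sec_body _)] at this
  norm_num at this
  linarith

end Mah

namespace Mah
open Topology

theorem Body.pol_gauge_one {n : ℕ} {K : Set (Fin n → ℝ)} (h : Body K) {x l : Fin n → ℝ} (hl : l ∈ pol K) (hx : x ∈ K)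
    (hxl : x ⬝ᵥ l = 1) : gauge (pol K) l = 1 :=
  le_antisymm (h.pol_body.gauge_le_one.2 hl) (hxl ▸ h.dot_le_supp hx)

/-- contact data -/
structure TR {n : ℕ} (K : Set (Fin n → ℝ)) (c : Fin n → ℝ) : Prop where
  body : Body K
  pos : ∀ i, 0 < c i
  sum_le : ∀ x ∈ K, ∑ i, c i * |x i| ≤ 1
  touch : ∀ y, y ≠ 0 → ∃ x ∈ K, x ⬝ᵥ y = gauge (pol K) y ∧ ∑ i, c i * |x i| = 1
  face : ∀ x ∈ K, ∑ i, c i * |x i| = 1 → ∀ y, gauge K y = 1 → (∀ i, 0 ≤ x i * y i) → ∃ l ∈ pol K, x ⬝ᵥ l = 1 ∧ y ⬝ᵥ l = 1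

theorem Equi.tr {n : ℕ} {K : Set (Fin (n+1) → ℝ)} (h : Equi K) (hm : (n+1)^2 * vp K ≤ 4 * ∑ i, vp (sec i K)) :
    TR K (cc K) where
  body := h.body
  pos := h.cc_pos
  sum_le := fun x hx => h.sum_le hx
  touch := fun y hy => h.exists_touch hm hy
  face := fun x hx hs y hy hxy => by
    have h1 := h.touch_face hx hs hy hxy
    obtain ⟨l, hl, e⟩ := h.body.exists_pol_eq (x + y)
    rw [h1, add_dotProduct] at e
    have h2 := h.body.dot_le_gauge (x := y) hl
    have h3 := hl x hx
    exact ⟨l, hl, by linarith, by linarith⟩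

theorem TR.touch' {n : ℕ} {K : Set (Fin n → ℝ)} {c : Fin n → ℝ} (h : TR K c) {l l' z : Fin n → ℝ} (hl : l ∈ pol K) (hl' : l' ∈ pol K)
    (hz : z ∈ K) (h1 : z ⬝ᵥ l = 1) (h2 : z ⬝ᵥ l' = 1) : ∃ x ∈ K, x ⬝ᵥ l = 1 ∧ x ⬝ᵥ l' = 1 ∧ ∑ i, c i * |x i| = 1 := by
  set m := (1/2:ℝ) • l + (1/2:ℝ) • l' with hm
  have hmp : m ∈ pol K := h.body.pol_body.convex hl hl' (by norm_num) (by norm_num) (by norm_num)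
  have hd : ∀ x, x ⬝ᵥ m = 1/2 * (x ⬝ᵥ l) + 1/2 * (x ⬝ᵥ l') := fun x => by
    rw [hm, dotProduct_add, dotProduct_smul, dotProduct_smul]; rfl
  have hzm : z ⬝ᵥ m = 1 := by rw [hd, h1, h2]; norm_num
  have hm0 : m ≠ 0 := by rintro e; rw [e] at hzm; simp at hzm
  obtain ⟨x, hx, hxm, hs⟩ := h.touch m hm0
  rw [h.body.pol_gauge_one hmp hz hzm, hd] at hxm
  have := hl x hx
  have := hl' x hx
  exact ⟨x, hx, by linarith, by linarith, hs⟩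

def Dg (k : ℝ → ℝ → Prop) : Prop := ∀ a b, k a b ↔ |a| + |b| ≤ 1
def Sg (τ : ℝ) (k : ℝ → ℝ → Prop) : Prop := ∀ a b, k a b ↔ |a + τ * b| ≤ 1 ∧ |b - τ * a| ≤ 1
def DS (k : ℝ → ℝ → Prop) : Prop := Dg k ∨ ∃ τ, |τ| < 1 ∧ Sg τ k

theorem dot2 (x y : Fin 2 → ℝ) : x ⬝ᵥ y = x 0 * y 0 + x 1 * y 1 := by simp [dotProduct, Fin.sum_univ_two]

theorem two_class {Q : Set (Fin 2 → ℝ)} {c : ℝ} (h : TR Q (fun _ => c)) (g0 : gauge Q ![1,0] = 1) (g1 : gauge Q ![0,1] = 1) :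
    DS (fun a b => ![a,b] ∈ Q) := by
  have hc := h.pos 0
  have hb := h.body
  have m0 : ![1,0] ∈ Q := hb.gauge_le_one.1 g0.le
  have m1 : ![0,1] ∈ Q := hb.gauge_le_one.1 g1.le
  have hs : ∀ x ∈ Q, c * (|x 0| + |x 1|) ≤ 1 := fun x hx => by
    have := h.sum_le x hx; rw [Fin.sum_univ_two] at this; linarith
  have hc1 : c ≤ 1 := by simpa using hs _ m0
  rcases eq_or_lt_of_le hc1 with e | hlt
  · left
    intro a b
    constructor
    · intro hab
      have := hs _ hab
      rw [e, one_mul] at this; simpa using this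
    · intro hab
      refine hb.mem_of fun l hl => ?_
      have h1 := hl _ m0
      have h2 := hl _ m1
      have h3 := hl _ (hb.symm _ m0)
      have h4 := hl _ (hb.symm _ m1)
      simp [dot2, -Matrix.cons_dotProduct] at h1 h2 h3 h4 ⊢
      calc a * l 0 + b * l 1 ≤ |a * l 0| + |b * l 1| := add_le_add (le_abs_self _) (le_abs_self _)
        _ = |a| * |l 0| + |b| * |l 1| := by rw [abs_mul, abs_mul]
        _ ≤ |a| * 1 + |b| * 1 := by
          gcongr
          · exact abs_le.2 ⟨by linarith, h1⟩
          · exact abs_le.2 ⟨by linarith, h2⟩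
        _ ≤ 1 := by linarith
  right
  have hTs : ∀ x : Fin 2 → ℝ, ∑ i, c * |x i| = 1 ↔ c * (|x 0| + |x 1|) = 1 := fun x => by
    rw [Fin.sum_univ_two, mul_add]
  obtain ⟨l, hl, el⟩ := hb.exists_pol_eq ![1,0]
  obtain ⟨l', hl', el'⟩ := hb.exists_pol_eq ![0,1]
  rw [g0] at el; rw [g1] at el'
  have el0 : l 0 = 1 := by simpa [dot2, -Matrix.cons_dotProduct] using el
  have el1 : l' 1 = 1 := by simpa [dot2, -Matrix.cons_dotProduct] using el'
  have uni0 : ∀ k ∈ pol Q, k 0 = 1 → k 1 = l 1 := by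
    intro k hk hk0
    obtain ⟨x, hx, hx1, hx2, hxs⟩ := h.touch' hk hl m0 (by simp [dot2, -Matrix.cons_dotProduct, hk0]) el
    rw [dot2] at hx1 hx2
    by_contra hne
    have hx0 : x 1 = 0 := by
      have : x 1 * (k 1 - l 1) = 0 := by rw [hk0] at hx1; rw [el0] at hx2; linarith
      rcases mul_eq_zero.1 this with h | h
      · exact h
      · exact absurd (by linarith) hne
    have : x 0 = 1 := by rw [hx0, el0] at hx2; linarith
    rw [hTs, hx0, this] at hxs
    simp at hxs; linarith
  have uni1 : ∀ k ∈ pol Q, k 1 = 1 → k 0 = l' 0 := by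
    intro k hk hk0
    obtain ⟨x, hx, hx1, hx2, hxs⟩ := h.touch' hk hl' m1 (by simp [dot2, -Matrix.cons_dotProduct, hk0]) el'
    rw [dot2] at hx1 hx2
    by_contra hne
    have hx0 : x 0 = 0 := by
      have : x 0 * (k 0 - l' 0) = 0 := by rw [hk0] at hx1; rw [el1] at hx2; linarith
      rcases mul_eq_zero.1 this with h | h
      · exact h
      · exact absurd (by linarith) hne
    have : x 1 = 1 := by rw [hx0, el1] at hx2; linarith
    rw [hTs, hx0, this] at hxs
    simp at hxs; linarith
  set τ := l 1 with hτ
  set σ := l' 0 with hσ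
  -- touching points
  have hT0 : ∀ x ∈ Q, ∑ i, c * |x i| = 1 → 0 ≤ x 0 → x 0 + τ * x 1 = 1 := by
    intro x hx hxs h0
    obtain ⟨k, hk, h1, h2⟩ := h.face x hx hxs ![1,0] g0 (by intro i; fin_cases i <;> simp [h0])
    have hk0 : k 0 = 1 := by simpa [dot2, -Matrix.cons_dotProduct] using h2
    rw [dot2, uni0 k hk hk0, hk0] at h1
    linarith
  have hT1 : ∀ x ∈ Q, ∑ i, c * |x i| = 1 → 0 ≤ x 1 → σ * x 0 + x 1 = 1 := by
    intro x hx hxs h0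
    obtain ⟨k, hk, h1, h2⟩ := h.face x hx hxs ![0,1] g1 (by intro i; fin_cases i <;> simp [h0])
    have hk0 : k 1 = 1 := by simpa [dot2, -Matrix.cons_dotProduct] using h2
    rw [dot2, uni1 k hk hk0, hk0] at h1
    linarith
  have hneg : ∀ x : Fin 2 → ℝ, ∑ i, c * |x i| = 1 → ∑ i, c * |(-x) i| = 1 := fun x hx => by simpa using hx
  have hT0' : ∀ x ∈ Q, ∑ i, c * |x i| = 1 → x 0 ≤ 0 → x 0 + τ * x 1 = -1 := by
    intro x hx hxs h0
    have := hT0 _ (hb.symm x hx) (hneg x hxs) (by simpa using h0)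
    simp at this; linarith
  have hT1' : ∀ x ∈ Q, ∑ i, c * |x i| = 1 → x 1 ≤ 0 → σ * x 0 + x 1 = -1 := by
    intro x hx hxs h0
    have := hT1 _ (hb.symm x hx) (hneg x hxs) (by simpa using h0)
    simp at this; linarith
  have nz : ∀ x ∈ Q, ∑ i, c * |x i| = 1 → x 0 ≠ 0 ∧ x 1 ≠ 0 := by
    intro x hx hxs
    constructor
    · intro e
      have h1 := hT0 x hx hxs e.ge
      have h2 := hT0' x hx hxs e.le
      linarith
    · intro e
      have h1 := hT1 x hx hxs e.ge
      have h2 := hT1' x hx hxs e.le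
      linarith
  -- a touching point in each quadrant
  have hdet : τ * σ ≠ 1 := by
    intro e
    obtain ⟨x, hx, -, hxs⟩ := h.touch ![1,0] (by intro e; simpa using congrFun e 0)
    have hlt' : 1 < |x 0| + |x 1| := by
      rw [hTs] at hxs; nlinarith [abs_nonneg (x 0), abs_nonneg (x 1)]
    rcases le_total 0 (x 0) with a | a <;> rcases le_total 0 (x 1) with b | b
    · have h1 := hT0 x hx hxs a
      have h2 := hT1 x hx hxs b
      have : τ = 1 := by linear_combination h1 - τ * h2 + x 0 * e
      rw [abs_of_nonneg a, abs_of_nonneg b] at hlt'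
      rw [this] at h1; linarith
    · have h1 := hT0 x hx hxs a
      have h2 := hT1' x hx hxs b
      have : τ = -1 := by linear_combination -(h1 - τ * h2 + x 0 * e)
      rw [abs_of_nonneg a, abs_of_nonpos b] at hlt'
      rw [this] at h1; linarith
    · have h1 := hT0' x hx hxs a
      have h2 := hT1 x hx hxs b
      have : τ = -1 := by linear_combination (h1 - τ * h2 + x 0 * e)
      rw [abs_of_nonpos a, abs_of_nonneg b] at hlt'
      rw [this] at h1; linarith
    · have h1 := hT0' x hx hxs a
      have h2 := hT1' x hx hxs b
      have : τ = 1 := by linear_combination -(h1 - τ * h2 + x 0 * e)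
      rw [abs_of_nonpos a, abs_of_nonpos b] at hlt'
      rw [this] at h1; linarith
  have hdet' : 1 - τ * σ ≠ 0 := fun e => hdet (by linarith)
  have exq : ∀ s : ℝ, (s = 1 ∨ s = -1) → ∃ x ∈ Q, ∑ i, c * |x i| = 1 ∧ 0 ≤ x 0 ∧ 0 ≤ s * x 1 := by
    intro s hs
    by_contra! hcon
    -- all touching points lie on one line
    have hss : s * s = 1 := by rcases hs with h | h <;> rw [h] <;> norm_num
    have key : ∀ x ∈ Q, ∑ i, c * |x i| = 1 → 0 ≤ x 0 → x 0 + τ * x 1 = 1 ∧ σ * x 0 + x 1 = -s := by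
      intro x hx hxs h0
      have h1 := hcon x hx hxs h0
      refine ⟨hT0 x hx hxs h0, ?_⟩
      rcases hs with rfl | rfl
      · exact hT1' x hx hxs (by linarith)
      · have := hT1 x hx hxs (by linarith); rw [this]; ring
    have key2 : ∀ x ∈ Q, ∑ i, c * |x i| = 1 → x 0 * (-s - σ) - x 1 * (1 + τ * s) = 0 := by
      intro x hx hxs
      have aux : ∀ a b : ℝ, a + τ * b = 1 → σ * a + b = -s → a * (-s - σ) - b * (1 + τ * s) = 0 := by
        intro a b h1 h2
        linear_combination (-s) * h1 - h2
      rcases le_total 0 (x 0) with a | a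
      · obtain ⟨h1, h2⟩ := key x hx hxs a
        exact aux _ _ h1 h2
      · obtain ⟨h1, h2⟩ := key _ (hb.symm x hx) (hneg x hxs) (by simpa using a)
        have := aux _ _ h1 h2
        simp at this ⊢; linarith
    have hy : (![-s - σ, -(1 + τ * s)] : Fin 2 → ℝ) ≠ 0 := by
      intro e
      have e0 := congrFun e 0
      have e1 := congrFun e 1
      simp at e0 e1
      apply hdet
      have : σ = -s := by linarith
      rw [this]; linarith
    obtain ⟨x, hx, hxy, hxs⟩ := h.touch _ hy
    have := hb.pol_body.gauge_pos.2 hy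
    rw [← hxy, dot2] at this
    have h2 := key2 x hx hxs
    simp at this; linarith
  obtain ⟨p, hp, hps, hp0, hp1⟩ := exq 1 (Or.inl rfl)
  obtain ⟨q, hq, hqs, hq0, hq1⟩ := exq (-1) (Or.inr rfl)
  have a1 := hT0 p hp hps hp0
  have a2 := hT1 p hp hps (by linarith)
  have b1 := hT0 q hq hqs hq0
  have b2 := hT1' q hq hqs (by linarith)
  have hp0' := lt_of_le_of_ne hp0 (nz p hp hps).1.symm
  have hq0' := lt_of_le_of_ne hq0 (nz q hq hqs).1.symm
  have hsig : σ = -τ := by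
    rw [hTs, abs_of_nonneg hp0, abs_of_nonneg (by linarith)] at hps
    rw [hTs, abs_of_nonneg hq0, abs_of_nonpos (by linarith)] at hqs
    have e1 : p 0 + p 1 = q 0 - q 1 := by
      have : c * (p 0 + p 1) = c * (q 0 - q 1) := by linarith
      exact mul_left_cancel₀ hc.ne' this
    have f0 : (1 - τ * σ) * p 0 = 1 - τ := by linear_combination a1 - τ * a2
    have f1 : (1 - τ * σ) * p 1 = 1 - σ := by linear_combination a2 - σ * a1
    have f2 : (1 - τ * σ) * q 0 = 1 + τ := by linear_combination b1 - τ * b2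
    have f3 : (1 - τ * σ) * q 1 = -1 - σ := by linear_combination b2 - σ * b1
    linear_combination (1/2) * (f0 + f1 - f2 + f3 - (1 - τ * σ) * e1)
  refine ⟨τ, ?_, ?_⟩
  · rw [hsig] at a2 b2
    have f0 : (1 + τ * τ) * p 0 = 1 - τ := by linear_combination a1 - τ * a2
    have f2 : (1 + τ * τ) * q 0 = 1 + τ := by linear_combination b1 - τ * b2
    have : 0 < 1 + τ * τ := by nlinarith [mul_self_nonneg τ]
    rw [abs_lt]; constructor <;> nlinarith
  · intro a b
    rw [hsig] at a2 b2
    constructor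
    · intro hab
      have h1 := hl _ hab
      have h2 := hl _ (hb.symm _ hab)
      have h3 := hl' _ hab
      have h4 := hl' _ (hb.symm _ hab)
      simp [dot2, -Matrix.cons_dotProduct, el0, el1, ← hτ, ← hσ, hsig] at h1 h2 h3 h4
      constructor <;> rw [abs_le] <;> constructor <;> linarith
    · rintro ⟨h1, h2⟩
      have ht : 1 + τ * τ ≠ 0 := by nlinarith [mul_self_nonneg τ]
      set u := a + τ * b
      set v := b - τ * a
      refine hb.mem_of fun k hk => ?_
      have k1 := hk _ hp
      have k2 := hk _ hq
      have k3 := hk _ (hb.symm _ hp)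
      have k4 := hk _ (hb.symm _ hq)
      rw [neg_dotProduct] at k3 k4
      have e0 : a = (u+v)/2 * p 0 + (u-v)/2 * q 0 := by
        have f0 : (1 + τ * τ) * p 0 = 1 - τ := by linear_combination a1 - τ * a2
        have f2 : (1 + τ * τ) * q 0 = 1 + τ := by linear_combination b1 - τ * b2
        apply mul_left_cancel₀ ht
        linear_combination (-(u+v)/2) * f0 - (u-v)/2 * f2
      have e1 : b = (u+v)/2 * p 1 + (u-v)/2 * q 1 := by
        have f0 : (1 + τ * τ) * p 1 = 1 + τ := by linear_combination a2 + τ * a1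
        have f2 : (1 + τ * τ) * q 1 = -1 + τ := by linear_combination b2 + τ * b1
        apply mul_left_cancel₀ ht
        linear_combination (-(u+v)/2) * f0 - (u-v)/2 * f2
      have : ![a,b] ⬝ᵥ k = (u+v)/2 * (p ⬝ᵥ k) + (u-v)/2 * (q ⬝ᵥ k) := by
        simp only [dot2, Matrix.cons_val_zero, Matrix.cons_val_one]
        linear_combination k 0 * e0 + k 1 * e1
      rw [this]
      rw [abs_le] at h1 h2
      have A1 : |p ⬝ᵥ k| ≤ 1 := abs_le.2 ⟨by linarith, k1⟩
      have A2 : |q ⬝ᵥ k| ≤ 1 := abs_le.2 ⟨by linarith, k2⟩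
      calc _ ≤ |(u+v)/2 * (p ⬝ᵥ k)| + |(u-v)/2 * (q ⬝ᵥ k)| := add_le_add (le_abs_self _) (le_abs_self _)
        _ ≤ |(u+v)/2| * 1 + |(u-v)/2| * 1 := by rw [abs_mul, abs_mul]; gcongr
        _ ≤ 1 := by
          rcases abs_cases ((u+v)/2) with ⟨e, _⟩ | ⟨e, _⟩ <;> rcases abs_cases ((u-v)/2) with ⟨e', _⟩ | ⟨e', _⟩ <;> rw [e, e'] <;> linarith

end Mah

namespace Mah
open Topology

abbrev V3 := Fin 3 → ℝ

theorem dot3 (x y : V3) : x ⬝ᵥ y = x 0 * y 0 + x 1 * y 1 + x 2 * y 2 := by simp [dotProduct, Fin.sum_univ_three]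

def IsCube (K : Set V3) : Prop := ∃ A : Matrix (Fin 3) (Fin 3) ℝ, ∀ x, x ∈ K ↔ ∀ i, |(A.mulVec x) i| ≤ 1
def IsOct (K : Set V3) : Prop := ∃ A : Matrix (Fin 3) (Fin 3) ℝ, ∀ x, x ∈ K ↔ ∑ i, |(A.mulVec x) i| ≤ 1

theorem supp_pair {n : ℕ} {K : Set (Fin n → ℝ)} (h : Body K) {x y : Fin n → ℝ} (hx : x ∈ K) (hy : y ∈ K)
    (hr : ∀ r : ℝ, 0 < r → r • (x + y) ∈ K → 2 * r ≤ 1) : ∃ l ∈ pol K, x ⬝ᵥ l = 1 ∧ y ⬝ᵥ l = 1 := by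
  obtain ⟨l, hl, e⟩ := h.exists_pol_eq (x + y)
  have h1 := hl x hx
  have h2 := hl y hy
  have hg : 2 ≤ gauge K (x+y) := by
    by_contra! hlt
    have := hr _ (inv_pos.2 (lt_of_le_of_lt (le_max_left _ 1) (max_lt hlt (by norm_num : (1:ℝ) < 2)) |> fun _ => (lt_max_of_lt_right one_pos : 0 < max (gauge K (x+y)) 1)))
      ((h.gauge_le_iff (lt_max_of_lt_right one_pos)).1 (le_max_left _ 1))
    have h3 : max (gauge K (x+y)) 1 < 2 := max_lt hlt (by norm_num)
    have h4 : 0 < max (gauge K (x+y)) 1 := lt_max_of_lt_right one_pos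
    rw [← div_eq_mul_inv, div_le_one h4] at this
    linarith
  rw [add_dotProduct] at e
  exact ⟨l, hl, by linarith, by linarith⟩

theorem oct_lemma {K : Set V3} (h : Body K) (f : Fin 3 → V3) (hf : ∀ k, f k ∈ K)
    (hy : ∀ y, y ≠ 0 → ∃ k, gauge (pol K) y ≤ |f k ⬝ᵥ y|) : IsOct K := by
  set F : Matrix (Fin 3) (Fin 3) ℝ := Matrix.of f with hF
  have hFv : ∀ y k, (F.mulVec y) k = f k ⬝ᵥ y := fun y k => rfl
  have hdet : F.det ≠ 0 := by
    intro h0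
    obtain ⟨v, hv, e⟩ := Matrix.exists_mulVec_eq_zero_iff.2 h0
    obtain ⟨k, hk⟩ := hy v hv
    rw [← hFv, e] at hk
    have := h.pol_body.gauge_pos.2 hv
    simp at hk; linarith
  have hu : IsUnit F.det := isUnit_iff_ne_zero.2 hdet
  refine ⟨(F⁻¹).transpose, fun x => ?_⟩
  set a : V3 := (F⁻¹).transpose.mulVec x with ha
  have hx : ∀ y, x ⬝ᵥ y = ∑ j, a j * (f j ⬝ᵥ y) := by
    intro y
    have : x = Matrix.vecMul a F := by
      rw [ha, Matrix.mulVec_transpose, Matrix.vecMul_vecMul, Matrix.nonsing_inv_mul _ hu, Matrix.vecMul_one]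
    rw [this, ← Matrix.dotProduct_mulVec]; rfl
  have hb : ∀ k ∈ pol K, ∀ j, |f j ⬝ᵥ k| ≤ 1 := fun k hk j => by
    have h1 := hk _ (hf j)
    have h2 := hk _ (h.symm _ (hf j))
    rw [neg_dotProduct] at h2
    exact abs_le.2 ⟨by linarith, h1⟩
  constructor
  · intro hxK
    set s : V3 := fun j => if 0 ≤ a j then 1 else -1
    have hs : ∀ j, a j * s j = |a j| := fun j => by
      simp only [s]; split_ifs with h
      · rw [abs_of_nonneg h]; ring
      · rw [abs_of_neg (not_le.1 h)]; ring
    have hs1 : ∀ j, |s j| = 1 := fun j => by simp only [s]; split_ifs <;> simp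
    set y : V3 := (F⁻¹).mulVec s
    have hfy : ∀ j, f j ⬝ᵥ y = s j := fun j => by
      rw [← hFv, Matrix.mulVec_mulVec, Matrix.mul_nonsing_inv _ hu, Matrix.one_mulVec]
    have hy0 : y ≠ 0 := by
      intro e
      have := hfy 0
      have h1 := hs1 0
      rw [← this, e] at h1; simp at h1
    obtain ⟨k, hk⟩ := hy y hy0
    rw [hfy, hs1] at hk
    have := (h.dot_le_supp (y := y) hxK).trans hk
    rw [hx] at this
    simpa [hfy, hs] using this
  · intro hsum
    refine h.mem_of fun k hk => ?_
    rw [hx]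
    refine le_trans (Finset.sum_le_sum fun j _ => ?_) hsum
    calc a j * (f j ⬝ᵥ k) ≤ |a j * (f j ⬝ᵥ k)| := le_abs_self _
      _ = |a j| * |f j ⬝ᵥ k| := abs_mul _ _
      _ ≤ |a j| * 1 := by gcongr; exact hb k hk j
      _ = _ := mul_one _

def touches {n : ℕ} (K : Set (Fin n → ℝ)) (c : Fin n → ℝ) : Set (Fin n → ℝ) := {x | x ∈ K ∧ ∑ i, c i * |x i| = 1}

theorem neg_touch {n : ℕ} {K : Set (Fin n → ℝ)} {c x : Fin n → ℝ} (h : Body K) (hx : x ∈ touches K c) : -x ∈ touches K c :=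
  ⟨h.symm _ hx.1, by simpa using hx.2⟩

theorem oct_alt {K : Set V3} {c : V3} (h : TR K c) (nz : ∀ x ∈ touches K c, ∀ i, x i ≠ 0)
    (uni : ∀ x ∈ touches K c, ∀ x' ∈ touches K c, (∀ i, 0 < x i * x' i) → x = x') :
    (∀ ε : V3, IsSign ε → ∃ x ∈ touches K c, x ∈ oct ε) ∨ IsOct K := by
  classical
  by_cases hall : ∀ ε : V3, IsSign ε → ∃ x ∈ touches K c, x ∈ oct ε
  · exact Or.inl hall
  right
  push Not at hall
  obtain ⟨ε, hε, hno⟩ := hall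
  set fl : Fin 3 → V3 := fun k j => if j = k then - ε j else ε j with hfl
  set f : Fin 3 → V3 := fun k => if hk : ∃ x ∈ touches K c, x ∈ oct (fl k) then hk.choose else 0 with hf
  refine oct_lemma h.body f (fun k => ?_) (fun y hy => ?_)
  · simp only [hf]; split_ifs with hk
    · exact hk.choose_spec.1.1
    · exact h.body.zero_mem
  · obtain ⟨x, hx, hxy, hs⟩ := h.touch y hy
    have hxt : x ∈ touches K c := ⟨hx, hs⟩
    have key : ∀ k, ∀ z ∈ touches K c, z ∈ oct (fl k) → f k = z := by
      intro k z hz hzo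
      have hk : ∃ x ∈ touches K c, x ∈ oct (fl k) := ⟨z, hz, hzo⟩
      have e : f k = hk.choose := by simp only [hf]; rw [dif_pos hk]
      rw [e]
      refine uni _ hk.choose_spec.1 _ hz fun i => ?_
      have h1 := hk.choose_spec.2 i
      have h2 := hzo i
      have h3 : fl k i * fl k i = 1 := by
        simp only [hfl]; rcases hε i with h | h <;> split_ifs <;> rw [h] <;> norm_num
      have := mul_pos h1 h2
      nlinarith
    suffices hh : ∃ k, x ∈ oct (fl k) ∨ -x ∈ oct (fl k) by
      obtain ⟨k, hk | hk⟩ := hh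
      · refine ⟨k, ?_⟩
        rw [key k x hxt hk, hxy]; exact le_abs_self _
      · refine ⟨k, ?_⟩
        rw [key k _ (neg_touch h.body hxt) hk, neg_dotProduct, abs_neg, hxy]; exact le_abs_self _
    have n1 : ¬ (0 < ε 0 * x 0 ∧ 0 < ε 1 * x 1 ∧ 0 < ε 2 * x 2) := fun hh =>
      hno x hxt (by intro i; fin_cases i; exacts [hh.1, hh.2.1, hh.2.2])
    have n2 : ¬ (ε 0 * x 0 < 0 ∧ ε 1 * x 1 < 0 ∧ ε 2 * x 2 < 0) := fun hh =>
      hno (-x) (neg_touch h.body hxt) (by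
        intro i; fin_cases i
        · simpa using hh.1
        · simpa using hh.2.1
        · simpa using hh.2.2)
    have hn : ∀ i, ε i * x i ≠ 0 := fun i => mul_ne_zero (by rcases hε i with h | h <;> rw [h] <;> norm_num) (nz x hxt i)
    have mk : ∀ k, (∀ j, 0 < fl k j * x j) → x ∈ oct (fl k) := fun k hk => hk
    have mk' : ∀ k, (∀ j, fl k j * x j < 0) → -x ∈ oct (fl k) := fun k hk j => by
      have := hk j
      simp only [Pi.neg_apply]; linarith
    rcases lt_or_gt_of_ne (hn 0) with h0 | h0 <;> rcases lt_or_gt_of_ne (hn 1) with h1 | h1 <;>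
      rcases lt_or_gt_of_ne (hn 2) with h2 | h2
    · exact absurd ⟨h0, h1, h2⟩ n2
    · exact ⟨2, Or.inr (mk' 2 (by intro j; fin_cases j <;> simp [hfl] <;> linarith))⟩
    · exact ⟨1, Or.inr (mk' 1 (by intro j; fin_cases j <;> simp [hfl] <;> linarith))⟩
    · exact ⟨0, Or.inl (mk 0 (by intro j; fin_cases j <;> simp [hfl] <;> linarith))⟩
    · exact ⟨0, Or.inr (mk' 0 (by intro j; fin_cases j <;> simp [hfl] <;> linarith))⟩
    · exact ⟨1, Or.inl (mk 1 (by intro j; fin_cases j <;> simp [hfl] <;> linarith))⟩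
    · exact ⟨2, Or.inl (mk 2 (by intro j; fin_cases j <;> simp [hfl] <;> linarith))⟩
    · exact absurd ⟨h0, h1, h2⟩ n1

theorem sq_uni {k : ℝ → ℝ → Prop} {τ : ℝ} (hS : Sg τ k) (hτ : |τ| < 1) {u v : ℝ} (hu : ∀ a b, k a b → a * u + b * v ≤ 1) :
    (u = 1 → v = τ) ∧ (v = 1 → u = -τ) ∧ (u = -1 → v = -τ) ∧ (v = -1 → u = τ) := by
  set s := (1 - |τ|) / 2 with hs
  have hs0 : 0 < s := by rw [hs]; linarith
  have ht1 : τ ^ 2 ≤ 1 := by rw [← sq_abs]; nlinarith [abs_nonneg τ]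
  have hA : ∀ r : ℝ, |r| ≤ s → |r * (1 + τ^2) - τ| ≤ 1 ∧ |r * (1 + τ^2) + τ| ≤ 1 := by
    intro r hr
    have h1 : |r * (1 + τ^2)| ≤ 2 * s := by
      rw [abs_mul, abs_of_nonneg (by positivity : 0 ≤ 1 + τ^2)]
      nlinarith [abs_nonneg r]
    exact ⟨(abs_sub _ _).trans (by linarith), (abs_add_le _ _).trans (by linarith)⟩
  have hss : |s| ≤ s := (abs_of_pos hs0).le
  have hsn : |-s| ≤ s := by rw [abs_neg]; exact hss
  have P : ∀ r : ℝ, |r| ≤ s → (1 - τ * r) * u + r * v ≤ 1 ∧ r * u + (1 + τ * r) * v ≤ 1 ∧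
      (-(1 - τ * r)) * u + (-r) * v ≤ 1 ∧ (-r) * u + (-(1 + τ * r)) * v ≤ 1 := by
    intro r hr
    obtain ⟨h1, h2⟩ := hA r hr
    have e1 : 1 - τ * r + τ * r = 1 := by ring
    have e2 : r - τ * (1 - τ * r) = r * (1 + τ^2) - τ := by ring
    have e3 : r + τ * (1 + τ * r) = r * (1 + τ^2) + τ := by ring
    have e4 : 1 + τ * r - τ * r = 1 := by ring
    refine ⟨hu _ _ ((hS _ _).2 ⟨by rw [e1]; simp, by rw [e2]; exact h1⟩),
      hu _ _ ((hS _ _).2 ⟨by rw [e3]; exact h2, by rw [e4]; simp⟩),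
      hu _ _ ((hS _ _).2 ⟨?_, ?_⟩), hu _ _ ((hS _ _).2 ⟨?_, ?_⟩)⟩
    · rw [show -(1 - τ * r) + τ * -r = -1 by ring]; simp
    · rw [show -r - τ * -(1 - τ * r) = -(r * (1 + τ^2) - τ) by ring, abs_neg]; exact h1
    · rw [show -r + τ * -(1 + τ * r) = -(r * (1 + τ^2) + τ) by ring, abs_neg]; exact h2
    · rw [show -(1 + τ * r) - τ * -r = -1 by ring]; simp
  obtain ⟨p1, p2, p3, p4⟩ := P s hss
  obtain ⟨q1, q2, q3, q4⟩ := P (-s) hsn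
  refine ⟨fun e => ?_, fun e => ?_, fun e => ?_, fun e => ?_⟩ <;> subst e <;> apply le_antisymm <;> by_contra! hc <;>
    nlinarith [mul_pos hs0 (sub_pos.2 hc)]

theorem isCube_of {K : Set V3} (l0 l1 l2 : V3) (h : ∀ x, x ∈ K ↔ |x ⬝ᵥ l0| ≤ 1 ∧ |x ⬝ᵥ l1| ≤ 1 ∧ |x ⬝ᵥ l2| ≤ 1) : IsCube K := by
  refine ⟨Matrix.of ![l0, l1, l2], fun x => ?_⟩
  rw [h]
  simp [Fin.forall_fin_succ, Matrix.mulVec, dotProduct_comm x]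

theorem isOct_of {K : Set V3} (l0 l1 l2 : V3) (h : ∀ x, x ∈ K ↔ |x ⬝ᵥ l0| + |x ⬝ᵥ l1| + |x ⬝ᵥ l2| ≤ 1) : IsOct K := by
  refine ⟨Matrix.of ![l0, l1, l2], fun x => ?_⟩
  rw [h]
  simp [Fin.sum_univ_three, Matrix.mulVec, dotProduct_comm x]

end Mah

namespace Mah
open Topology

theorem v3_eta (x : V3) : x = ![x 0, x 1, x 2] := by ext i; fin_cases i <;> rfl

theorem v3_ext {x y : V3} (h0 : x 0 = y 0) (h1 : x 1 = y 1) (h2 : x 2 = y 2) : x = y := by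
  ext i; fin_cases i; exacts [h0, h1, h2]

theorem res1 {K : Set V3} {l : V3} (hl : l ∈ pol K) (a b : ℝ) (h : ![0,a,b] ∈ K) : a * l 1 + b * l 2 ≤ 1 := by
  have := hl _ h; rw [dot3] at this; simpa using this
theorem res2 {K : Set V3} {l : V3} (hl : l ∈ pol K) (a b : ℝ) (h : ![b,0,a] ∈ K) : a * l 2 + b * l 0 ≤ 1 := by
  have := hl _ h; rw [dot3] at this; simp at this; linarith
theorem res3 {K : Set V3} {l : V3} (hl : l ∈ pol K) (a b : ℝ) (h : ![a,b,0] ∈ K) : a * l 0 + b * l 1 ≤ 1 := by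
  have := hl _ h; rw [dot3] at this; simpa using this

theorem abs_dot_le {n : ℕ} {K : Set (Fin n → ℝ)} (h : Body K) {x l : Fin n → ℝ} (hx : x ∈ K) (hl : l ∈ pol K) : |x ⬝ᵥ l| ≤ 1 := by
  have h1 := hl _ hx
  have h2 := hl _ (h.symm _ hx)
  rw [neg_dotProduct] at h2
  exact abs_le.2 ⟨by linarith, h1⟩

theorem case_SSS {K : Set V3} {c : V3} (h : TR K c) (g0 : gauge K ![1,0,0] = 1) (g1 : gauge K ![0,1,0] = 1) (g2 : gauge K ![0,0,1] = 1)
    {τ1 τ2 τ3 : ℝ} (h1 : |τ1| < 1) (h2 : |τ2| < 1) (h3 : |τ3| < 1)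
    (S1 : Sg τ1 (fun a b => ![0,a,b] ∈ K)) (S2 : Sg τ2 (fun a b => ![b,0,a] ∈ K)) (S3 : Sg τ3 (fun a b => ![a,b,0] ∈ K)) :
    IsCube K ∨ IsOct K := by
  have u0 : ∀ l ∈ pol K, l 0 = 1 → l = ![1, τ3, -τ2] := fun l hl e =>
    v3_ext e ((sq_uni S3 h3 (res3 hl)).1 e) ((sq_uni S2 h2 (res2 hl)).2.1 e)
  have u1 : ∀ l ∈ pol K, l 1 = 1 → l = ![-τ3, 1, τ1] := fun l hl e =>
    v3_ext ((sq_uni S3 h3 (res3 hl)).2.1 e) e ((sq_uni S1 h1 (res1 hl)).1 e)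
  have u2 : ∀ l ∈ pol K, l 2 = 1 → l = ![τ2, -τ1, 1] := fun l hl e =>
    v3_ext ((sq_uni S2 h2 (res2 hl)).1 e) ((sq_uni S1 h1 (res1 hl)).2.1 e) e
  have m0 : ![1, τ3, -τ2] ∈ pol K := by
    obtain ⟨l, hl, e⟩ := h.body.exists_pol_eq ![1,0,0]
    rw [g0, dot3] at e
    have := u0 l hl (by simpa using e)
    rwa [this] at hl
  have m1 : ![-τ3, 1, τ1] ∈ pol K := by
    obtain ⟨l, hl, e⟩ := h.body.exists_pol_eq ![0,1,0]
    rw [g1, dot3] at e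
    have := u1 l hl (by simpa using e)
    rwa [this] at hl
  have m2 : ![τ2, -τ1, 1] ∈ pol K := by
    obtain ⟨l, hl, e⟩ := h.body.exists_pol_eq ![0,0,1]
    rw [g2, dot3] at e
    have := u2 l hl (by simpa using e)
    rwa [this] at hl
  have t0 : ∀ x ∈ touches K c, 0 ≤ x 0 → x 0 + x 1 * τ3 - x 2 * τ2 = 1 := by
    intro x hx hs
    obtain ⟨l, hl, e1, e2⟩ := h.face x hx.1 hx.2 _ g0 (by intro i; fin_cases i <;> simp [hs])
    rw [dot3] at e1 e2
    rw [u0 l hl (by simpa using e2)] at e1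
    simp at e1; linarith
  have t1 : ∀ x ∈ touches K c, 0 ≤ x 1 → - x 0 * τ3 + x 1 + x 2 * τ1 = 1 := by
    intro x hx hs
    obtain ⟨l, hl, e1, e2⟩ := h.face x hx.1 hx.2 _ g1 (by intro i; fin_cases i <;> simp [hs])
    rw [dot3] at e1 e2
    rw [u1 l hl (by simpa using e2)] at e1
    simp at e1; linarith
  have t2 : ∀ x ∈ touches K c, 0 ≤ x 2 → x 0 * τ2 - x 1 * τ1 + x 2 = 1 := by
    intro x hx hs
    obtain ⟨l, hl, e1, e2⟩ := h.face x hx.1 hx.2 _ g2 (by intro i; fin_cases i <;> simp [hs])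
    rw [dot3] at e1 e2
    rw [u2 l hl (by simpa using e2)] at e1
    simp at e1; linarith
  have t0' : ∀ x ∈ touches K c, x 0 ≤ 0 → x 0 + x 1 * τ3 - x 2 * τ2 = -1 := fun x hx hs => by
    have := t0 _ (neg_touch h.body hx) (by simpa using hs); simp at this; linarith
  have t1' : ∀ x ∈ touches K c, x 1 ≤ 0 → - x 0 * τ3 + x 1 + x 2 * τ1 = -1 := fun x hx hs => by
    have := t1 _ (neg_touch h.body hx) (by simpa using hs); simp at this; linarith
  have t2' : ∀ x ∈ touches K c, x 2 ≤ 0 → x 0 * τ2 - x 1 * τ1 + x 2 = -1 := fun x hx hs => by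
    have := t2 _ (neg_touch h.body hx) (by simpa using hs); simp at this; linarith
  have nz : ∀ x ∈ touches K c, ∀ i, x i ≠ 0 := by
    intro x hx i e
    fin_cases i
    · have := t0 x hx (le_of_eq e.symm); have := t0' x hx (le_of_eq e); linarith
    · have := t1 x hx (le_of_eq e.symm); have := t1' x hx (le_of_eq e); linarith
    · have := t2 x hx (le_of_eq e.symm); have := t2' x hx (le_of_eq e); linarith
  have uni : ∀ x ∈ touches K c, ∀ x' ∈ touches K c, (∀ i, 0 < x i * x' i) → x = x' := by
    intro x hx x' hx' hp
    have e0 : (x 0 - x' 0) + (x 1 - x' 1) * τ3 - (x 2 - x' 2) * τ2 = 0 := by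
      rcases pos_and_pos_or_neg_and_neg_of_mul_pos (hp 0) with ⟨a, b⟩ | ⟨a, b⟩
      · linarith [t0 x hx a.le, t0 x' hx' b.le]
      · linarith [t0' x hx a.le, t0' x' hx' b.le]
    have e1 : -(x 0 - x' 0) * τ3 + (x 1 - x' 1) + (x 2 - x' 2) * τ1 = 0 := by
      rcases pos_and_pos_or_neg_and_neg_of_mul_pos (hp 1) with ⟨a, b⟩ | ⟨a, b⟩
      · linarith [t1 x hx a.le, t1 x' hx' b.le]
      · linarith [t1' x hx a.le, t1' x' hx' b.le]
    have e2 : (x 0 - x' 0) * τ2 - (x 1 - x' 1) * τ1 + (x 2 - x' 2) = 0 := by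
      rcases pos_and_pos_or_neg_and_neg_of_mul_pos (hp 2) with ⟨a, b⟩ | ⟨a, b⟩
      · linarith [t2 x hx a.le, t2 x' hx' b.le]
      · linarith [t2' x hx a.le, t2' x' hx' b.le]
    have s : (x 0 - x' 0)^2 + (x 1 - x' 1)^2 + (x 2 - x' 2)^2 = 0 := by
      linear_combination (x 0 - x' 0) * e0 + (x 1 - x' 1) * e1 + (x 2 - x' 2) * e2
    refine v3_ext ?_ ?_ ?_ <;> refine sub_eq_zero.1 (pow_eq_zero_iff (two_ne_zero)|>.1 (le_antisymm ?_ (sq_nonneg _))) <;>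
      nlinarith [sq_nonneg (x 0 - x' 0), sq_nonneg (x 1 - x' 1), sq_nonneg (x 2 - x' 2)]
  rcases oct_alt h nz uni with hall | ho
  swap
  · exact Or.inr ho
  left
  refine isCube_of _ _ _ (fun x => ⟨fun hx => ⟨abs_dot_le h.body hx m0, abs_dot_le h.body hx m1, abs_dot_le h.body hx m2⟩, fun hx => ?_⟩)
  obtain ⟨b0, b1, b2⟩ := hx
  refine h.body.mem_of fun k hk => ?_
  have hD : 0 < 1 + τ1^2 + τ2^2 + τ3^2 := by positivity
  set α0 := (k 0 + τ1 * (τ1 * k 0 + τ2 * k 1 + τ3 * k 2) - (τ2 * k 2 - τ3 * k 1)) / (1 + τ1^2 + τ2^2 + τ3^2) with ha0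
  set α1 := (k 1 + τ2 * (τ1 * k 0 + τ2 * k 1 + τ3 * k 2) - (τ3 * k 0 - τ1 * k 2)) / (1 + τ1^2 + τ2^2 + τ3^2) with ha1
  set α2 := (k 2 + τ3 * (τ1 * k 0 + τ2 * k 1 + τ3 * k 2) - (τ1 * k 1 - τ2 * k 0)) / (1 + τ1^2 + τ2^2 + τ3^2) with ha2
  have k0 : k 0 = α0 - τ3 * α1 + τ2 * α2 := by rw [ha0, ha1, ha2]; field_simp; ring
  have k1 : k 1 = τ3 * α0 + α1 - τ1 * α2 := by rw [ha0, ha1, ha2]; field_simp; ring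
  have k2 : k 2 = -τ2 * α0 + τ1 * α1 + α2 := by rw [ha0, ha1, ha2]; field_simp; ring
  clear_value α0 α1 α2
  have kd : ∀ z : V3, z ⬝ᵥ k = α0 * (z 0 + z 1 * τ3 - z 2 * τ2) + α1 * (- z 0 * τ3 + z 1 + z 2 * τ1) + α2 * (z 0 * τ2 - z 1 * τ1 + z 2) := by
    intro z; rw [dot3, k0, k1, k2]; ring
  set sg : ℝ → ℝ := fun a => if 0 ≤ a then 1 else -1 with hsg
  have sga : ∀ a, sg a = 1 ∨ sg a = -1 := fun a => by simp only [hsg]; split_ifs <;> simp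
  have sgm : ∀ a, a * sg a = |a| := fun a => by
    simp only [hsg]; split_ifs with h
    · rw [abs_of_nonneg h]; ring
    · rw [abs_of_neg (not_le.1 h)]; ring
  obtain ⟨z, hz, hzo⟩ := hall ![sg α0, sg α1, sg α2] (by intro i; fin_cases i; exacts [sga _, sga _, sga _])
  have hzk := hk z hz.1
  have f0 : z 0 + z 1 * τ3 - z 2 * τ2 = sg α0 := by
    have := hzo 0; simp at this
    rcases sga α0 with e | e <;> rw [e] at this ⊢
    · exact t0 z hz (by linarith)
    · exact t0' z hz (by linarith)
  have f1 : - z 0 * τ3 + z 1 + z 2 * τ1 = sg α1 := by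
    have := hzo 1; simp at this
    rcases sga α1 with e | e <;> rw [e] at this ⊢
    · exact t1 z hz (by linarith)
    · exact t1' z hz (by linarith)
  have f2 : z 0 * τ2 - z 1 * τ1 + z 2 = sg α2 := by
    have := hzo 2; simp at this
    rcases sga α2 with e | e <;> rw [e] at this ⊢
    · exact t2 z hz (by linarith)
    · exact t2' z hz (by linarith)
  rw [kd, f0, f1, f2, sgm, sgm, sgm] at hzk
  rw [kd]
  have bd : ∀ a b : ℝ, |b| ≤ 1 → a * b ≤ |a| := fun a b hb => by
    calc a * b ≤ |a * b| := le_abs_self _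
      _ = |a| * |b| := abs_mul _ _
      _ ≤ |a| * 1 := by gcongr
      _ = _ := mul_one _
  rw [dot3] at b0 b1 b2
  simp at b0 b1 b2
  have := bd α0 (x 0 + x 1 * τ3 - x 2 * τ2) (by convert b0 using 2; ring)
  have := bd α1 (- x 0 * τ3 + x 1 + x 2 * τ1) (by convert b1 using 2; ring)
  have := bd α2 (x 0 * τ2 - x 1 * τ1 + x 2) (by convert b2 using 2; ring)
  linarith

/-- one diamond section, two squares -/
theorem case_one {K : Set V3} (h : Body K) 
    {τ1 τ2 : ℝ} (h1 : |τ1| < 1) (h2 : |τ2| < 1)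
    (S1 : Sg τ1 (fun a b => ![0,a,b] ∈ K)) (S2 : Sg τ2 (fun a b => ![b,0,a] ∈ K)) (D3 : Dg (fun a b => ![a,b,0] ∈ K)) : IsCube K := by
  have p : ∀ s : ℝ, |s| = 1 → ∃ l ∈ pol K, l 0 = 1 ∧ s * l 1 = 1 := by
    intro s hs
    obtain ⟨l, hl, e1, e2⟩ := supp_pair h (x := ![1,0,0]) (y := ![0,s,0]) ((D3 1 0).2 (by simp)) ((D3 0 s).2 (by simp [hs]))
      (by
        intro r hr hm
        have := (D3 r (r * s)).1 (by simpa using hm)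
        rw [abs_mul, hs, abs_of_pos hr] at this; linarith)
    rw [dot3] at e1 e2
    exact ⟨l, hl, by simpa using e1, by simpa using e2⟩
  obtain ⟨l, hl, a0, a1⟩ := p 1 (by simp)
  obtain ⟨l', hl', b0, b1⟩ := p (-1) (by simp)
  have a1 : l 1 = 1 := by linarith
  have b1 : l' 1 = -1 := by linarith
  have e1 := (sq_uni S2 h2 (res2 hl)).2.1 a0
  have e2 := (sq_uni S2 h2 (res2 hl')).2.1 b0
  have e3 := (sq_uni S1 h1 (res1 hl)).1 a1
  have e4 := (sq_uni S1 h1 (res1 hl')).2.2.1 b1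
  have z1 : τ1 = 0 := by linarith
  have z2 : τ2 = 0 := by linarith
  have m0 : l = ![1,1,0] := v3_ext a0 a1 (by rw [e1, z2]; simp)
  have m1 : l' = ![1,-1,0] := v3_ext b0 b1 (by rw [e2, z2]; simp)
  subst z1 z2
  have m2 : ![0,0,1] ∈ pol K := by
    obtain ⟨k, hk, e, -⟩ := supp_pair h (x := ![0,0,1]) (y := ![0,0,1]) ((S1 0 1).2 (by simp)) ((S1 0 1).2 (by simp))
      (by
        intro r hr hm
        have := (S1 0 (r * 2)).1 (by simp at hm ⊢; convert hm using 2; ring_nf)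
        simp at this
        rw [abs_of_pos hr] at this; linarith)
    rw [dot3] at e
    simp at e
    have f1 := (sq_uni S1 h1 (res1 hk)).2.1 e
    have f2 := (sq_uni S2 h2 (res2 hk)).1 e
    have : k = ![0,0,1] := v3_ext f2 (by rw [f1]; simp) e
    rwa [this] at hk
  refine isCube_of ![1,1,0] ![1,-1,0] ![0,0,1] (fun x => ⟨fun hx => ⟨abs_dot_le h hx (m0 ▸ hl), abs_dot_le h hx (m1 ▸ hl'), abs_dot_le h hx m2⟩, fun hx => ?_⟩)
  obtain ⟨c0, c1, c2⟩ := hx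
  refine h.mem_of fun k hk => ?_
  have hk2 : ∀ s t : ℝ, |s| = 1 → |t| = 1 → s * k 0 + t * k 2 ≤ 1 := fun s t hs ht => by
    have := res2 hk t s ((S2 t s).2 (by simp [hs, ht])); linarith
  have hk1 : ∀ s t : ℝ, |s| = 1 → |t| = 1 → s * k 1 + t * k 2 ≤ 1 := fun s t hs ht => by
    have := res1 hk s t ((S1 s t).2 (by simp [hs, ht])); linarith
  have q0 : |k 0| + |k 2| ≤ 1 := by
    rcases abs_cases (k 0) with ⟨e, -⟩ | ⟨e, -⟩ <;> rcases abs_cases (k 2) with ⟨e', -⟩ | ⟨e', -⟩ <;> rw [e, e']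
    · linarith [hk2 1 1 (by simp) (by simp)]
    · linarith [hk2 1 (-1) (by simp) (by simp)]
    · linarith [hk2 (-1) 1 (by simp) (by simp)]
    · linarith [hk2 (-1) (-1) (by simp) (by simp)]
  have q1 : |k 1| + |k 2| ≤ 1 := by
    rcases abs_cases (k 1) with ⟨e, -⟩ | ⟨e, -⟩ <;> rcases abs_cases (k 2) with ⟨e', -⟩ | ⟨e', -⟩ <;> rw [e, e']
    · linarith [hk1 1 1 (by simp) (by simp)]
    · linarith [hk1 1 (-1) (by simp) (by simp)]
    · linarith [hk1 (-1) 1 (by simp) (by simp)]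
    · linarith [hk1 (-1) (-1) (by simp) (by simp)]
  rw [dot3] at c0 c1 c2
  simp at c0 c1 c2
  have hx : |x 0| + |x 1| ≤ 1 := by
    rw [abs_le] at c0 c1
    rcases abs_cases (x 0) with ⟨e, -⟩ | ⟨e, -⟩ <;> rcases abs_cases (x 1) with ⟨e', -⟩ | ⟨e', -⟩ <;> rw [e, e'] <;> linarith
  rw [dot3]
  have ba : ∀ a b : ℝ, a * b ≤ |a| * |b| := fun a b => by rw [← abs_mul]; exact le_abs_self _
  have := ba (x 0) (k 0)
  have := ba (x 1) (k 1)
  have := ba (x 2) (k 2)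
  have := abs_nonneg (k 2)
  have := abs_nonneg (x 0)
  have := abs_nonneg (x 1)
  have i1 : |x 0| * |k 0| ≤ |x 0| * (1 - |k 2|) := by gcongr; linarith
  have i2 : |x 1| * |k 1| ≤ |x 1| * (1 - |k 2|) := by gcongr; linarith
  have i3 : |x 2| * |k 2| ≤ 1 * |k 2| := by gcongr
  have : 0 ≤ 1 - |k 2| := by linarith [abs_nonneg (k 0)]
  nlinarith [mul_le_mul_of_nonneg_right hx this]

/-- two diamond sections, one square -/
theorem case_two {K : Set V3} (h : Body K)
    {τ : ℝ} (hτ : |τ| < 1)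
    (S1 : Sg τ (fun a b => ![0,a,b] ∈ K)) (D2 : Dg (fun a b => ![b,0,a] ∈ K)) (D3 : Dg (fun a b => ![a,b,0] ∈ K)) : IsOct K := by
  have p : ∀ s : ℝ, |s| = 1 → ∃ l ∈ pol K, l 0 = 1 ∧ s * l 1 = 1 := by
    intro s hs
    obtain ⟨l, hl, e1, e2⟩ := supp_pair h (x := ![1,0,0]) (y := ![0,s,0]) ((D3 1 0).2 (by simp)) ((D3 0 s).2 (by simp [hs]))
      (by
        intro r hr hm
        have := (D3 r (r * s)).1 (by simpa using hm)
        rw [abs_mul, hs, abs_of_pos hr] at this; linarith)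
    rw [dot3] at e1 e2
    exact ⟨l, hl, by simpa using e1, by simpa using e2⟩
  have q : ∀ s : ℝ, |s| = 1 → ∃ l ∈ pol K, l 0 = 1 ∧ s * l 2 = 1 := by
    intro s hs
    obtain ⟨l, hl, e1, e2⟩ := supp_pair h (x := ![1,0,0]) (y := ![0,0,s]) ((D2 0 1).2 (by simp)) ((D2 s 0).2 (by simp [hs]))
      (by
        intro r hr hm
        have := (D2 (r * s) r).1 (by simpa using hm)
        rw [abs_mul, hs, abs_of_pos hr] at this; linarith)
    rw [dot3] at e1 e2
    exact ⟨l, hl, by simpa using e1, by simpa using e2⟩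
  obtain ⟨l, hl, a0, a1⟩ := p 1 (by simp)
  obtain ⟨l', hl', b0, b1⟩ := p (-1) (by simp)
  obtain ⟨k, hk, c0, c1⟩ := q 1 (by simp)
  obtain ⟨k', hk', d0, d1⟩ := q (-1) (by simp)
  have a1 : l 1 = 1 := by linarith
  have b1 : l' 1 = -1 := by linarith
  have c1 : k 2 = 1 := by linarith
  have d1 : k' 2 = -1 := by linarith
  have a2 := (sq_uni S1 hτ (res1 hl)).1 a1
  have b2 := (sq_uni S1 hτ (res1 hl')).2.2.1 b1
  have c2 := (sq_uni S1 hτ (res1 hk)).2.1 c1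
  have d2 := (sq_uni S1 hτ (res1 hk')).2.2.2 d1
  refine isOct_of ![1,0,0] ![0,(1-τ)/2,(1+τ)/2] ![0,(1+τ)/2,(τ-1)/2] (fun x => ?_)
  simp only [dot3]
  simp
  constructor
  · intro hx
    have A := abs_le.1 (abs_dot_le h hx hl)
    have B := abs_le.1 (abs_dot_le h hx hl')
    have C := abs_le.1 (abs_dot_le h hx hk)
    have D := abs_le.1 (abs_dot_le h hx hk')
    rw [dot3, a0, a1, a2] at A
    rw [dot3, b0, b1, b2] at B
    rw [dot3, c0, c1, c2] at C
    rw [dot3, d0, d1, d2] at D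
    rcases abs_cases (x 0) with ⟨e, -⟩ | ⟨e, -⟩ <;> rcases abs_cases (x 1 * ((1 - τ) / 2) + x 2 * ((1 + τ) / 2)) with ⟨e', -⟩ | ⟨e', -⟩ <;>
      rcases abs_cases (x 1 * ((1 + τ) / 2) + x 2 * ((τ - 1) / 2)) with ⟨e'', -⟩ | ⟨e'', -⟩ <;> rw [e, e', e''] <;> linarith
  · intro hx
    refine h.mem_of fun m hm => ?_
    set α := x 1 * ((1 - τ) / 2) + x 2 * ((1 + τ) / 2)
    set β := x 1 * ((1 + τ) / 2) + x 2 * ((τ - 1) / 2)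
    have hD : 0 < 1 + τ^2 := by positivity
    set P := ((1-τ) * m 1 + (1+τ) * m 2) / (1+τ^2) with hP
    set Q := ((1+τ) * m 1 + (τ-1) * m 2) / (1+τ^2) with hQ
    have ex : x ⬝ᵥ m = x 0 * m 0 + α * P + β * Q := by
      rw [dot3, hP, hQ]; simp only [α, β]; field_simp; ring
    have b0 : |m 0| ≤ 1 := by
      have := res2 hm 0 1 ((D2 0 1).2 (by simp))
      have := res2 hm 0 (-1) ((D2 0 (-1)).2 (by simp))
      rw [abs_le]; constructor <;> linarith
    have pb : ![0, (1-τ)/(1+τ^2), (1+τ)/(1+τ^2)] ∈ K := (S1 _ _).2 (by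
      constructor
      · rw [show (1-τ)/(1+τ^2) + τ * ((1+τ)/(1+τ^2)) = 1 by field_simp; ring]; simp
      · rw [show (1+τ)/(1+τ^2) - τ * ((1-τ)/(1+τ^2)) = 1 by field_simp; ring]; simp)
    have qb : ![0, (1+τ)/(1+τ^2), (τ-1)/(1+τ^2)] ∈ K := (S1 _ _).2 (by
      constructor
      · rw [show (1+τ)/(1+τ^2) + τ * ((τ-1)/(1+τ^2)) = 1 by field_simp; ring]; simp
      · rw [show (τ-1)/(1+τ^2) - τ * ((1+τ)/(1+τ^2)) = -1 by field_simp; ring]; simp)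
    have bP : |P| ≤ 1 := by
      have := abs_dot_le h pb hm
      rw [dot3] at this
      simp at this
      convert this using 2; rw [hP]; ring
    have bQ : |Q| ≤ 1 := by
      have := abs_dot_le h qb hm
      rw [dot3] at this
      simp at this
      convert this using 2; rw [hQ]; ring
    have bd : ∀ a b : ℝ, |b| ≤ 1 → a * b ≤ |a| := fun a b hb => by
      calc a * b ≤ |a * b| := le_abs_self _
        _ = |a| * |b| := abs_mul _ _
        _ ≤ |a| * 1 := by gcongr
        _ = _ := mul_one _
    rw [ex]
    linarith [bd (x 0) _ b0, bd α _ bP, bd β _ bQ]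

end Mah

namespace Mah
open Topology

theorem gauge_one_of {n : ℕ} {K : Set (Fin n → ℝ)} (h : Body K) {y : Fin n → ℝ} (hy : y ∈ K)
    (hr : ∀ r : ℝ, 0 < r → r • y ∈ K → r ≤ 1) : gauge K y = 1 := by
  have h1 := h.gauge_le_one.2 hy
  refine le_antisymm h1 ?_
  by_contra! hlt
  have hp : 0 < (gauge K y + 1) / 2 := by have := gauge_nonneg (s := K) y; linarith
  have := hr _ (inv_pos.2 hp) ((h.gauge_le_iff hp).1 (by linarith))
  have h2 := (inv_le_one₀ hp).1 this
  linarith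

theorem avg_pol {n : ℕ} {K : Set (Fin n → ℝ)} (h : Body K) {l l' : Fin n → ℝ} (hl : l ∈ pol K) (hl' : l' ∈ pol K) :
    (1/2:ℝ) • l + (1/2:ℝ) • l' ∈ pol K := h.pol_body.convex hl hl' (by norm_num) (by norm_num) (by norm_num)

theorem case_DDD {K : Set V3} {c0 : ℝ} (h : TR K (fun _ => c0))
    (DD : ∀ (k : Fin 3) (x : V3), x k = 0 → (x ∈ K ↔ ∑ j, |x j| ≤ 1)) : IsOct K := by
  have hc : 0 < c0 := h.pos 0
  have eb : ∀ l ∈ pol K, ∀ j, |l j| ≤ 1 := by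
    intro l hl j
    have e : (Pi.single j 1 : V3) ∈ K := by
      refine (DD (j+1) _ ?_).2 ?_
      · fin_cases j <;> simp
      · rw [Fin.sum_univ_three]; fin_cases j <;> simp [Pi.single_apply]
    have := abs_dot_le h.body e hl
    simpa using this
  by_cases h1 : 1 ≤ c0
  · refine ⟨1, fun x => ?_⟩
    simp only [Matrix.one_mulVec]
    constructor
    · intro hx
      have := h.sum_le x hx
      rw [← Finset.mul_sum] at this
      have h0 : 0 ≤ ∑ i, |x i| := Finset.sum_nonneg fun _ _ => abs_nonneg _
      nlinarith
    · intro hx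
      refine h.body.mem_of fun l hl => le_trans (Finset.sum_le_sum fun j _ => ?_) hx
      calc x j * l j ≤ |x j * l j| := le_abs_self _
        _ = |x j| * |l j| := abs_mul _ _
        _ ≤ |x j| * 1 := by gcongr; exact eb l hl j
        _ = _ := mul_one _
  push Not at h1
  set d := 1 / c0 - 1 with hd
  have hd0 : 0 < d := by rw [hd, sub_pos, one_lt_div hc]; exact h1
  have ts : ∀ x ∈ touches K (fun _ => c0), |x 0| + |x 1| + |x 2| = 1 + d := by
    intro x hx
    have := hx.2
    rw [← Finset.mul_sum, Fin.sum_univ_three] at this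
    rw [hd]; field_simp; linarith
  have nz : ∀ x ∈ touches K (fun _ => c0), ∀ i, x i ≠ 0 := by
    intro x hx i e
    have := (DD i x e).1 hx.1
    rw [Fin.sum_univ_three, ts x hx] at this
    linarith
  set sg : ℝ → ℝ := fun a => if 0 ≤ a then 1 else -1 with hsg
  have sga : ∀ a, |sg a| = 1 := fun a => by simp only [hsg]; split_ifs <;> simp
  have sgm : ∀ a, a * sg a = |a| := fun a => by
    simp only [hsg]; split_ifs with h
    · rw [abs_of_nonneg h]; ring
    · rw [abs_of_neg (not_le.1 h)]; ring
  have sgs : ∀ a b, |b| ≤ 1 → sg a * b ≤ 1 := fun a b hb => by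
    calc sg a * b ≤ |sg a * b| := le_abs_self _
      _ = |b| := by rw [abs_mul, sga, one_mul]
      _ ≤ 1 := hb
  have sgq : ∀ a, sg a * sg a = 1 := fun a => by simp only [hsg]; split_ifs <;> simp
  have F : ∀ k, ∀ x ∈ touches K (fun _ => c0), ∃ l ∈ pol K, (∀ j, j ≠ k → l j = sg (x j)) ∧ x k * l k = |x k| - d := by
    intro k x hx
    set y : V3 := fun j => if j = k then 0 else sg (x j) / 2 with hy
    have hyk : y k = 0 := by simp [hy]
    have hys : ∑ j, |y j| = 1 := by
      rw [Fin.sum_univ_three]; fin_cases k <;> simp [hy, abs_div, sga] <;> norm_num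
    have gy : gauge K y = 1 := by
      refine gauge_one_of h.body ((DD k y hyk).2 hys.le) fun r hr hm => ?_
      have := (DD k (r • y) (by simp [hyk])).1 hm
      simpa [abs_mul, ← Finset.mul_sum, hys, abs_of_pos hr] using this
    obtain ⟨l, hl, e1, e2⟩ := h.face x hx.1 hx.2 y gy (by
      intro j
      simp only [hy]; split_ifs
      · simp
      · have := sgm (x j); rw [mul_div_assoc', this]; positivity)
    have s := ts x hx
    have a0 := sgs (x 0) _ (eb l hl 0)
    have a1 := sgs (x 1) _ (eb l hl 1)
    have a2 := sgs (x 2) _ (eb l hl 2)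
    have inv : ∀ j, sg (x j) * l j = 1 → l j = sg (x j) := fun j e => by
      have := sgq (x j)
      calc l j = (sg (x j) * sg (x j)) * l j := by rw [this, one_mul]
        _ = sg (x j) * (sg (x j) * l j) := by ring
        _ = _ := by rw [e, mul_one]
    rw [dot3] at e1 e2
    refine ⟨l, hl, ?_⟩
    fin_cases k
    · simp [hy] at e2 ⊢
      have r1 := inv 1 (by linarith)
      have r2 := inv 2 (by linarith)
      refine ⟨fun j hj => ?_, ?_⟩
      · fin_cases j
        · exact absurd rfl hj
        · exact r1
        · exact r2
      · rw [r1, r2, sgm, sgm] at e1; linarith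
    · simp [hy] at e2 ⊢
      have r1 := inv 0 (by linarith)
      have r2 := inv 2 (by linarith)
      refine ⟨fun j hj => ?_, ?_⟩
      · fin_cases j
        · exact r1
        · exact absurd rfl hj
        · exact r2
      · rw [r1, r2, sgm, sgm] at e1; linarith
    · simp [hy] at e2 ⊢
      have r1 := inv 0 (by linarith)
      have r2 := inv 1 (by linarith)
      refine ⟨fun j hj => ?_, ?_⟩
      · fin_cases j
        · exact r1
        · exact r2
        · exact absurd rfl hj
      · rw [r1, r2, sgm, sgm] at e1; linarith
  have mono : ∀ x ∈ touches K (fun _ => c0), ∀ x' ∈ touches K (fun _ => c0), (∀ i, 0 < x i * x' i) → ∀ k, |x k| ≤ |x' k| := by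
    intro x hx x' hx' hp k
    obtain ⟨l, hl, e1, e2⟩ := F k x hx
    have sgx : ∀ j, sg (x j) = sg (x' j) := by
      intro j; simp only [hsg]
      rcases pos_and_pos_or_neg_and_neg_of_mul_pos (hp j) with ⟨a, b⟩ | ⟨a, b⟩
      · rw [if_pos a.le, if_pos b.le]
      · rw [if_neg (not_le.2 a), if_neg (not_le.2 b)]
    have hle := hl x' hx'.1
    have s := ts x' hx'
    have hk : x' k * l k ≤ |x' k| - d := by
      rw [dot3] at hle
      fin_cases k
      · have r1 := e1 1 (by decide)
        have r2 := e1 2 (by decide)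
        rw [r1, r2, sgx, sgx, sgm, sgm] at hle
        simp; linarith
      · have r1 := e1 0 (by decide)
        have r2 := e1 2 (by decide)
        rw [r1, r2, sgx, sgx, sgm, sgm] at hle
        simp; linarith
      · have r1 := e1 0 (by decide)
        have r2 := e1 1 (by decide)
        rw [r1, r2, sgx, sgx, sgm, sgm] at hle
        simp; linarith
    have e3 : x' k = sg (x k) * |x' k| := by rw [← sgm (x' k), ← sgx k, mul_comm (x' k), ← mul_assoc, sgq, one_mul]
    have e4 : x k = sg (x k) * |x k| := by rw [← sgm (x k), mul_comm (x k), ← mul_assoc, sgq, one_mul]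
    have p1 := abs_pos.2 (nz x hx k)
    have p2 := abs_pos.2 (nz x' hx' k)
    set m := sg (x k) * l k with hm
    have e5 : |x k| * m = |x k| - d := by rw [← e2, hm]; nth_rw 3 [e4]; ring
    have e6 : |x' k| * m ≤ |x' k| - d := by rw [hm]; nth_rw 1 [e3] at hk; linarith
    have : |x' k| * (|x k| * m) ≤ |x k| * (|x' k| - d) := by nlinarith
    rw [e5] at this
    have : 0 ≤ d * (|x' k| - |x k|) := by linarith
    have := nonneg_of_mul_nonneg_right this hd0
    linarith
  have uni : ∀ x ∈ touches K (fun _ => c0), ∀ x' ∈ touches K (fun _ => c0), (∀ i, 0 < x i * x' i) → x = x' := by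
    intro x hx x' hx' hp
    ext k
    have h1 := mono x hx x' hx' hp k
    have h2 := mono x' hx' x hx (fun i => by rw [mul_comm]; exact hp i) k
    have h3 := hp k
    rcases pos_and_pos_or_neg_and_neg_of_mul_pos h3 with ⟨a, b⟩ | ⟨a, b⟩
    · rw [abs_of_pos a, abs_of_pos b] at *; linarith
    · rw [abs_of_neg a, abs_of_neg b] at *; linarith
  rcases oct_alt h nz uni with hall | ho
  swap
  · exact ho
  exfalso
  have G : ∀ (k : Fin 3) (ε : V3), IsSign ε → ∃ l ∈ pol K, (∀ j, j ≠ k → l j = ε j) ∧ |l k| < 1 := by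
    intro k ε hε
    obtain ⟨x, hx, hxo⟩ := hall ε hε
    obtain ⟨x', hx', hxo'⟩ := hall (fun j => if j = k then - ε j else ε j) (by
      intro j; simp only; split_ifs
      · rcases hε j with e | e <;> simp [e]
      · exact hε j)
    obtain ⟨l, hl, e1, e2⟩ := F k x hx
    obtain ⟨l', hl', e1', e2'⟩ := F k x' hx'
    have sgx : ∀ ε a : ℝ, (ε = 1 ∨ ε = -1) → 0 < ε * a → sg a = ε := by
      intro ε a he hp
      rcases he with e | e <;> subst e <;> simp only [hsg]
      · rw [if_pos (by linarith)]
      · rw [if_neg (by linarith)]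
    refine ⟨_, avg_pol h.body hl hl', fun j hj => ?_, ?_⟩
    · have r1 := e1 j hj
      have r2 := e1' j hj
      have := hxo' j
      simp only [if_neg hj] at this
      rw [sgx _ _ (hε j) (hxo j)] at r1
      rw [sgx _ _ (hε j) this] at r2
      simp [r1, r2]; ring
    · have b1 := abs_le.1 (eb l hl k)
      have b2 := abs_le.1 (eb l' hl' k)
      have p1 := hxo k
      have p2 := hxo' k
      simp only [if_true] at p2
      simp
      rw [abs_lt]
      rcases hε k with e | e <;> rw [e] at p1 p2
      · rw [abs_of_pos (by linarith)] at e2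
        rw [abs_of_neg (by linarith)] at e2'
        have : l k < 1 := by nlinarith
        have : -1 < l' k := by nlinarith
        constructor <;> linarith
      · rw [abs_of_neg (by linarith)] at e2
        rw [abs_of_pos (by linarith)] at e2'
        have : -1 < l k := by nlinarith
        have : l' k < 1 := by nlinarith
        constructor <;> linarith
  obtain ⟨p1, hp1, f1, g1⟩ := G 2 ![1,1,1] (by intro i; fin_cases i <;> simp)
  obtain ⟨p2, hp2, f2, g2⟩ := G 2 ![1,-1,1] (by intro i; fin_cases i <;> simp)
  obtain ⟨p3, hp3, f3, g3⟩ := G 1 ![1,1,1] (by intro i; fin_cases i <;> simp)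
  obtain ⟨p4, hp4, f4, g4⟩ := G 1 ![1,1,-1] (by intro i; fin_cases i <;> simp)
  have f10 : p1 0 = 1 := f1 0 (by decide)
  have f11 : p1 1 = 1 := f1 1 (by decide)
  have f20 : p2 0 = 1 := f2 0 (by decide)
  have f21 : p2 1 = -1 := f2 1 (by decide)
  have f30 : p3 0 = 1 := f3 0 (by decide)
  have f32 : p3 2 = 1 := f3 2 (by decide)
  have f40 : p4 0 = 1 := f4 0 (by decide)
  have f42 : p4 2 = -1 := f4 2 (by decide)
  obtain ⟨x, hx, e1, e2, e3⟩ := h.touch' (avg_pol h.body hp1 hp2) (avg_pol h.body hp3 hp4) (z := ![1,0,0])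
    ((DD 1 _ (by simp)).2 (by simp [Fin.sum_univ_three])) (by rw [dot3]; simp [f10, f20]; norm_num)
      (by rw [dot3]; simp [f30, f40]; norm_num)
  have q1 := hp1 x hx
  have q2 := hp2 x hx
  have q3 := hp3 x hx
  have q4 := hp4 x hx
  rw [dot3] at e1 e2 q1 q2 q3 q4
  simp [f10, f11, f20, f21, f30, f32, f40, f42] at e1 e2 q1 q2 q3 q4
  have r1 : 2 * x 1 = (p2 2 - p1 2) * x 2 := by linarith
  have r2 : 2 * x 2 = (p4 1 - p3 1) * x 1 := by linarith
  have n1 := abs_pos.2 (nz x ⟨hx, e3⟩ 1)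
  have n2 := abs_pos.2 (nz x ⟨hx, e3⟩ 2)
  have r1 := congrArg abs r1
  have r2 := congrArg abs r2
  rw [abs_mul, abs_mul] at r1 r2
  have w1 := abs_sub (p2 2) (p1 2)
  have w2 := abs_sub (p4 1) (p3 1)
  simp at r1 r2
  have v1 : |x 1| < |x 2| := by nlinarith
  have v2 : |x 2| < |x 1| := by nlinarith
  linarith

theorem isCube_comap {K : Set V3} (e : V3 ≃ₗ[ℝ] V3) (h : IsCube (e ⁻¹' K)) : IsCube K := by
  obtain ⟨A, hA⟩ := h
  refine ⟨A * LinearMap.toMatrix' (e.symm : V3 →ₗ[ℝ] V3), fun x => ?_⟩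
  have := hA (e.symm x)
  simp at this
  rw [this, ← Matrix.mulVec_mulVec, LinearMap.toMatrix'_mulVec]; rfl

theorem isOct_comap {K : Set V3} (e : V3 ≃ₗ[ℝ] V3) (h : IsOct (e ⁻¹' K)) : IsOct K := by
  obtain ⟨A, hA⟩ := h
  refine ⟨A * LinearMap.toMatrix' (e.symm : V3 →ₗ[ℝ] V3), fun x => ?_⟩
  have := hA (e.symm x)
  simp at this
  rw [this, ← Matrix.mulVec_mulVec, LinearMap.toMatrix'_mulVec]; rfl

def rotE : V3 ≃ₗ[ℝ] V3 where
  toFun x := ![x 1, x 2, x 0]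
  invFun x := ![x 2, x 0, x 1]
  map_add' x y := by ext i; fin_cases i <;> rfl
  map_smul' r x := by ext i; fin_cases i <;> rfl
  left_inv x := by ext i; fin_cases i <;> rfl
  right_inv x := by ext i; fin_cases i <;> rfl

theorem rot_mem (K : Set V3) (a b c : ℝ) : (![a,b,c] ∈ rotE ⁻¹' K) ↔ ![b,c,a] ∈ K := Iff.rfl

def k1 (K : Set V3) : ℝ → ℝ → Prop := fun a b => ![0,a,b] ∈ K
def k2 (K : Set V3) : ℝ → ℝ → Prop := fun a b => ![b,0,a] ∈ K
def k3 (K : Set V3) : ℝ → ℝ → Prop := fun a b => ![a,b,0] ∈ K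

def Good (K : Set V3) : Prop := IsCube K ∨ IsOct K
theorem good_comap {K : Set V3} (e : V3 ≃ₗ[ℝ] V3) (h : Good (e ⁻¹' K)) : Good K := h.imp (isCube_comap e) (isOct_comap e)

theorem mixed {K : Set V3} {c : V3} (h : TR K c) (g0 : gauge K ![1,0,0] = 1) (g1 : gauge K ![0,1,0] = 1) (g2 : gauge K ![0,0,1] = 1)
    (h1 : DS (k1 K)) (h2 : DS (k2 K)) (h3 : DS (k3 K)) (hD : Dg (k1 K) → Dg (k2 K) → Dg (k3 K) → Good K) : Good K := by
  have b' := h.body.comap rotE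
  have b'' := b'.comap rotE
  rcases h1 with d1 | ⟨τ1, t1, s1⟩ <;> rcases h2 with d2 | ⟨τ2, t2, s2⟩ <;> rcases h3 with d3 | ⟨τ3, t3, s3⟩
  · exact hD d1 d2 d3
  · exact good_comap rotE (Or.inr (case_two b' t3 s3 d1 d2))
  · exact good_comap rotE (good_comap rotE (Or.inr (case_two b'' t2 s2 d3 d1)))
  · exact good_comap rotE (good_comap rotE (Or.inl (case_one b'' t2 t3 s2 s3 d1)))
  · exact Or.inr (case_two h.body t1 s1 d2 d3)
  · exact good_comap rotE (Or.inl (case_one b' t3 t1 s3 s1 d2))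
  · exact Or.inl (case_one h.body t1 t2 s1 s2 d3)
  · exact case_SSS h g0 g1 g2 t1 t2 t3 s1 s2 s3

end Mah

namespace Mah
open Topology

theorem gauge_comap {n : ℕ} (e : (Fin n → ℝ) ≃ₗ[ℝ] (Fin n → ℝ)) (K : Set (Fin n → ℝ)) (x) : gauge (e ⁻¹' K) x = gauge K (e x) := by
  simp [gauge_def']

theorem ins_e0 (a b : ℝ) : ins (0 : Fin 3) 0 ![a,b] = ![0,a,b] := by
  ext i; fin_cases i <;> rfl
theorem ins_e1 (a b : ℝ) : ins (1 : Fin 3) 0 ![a,b] = ![a,0,b] := by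
  ext i; fin_cases i <;> rfl
theorem ins_e2 (a b : ℝ) : ins (2 : Fin 3) 0 ![a,b] = ![a,b,0] := by
  ext i; fin_cases i <;> rfl

theorem v2_eta (x : Fin 2 → ℝ) : x = ![x 0, x 1] := by ext i; fin_cases i <;> rfl

theorem gauge_sec {n : ℕ} (i : Fin (n+1)) (K : Set (Fin (n+1) → ℝ)) (y) : gauge (sec i K) y = gauge K (ins i 0 y) := by
  simp only [gauge_def']
  congr 1; ext r
  simp only [sec, Set.mem_setOf_eq, ← ins_smul, mul_zero]

theorem sec1_vol {Q : Set (Fin 2 → ℝ)} (h : Body Q) (g0 : gauge Q ![1,0] = 1) (g1 : gauge Q ![0,1] = 1) (i : Fin 2) : vol (sec i Q) = 2 := by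
  have hb := h.sec_body i
  obtain ⟨a, ha, e⟩ := one_form hb
  have hg : gauge (sec i Q) (fun _ => 1) = 1 := by
    rw [gauge_sec]
    fin_cases i
    · refine Eq.trans ?_ g1; congr 1; ext j; fin_cases j <;> rfl
    · refine Eq.trans ?_ g0; congr 1; ext j; fin_cases j <;> rfl
  have h1 := hb.gauge_le_one.1 hg.le
  rw [e] at h1
  simp at h1
  have h2 : a ≤ 1 := by
    have : gauge (sec i Q) (a • fun _ => 1) ≤ 1 := by
      rw [hb.gauge_le_one, e]; simp [abs_of_pos ha]
    rw [Body.gauge_smul' ha.le, hg] at this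
    linarith
  rw [e, one_vol _ ha.le]
  linarith

theorem sec_ds {Q : Set (Fin 2 → ℝ)} (h : Body Q) (he : EqOct Q) (hv : vp Q ≤ 8) (g0 : gauge Q ![1,0] = 1) (g1 : gauge Q ![0,1] = 1) :
    DS (fun a b => ![a,b] ∈ Q) := by
  have hE := equi_two h he
  have ht := hE.tr (by
    rw [Fin.sum_univ_two, one_vp (h.sec_body 0), one_vp (h.sec_body 1)]
    norm_num; linarith)
  have : cc Q = fun _ => 2 / vol Q := by
    ext i; rw [cc, sec1_vol h g0 g1]; have := h.vol_pos; push_cast; field_simp; norm_num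
  rw [this] at ht
  exact two_class ht g0 g1

theorem DS.swap {k : ℝ → ℝ → Prop} (h : DS k) : DS (fun a b => k b a) := by
  rcases h with d | ⟨τ, ht, s⟩
  · left; intro a b; rw [add_comm]; exact d b a
  · right; refine ⟨-τ, by simpa using ht, fun a b => ?_⟩
    refine (s b a).trans ?_
    rw [and_comm]
    rw [show a - τ * b = a + -τ * b by ring, show b + τ * a = b - -τ * a by ring]

theorem classify0 {K : Set V3} (h : Equi K) (hv : vp K ≤ 32/3) (g0 : gauge K ![1,0,0] = 1) (g1 : gauge K ![0,1,0] = 1) (g2 : gauge K ![0,0,1] = 1) :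
    Good K := by
  have b := fun i => h.body.sec_body i
  have v0 := two_vp (b 0) (h.eqs 0)
  have v1 := two_vp (b 1) (h.eqs 1)
  have v2 := two_vp (b 2) (h.eqs 2)
  have vg := h.vp_ge
  rw [Fin.sum_univ_three] at vg
  norm_num at vg
  have ht := h.tr (by rw [Fin.sum_univ_three]; norm_num; linarith)
  have q0 := sec_ds (b 0) (h.eqs 0) (by linarith) (by rw [gauge_sec, ins_e0, g1]) (by rw [gauge_sec, ins_e0, g2])
  have q1 := sec_ds (b 1) (h.eqs 1) (by linarith) (by rw [gauge_sec, ins_e1, g0]) (by rw [gauge_sec, ins_e1, g2])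
  have q2 := sec_ds (b 2) (h.eqs 2) (by linarith) (by rw [gauge_sec, ins_e2, g0]) (by rw [gauge_sec, ins_e2, g1])
  simp only [sec, Set.mem_setOf_eq, ins_e0, ins_e1, ins_e2] at q0 q1 q2
  refine mixed ht g0 g1 g2 q0 q1.swap q2 fun d1 d2 d3 => Or.inr ?_
  have s0 : sec 0 K = {y | |y 0| + |y 1| ≤ 1} := by
    ext y; rw [v2_eta y]; simp only [sec, Set.mem_setOf_eq, ins_e0]; exact d1 _ _
  have s1 : sec 1 K = {y | |y 0| + |y 1| ≤ 1} := by
    ext y; rw [v2_eta y]; simp only [sec, Set.mem_setOf_eq, ins_e1]; exact (d2 _ _).trans (by simp [add_comm])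
  have s2 : sec 2 K = {y | |y 0| + |y 1| ≤ 1} := by
    ext y; rw [v2_eta y]; simp only [sec, Set.mem_setOf_eq, ins_e2]; exact d3 _ _
  have hc : cc K = fun _ => cc K 0 := by
    ext i; fin_cases i <;> simp [cc, s0, s1, s2]
  rw [hc] at ht
  refine case_DDD ht fun k x hx => ?_
  rw [Fin.sum_univ_three]
  have ex := v3_eta x
  fin_cases k
  · have hx : x 0 = 0 := hx
    rw [hx] at ex; rw [hx]; nth_rw 1 [ex]; exact (d1 (x 1) (x 2)).trans (by simp)
  · have hx : x 1 = 0 := hx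
    rw [hx] at ex; rw [hx]; nth_rw 1 [ex]; refine (d2 (x 2) (x 0)).trans (by simp [add_comm])
  · have hx : x 2 = 0 := hx
    rw [hx] at ex; rw [hx]; nth_rw 1 [ex]; exact (d3 (x 0) (x 1)).trans (by simp)

theorem classify {K : Set V3} (h : Equi K) (hv : vp K ≤ 32/3) : Good K := by
  have gp : ∀ i, 0 < gauge K (Pi.single i 1) := fun i => h.body.gauge_pos.2 (by simp)
  have hd : ∀ i, 0 < (gauge K (Pi.single i 1))⁻¹ := fun i => inv_pos.2 (gp i)
  set d : V3 := fun i => (gauge K (Pi.single i 1))⁻¹ with hdd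
  have gg : ∀ i, gauge (dg d (fun i => (hd i).ne') ⁻¹' K) (Pi.single i 1) = 1 := by
    intro i
    rw [gauge_comap]
    have : dg d (fun i => (hd i).ne') (Pi.single i 1) = d i • (Pi.single i 1 : V3) := by
      ext j; by_cases hj : j = i
      · subst hj; simp
      · simp [hj]
    rw [this, Body.gauge_smul' (hd i).le]
    exact inv_mul_cancel₀ (gp i).ne'
  have e0 : (Pi.single 0 1 : V3) = ![1,0,0] := by ext i; fin_cases i <;> simp
  have e1 : (Pi.single 1 1 : V3) = ![0,1,0] := by ext i; fin_cases i <;> simp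
  have e2 : (Pi.single 2 1 : V3) = ![0,0,1] := by ext i; fin_cases i <;> simp
  refine good_comap (dg d (fun i => (hd i).ne')) (classify0 (h.dg d hd) ?_ (e0 ▸ gg 0) (e1 ▸ gg 1) (e2 ▸ gg 2))
  rw [vp_comap]; exact hv

end Mah

namespace Mah
open Topology

theorem meas_sign : Measurable Real.sign := by
  unfold Real.sign
  exact Measurable.ite measurableSet_Iio measurable_const (Measurable.ite measurableSet_Ioi measurable_const measurable_const)

theorem abs_sign_le (r : ℝ) : |Real.sign r| ≤ 1 := by
  rcases Real.sign_apply_eq r with e | e | e <;> rw [e] <;> norm_num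

theorem sign_pos_mul {r x : ℝ} (hr : 0 < r) : Real.sign (r * x) = Real.sign x := by
  rcases lt_trichotomy x 0 with h | h | h
  · rw [Real.sign_of_neg h, Real.sign_of_neg (mul_neg_of_pos_of_neg hr h)]
  · simp [h]
  · rw [Real.sign_of_pos h, Real.sign_of_pos (mul_pos hr h)]

theorem contAt_sign {r : ℝ} (hr : r ≠ 0) : ContinuousAt Real.sign r := by
  rcases lt_or_gt_of_ne hr with h | h
  · refine ContinuousAt.congr (f := fun _ => (-1:ℝ)) continuousAt_const ?_
    filter_upwards [Iio_mem_nhds h] with x hx using (Real.sign_of_neg hx).symm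
  · refine ContinuousAt.congr (f := fun _ => (1:ℝ)) continuousAt_const ?_
    filter_upwards [Ioi_mem_nhds h] with x hx using (Real.sign_of_pos hx).symm

theorem null_hyper {n : ℕ} {a : Fin n → ℝ} (ha : a ≠ 0) : volume {x : Fin n → ℝ | a ⬝ᵥ x = 0} = 0 := by
  let f : (Fin n → ℝ) →ₗ[ℝ] ℝ := { toFun := fun x => a ⬝ᵥ x, map_add' := dotProduct_add a, map_smul' := fun r x => dotProduct_smul r a x }
  have : {x : Fin n → ℝ | a ⬝ᵥ x = 0} = (LinearMap.ker f : Set (Fin n → ℝ)) := by ext x; simp [f]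
  rw [this]
  refine Measure.addHaar_submodule _ _ fun h => ha ?_
  have : a ∈ LinearMap.ker f := h ▸ Submodule.mem_top
  have : a ⬝ᵥ a = 0 := by simpa [f] using this
  exact dotProduct_self_eq_zero.1 this

theorem ae_ne {n : ℕ} {a : Fin n → ℝ} (ha : a ≠ 0) : ∀ᵐ x : Fin n → ℝ, a ⬝ᵥ x ≠ 0 := by
  rw [ae_iff]; simpa using null_hyper ha

theorem odd_int {n : ℕ} {K : Set (Fin n → ℝ)} (h : Body K) (g : (Fin n → ℝ) → ℝ) (hg : ∀ x, g (-x) = - g x) : ∫ x in K, g x = 0 := by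
  rw [← integral_indicator h.meas]
  have h1 := integral_neg_eq_self (K.indicator g) volume
  have h2 : ∀ x, K.indicator g (-x) = - K.indicator g x := fun x => by
    by_cases hx : x ∈ K
    · rw [Set.indicator_of_mem hx, Set.indicator_of_mem (h.symm x hx), hg]
    · rw [Set.indicator_of_notMem hx, Set.indicator_of_notMem (fun hh => hx (h.neg_mem_iff.1 hh)), neg_zero]
  simp only [h2, integral_neg] at h1
  linarith

theorem bdd_int {n : ℕ} {K : Set (Fin n → ℝ)} (h : Body K) {g : (Fin n → ℝ) → ℝ} (hm : Measurable g) (hb : ∀ x, |g x| ≤ 1) : IntegrableOn g K := by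
  refine Measure.integrableOn_of_bounded (M := 1) h.vol_ne_top hm.aestronglyMeasurable (Filter.Eventually.of_forall fun x => hb x)

theorem iadd {n : ℕ} {K : Set (Fin n → ℝ)} {f g : (Fin n → ℝ) → ℝ} (hf : IntegrableOn f K) (hg : IntegrableOn g K) (c : ℝ) :
    IntegrableOn (fun x => f x + c * g x) K ∧ ∫ x in K, (f x + c * g x) = (∫ x in K, f x) + c * ∫ x in K, g x :=
  ⟨hf.add (hg.const_mul c), by rw [integral_add hf (hg.const_mul c), integral_const_mul]⟩

theorem eq3 {K : Set V3} (h : Body K) (h01 : ∫ x in K, Real.sign (x 0) * Real.sign (x 1) = 0) (h02 : ∫ x in K, Real.sign (x 0) * Real.sign (x 2) = 0)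
    (h12 : ∫ x in K, Real.sign (x 1) * Real.sign (x 2) = 0) : EqOct K := by
  intro ε hε
  have ms : ∀ i, Measurable fun x : V3 => Real.sign (x i) := fun i => meas_sign.comp (measurable_pi_apply i)
  have bs : ∀ i (x : V3), |Real.sign (x i)| ≤ 1 := fun i x => abs_sign_le _
  have nz : ∀ᵐ x : V3, ∀ i, x i ≠ 0 := by
    rw [ae_all_iff]; intro i
    have := ae_ne (a := (Pi.single i 1 : V3)) (by simp)
    simpa using this
  have i2 : ∀ i j, IntegrableOn (fun x : V3 => Real.sign (x i) * Real.sign (x j)) K := fun i j =>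
    bdd_int h ((ms i).mul (ms j)) fun x => by rw [abs_mul]; exact mul_le_one₀ (bs i x) (abs_nonneg _) (bs j x)
  have i1 : ∀ i, IntegrableOn (fun x : V3 => Real.sign (x i)) K := fun i => bdd_int h (ms i) (bs i)
  have i3 : IntegrableOn (fun x : V3 => Real.sign (x 0) * Real.sign (x 1) * Real.sign (x 2)) K :=
    bdd_int h (((ms 0).mul (ms 1)).mul (ms 2)) fun x => by
      rw [abs_mul, abs_mul]; exact mul_le_one₀ (mul_le_one₀ (bs 0 x) (abs_nonneg _) (bs 1 x)) (abs_nonneg _) (bs 2 x)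
  have i0 : IntegrableOn (fun x : V3 => (1:ℝ)) K := bdd_int h measurable_const (by simp)
  have key : ∫ x in K, (oct ε).indicator (fun _ => (8:ℝ)) x = ∫ x in K, (1 + ε 0 * Real.sign (x 0) + ε 1 * Real.sign (x 1) + ε 2 * Real.sign (x 2)
      + ε 0 * ε 1 * (Real.sign (x 0) * Real.sign (x 1)) + ε 0 * ε 2 * (Real.sign (x 0) * Real.sign (x 2)) + ε 1 * ε 2 * (Real.sign (x 1) * Real.sign (x 2))
      + ε 0 * ε 1 * ε 2 * (Real.sign (x 0) * Real.sign (x 1) * Real.sign (x 2))) := by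
    refine integral_congr_ae (ae_restrict_of_ae ?_)
    filter_upwards [nz] with x hx
    have e : ∀ i, ε i * Real.sign (x i) = 1 ∧ 0 < ε i * x i ∨ ε i * Real.sign (x i) = -1 ∧ ε i * x i < 0 := by
      intro i
      rcases hε i with e | e <;> rcases lt_or_gt_of_ne (hx i) with h | h <;> rw [e]
      · right; rw [Real.sign_of_neg h]; constructor <;> linarith
      · left; rw [Real.sign_of_pos h]; constructor <;> linarith
      · left; rw [Real.sign_of_neg h]; constructor <;> linarith
      · right; rw [Real.sign_of_pos h]; constructor <;> linarith
    trans (1 + ε 0 * Real.sign (x 0)) * (1 + ε 1 * Real.sign (x 1)) * (1 + ε 2 * Real.sign (x 2))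
    swap
    · ring
    by_cases hm : x ∈ oct ε
    · rw [Set.indicator_of_mem hm]
      have q : ∀ i, ε i * Real.sign (x i) = 1 := fun i => by
        rcases e i with h | h
        · exact h.1
        · have := hm i; linarith
      rw [q, q, q]; norm_num
    · rw [Set.indicator_of_notMem hm]
      have : ∃ i, ¬ 0 < ε i * x i := by simpa [oct] using hm
      obtain ⟨i, hi⟩ := this
      have q : 1 + ε i * Real.sign (x i) = 0 := by
        rcases e i with h | h
        · exact absurd h.2 hi
        · rw [h.1]; norm_num
      fin_cases i
      · have q : 1 + ε 0 * Real.sign (x 0) = 0 := q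
        rw [q]; ring
      · have q : 1 + ε 1 * Real.sign (x 1) = 0 := q
        rw [q]; ring
      · have q : 1 + ε 2 * Real.sign (x 2) = 0 := q
        rw [q]; ring
  have o1 : ∀ i, ∫ x in K, Real.sign (x i) = 0 := fun i => odd_int h (fun x => Real.sign (x i)) fun x => by simp [Real.sign_neg]
  have o3 : ∫ x in K, Real.sign (x 0) * Real.sign (x 1) * Real.sign (x 2) = 0 := odd_int h (fun x => Real.sign (x 0) * Real.sign (x 1) * Real.sign (x 2)) fun x => by simp [Real.sign_neg]
  have a1 := iadd i0 (i1 0) (ε 0)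
  have a2 := iadd a1.1 (i1 1) (ε 1)
  have a3 := iadd a2.1 (i1 2) (ε 2)
  have a4 := iadd a3.1 (i2 0 1) (ε 0 * ε 1)
  have a5 := iadd a4.1 (i2 0 2) (ε 0 * ε 2)
  have a6 := iadd a5.1 (i2 1 2) (ε 1 * ε 2)
  have a7 := iadd a6.1 i3 (ε 0 * ε 1 * ε 2)
  rw [a7.2, a6.2, a5.2, a4.2, a3.2, a2.2, a1.2] at key
  simp only [o1, o3, h01, h02, h12] at key
  rw [setIntegral_indicator (oct_open ε).measurableSet, setIntegral_const, setIntegral_const] at key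
  simp [Measure.real] at key
  simp only [vol]
  linarith

theorem eq2 {K : Set (Fin 2 → ℝ)} (h : Body K) (h01 : ∫ x in K, Real.sign (x 0) * Real.sign (x 1) = 0) : EqOct K := by
  intro ε hε
  have ms : ∀ i, Measurable fun x : Fin 2 → ℝ => Real.sign (x i) := fun i => meas_sign.comp (measurable_pi_apply i)
  have bs : ∀ i (x : Fin 2 → ℝ), |Real.sign (x i)| ≤ 1 := fun i x => abs_sign_le _
  have nz : ∀ᵐ x : Fin 2 → ℝ, ∀ i, x i ≠ 0 := by
    rw [ae_all_iff]; intro i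
    have := ae_ne (a := (Pi.single i 1 : Fin 2 → ℝ)) (by simp)
    simpa using this
  have i2 : ∀ i j, IntegrableOn (fun x : Fin 2 → ℝ => Real.sign (x i) * Real.sign (x j)) K := fun i j =>
    bdd_int h ((ms i).mul (ms j)) fun x => by rw [abs_mul]; exact mul_le_one₀ (bs i x) (abs_nonneg _) (bs j x)
  have i1 : ∀ i, IntegrableOn (fun x : Fin 2 → ℝ => Real.sign (x i)) K := fun i => bdd_int h (ms i) (bs i)
  have i0 : IntegrableOn (fun x : Fin 2 → ℝ => (1:ℝ)) K := bdd_int h measurable_const (by simp)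
  have key : ∫ x in K, (oct ε).indicator (fun _ => (4:ℝ)) x = ∫ x in K, (1 + ε 0 * Real.sign (x 0) + ε 1 * Real.sign (x 1)
      + ε 0 * ε 1 * (Real.sign (x 0) * Real.sign (x 1))) := by
    refine integral_congr_ae (ae_restrict_of_ae ?_)
    filter_upwards [nz] with x hx
    have e : ∀ i, ε i * Real.sign (x i) = 1 ∧ 0 < ε i * x i ∨ ε i * Real.sign (x i) = -1 ∧ ε i * x i < 0 := by
      intro i
      rcases hε i with e | e <;> rcases lt_or_gt_of_ne (hx i) with h | h <;> rw [e]
      · right; rw [Real.sign_of_neg h]; constructor <;> linarith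
      · left; rw [Real.sign_of_pos h]; constructor <;> linarith
      · left; rw [Real.sign_of_neg h]; constructor <;> linarith
      · right; rw [Real.sign_of_pos h]; constructor <;> linarith
    trans (1 + ε 0 * Real.sign (x 0)) * (1 + ε 1 * Real.sign (x 1))
    swap
    · ring
    by_cases hm : x ∈ oct ε
    · rw [Set.indicator_of_mem hm]
      have q : ∀ i, ε i * Real.sign (x i) = 1 := fun i => by
        rcases e i with h | h
        · exact h.1
        · have := hm i; linarith
      rw [q, q]; norm_num
    · rw [Set.indicator_of_notMem hm]
      have : ∃ i, ¬ 0 < ε i * x i := by simpa only [oct, Set.mem_setOf_eq, not_forall] using hm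
      obtain ⟨i, hi⟩ := this
      have q : 1 + ε i * Real.sign (x i) = 0 := by
        rcases e i with h | h
        · exact absurd h.2 hi
        · rw [h.1]; norm_num
      fin_cases i
      · have q : 1 + ε 0 * Real.sign (x 0) = 0 := q
        rw [q]; ring
      · have q : 1 + ε 1 * Real.sign (x 1) = 0 := q
        rw [q]; ring
  have o1 : ∀ i, ∫ x in K, Real.sign (x i) = 0 := fun i => odd_int h (fun x => Real.sign (x i)) fun x => by simp [Real.sign_neg]
  have a1 := iadd i0 (i1 0) (ε 0)
  have a2 := iadd a1.1 (i1 1) (ε 1)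
  have a3 := iadd a2.1 (i2 0 1) (ε 0 * ε 1)
  rw [a3.2, a2.2, a1.2] at key
  simp only [o1, h01] at key
  rw [setIntegral_indicator (oct_open ε).measurableSet, setIntegral_const, setIntegral_const] at key
  simp [Measure.real] at key
  simp only [vol]
  linarith

/-- pair sign integral -/
noncomputable def SI {n : ℕ} (K : Set (Fin n → ℝ)) (a b : Fin n → ℝ) : ℝ := ∫ x in K, Real.sign (a ⬝ᵥ x) * Real.sign (b ⬝ᵥ x)

theorem SI_comm {n : ℕ} (K : Set (Fin n → ℝ)) (a b : Fin n → ℝ) : SI K a b = SI K b a := by simp only [SI, mul_comm]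
theorem SI_neg {n : ℕ} (K : Set (Fin n → ℝ)) (a b : Fin n → ℝ) : SI K (-a) b = - SI K a b := by
  simp only [SI, neg_dotProduct, Real.sign_neg, neg_mul, integral_neg]
theorem SI_neg' {n : ℕ} (K : Set (Fin n → ℝ)) (a b : Fin n → ℝ) : SI K a (-b) = - SI K a b := by
  rw [SI_comm, SI_neg, SI_comm]
theorem SI_smul {n : ℕ} (K : Set (Fin n → ℝ)) (a b : Fin n → ℝ) {r : ℝ} (hr : 0 < r) : SI K a (r • b) = SI K a b := by
  simp only [SI, smul_dotProduct, smul_eq_mul, sign_pos_mul hr]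

theorem meas_sdot {n : ℕ} (a : Fin n → ℝ) : Measurable fun x : Fin n → ℝ => Real.sign (a ⬝ᵥ x) :=
  meas_sign.comp (continuous_dot_right a).measurable

theorem abs_ss_le (r s : ℝ) : |Real.sign r * Real.sign s| ≤ 1 := by
  rw [abs_mul]; exact mul_le_one₀ (abs_sign_le _) (abs_nonneg _) (abs_sign_le _)

theorem SI_self {n : ℕ} {K : Set (Fin n → ℝ)} {a : Fin n → ℝ} (ha : a ≠ 0) : SI K a a = vol K := by
  have : SI K a a = ∫ x in K, (1:ℝ) := by
    refine integral_congr_ae (ae_restrict_of_ae ?_)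
    filter_upwards [ae_ne ha] with x hx
    rcases Real.sign_apply_eq_of_ne_zero _ hx with e | e <;> rw [e] <;> norm_num
  rw [this, setIntegral_const]; simp [vol, Measure.real]

theorem SI_cont {n : ℕ} {K : Set (Fin n → ℝ)} (h : Body K) {p : (Fin n → ℝ) × (Fin n → ℝ)} (h1 : p.1 ≠ 0) (h2 : p.2 ≠ 0) :
    ContinuousAt (fun p : (Fin n → ℝ) × (Fin n → ℝ) => SI K p.1 p.2) p := by
  refine continuousAt_of_dominated (bound := fun _ => 1) ?_ ?_ ?_ ?_
  · exact Filter.Eventually.of_forall fun q => ((meas_sdot _).mul (meas_sdot _)).aestronglyMeasurable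
  · exact Filter.Eventually.of_forall fun q => Filter.Eventually.of_forall fun x => abs_ss_le _ _
  · exact bdd_int h measurable_const (by simp)
  · refine ae_restrict_of_ae ?_
    filter_upwards [ae_ne h1, ae_ne h2] with x hx hy
    refine ContinuousAt.mul ?_ ?_
    · exact ContinuousAt.comp (g := Real.sign) (f := fun q : (Fin n → ℝ) × (Fin n → ℝ) => q.1 ⬝ᵥ x) (contAt_sign hx) ((continuous_dot_left x).comp continuous_fst).continuousAt
    · exact ContinuousAt.comp (g := Real.sign) (f := fun q : (Fin n → ℝ) × (Fin n → ℝ) => q.2 ⬝ᵥ x) (contAt_sign hy) ((continuous_dot_left x).comp continuous_snd).continuousAt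

end Mah

namespace Mah
open Topology

theorem set_comap {n : ℕ} (e : (Fin n → ℝ) ≃ₗ[ℝ] (Fin n → ℝ)) (K : Set (Fin n → ℝ)) (g : (Fin n → ℝ) → ℝ) :
    ∫ x in e ⁻¹' K, g (e x) = |LinearMap.det (e : (Fin n → ℝ) →ₗ[ℝ] (Fin n → ℝ))|⁻¹ * ∫ x in K, g x := by
  have h1 : MeasurableEmbedding e := e.toContinuousLinearEquiv.toHomeomorph.measurableEmbedding
  have h2 := h1.setIntegral_map (μ := volume) g K
  rw [← h2]
  have h3 : Measure.map e volume = ENNReal.ofReal |(LinearMap.det (e : (Fin n → ℝ) →ₗ[ℝ] (Fin n → ℝ)))⁻¹| • (volume : Measure (Fin n → ℝ)) :=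
    Measure.map_linearMap_addHaar_eq_smul_addHaar (μ := volume) (f := (e : (Fin n → ℝ) →ₗ[ℝ] (Fin n → ℝ))) (det_ne e)
  rw [h3, Measure.restrict_smul, integral_smul_measure, ENNReal.toReal_ofReal (abs_nonneg _), abs_inv, smul_eq_mul]

/-- planar section in a frame -/
def pl (K : Set V3) (w z : V3) : Set (Fin 2 → ℝ) := {y | y 0 • w + y 1 • z ∈ K}

def pr (w z a : V3) : Fin 2 → ℝ := ![a ⬝ᵥ w, a ⬝ᵥ z]

noncomputable def JJ (K : Set V3) (w z a b : V3) : ℝ := SI (pl K w z) (pr w z a) (pr w z b)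

theorem pr_dot (w z a : V3) (y : Fin 2 → ℝ) : pr w z a ⬝ᵥ y = a ⬝ᵥ (y 0 • w + y 1 • z) := by
  rw [dot2]; simp [pr, dotProduct_add, dotProduct_smul, mul_comm]

theorem gauge_pl (K : Set V3) (w z : V3) (y) : gauge (pl K w z) y = gauge K (y 0 • w + y 1 • z) := by
  simp only [gauge_def']
  congr 1; ext r
  simp only [pl, Set.mem_setOf_eq, smul_add, smul_smul, Pi.smul_apply, smul_eq_mul]

theorem pl_norm {w z : V3} (h1 : w ⬝ᵥ w = 1) (h2 : w ⬝ᵥ z = 0) (h3 : 1 ≤ z ⬝ᵥ z) {R : ℝ} (hR : 0 < R) {y : Fin 2 → ℝ} (hy : ‖y 0 • w + y 1 • z‖ ≤ R) : ‖y‖ ≤ 2 * R := by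
  have h := dot_le_norm (y 0 • w + y 1 • z) (y 0 • w + y 1 • z)
  have e : (y 0 • w + y 1 • z) ⬝ᵥ (y 0 • w + y 1 • z) = y 0 ^ 2 + y 1 ^ 2 * (z ⬝ᵥ z) := by
    have h2' : z ⬝ᵥ w = 0 := by rw [dotProduct_comm, h2]
    simp only [dotProduct_add, add_dotProduct, dotProduct_smul, smul_dotProduct, h1, h2, h2', smul_eq_mul]; ring
  rw [e] at h
  have h5 : ‖y 0 • w + y 1 • z‖ * ‖y 0 • w + y 1 • z‖ ≤ R * R := mul_self_le_mul_self (norm_nonneg _) hy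
  push_cast at h
  have h6 : y 0 ^ 2 + y 1 ^ 2 ≤ 4 * R ^ 2 := by nlinarith [sq_nonneg (y 1)]
  rw [pi_norm_le_iff_of_nonneg (by positivity)]
  intro i
  rw [Real.norm_eq_abs]
  refine abs_le_of_sq_le_sq ?_ (by positivity)
  fin_cases i
  · show y 0 ^ 2 ≤ _; nlinarith [sq_nonneg (y 1)]
  · show y 1 ^ 2 ≤ _; nlinarith [sq_nonneg (y 0)]

theorem pl_cont (w z : V3) : Continuous fun y : Fin 2 → ℝ => y 0 • w + y 1 • z := by fun_prop

theorem pl_body {K : Set V3} (h : Body K) {w z : V3} (h1 : w ⬝ᵥ w = 1) (h2 : w ⬝ᵥ z = 0) (h3 : 1 ≤ z ⬝ᵥ z) : Body (pl K w z) where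
  compact := by
    obtain ⟨R, hR, hb⟩ := h.bdd
    refine Metric.isCompact_of_isClosed_isBounded (h.isClosed.preimage (pl_cont w z)) ?_
    refine (Metric.isBounded_closedBall (x := (0 : Fin 2 → ℝ)) (r := 2 * R)).subset fun y hy => ?_
    rw [mem_closedBall_zero_iff]
    exact pl_norm h1 h2 h3 hR (hb _ hy)
  convex := by
    intro x hx y hy a b ha hb hab
    have := h.convex hx hy ha hb hab
    show _ ∈ K
    convert this using 1
    simp only [Pi.add_apply, Pi.smul_apply, smul_eq_mul]; module
  symm := fun x hx => by
    show _ ∈ K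
    have := h.symm _ hx
    convert this using 1
    simp only [Pi.neg_apply]; module
  nhds := by
    refine (pl_cont w z).continuousAt.preimage_mem_nhds ?_
    simpa using h.nhds

theorem null_gauge {n : ℕ} {Q : Set (Fin n → ℝ)} (h : Body Q) : ∀ᵐ x, gauge Q x ≠ 1 := by
  have := h.convex.addHaar_frontier (volume : Measure (Fin n → ℝ))
  rw [ae_iff]
  refine measure_mono_null (fun x hx => ?_) this
  have hx : gauge Q x = 1 := by simpa using hx
  refine ⟨subset_closure (h.gauge_le_one.1 hx.le), fun hi => ?_⟩
  have := interior_subset_gauge_lt_one Q hi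
  exact absurd hx this.ne

theorem JJ_cont {K : Set V3} (h : Body K) {X : Type*} [TopologicalSpace X] [FirstCountableTopology X] {w z a b : X → V3}
    (cw : Continuous w) (cz : Continuous z) (ca : Continuous a) (cb : Continuous b)
    (h1 : ∀ x, w x ⬝ᵥ w x = 1) (h2 : ∀ x, w x ⬝ᵥ z x = 0) (h3 : ∀ x, 1 ≤ z x ⬝ᵥ z x)
    (ha : ∀ x, pr (w x) (z x) (a x) ≠ 0) (hb : ∀ x, pr (w x) (z x) (b x) ≠ 0) :
    Continuous fun x => JJ K (w x) (z x) (a x) (b x) := by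
  rw [continuous_iff_continuousAt]; intro x0
  obtain ⟨R, hR, hbd⟩ := h.bdd
  have B := fun x => pl_body h (h1 x) (h2 x) (h3 x)
  have e : ∀ x, JJ K (w x) (z x) (a x) (b x) = ∫ y, (pl K (w x) (z x)).indicator (fun y => Real.sign (pr (w x) (z x) (a x) ⬝ᵥ y) * Real.sign (pr (w x) (z x) (b x) ⬝ᵥ y)) y :=
    fun x => (integral_indicator (B x).meas).symm
  simp only [e]
  refine continuousAt_of_dominated (bound := (Metric.closedBall (0 : Fin 2 → ℝ) (2 * R)).indicator fun _ => 1) ?_ ?_ ?_ ?_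
  · exact Filter.Eventually.of_forall fun q => (((meas_sdot _).mul (meas_sdot _)).indicator (B q).meas).aestronglyMeasurable
  · refine Filter.Eventually.of_forall fun q => Filter.Eventually.of_forall fun y => ?_
    by_cases hy : y ∈ pl K (w q) (z q)
    · rw [Set.indicator_of_mem hy, Set.indicator_of_mem]
      · exact abs_ss_le _ _
      · rw [mem_closedBall_zero_iff]
        exact pl_norm (h1 q) (h2 q) (h3 q) hR (hbd _ hy)
    · rw [Set.indicator_of_notMem hy, norm_zero]
      exact Set.indicator_nonneg (fun _ _ => zero_le_one) _
  · rw [integrable_indicator_iff Metric.isClosed_closedBall.measurableSet]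
    exact integrableOn_const (isCompact_closedBall _ _).measure_lt_top.ne
  · filter_upwards [ae_ne (ha x0), ae_ne (hb x0), null_gauge (B x0)] with y ya yb yg
    have cg : Continuous fun x => gauge (pl K (w x) (z x)) y := by
      simp only [gauge_pl]
      exact h.cont_gauge.comp (by fun_prop)
    rcases lt_or_gt_of_ne yg with hlt | hgt
    · have ev : ∀ᶠ x in 𝓝 x0, y ∈ pl K (w x) (z x) := by
        filter_upwards [cg.continuousAt.eventually (Iio_mem_nhds hlt)] with x hx
        exact (B x).gauge_le_one.1 (le_of_lt hx)
      have hc : ContinuousAt (fun x => Real.sign (pr (w x) (z x) (a x) ⬝ᵥ y) * Real.sign (pr (w x) (z x) (b x) ⬝ᵥ y)) x0 := by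
        refine ContinuousAt.mul ?_ ?_
        · refine ContinuousAt.comp (g := Real.sign) (f := fun x => pr (w x) (z x) (a x) ⬝ᵥ y) (contAt_sign ya) ?_
          simp only [pr_dot]
          exact (continuous_dot.comp (ca.prodMk (by fun_prop : Continuous fun x => y 0 • w x + y 1 • z x))).continuousAt
        · refine ContinuousAt.comp (g := Real.sign) (f := fun x => pr (w x) (z x) (b x) ⬝ᵥ y) (contAt_sign yb) ?_
          simp only [pr_dot]
          exact (continuous_dot.comp (cb.prodMk (by fun_prop : Continuous fun x => y 0 • w x + y 1 • z x))).continuousAt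
      refine hc.congr ?_
      filter_upwards [ev] with x hx
      rw [Set.indicator_of_mem hx]
    · refine ContinuousAt.congr (f := fun _ => (0:ℝ)) continuousAt_const ?_
      filter_upwards [cg.continuousAt.eventually (Ioi_mem_nhds hgt)] with x hx
      rw [Set.indicator_of_notMem]
      intro hh
      exact absurd ((B x).gauge_le_one.2 hh) (not_le.2 hx)

theorem pr_neg (w z a : V3) : pr w z (-a) = - pr w z a := by ext i; fin_cases i <;> simp [pr]
theorem JJ_neg1 (K : Set V3) (w z a b : V3) : JJ K w z (-a) b = - JJ K w z a b := by rw [JJ, pr_neg, SI_neg]; rfl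
theorem JJ_neg2 (K : Set V3) (w z a b : V3) : JJ K w z a (-b) = - JJ K w z a b := by rw [JJ, pr_neg, SI_neg']; rfl

theorem JJ_eq (K : Set V3) (w z a b : V3) : JJ K w z a b = ∫ y in pl K w z, Real.sign (a ⬝ᵥ (y 0 • w + y 1 • z)) * Real.sign (b ⬝ᵥ (y 0 • w + y 1 • z)) := by
  simp only [JJ, SI, pr_dot]

theorem JJ_d (K : Set V3) (w z a b : V3) (d : Fin 2 → ℝ) (hd : ∀ i, d i = 1 ∨ d i = -1) : JJ K (d 0 • w) (d 1 • z) a b = JJ K w z a b := by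
  have hd' : ∀ i, d i ≠ 0 := fun i => by rcases hd i with h | h <;> rw [h] <;> norm_num
  have := set_comap (dg d hd') (pl K w z) fun y => Real.sign (a ⬝ᵥ (y 0 • w + y 1 • z)) * Real.sign (b ⬝ᵥ (y 0 • w + y 1 • z))
  rw [← JJ_eq] at this
  have e1 : dg d hd' ⁻¹' pl K w z = pl K (d 0 • w) (d 1 • z) := by
    ext y; simp only [pl, Set.mem_preimage, Set.mem_setOf_eq, dg_apply, smul_smul, mul_comm]
  have e2 : |LinearMap.det (dg d hd' : (Fin 2 → ℝ) →ₗ[ℝ] (Fin 2 → ℝ))| = 1 := by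
    have h2 : LinearMap.det (dg d hd' : (Fin 2 → ℝ) →ₗ[ℝ] (Fin 2 → ℝ)) = d 0 * d 1 := by
      rw [← LinearMap.det_toMatrix', Matrix.det_fin_two]
      simp [LinearMap.toMatrix'_apply]
    rw [h2, abs_mul]
    rcases hd 0 with h | h <;> rcases hd 1 with h' | h' <;> rw [h, h'] <;> norm_num
  rw [e1, e2] at this
  rw [JJ_eq]
  simp only [dg_apply] at this
  simp only [smul_smul, mul_comm (_ : ℝ) (d _)]
  rw [this]; simp

theorem JJ_negw (K : Set V3) (w z a b : V3) : JJ K (-w) z a b = JJ K w z a b := by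
  simpa using JJ_d K w z a b ![-1,1] (by intro i; fin_cases i <;> simp)
theorem JJ_negz (K : Set V3) (w z a b : V3) : JJ K w (-z) a b = JJ K w z a b := by
  simpa using JJ_d K w z a b ![1,-1] (by intro i; fin_cases i <;> simp)

end Mah

namespace Mah
open Topology

theorem impl_cont {X : Type*} [TopologicalSpace X] {G : X → ℝ → ℝ} {g h : X → ℝ} (hG : ∀ s, Continuous fun x => G x s)
    (hm : ∀ x, StrictMono (G x)) (hh : Continuous h) (e : ∀ x, G x (g x) = h x) : Continuous g := by
  rw [continuous_iff_continuousAt]; intro x0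
  refine tendsto_order.2 ⟨fun a ha => ?_, fun a ha => ?_⟩
  · have : G x0 a < h x0 := by rw [← e]; exact hm x0 ha
    filter_upwards [(hG a).continuousAt.eventually_lt hh.continuousAt this] with x hx
    rw [← e] at hx; exact (hm x).lt_iff_lt.1 hx
  · have : h x0 < G x0 a := by rw [← e]; exact hm x0 ha
    filter_upwards [hh.continuousAt.eventually_lt (hG a).continuousAt this] with x hx
    rw [← e] at hx; exact (hm x).lt_iff_lt.1 hx

def On2 (b v : V3) : Prop := b ⬝ᵥ b = 1 ∧ v ⬝ᵥ v = 1 ∧ b ⬝ᵥ v = 0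

/-- point on the circle -/
noncomputable def ci (b v : V3) (φ : ℝ) : V3 := Real.cos φ • b + Real.sin φ • v
noncomputable def rh (K : Set V3) (b v : V3) (φ : ℝ) : ℝ := (gauge K (ci b v φ) ^ 2)⁻¹
noncomputable def Th (K : Set V3) (b v : V3) (θ : ℝ) : ℝ := ∫ φ in (0:ℝ)..θ, rh K b v φ

theorem ci_dot {b v : V3} (h : On2 b v) (α β : ℝ) : ci b v α ⬝ᵥ ci b v β = Real.cos (α - β) := by
  obtain ⟨h1, h2, h3⟩ := h
  have h3' : v ⬝ᵥ b = 0 := by rw [dotProduct_comm, h3]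
  simp only [ci, dotProduct_add, add_dotProduct, dotProduct_smul, smul_dotProduct, h1, h2, h3, h3', smul_eq_mul, Real.cos_sub]; ring

theorem ci_ne {b v : V3} (h : On2 b v) (α : ℝ) : ci b v α ≠ 0 := fun h0 => by
  have := ci_dot h α α
  rw [h0] at this; simp at this

theorem ci_pi (b v : V3) (α : ℝ) : ci b v (α + Real.pi) = - ci b v α := by
  simp only [ci, Real.cos_add_pi, Real.sin_add_pi]; module

theorem ci_cont {X : Type*} [TopologicalSpace X] {b v : X → V3} {φ : X → ℝ} (hb : Continuous b) (hv : Continuous v) (hp : Continuous φ) :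
    Continuous fun x => ci (b x) (v x) (φ x) := by unfold ci; fun_prop

section

theorem rh_pos {K : Set V3} (hK : Body K) {b v : V3} (h : On2 b v) (φ : ℝ) : 0 < rh K b v φ := by
  have := hK.gauge_pos.2 (ci_ne h φ); unfold rh; positivity

theorem rh_cont {K : Set V3} (hK : Body K) {X : Type*} [TopologicalSpace X] {b v : X → V3} {φ : X → ℝ} (hb : Continuous b) (hv : Continuous v) (hp : Continuous φ) (ho : ∀ x, On2 (b x) (v x)) :
    Continuous fun x => rh K (b x) (v x) (φ x) :=
  ((hK.cont_gauge.comp (ci_cont hb hv hp)).pow 2).inv₀ fun x => (pow_pos (hK.gauge_pos.2 (ci_ne (ho x) _)) 2).ne'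

theorem rh_cont1 {K : Set V3} (hK : Body K) {b v : V3} (ho : On2 b v) : Continuous (rh K b v) :=
  rh_cont hK continuous_const continuous_const continuous_id fun _ => ho

theorem rh_int {K : Set V3} (hK : Body K) {b v : V3} (ho : On2 b v) (x y : ℝ) : IntervalIntegrable (rh K b v) volume x y :=
  (rh_cont1 hK ho).intervalIntegrable _ _

theorem rh_per {K : Set V3} (hK : Body K) (b v : V3) : Function.Periodic (rh K b v) Real.pi := fun φ => by
  simp only [rh, ci_pi, hK.gauge_neg]

theorem Th_mono {K : Set V3} (hK : Body K) {b v : V3} (ho : On2 b v) : StrictMono (Th K b v) := by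
  intro x y hxy
  have h1 := intervalIntegral.integral_add_adjacent_intervals (rh_int hK ho 0 x) (rh_int hK ho x y)
  have h2 : 0 < ∫ φ in x..y, rh K b v φ := intervalIntegral.intervalIntegral_pos_of_pos (rh_int hK ho x y) (rh_pos hK ho) hxy
  unfold Th; linarith

theorem Th_cont {K : Set V3} (hK : Body K) {X : Type*} [TopologicalSpace X] {b v : X → V3} {φ : X → ℝ} (hb : Continuous b) (hv : Continuous v) (hp : Continuous φ) (ho : ∀ x, On2 (b x) (v x)) :
    Continuous fun x => Th K (b x) (v x) (φ x) :=
  intervalIntegral.continuous_parametric_intervalIntegral_of_continuous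
    (f := fun x φ => rh K (b x) (v x) φ)
    (rh_cont hK (hb.comp continuous_fst) (hv.comp continuous_fst) continuous_snd fun x => ho x.1) hp

theorem Th_shift {K : Set V3} (hK : Body K) {b v : V3} (ho : On2 b v) (θ : ℝ) : Th K b v (θ + Real.pi) = Th K b v θ + Th K b v Real.pi := by
  have := (rh_per hK b v).intervalIntegral_add_eq_add 0 θ (fun x y => rh_int hK ho x y)
  simpa [Th] using this

theorem Th_surj {K : Set V3} (hK : Body K) {b v : V3} (ho : On2 b v) : Function.Surjective (Th K b v) := by
  have c : Continuous (Th K b v) := Th_cont hK continuous_const continuous_const continuous_id fun _ => ho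
  refine c.surjective ?_ ?_
  · exact (rh_per hK b v).tendsto_atTop_intervalIntegral_of_pos' (rh_int hK ho _ _) (rh_pos hK ho) Real.pi_pos
  · exact (rh_per hK b v).tendsto_atBot_intervalIntegral_of_pos' (rh_int hK ho _ _) (rh_pos hK ho) Real.pi_pos
end

open Classical in
noncomputable def ang (K : Set V3) (b v : V3) (ψ : ℝ) : ℝ :=
  if h : ∃ θ, Th K b v θ = ψ / 2 * Th K b v Real.pi then h.choose else 0

section

theorem ang_spec {K : Set V3} (hK : Body K) {b v : V3} (ho : On2 b v) (ψ : ℝ) : Th K b v (ang K b v ψ) = ψ / 2 * Th K b v Real.pi := by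
  have h : ∃ θ, Th K b v θ = ψ / 2 * Th K b v Real.pi := Th_surj hK ho _
  rw [ang, dif_pos h]; exact h.choose_spec

theorem ang_uniq {K : Set V3} (hK : Body K) {b v : V3} (ho : On2 b v) {ψ θ : ℝ} (h : Th K b v θ = ψ / 2 * Th K b v Real.pi) : ang K b v ψ = θ :=
  (Th_mono hK ho).injective ((ang_spec hK ho ψ).trans h.symm)

theorem Th_pi_pos {K : Set V3} (hK : Body K) {b v : V3} (ho : On2 b v) : 0 < Th K b v Real.pi := by
  have := Th_mono hK ho Real.pi_pos
  simpa [Th] using this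

theorem ang_cont {K : Set V3} (hK : Body K) {X : Type*} [TopologicalSpace X] {b v : X → V3} {ψ : X → ℝ} (hb : Continuous b) (hv : Continuous v) (hp : Continuous ψ) (ho : ∀ x, On2 (b x) (v x)) :
    Continuous fun x => ang K (b x) (v x) (ψ x) :=
  impl_cont (G := fun x => Th K (b x) (v x)) (h := fun x => ψ x / 2 * Th K (b x) (v x) Real.pi)
    (fun s => Th_cont hK hb hv continuous_const ho) (fun x => Th_mono hK (ho x))
    ((hp.div_const 2).mul (Th_cont hK hb hv continuous_const ho)) fun x => ang_spec hK (ho x) _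

theorem ang_two {K : Set V3} (hK : Body K) {b v : V3} (ho : On2 b v) (ψ : ℝ) : ang K b v (ψ + 2) = ang K b v ψ + Real.pi := by
  refine ang_uniq hK ho ?_
  rw [Th_shift hK ho, ang_spec hK ho]; ring

theorem ang_zero {K : Set V3} (hK : Body K) {b v : V3} (ho : On2 b v) : ang K b v 0 = 0 := by
  refine ang_uniq hK ho ?_
  simp [Th]

theorem ang_mono {K : Set V3} (hK : Body K) {b v : V3} (ho : On2 b v) : StrictMono (ang K b v) := by
  intro x y hxy
  refine (Th_mono hK ho).lt_iff_lt.1 ?_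
  rw [ang_spec hK ho, ang_spec hK ho]
  have := Th_pi_pos hK ho
  nlinarith

theorem ci_rot {K : Set V3} (hK : Body K) (b v : V3) (α φ : ℝ) : ci (ci b v α) (ci b v (α + Real.pi / 2)) φ = ci b v (α + φ) := by
  simp only [ci, Real.cos_add_pi_div_two, Real.sin_add_pi_div_two]; rw [Real.cos_add, Real.sin_add]; module

theorem on2_rot {K : Set V3} (hK : Body K) {b v : V3} (ho : On2 b v) (α : ℝ) : On2 (ci b v α) (ci b v (α + Real.pi / 2)) := by
  refine ⟨?_, ?_, ?_⟩ <;> rw [ci_dot ho] <;> simp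

theorem Th_rot {K : Set V3} (hK : Body K) {b v : V3} (ho : On2 b v) (α θ : ℝ) : Th K (ci b v α) (ci b v (α + Real.pi / 2)) θ = Th K b v (α + θ) - Th K b v α := by
  have h1 := intervalIntegral.integral_add_adjacent_intervals (rh_int hK ho 0 α) (rh_int hK ho α (α + θ))
  have h2 : Th K (ci b v α) (ci b v (α + Real.pi / 2)) θ = ∫ φ in (0:ℝ)..θ, rh K b v (α + φ) := by
    unfold Th; congr 1; ext φ; simp only [rh, ci_rot hK]
  rw [h2, intervalIntegral.integral_comp_add_left (fun φ => rh K b v φ)]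
  unfold Th; rw [← h1, add_zero]; ring

theorem ang_rot {K : Set V3} (hK : Body K) {b v : V3} (ho : On2 b v) (t ψ : ℝ) :
    ang K (ci b v (ang K b v t)) (ci b v (ang K b v t + Real.pi / 2)) ψ + ang K b v t = ang K b v (t + ψ) := by
  symm
  refine ang_uniq hK ho ?_
  have h := ang_spec hK (on2_rot hK ho (ang K b v t)) ψ
  rw [Th_rot hK ho, Th_rot hK ho, Th_shift hK ho, ang_spec hK ho] at h
  rw [add_comm]; linarith

theorem ci_refl {K : Set V3} (hK : Body K) (b v : V3) (φ : ℝ) : ci b (-v) φ = ci b v (-φ) := by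
  simp only [ci, Real.cos_neg, Real.sin_neg]; module

theorem ang_refl {K : Set V3} (hK : Body K) {b v : V3} (ho : On2 b v) (ψ : ℝ) : ang K b (-v) ψ = - ang K b v (-ψ) := by
  have ho' : On2 b (-v) := ⟨ho.1, by simpa using ho.2.1, by simpa using ho.2.2⟩
  have key : ∀ θ, Th K b (-v) θ = - Th K b v (-θ) := fun θ => by
    have : Th K b (-v) θ = ∫ φ in (0:ℝ)..θ, rh K b v (-φ) := by
      unfold Th; congr 1; ext φ; simp only [rh, ci_refl hK]
    rw [this, intervalIntegral.integral_comp_neg (fun φ => rh K b v φ), neg_zero, intervalIntegral.integral_symm]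
    rfl
  refine ang_uniq hK ho' ?_
  rw [key, key, neg_neg, ang_spec hK ho]
  have := Th_shift hK ho (-Real.pi)
  rw [neg_add_cancel] at this
  have h0 : Th K b v 0 = 0 := by simp [Th]
  rw [h0] at this
  have : Th K b v (-Real.pi) = - Th K b v Real.pi := by linarith
  rw [this]; ring

end
end Mah

namespace Mah
open Topology

theorem On2.swap {b v : V3} (h : On2 b v) : On2 v b := ⟨h.2.1, h.1, by rw [dotProduct_comm]; exact h.2.2⟩
theorem On2.neg_left {b v : V3} (h : On2 b v) : On2 (-b) v := ⟨by simpa using h.1, h.2.1, by simpa using h.2.2⟩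
theorem On2.neg_right {b v : V3} (h : On2 b v) : On2 b (-v) := h.swap.neg_left.swap

theorem On2.ne {u m : V3} (h : On2 u m) : u ≠ 0 := fun h0 => by
  have := h.1; rw [h0] at this; simp at this

theorem On2.add_ne {u m : V3} (h : On2 u m) (s : ℝ) : m + s • u ≠ 0 := fun h0 => by
  have : (m + s • u) ⬝ᵥ m = 1 := by simp [add_dotProduct, smul_dotProduct, h.2.1, h.2.2]
  rw [h0] at this; simp at this

section

theorem SI_contOn {K : Set V3} (hK : Body K) {X : Type*} [TopologicalSpace X] {a b : X → V3} (ha : Continuous a) (hb : Continuous b) (a0 : ∀ x, a x ≠ 0) (b0 : ∀ x, b x ≠ 0) :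
    Continuous fun x => SI K (a x) (b x) := by
  rw [continuous_iff_continuousAt]; intro x
  exact ContinuousAt.comp (g := fun p : V3 × V3 => SI K p.1 p.2) (f := fun x => (a x, b x)) (SI_cont hK (a0 x) (b0 x)) (ha.prodMk hb).continuousAt

theorem sign_shear {K : Set V3} (hK : Body K) (r q : ℝ) {s s' : ℝ} (h : s ≤ s') : Real.sign r * Real.sign (q + s * r) ≤ Real.sign r * Real.sign (q + s' * r) := by
  have mono : ∀ x y : ℝ, x ≤ y → Real.sign x ≤ Real.sign y := fun x y hxy => by
    rcases lt_trichotomy x 0 with h1 | h1 | h1 <;> rcases lt_trichotomy y 0 with h2 | h2 | h2 <;>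
      first
      | (exfalso; linarith)
      | (simp only [Real.sign_of_neg, Real.sign_of_pos, h1, h2, Real.sign_zero]; norm_num)
  rcases lt_trichotomy r 0 with h1 | h1 | h1
  · rw [Real.sign_of_neg h1]
    have := mono (q + s' * r) (q + s * r) (by nlinarith)
    linarith
  · simp [h1]
  · rw [Real.sign_of_pos h1]
    have := mono (q + s * r) (q + s' * r) (by nlinarith)
    linarith

theorem sl_mono {K : Set V3} (hK : Body K) {u m : V3} (h : On2 u m) : StrictMono fun s : ℝ => SI K u (m + s • u) := by
  intro s s' hs
  have int : ∀ s : ℝ, IntegrableOn (fun x => Real.sign (u ⬝ᵥ x) * Real.sign ((m + s • u) ⬝ᵥ x)) K := fun s =>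
    bdd_int hK ((meas_sdot _).mul (meas_sdot _)) fun x => abs_ss_le _ _
  show SI K u (m + s • u) < SI K u (m + s' • u)
  unfold SI
  rw [← sub_pos, ← integral_sub (int s') (int s)]
  have e : ∀ (s : ℝ) (x : V3), (m + s • u) ⬝ᵥ x = m ⬝ᵥ x + s * (u ⬝ᵥ x) := fun s x => by simp [add_dotProduct, smul_dotProduct]
  rw [setIntegral_pos_iff_support_of_nonneg_ae]
  rotate_left
  · refine Filter.Eventually.of_forall fun x => ?_
    simp only [e, Pi.zero_apply]
    have := sign_shear hK (u ⬝ᵥ x) (m ⬝ᵥ x) hs.le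
    linarith
  · exact (int s').sub (int s)
  let U : Set V3 := {x | 0 < u ⬝ᵥ x} ∩ {x | m ⬝ᵥ x + s * (u ⬝ᵥ x) < 0} ∩ {x | 0 < m ⬝ᵥ x + s' * (u ⬝ᵥ x)} ∩ interior K
  have cu := continuous_dot_right u
  have cm := continuous_dot_right m
  have oU : IsOpen U := by
    refine IsOpen.inter (IsOpen.inter (IsOpen.inter ?_ ?_) ?_) isOpen_interior
    · exact isOpen_lt continuous_const cu
    · exact isOpen_lt (cm.add (continuous_const.mul cu)) continuous_const
    · exact isOpen_lt continuous_const (cm.add (continuous_const.mul cu))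
  have nU : U.Nonempty := by
    let x0 : V3 := u - ((s + s') / 2) • m
    have hintr : interior K ∈ 𝓝 (0 : V3) := interior_mem_nhds.2 hK.nhds
    have ht : Filter.Tendsto (fun r : ℝ => r • x0) (𝓝[>] 0) (𝓝 0) := by
      have : Continuous fun r : ℝ => r • x0 := by fun_prop
      have := this.tendsto 0
      rw [zero_smul] at this
      exact this.mono_left nhdsWithin_le_nhds
    obtain ⟨r, hr, hr0⟩ := ((ht.eventually hintr).and self_mem_nhdsWithin).exists
    have hr0 : 0 < r := hr0
    have e1 : u ⬝ᵥ x0 = 1 := by simp [x0, dotProduct_sub, h.1, h.2.2]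
    have e2 : m ⬝ᵥ x0 = -((s + s') / 2) := by simp [x0, dotProduct_sub, h.2.1, dotProduct_comm m u, h.2.2]
    refine ⟨r • x0, ⟨⟨?_, ?_⟩, ?_⟩, hr⟩ <;> simp only [Set.mem_setOf_eq, dotProduct_smul, e1, e2, smul_eq_mul] <;> nlinarith
  refine lt_of_lt_of_le (oU.measure_pos volume nU) (measure_mono fun x hx => ⟨?_, interior_subset hx.2⟩)
  obtain ⟨⟨⟨h1, h2⟩, h3⟩, -⟩ := hx
  rw [Function.mem_support]
  simp only [e]
  rw [Real.sign_of_pos h1, Real.sign_of_neg h2, Real.sign_of_pos h3]; norm_num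

theorem sl_exists {K : Set V3} (hK : Body K) {u m : V3} (h : On2 u m) : ∃ s : ℝ, SI K u (m + s • u) = 0 := by
  have c : Continuous fun s : ℝ => SI K u (m + s • u) := SI_contOn hK continuous_const (by fun_prop) (fun _ => h.ne) h.add_ne
  have key : ∀ m, On2 u m → ∃ s : ℝ, 0 < s ∧ 0 < SI K u (m + s • u) := fun m h => by
    have c2 : ContinuousAt (fun r : ℝ => SI K u (r • m + u)) 0 := by
      refine ContinuousAt.comp (g := fun p : V3 × V3 => SI K p.1 p.2) (f := fun r : ℝ => (u, r • m + u)) (SI_cont hK h.ne ?_) (by fun_prop)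
      simpa using h.ne
    have h0 : 0 < SI K u ((0:ℝ) • m + u) := by
      rw [zero_smul, zero_add, SI_self h.ne]; exact hK.vol_pos
    have ev := c2.eventually (lt_mem_nhds h0)
    have ev' : ∀ᶠ r in 𝓝[>] (0:ℝ), 0 < SI K u (r • m + u) := nhdsWithin_le_nhds ev
    obtain ⟨r, hr, hr0⟩ := (ev'.and self_mem_nhdsWithin).exists
    have hr0 : 0 < r := hr0
    refine ⟨r⁻¹, by positivity, ?_⟩
    rw [← SI_smul K u _ hr0, smul_add, smul_smul, mul_inv_cancel₀ hr0.ne', one_smul]; exact hr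
  obtain ⟨s1, _, h1⟩ := key m h
  obtain ⟨s2, _, h2⟩ := key (-m) h.neg_right
  have h3 : SI K u (m + (-s2) • u) < 0 := by
    have : m + (-s2) • u = -(-m + s2 • u) := by module
    rw [this, SI_neg']; linarith
  obtain ⟨s, hs⟩ := mem_range_of_exists_le_of_exists_ge c ⟨-s2, h3.le⟩ ⟨s1, h1.le⟩
  exact ⟨s, hs⟩
end

open Classical in
noncomputable def sl (K : Set V3) (u m : V3) : ℝ := if h : ∃ s : ℝ, SI K u (m + s • u) = 0 then h.choose else 0
noncomputable def nn (K : Set V3) (u m : V3) : V3 := m + sl K u m • u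
noncomputable def zz (K : Set V3) (u m : V3) : V3 := u - sl K u m • m

section
theorem sl_spec {K : Set V3} (hK : Body K) {u m : V3} (h : On2 u m) : SI K u (m + sl K u m • u) = 0 := by
  have := sl_exists hK h
  rw [sl, dif_pos this]; exact this.choose_spec
theorem sl_uniq {K : Set V3} (hK : Body K) {u m : V3} (h : On2 u m) {s : ℝ} (hs : SI K u (m + s • u) = 0) : sl K u m = s :=
  (sl_mono hK h).injective ((sl_spec hK h).trans hs.symm)

theorem sl_cont {K : Set V3} (hK : Body K) {X : Type*} [TopologicalSpace X] {u m : X → V3} (hu : Continuous u) (hm : Continuous m) (ho : ∀ x, On2 (u x) (m x)) :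
    Continuous fun x => sl K (u x) (m x) :=
  impl_cont (G := fun x s => SI K (u x) (m x + s • u x)) (h := fun x => 0)
    (fun s => SI_contOn hK hu (by fun_prop) (fun x => (ho x).ne) fun x => (ho x).add_ne s) (fun x => sl_mono hK (ho x))
    continuous_const fun x => sl_spec hK (ho x)

theorem sl_neg2 {K : Set V3} (hK : Body K) {u m : V3} (h : On2 u m) : sl K u (-m) = - sl K u m := by
  refine sl_uniq hK h.neg_right ?_
  have : -m + (-sl K u m) • u = -(m + sl K u m • u) := by module
  rw [this, SI_neg', sl_spec hK h, neg_zero]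
theorem sl_neg1 {K : Set V3} (hK : Body K) {u m : V3} (h : On2 u m) : sl K (-u) m = - sl K u m := by
  refine sl_uniq hK h.neg_left ?_
  have : m + (-sl K u m) • -u = m + sl K u m • u := by module
  rw [this, SI_neg, sl_spec hK h, neg_zero]
theorem nn_neg2 {K : Set V3} (hK : Body K) {u m : V3} (h : On2 u m) : nn K u (-m) = - nn K u m := by
  unfold nn; rw [sl_neg2 hK h]; module
theorem nn_neg1 {K : Set V3} (hK : Body K) {u m : V3} (h : On2 u m) : nn K (-u) m = nn K u m := by
  unfold nn; rw [sl_neg1 hK h]; module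
theorem zz_neg2 {K : Set V3} (hK : Body K) {u m : V3} (h : On2 u m) : zz K u (-m) = zz K u m := by
  unfold zz; rw [sl_neg2 hK h]; module
theorem zz_neg1 {K : Set V3} (hK : Body K) {u m : V3} (h : On2 u m) : zz K (-u) m = - zz K u m := by
  unfold zz; rw [sl_neg1 hK h]; module
end

structure On3 (u b v : V3) : Prop where
  bv : On2 b v
  ub : On2 u b
  uv : On2 u v

/-- data of the frame -/
noncomputable def fw (K : Set V3) (b v : V3) (ψ : ℝ) : V3 := ci b v (ang K b v ψ)
noncomputable def fm (K : Set V3) (b v : V3) (ψ : ℝ) : V3 := ci b v (ang K b v ψ + Real.pi / 2)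
noncomputable def F1 (K : Set V3) (u b v : V3) (ψ : ℝ) : ℝ := SI K (nn K u (fm K b v ψ)) (nn K u (fm K b v (ψ + 1)))
noncomputable def F2 (K : Set V3) (u b v : V3) (ψ : ℝ) : ℝ := JJ K (fw K b v ψ) (zz K u (fm K b v ψ)) u (nn K u (fm K b v (ψ + 1)))
noncomputable def F3 (K : Set V3) (u b v : V3) (ψ : ℝ) : ℝ := JJ K (fw K b v (ψ+1)) (zz K u (fm K b v (ψ + 1))) u (nn K u (fm K b v ψ))

theorem On3.ci {u b v : V3} (h : On3 u b v) (α : ℝ) : On2 u (ci b v α) := by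
  refine ⟨h.ub.1, ?_, ?_⟩
  · rw [ci_dot h.bv]; simp
  · simp [Mah.ci, dotProduct_add, h.ub.2.2, h.uv.2.2]
theorem On3.fm {u b v : V3} (h : On3 u b v) (K : Set V3) (ψ : ℝ) : On2 u (fm K b v ψ) := h.ci _

section

theorem fw_two {K : Set V3} (hK : Body K) {b v : V3} (h : On2 b v) (ψ : ℝ) : fw K b v (ψ + 2) = - fw K b v ψ := by
  unfold fw; rw [ang_two hK h, ci_pi]
theorem fm_two {K : Set V3} (hK : Body K) {b v : V3} (h : On2 b v) (ψ : ℝ) : fm K b v (ψ + 2) = - fm K b v ψ := by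
  unfold fm; rw [ang_two hK h, ← ci_pi]; ring_nf

theorem fw_refl {K : Set V3} (hK : Body K) {b v : V3} (h : On2 b v) (ψ : ℝ) : fw K b (-v) ψ = fw K b v (-ψ) := by
  unfold fw; rw [ci_refl hK, ang_refl hK h, neg_neg]
theorem fm_refl {K : Set V3} (hK : Body K) {b v : V3} (h : On2 b v) (ψ : ℝ) : fm K b (-v) ψ = - fm K b v (-ψ) := by
  unfold fm; rw [ci_refl hK, ang_refl hK h, eq_neg_iff_add_eq_zero, ← neg_eq_iff_add_eq_zero, ← ci_pi]; ring_nf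

theorem F1_one {K : Set V3} (hK : Body K) {u b v : V3} (h : On3 u b v) : F1 K u b v 1 = - F1 K u b v 0 := by
  have e : fm K b v (1 + 1) = - fm K b v 0 := by rw [← fm_two hK h.bv]; norm_num
  unfold F1
  rw [e, nn_neg2 hK (h.fm K _), SI_neg', SI_comm, zero_add]

theorem F2_one {K : Set V3} (hK : Body K) {u b v : V3} (h : On3 u b v) : F2 K u b v 1 = - F3 K u b v 0 := by
  have e : fm K b v (1 + 1) = - fm K b v 0 := by rw [← fm_two hK h.bv]; norm_num
  unfold F2 F3
  rw [e, nn_neg2 hK (h.fm K _), JJ_neg2, zero_add]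

theorem F3_one {K : Set V3} (hK : Body K) {u b v : V3} (h : On3 u b v) : F3 K u b v 1 = F2 K u b v 0 := by
  have e : fm K b v (1 + 1) = - fm K b v 0 := by rw [← fm_two hK h.bv]; norm_num
  have e' : fw K b v (1 + 1) = - fw K b v 0 := by rw [← fw_two hK h.bv]; norm_num
  unfold F2 F3
  rw [e, e', zz_neg2 hK (h.fm K _), JJ_negw, zero_add]

theorem F_refl {K : Set V3} (hK : Body K) {u b v : V3} (h : On3 u b v) (ψ : ℝ) :
    F1 K (-u) b (-v) (1 - ψ) = F1 K u b v ψ ∧ F2 K (-u) b (-v) (1 - ψ) = - F3 K u b v ψ ∧ F3 K (-u) b (-v) (1 - ψ) = - F2 K u b v ψ := by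
  have m1 : fm K b (-v) (1 - ψ) = fm K b v (ψ + 1) := by
    rw [fm_refl hK h.bv, ← fm_two hK h.bv]; ring_nf
  have m2 : fm K b (-v) (1 - ψ + 1) = fm K b v ψ := by
    rw [fm_refl hK h.bv, ← fm_two hK h.bv]; ring_nf
  have w1 : fw K b (-v) (1 - ψ) = - fw K b v (ψ + 1) := by
    rw [fw_refl hK h.bv, eq_neg_iff_add_eq_zero, ← neg_eq_iff_add_eq_zero, ← fw_two hK h.bv]; ring_nf
  have w2 : fw K b (-v) (1 - ψ + 1) = - fw K b v ψ := by
    rw [fw_refl hK h.bv, eq_neg_iff_add_eq_zero, ← neg_eq_iff_add_eq_zero, ← fw_two hK h.bv]; ring_nf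
  unfold F1 F2 F3
  rw [m1, m2, w1, w2, nn_neg1 hK (h.fm K _), nn_neg1 hK (h.fm K _), zz_neg1 hK (h.fm K _), zz_neg1 hK (h.fm K _)]
  refine ⟨SI_comm _ _ _, ?_, ?_⟩ <;> rw [JJ_negw, JJ_negz, JJ_neg1]

theorem sin_pos_ang {K : Set V3} (hK : Body K) {b v : V3} (h : On2 b v) (ψ : ℝ) : 0 < Real.sin (ang K b v (ψ + 1) - ang K b v ψ) := by
  have h1 := ang_mono hK h (lt_add_one ψ)
  have h2 := ang_mono hK h (show ψ + 1 < ψ + 2 by linarith)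
  rw [ang_two hK h] at h2
  exact Real.sin_pos_of_pos_of_lt_pi (by linarith) (by linarith)

theorem nn_dot_w {K : Set V3} (hK : Body K) {u b v : V3} (h : On3 u b v) (α β : ℝ) : nn K u (ci b v α) ⬝ᵥ ci b v β = Real.cos (α - β) := by
  unfold nn
  rw [add_dotProduct, smul_dotProduct, ci_dot h.bv, (h.ci _).2.2]; simp

theorem u_dot_z {K : Set V3} (hK : Body K) {u m : V3} (h : On2 u m) : u ⬝ᵥ zz K u m = 1 := by
  unfold zz; simp [dotProduct_sub, h.1, h.2.2]

theorem z_dot_z {K : Set V3} (hK : Body K) {u m : V3} (h : On2 u m) : 1 ≤ zz K u m ⬝ᵥ zz K u m := by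
  have : zz K u m ⬝ᵥ zz K u m = 1 + sl K u m ^ 2 := by
    have h' := h.swap.2.2
    unfold zz; simp only [dotProduct_sub, sub_dotProduct, dotProduct_smul, smul_dotProduct, h.1, h.2.1, h.2.2, h', smul_eq_mul]; ring
  rw [this]; nlinarith [sq_nonneg (sl K u m)]

theorem w_dot_z {K : Set V3} (hK : Body K) {u b v : V3} (h : On3 u b v) (ψ : ℝ) : fw K b v ψ ⬝ᵥ zz K u (fm K b v ψ) = 0 := by
  unfold zz fm fw
  rw [dotProduct_sub, dotProduct_smul, ci_dot h.bv, (h.ci _).swap.2.2]; simp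

theorem nn_dot_z {K : Set V3} (hK : Body K) {u m : V3} (h : On2 u m) : nn K u m ⬝ᵥ zz K u m = 0 := by
  have h' := h.swap.2.2
  unfold nn zz; simp only [dotProduct_sub, add_dotProduct, dotProduct_smul, smul_dotProduct, h.1, h.2.1, h.2.2, h', smul_eq_mul]; ring

theorem F_cont {K : Set V3} (hK : Body K) {X : Type*} [TopologicalSpace X] [FirstCountableTopology X] {u b v : X → V3} {ψ : X → ℝ} (hu : Continuous u) (hb : Continuous b) (hv : Continuous v) (hp : Continuous ψ)
    (h : ∀ x, On3 (u x) (b x) (v x)) : (Continuous fun x => F1 K (u x) (b x) (v x) (ψ x)) ∧ (Continuous fun x => F2 K (u x) (b x) (v x) (ψ x)) ∧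
      Continuous fun x => F3 K (u x) (b x) (v x) (ψ x) := by
  have hp' : Continuous fun x => ψ x + 1 := hp.add continuous_const
  have cw : ∀ ψ : X → ℝ, Continuous ψ → Continuous fun x => fw K (b x) (v x) (ψ x) := fun ψ hp => ci_cont hb hv (ang_cont hK hb hv hp fun x => (h x).bv)
  have cm : ∀ ψ : X → ℝ, Continuous ψ → Continuous fun x => fm K (b x) (v x) (ψ x) := fun ψ hp => ci_cont hb hv ((ang_cont hK hb hv hp fun x => (h x).bv).add continuous_const)
  have cs : ∀ ψ : X → ℝ, Continuous ψ → Continuous fun x => sl K (u x) (fm K (b x) (v x) (ψ x)) := fun ψ hp => sl_cont hK hu (cm ψ hp) fun x => (h x).ci _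
  have cn : ∀ ψ : X → ℝ, Continuous ψ → Continuous fun x => nn K (u x) (fm K (b x) (v x) (ψ x)) := fun ψ hp => (cm ψ hp).add ((cs ψ hp).smul hu)
  have cz : ∀ ψ : X → ℝ, Continuous ψ → Continuous fun x => zz K (u x) (fm K (b x) (v x) (ψ x)) := fun ψ hp => hu.sub ((cs ψ hp).smul (cm ψ hp))
  have n0 : ∀ x ψ, nn K (u x) (fm K (b x) (v x) ψ) ≠ 0 := fun x ψ => ((h x).ci _).add_ne _
  have ww : ∀ x ψ, fw K (b x) (v x) ψ ⬝ᵥ fw K (b x) (v x) ψ = 1 := fun x ψ => by unfold fw; rw [ci_dot (h x).bv]; simp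
  have pu : ∀ x w ψ, pr w (zz K (u x) (fm K (b x) (v x) ψ)) (u x) ≠ 0 := fun x w ψ h0 => by
    have := congrFun h0 1
    have : u x ⬝ᵥ (zz K (u x) (fm K (b x) (v x) ψ)) = 0 := this
    rw [u_dot_z hK ((h x).fm K _)] at this; norm_num at this
  refine ⟨SI_contOn hK (cn _ hp) (cn _ hp') (fun x => n0 _ _) fun x => n0 _ _, ?_, ?_⟩
  · refine JJ_cont hK (cw _ hp) (cz _ hp) hu (cn _ hp') (fun x => ww _ _) (fun x => w_dot_z hK (h x) _) (fun x => z_dot_z hK ((h x).ci _)) (fun x => pu _ _ _) fun x h0 => ?_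
    have := congrFun h0 0
    have : nn K (u x) (fm K (b x) (v x) (ψ x + 1)) ⬝ᵥ fw K (b x) (v x) (ψ x) = 0 := this
    have hs := sin_pos_ang hK (h x).bv (ψ x)
    unfold fm fw at this
    rw [nn_dot_w hK (h x), add_sub_right_comm, Real.cos_add_pi_div_two] at this
    linarith
  · refine JJ_cont hK (cw _ hp') (cz _ hp') hu (cn _ hp) (fun x => ww _ _) (fun x => w_dot_z hK (h x) _) (fun x => z_dot_z hK ((h x).ci _)) (fun x => pu _ _ _) fun x h0 => ?_
    have := congrFun h0 0
    have : nn K (u x) (fm K (b x) (v x) (ψ x)) ⬝ᵥ fw K (b x) (v x) (ψ x + 1) = 0 := this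
    have hs := sin_pos_ang hK (h x).bv (ψ x)
    unfold fm fw at this
    rw [nn_dot_w hK (h x), add_sub_right_comm, Real.cos_add_pi_div_two, ← Real.sin_neg, neg_sub] at this
    linarith
end

end Mah

namespace Mah
open Topology

theorem exists_zero {K : Set V3} (hK : Body K) : ∃ u b v ψ, On3 u b v ∧ F1 K u b v ψ = 0 ∧ F2 K u b v ψ = 0 ∧ F3 K u b v ψ = 0 := by
  let e1 : V3 := ![1,0,0]
  let e2 : V3 := ![0,1,0]
  let e3 : V3 := ![0,0,1]
  have o12 : On2 e1 e2 := by refine ⟨?_, ?_, ?_⟩ <;> rw [dot3] <;> simp [e1, e2]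
  have o31 : On2 e3 e1 := by refine ⟨?_, ?_, ?_⟩ <;> rw [dot3] <;> simp [e1, e3]
  have o32 : On2 e3 e2 := by refine ⟨?_, ?_, ?_⟩ <;> rw [dot3] <;> simp [e2, e3]
  have o3 : On3 e3 e1 e2 := ⟨o12, o31, o32⟩
  let bt : ℝ → V3 := fun t => ci e1 e2 (ang K e1 e2 t)
  let V : ℝ → V3 := fun t => ci e1 e2 (ang K e1 e2 t + Real.pi / 2)
  let U : ℝ → ℝ → V3 := fun t β => ci e3 (bt t) (β * (Real.pi / 2))
  let B : ℝ → ℝ → V3 := fun t β => ci e3 (bt t) (β * (Real.pi / 2) + Real.pi / 2)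
  have ob : ∀ t, On2 e3 (bt t) := fun t => o3.ci _
  have ov : ∀ t, On2 e3 (V t) := fun t => o3.ci _
  have obv : ∀ t, On2 (bt t) (V t) := fun t => on2_rot hK o12 _
  have o3t : ∀ t, On3 (V t) e3 (bt t) := fun t => ⟨ob t, (ov t).swap, (obv t).swap⟩
  have hO : ∀ t β, On3 (U t β) (B t β) (V t) := fun t β => ⟨((o3t t).ci _).swap, on2_rot hK (ob t) _, ((o3t t).ci _).swap⟩
  have cbt : Continuous bt := ci_cont continuous_const continuous_const (ang_cont hK continuous_const continuous_const continuous_id fun _ => o12)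
  have cV : Continuous V := ci_cont continuous_const continuous_const ((ang_cont hK continuous_const continuous_const continuous_id fun _ => o12).add continuous_const)
  have cU : Continuous fun p : ℝ × ℝ × ℝ => U p.1 p.2.1 := ci_cont continuous_const (cbt.comp continuous_fst) (by fun_prop)
  have cB : Continuous fun p : ℝ × ℝ × ℝ => B p.1 p.2.1 := ci_cont continuous_const (cbt.comp continuous_fst) (by fun_prop)
  obtain ⟨c1, c2, c3⟩ := F_cont hK cU cB (cV.comp continuous_fst) (continuous_snd.snd : Continuous fun p : ℝ × ℝ × ℝ => p.2.2) fun p => hO p.1 p.2.1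
  have b2 : ∀ t, bt (t + 2) = - bt t := fun t => by simp only [bt]; rw [ang_two hK o12, ci_pi]
  have V2 : ∀ t, V (t + 2) = - V t := fun t => by simp only [V]; rw [ang_two hK o12, add_right_comm, ci_pi]
  have b4 : ∀ t, bt (t + 4) = bt t := fun t => by rw [show t + 4 = t + 2 + 2 by ring, b2, b2, neg_neg]
  have V4 : ∀ t, V (t + 4) = V t := fun t => by rw [show t + 4 = t + 2 + 2 by ring, V2, V2, neg_neg]
  have U4 : ∀ t β, U (t + 4) β = U t β := fun t β => by simp only [U, b4]
  have B4 : ∀ t β, B (t + 4) β = B t β := fun t β => by simp only [B, b4]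
  have U0 : ∀ t, U t 0 = e3 := fun t => by simp [U, ci]
  have B0 : ∀ t, B t 0 = bt t := fun t => by simp [B, ci]
  have U1 : ∀ t, U t 1 = bt t := fun t => by simp [U, ci]
  have B1 : ∀ t, B t 1 = - e3 := fun t => by simp [B, ci]
  have an : ∀ t ψ, ang K (bt t) (V t) ψ + ang K e1 e2 t = ang K e1 e2 (t + ψ) := fun t ψ => ang_rot hK o12 t ψ
  have w0 : ∀ t ψ, fw K (bt t) (V t) ψ = fw K e1 e2 (t + ψ) := fun t ψ => by
    rw [fw, fw, ← an t ψ]; simp only [bt, V]; rw [ci_rot hK, add_comm]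
  have m0 : ∀ t ψ, fm K (bt t) (V t) ψ = fm K e1 e2 (t + ψ) := fun t ψ => by
    rw [fm, fm, ← an t ψ]; simp only [bt, V]; rw [ci_rot hK]; ring_nf
  obtain ⟨t, β, ψ, h1, h2⟩ := top_lemma (fun t β ψ => F1 K (U t β) (B t β) (V t) ψ)
    (fun t β ψ => (F2 K (U t β) (B t β) (V t) ψ : ℂ) + Complex.I * (F3 K (U t β) (B t β) (V t) ψ : ℂ)) c1
    ((Complex.continuous_ofReal.comp c2).add (continuous_const.mul (Complex.continuous_ofReal.comp c3)))
    (fun t β ψ => by simp only [U4, B4, V4]) (fun t β ψ => by simp only [U4, B4, V4])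
    (fun t β => F1_one hK (hO t β))
    (fun t β => by
      simp only [F2_one hK (hO t β), F3_one hK (hO t β)]
      push_cast
      linear_combination (-(F3 K (U t β) (B t β) (V t) 0 : ℂ)) * Complex.I_mul_I)
    (fun t ψ => by simp only [U0, B0, F1, m0, zero_add, add_assoc])
    (fun t ψ => by simp only [U0, B0, F2, F3, m0, w0, zero_add, add_assoc])
    (fun t ψ => by
      simp only [U1, B1, b2, V2]
      have := (F_refl hK (hO t 1) ψ).1
      rwa [U1, B1] at this)
    (fun t ψ => by
      simp only [U1, B1, b2, V2]
      have h := (F_refl hK (hO t 1) ψ).2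
      rw [U1, B1] at h
      rw [h.1, h.2]
      simp only [map_add, map_mul, Complex.conj_I, Complex.conj_ofReal]
      push_cast
      linear_combination (-(F3 K (bt t) (-e3) (V t) ψ : ℂ)) * Complex.I_mul_I)
  refine ⟨U t β, B t β, V t, ψ, hO t β, h1, ?_, ?_⟩
  · have := congrArg Complex.re h2; simpa using this
  · have := congrArg Complex.im h2; simpa using this

end Mah

namespace Mah
open Topology

section

noncomputable def sg (a c φ : ℝ) : ℝ := Real.sign (Real.sin (φ - a)) * Real.sign (Real.sin (φ - c))

theorem sg_meas {K : Set V3} (hK : Body K) (a c : ℝ) : Measurable (sg a c) :=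
  (meas_sign.comp (by fun_prop : Continuous fun φ : ℝ => Real.sin (φ - a)).measurable).mul (meas_sign.comp (by fun_prop : Continuous fun φ : ℝ => Real.sin (φ - c)).measurable)

theorem circ_zero {K : Set V3} (hK : Body K) {b v : V3} (h : On2 b v) (ψ : ℝ) :
    ∫ φ in (-Real.pi)..Real.pi, rh K b v φ * sg (ang K b v ψ) (ang K b v (ψ+1)) φ = 0 := by
  set a := ang K b v ψ
  set c := ang K b v (ψ + 1)
  have hac : a < c := ang_mono hK h (lt_add_one ψ)
  have hca : c < a + Real.pi := by
    have h2 := ang_mono hK h (show ψ + 1 < ψ + 2 by linarith)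
    rwa [ang_two hK h] at h2
  have ii : ∀ x y, IntervalIntegrable (fun φ => rh K b v φ * sg a c φ) volume x y := fun x y => by
    refine (rh_int hK h x y).mono_fun ?_ ?_
    · exact ((rh_cont1 hK h).measurable.mul (sg_meas hK a c)).aestronglyMeasurable
    · refine Filter.Eventually.of_forall fun φ => ?_
      simp only [norm_mul, Real.norm_eq_abs]
      exact mul_le_of_le_one_right (abs_nonneg _) (abs_ss_le _ _)
  have per : Function.Periodic (fun φ => rh K b v φ * sg a c φ) Real.pi := fun φ => by
    have := rh_per hK b v φ
    simp only [this, sg]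
    rw [show φ + Real.pi - a = φ - a + Real.pi by ring, show φ + Real.pi - c = φ - c + Real.pi by ring, Real.sin_add_pi, Real.sin_add_pi, Real.sign_neg, Real.sign_neg]; ring
  have p1 : ∫ φ in (-Real.pi)..0, rh K b v φ * sg a c φ = ∫ φ in a..(a + Real.pi), rh K b v φ * sg a c φ := by
    have := per.intervalIntegral_add_eq (-Real.pi) a
    rwa [neg_add_cancel] at this
  have p2 : ∫ φ in 0..Real.pi, rh K b v φ * sg a c φ = ∫ φ in a..(a + Real.pi), rh K b v φ * sg a c φ := by
    have := per.intervalIntegral_add_eq 0 a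
    rwa [zero_add] at this
  have q1 : ∫ φ in a..c, rh K b v φ * sg a c φ = ∫ φ in a..c, - rh K b v φ := by
    refine intervalIntegral.integral_congr_ae ?_
    have : ∀ᵐ φ : ℝ, φ ≠ c := Measure.ae_ne volume c
    filter_upwards [this] with φ hφ hm
    rw [Set.uIoc_of_le hac.le] at hm
    have : φ < c := lt_of_le_of_ne hm.2 hφ
    have s1 : 0 < Real.sin (φ - a) := Real.sin_pos_of_pos_of_lt_pi (by linarith [hm.1]) (by linarith)
    have s2 : Real.sin (φ - c) < 0 := Real.sin_neg_of_neg_of_neg_pi_lt (by linarith) (by linarith [hm.1])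
    rw [sg, Real.sign_of_pos s1, Real.sign_of_neg s2]; ring
  have q2 : ∫ φ in c..(a + Real.pi), rh K b v φ * sg a c φ = ∫ φ in c..(a + Real.pi), rh K b v φ := by
    refine intervalIntegral.integral_congr_ae ?_
    have : ∀ᵐ φ : ℝ, φ ≠ a + Real.pi := Measure.ae_ne volume _
    filter_upwards [this] with φ hφ hm
    rw [Set.uIoc_of_le hca.le] at hm
    have : φ < a + Real.pi := lt_of_le_of_ne hm.2 hφ
    have s1 : 0 < Real.sin (φ - a) := Real.sin_pos_of_pos_of_lt_pi (by linarith [hm.1]) (by linarith)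
    have s2 : 0 < Real.sin (φ - c) := Real.sin_pos_of_pos_of_lt_pi (by linarith [hm.1]) (by linarith)
    rw [sg, Real.sign_of_pos s1, Real.sign_of_pos s2]; ring
  rw [← intervalIntegral.integral_add_adjacent_intervals (ii _ 0) (ii _ _), p1, p2,
    ← intervalIntegral.integral_add_adjacent_intervals (ii a c) (ii _ _), q1, q2, intervalIntegral.integral_neg]
  have d : ∀ x y, ∫ φ in x..y, rh K b v φ = Th K b v y - Th K b v x := fun x y => by
    have := intervalIntegral.integral_add_adjacent_intervals (rh_int hK h 0 x) (rh_int hK h x y)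
    unfold Th; linarith
  rw [d, d, Th_shift hK h, ang_spec hK h, ang_spec hK h]; ring

theorem gauge_ci {K : Set V3} (hK : Body K) {b v : V3} (r : ℝ) (hr : 0 < r) (φ : ℝ) : ![r * Real.cos φ, r * Real.sin φ] ∈ pl K b v ↔ r * gauge K (ci b v φ) ≤ 1 := by
  rw [← Body.gauge_smul' hr.le, hK.gauge_le_one]
  simp only [pl, Set.mem_setOf_eq, ci, smul_add, smul_smul]; rfl

theorem polar_J {K : Set V3} (hK : Body K) {b v : V3} (h : On2 b v) (α β : ℝ) : JJ K b v (ci b v (α + Real.pi / 2)) (ci b v (β + Real.pi / 2)) =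
    ∫ φ in (-Real.pi)..Real.pi, (1/2) * (rh K b v φ * sg α β φ) := by
  have B := pl_body hK h.1 h.2.2 h.2.1.ge
  set f : (Fin 2 → ℝ) → ℝ := (pl K b v).indicator fun y => Real.sign (pr b v (ci b v (α + Real.pi / 2)) ⬝ᵥ y) * Real.sign (pr b v (ci b v (β + Real.pi / 2)) ⬝ᵥ y) with hf
  have fm : Measurable f := ((meas_sdot _).mul (meas_sdot _)).indicator B.meas
  have e0 : JJ K b v (ci b v (α + Real.pi / 2)) (ci b v (β + Real.pi / 2)) = ∫ y, f y := (integral_indicator B.meas).symm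
  have e1 : ∫ y, f y = ∫ p : ℝ × ℝ, f ![p.1, p.2] := by
    have := (volume_preserving_finTwoArrow ℝ).symm.integral_comp (MeasurableEquiv.measurableEmbedding _) f
    rw [← this]; rfl
  have e2 := integral_comp_polarCoord_symm (fun p : ℝ × ℝ => f ![p.1, p.2])
  have key : ∀ p : ℝ × ℝ, p ∈ polarCoord.target → f ![(polarCoord.symm p).1, (polarCoord.symm p).2] = if p.1 * gauge K (ci b v p.2) ≤ 1 then sg α β p.2 else 0 := by
    rintro ⟨r, φ⟩ hp
    have hr : 0 < r := hp.1
    simp only [polarCoord_symm_apply]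
    have hs : ∀ α, Real.sign (pr b v (ci b v (α + Real.pi / 2)) ⬝ᵥ ![r * Real.cos φ, r * Real.sin φ]) = Real.sign (Real.sin (φ - α)) := fun α => by
      rw [pr_dot]
      have : (![r * Real.cos φ, r * Real.sin φ] 0 • b + ![r * Real.cos φ, r * Real.sin φ] 1 • v) = r • ci b v φ := by
        simp [ci, smul_smul]
      rw [this, dotProduct_smul, smul_eq_mul, sign_pos_mul hr, ci_dot h, add_sub_right_comm, Real.cos_add_pi_div_two, ← Real.sin_neg, neg_sub]
    by_cases hm : r * gauge K (ci b v φ) ≤ 1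
    · rw [if_pos hm, hf, Set.indicator_of_mem ((gauge_ci hK r hr φ).2 hm), hs, hs]; rfl
    · rw [if_neg hm, hf, Set.indicator_of_notMem (fun hh => hm ((gauge_ci hK r hr φ).1 hh))]
  rw [e0, e1, ← e2]
  rw [setIntegral_congr_fun polarCoord.open_target.measurableSet (g := fun p : ℝ × ℝ => p.1 * if p.1 * gauge K (ci b v p.2) ≤ 1 then sg α β p.2 else 0) (fun p hp => by
    simp only [smul_eq_mul]; rw [key p hp])]
  have cg : Continuous fun φ => gauge K (ci b v φ) := hK.cont_gauge.comp (ci_cont continuous_const continuous_const continuous_id)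
  obtain ⟨R, hR, hb⟩ := hK.bdd
  have gp : ∀ φ, 0 < gauge K (ci b v φ) := fun φ => hK.gauge_pos.2 (ci_ne h φ)
  have hinv : ∀ r φ, 0 < r → r * gauge K (ci b v φ) ≤ 1 → r ≤ 2 * R := fun r φ hr hm => by
    have h1 : ![r * Real.cos φ, r * Real.sin φ] ∈ pl K b v := (gauge_ci hK r hr φ).2 hm
    rw [← Body.gauge_smul' hr.le, hK.gauge_le_one] at hm
    have h2 := dot_le_norm (r • ci b v φ) (r • ci b v φ)
    rw [dotProduct_smul, smul_dotProduct, ci_dot h] at h2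
    simp at h2
    have h3 := hb _ hm
    have h4 := mul_self_le_mul_self (norm_nonneg _) h3
    have h5 : r * r ≤ (2 * R) * (2 * R) := by nlinarith
    exact abs_le_of_sq_le_sq' (by nlinarith) (by positivity) |>.2
  have mt : MeasurableSet {p : ℝ × ℝ | p.1 * gauge K (ci b v p.2) ≤ 1} :=
    (isClosed_le (continuous_fst.mul (cg.comp continuous_snd)) continuous_const).measurableSet
  have hm : Measurable fun p : ℝ × ℝ => p.1 * if p.1 * gauge K (ci b v p.2) ≤ 1 then sg α β p.2 else 0 :=
    measurable_fst.mul (Measurable.ite mt ((sg_meas hK α β).comp measurable_snd) measurable_const)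
  have hintr : IntegrableOn (fun p : ℝ × ℝ => p.1 * if p.1 * gauge K (ci b v p.2) ≤ 1 then sg α β p.2 else 0) (Set.Ioi (0:ℝ) ×ˢ Set.Ioo (-Real.pi) Real.pi) := by
    have g0 : IntegrableOn (fun p : ℝ × ℝ => p.1 * if p.1 * gauge K (ci b v p.2) ≤ 1 then sg α β p.2 else 0) (Set.Ioc (0:ℝ) (2 * R) ×ˢ Set.Ioo (-Real.pi) Real.pi) := by
      refine Measure.integrableOn_of_bounded (M := 2 * R) ?_ hm.aestronglyMeasurable ?_
      · refine ((Metric.isBounded_Ioc _ _).prod (Metric.isBounded_Ioo _ _)).measure_lt_top.ne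
      · refine (ae_restrict_iff' (measurableSet_Ioc.prod measurableSet_Ioo)).2 (Filter.Eventually.of_forall fun p hp => ?_)
        rw [norm_mul, Real.norm_eq_abs, Real.norm_eq_abs, abs_of_pos hp.1.1]
        have : |if p.1 * gauge K (ci b v p.2) ≤ 1 then sg α β p.2 else 0| ≤ 1 := by
          split_ifs
          · exact abs_ss_le _ _
          · simp
        nlinarith [hp.1.2, hp.1.1]
    refine g0.of_forall_diff_eq_zero (measurableSet_Ioi.prod measurableSet_Ioo) ?_
    rintro ⟨r, φ⟩ ⟨⟨h1, h2⟩, h3⟩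
    have h1 : 0 < r := h1
    simp only
    rw [if_neg, mul_zero]
    intro h4
    exact h3 ⟨⟨h1, hinv r φ h1 h4⟩, h2⟩
  show ∫ p in Set.Ioi (0:ℝ) ×ˢ Set.Ioo (-Real.pi) Real.pi, _ = _
  rw [intervalIntegral.integral_of_le (by linarith [Real.pi_pos]), integral_Ioc_eq_integral_Ioo]
  rw [Measure.volume_eq_prod, ← setIntegral_prod_swap, setIntegral_prod _ (by
    have := hintr
    rw [Measure.volume_eq_prod] at this
    exact this.swap)]
  refine setIntegral_congr_fun measurableSet_Ioo fun φ _ => ?_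
  simp only [Prod.swap, rh]
  have i1 : ∫ r in Set.Ioi (0:ℝ), r * (if r * gauge K (ci b v φ) ≤ 1 then sg α β φ else 0) = ∫ r in Set.Ioc (0:ℝ) (gauge K (ci b v φ))⁻¹, r * sg α β φ := by
    rw [← integral_indicator measurableSet_Ioi, ← integral_indicator measurableSet_Ioc]
    congr 1; ext r
    by_cases hr : 0 < r
    · rw [Set.indicator_of_mem (show r ∈ Set.Ioi (0:ℝ) from hr)]
      by_cases hm : r * gauge K (ci b v φ) ≤ 1
      · rw [if_pos hm, Set.indicator_of_mem]
        exact ⟨hr, by rw [← one_div, le_div_iff₀ (gp φ)]; exact hm⟩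
      · rw [if_neg hm, Set.indicator_of_notMem, mul_zero]
        rintro ⟨_, h2⟩
        rw [← one_div, le_div_iff₀ (gp φ)] at h2; exact hm h2
    · rw [Set.indicator_of_notMem (show r ∉ Set.Ioi (0:ℝ) from hr), Set.indicator_of_notMem]
      exact fun hh => hr hh.1
  rw [i1, ← intervalIntegral.integral_of_le (by have := gp φ; positivity), intervalIntegral.integral_mul_const, integral_id]
  rw [inv_pow]; ring

theorem sec0_zero {K : Set V3} (hK : Body K) {b v : V3} (h : On2 b v) (ψ : ℝ) : JJ K b v (fm K b v ψ) (fm K b v (ψ+1)) = 0 := by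
  unfold fm
  rw [polar_J hK h, intervalIntegral.integral_const_mul, circ_zero hK h, mul_zero]

end
end Mah

namespace Mah
open Topology

theorem On3.zero {u b v x : V3} (h : On3 u b v) (h1 : u ⬝ᵥ x = 0) (h2 : b ⬝ᵥ x = 0) (h3 : v ⬝ᵥ x = 0) : x = 0 := by
  let M : Matrix (Fin 3) (Fin 3) ℝ := Matrix.of ![u, b, v]
  have e1 : M * M.transpose = 1 := by
    ext i j
    have : (M * M.transpose) i j = M i ⬝ᵥ M j := rfl
    rw [this]
    have := h.ub.1; have := h.ub.2.1; have := h.ub.2.2; have := h.uv.2.1; have := h.uv.2.2; have := h.bv.2.2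
    have := h.ub.swap.2.2; have := h.uv.swap.2.2; have := h.bv.swap.2.2
    fin_cases i <;> fin_cases j <;> simp [M] <;> assumption
  have e2 := mul_eq_one_comm.1 e1
  have e3 : M.mulVec x = 0 := by
    ext i; fin_cases i
    · exact h1
    · exact h2
    · exact h3
  have : (M.transpose * M).mulVec x = 0 := by rw [← Matrix.mulVec_mulVec, e3, Matrix.mulVec_zero]
  rwa [e2, Matrix.one_mulVec] at this

theorem sec_eq {K : Set V3} (hK : Body K) (N : V3 ≃ₗ[ℝ] V3) (i : Fin 3) {w z a c : V3} (h1 : w ⬝ᵥ w = 1) (h2 : w ⬝ᵥ z = 0) (h3 : 1 ≤ z ⬝ᵥ z)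
    (hN : ∀ y : Fin 2 → ℝ, N (y 0 • w + y 1 • z) = ins i 0 ![a ⬝ᵥ (y 0 • w + y 1 • z), c ⬝ᵥ (y 0 • w + y 1 • z)]) (hJ : JJ K w z a c = 0) :
    EqOct (sec i (N.symm ⁻¹' K)) := by
  refine eq2 ((hK.comap N.symm).sec_body i) ?_
  let L : (Fin 2 → ℝ) →ₗ[ℝ] (Fin 2 → ℝ) :=
    { toFun := fun y => ![a ⬝ᵥ (y 0 • w + y 1 • z), c ⬝ᵥ (y 0 • w + y 1 • z)]
      map_add' := fun x y => by
        ext i; fin_cases i <;> simp [dotProduct_add, add_smul, dotProduct_smul] <;> ring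
      map_smul' := fun r y => by
        ext i; fin_cases i <;> simp [dotProduct_add, dotProduct_smul] <;> ring }
  have hL : Function.Injective L := by
    rw [← LinearMap.ker_eq_bot, LinearMap.ker_eq_bot']
    intro y hy
    have hy : ![a ⬝ᵥ (y 0 • w + y 1 • z), c ⬝ᵥ (y 0 • w + y 1 • z)] = 0 := hy
    have h0 := hN y
    rw [hy, ins0_zero] at h0
    have h0 : y 0 • w + y 1 • z = 0 := N.map_eq_zero_iff.1 h0
    have q1 : w ⬝ᵥ (y 0 • w + y 1 • z) = y 0 := by simp [dotProduct_add, h1, h2]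
    have q2 : z ⬝ᵥ (y 0 • w + y 1 • z) = y 1 * (z ⬝ᵥ z) := by simp [dotProduct_add, dotProduct_comm z w, h2]
    rw [h0, dotProduct_zero] at q1 q2
    have q3 : y 1 = 0 := by
      rcases mul_eq_zero.1 q2.symm with h | h
      · exact h
      · linarith
    ext i; fin_cases i
    · exact q1.symm
    · exact q3
  let M := LinearEquiv.ofInjectiveEndo L hL
  have hM : ∀ y, M y = ![a ⬝ᵥ (y 0 • w + y 1 • z), c ⬝ᵥ (y 0 • w + y 1 • z)] := fun y => rfl
  have := set_comap M (sec i (N.symm ⁻¹' K)) fun x => Real.sign (x 0) * Real.sign (x 1)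
  have e1 : M ⁻¹' (sec i (N.symm ⁻¹' K)) = pl K w z := by
    ext y
    show N.symm (ins i 0 (M y)) ∈ K ↔ _
    rw [hM, ← hN, N.symm_apply_apply]; rfl
  rw [e1] at this
  simp only [hM] at this
  rw [JJ_eq] at hJ
  have h5 : ∫ x in pl K w z, Real.sign (![a ⬝ᵥ (x 0 • w + x 1 • z), c ⬝ᵥ (x 0 • w + x 1 • z)] 0) * Real.sign (![a ⬝ᵥ (x 0 • w + x 1 • z), c ⬝ᵥ (x 0 • w + x 1 • z)] 1) = 0 := hJ
  rw [h5] at this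
  rcases mul_eq_zero.1 this.symm with h | h
  · exact absurd h (inv_ne_zero (abs_ne_zero.2 (det_ne M)))
  · exact h

theorem exists_equi {K : Set V3} (hK : Body K) : ∃ e : V3 ≃ₗ[ℝ] V3, Equi (e ⁻¹' K) := by
  obtain ⟨u, b, v, ψ, h, z1, z2, z3⟩ := exists_zero hK
  set m2 := fm K b v ψ with hm2
  set m3 := fm K b v (ψ + 1) with hm3
  set n2 := nn K u m2 with hn2
  set n3 := nn K u m3 with hn3
  have o2 : On2 u m2 := h.fm K _
  have o3 : On2 u m3 := h.fm K _
  let L : V3 →ₗ[ℝ] V3 :=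
    { toFun := fun x => ![u ⬝ᵥ x, n2 ⬝ᵥ x, n3 ⬝ᵥ x]
      map_add' := fun x y => by
        ext i; fin_cases i <;> simp [dotProduct_add]
      map_smul' := fun r y => by
        ext i; fin_cases i <;> simp [dotProduct_smul] }
  have hL : Function.Injective L := by
    rw [← LinearMap.ker_eq_bot, LinearMap.ker_eq_bot']
    intro x hx
    have x0 : u ⬝ᵥ x = 0 := congrFun hx 0
    have x1 : n2 ⬝ᵥ x = 0 := congrFun hx 1
    have x2 : n3 ⬝ᵥ x = 0 := congrFun hx 2
    rw [hn2, nn, add_dotProduct, smul_dotProduct, x0, smul_zero, add_zero, hm2, fm, ci, add_dotProduct, smul_dotProduct, smul_dotProduct,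
      Real.cos_add_pi_div_two, Real.sin_add_pi_div_two, smul_eq_mul, smul_eq_mul] at x1
    rw [hn3, nn, add_dotProduct, smul_dotProduct, x0, smul_zero, add_zero, hm3, fm, ci, add_dotProduct, smul_dotProduct, smul_dotProduct,
      Real.cos_add_pi_div_two, Real.sin_add_pi_div_two, smul_eq_mul, smul_eq_mul] at x2
    have hs := sin_pos_ang hK h.bv ψ
    rw [Real.sin_sub] at hs
    have y1 : b ⬝ᵥ x = 0 := by
      refine (mul_eq_zero.1 ?_).resolve_left hs.ne'
      linear_combination (Real.cos (ang K b v (ψ+1))) * x1 - (Real.cos (ang K b v ψ)) * x2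
    have y2 : v ⬝ᵥ x = 0 := by
      refine (mul_eq_zero.1 ?_).resolve_left hs.ne'
      linear_combination (Real.sin (ang K b v (ψ+1))) * x1 - (Real.sin (ang K b v ψ)) * x2
    exact h.zero x0 y1 y2
  let N := LinearEquiv.ofInjectiveEndo L hL
  have hN : ∀ x, N x = ![u ⬝ᵥ x, n2 ⬝ᵥ x, n3 ⬝ᵥ x] := fun x => rfl
  have hB := hK.comap N.symm
  have tr : ∀ i j, ∫ x in K, Real.sign ((N x) i) * Real.sign ((N x) j) = 0 → ∫ x in N.symm ⁻¹' K, Real.sign (x i) * Real.sign (x j) = 0 := fun i j h0 => by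
    have := set_comap N (N.symm ⁻¹' K) fun x => Real.sign (x i) * Real.sign (x j)
    have e1 : N ⁻¹' (N.symm ⁻¹' K) = K := by ext x; simp
    rw [e1, h0] at this
    rcases mul_eq_zero.1 this.symm with h | h
    · exact absurd h (inv_ne_zero (abs_ne_zero.2 (det_ne N)))
    · exact h
  have mm : ∀ ψ, fw K b v ψ ⬝ᵥ fw K b v ψ = 1 := fun ψ => by unfold fw; rw [ci_dot h.bv]; simp
  have nw : ∀ ψ, nn K u (fm K b v ψ) ⬝ᵥ fw K b v ψ = 0 := fun ψ => by
    unfold fm fw; rw [nn_dot_w hK h]; simp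
  refine ⟨N.symm, hB, eq3 hB (tr 0 1 (sl_spec hK o2)) (tr 0 2 (sl_spec hK o3)) (tr 1 2 z1), fun i => ?_⟩
  fin_cases i
  · refine sec_eq hK N 0 (w := b) (z := v) (a := n2) (c := n3) h.bv.1 h.bv.2.2 h.bv.2.1.ge (fun y => ?_) ?_
    · rw [hN, ins_e0]
      have : u ⬝ᵥ (y 0 • b + y 1 • v) = 0 := by simp [dotProduct_add, h.ub.2.2, h.uv.2.2]
      rw [this]
    · have e : ∀ m, pr b v (nn K u m) = pr b v m := fun m => by
        ext i; fin_cases i <;> simp [pr, nn, add_dotProduct, h.ub.2.2, h.uv.2.2]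
      have := sec0_zero hK h.bv ψ
      unfold JJ at this ⊢
      rw [hn2, hn3, e, e]; exact this
  · refine sec_eq hK N 1 (w := fw K b v ψ) (z := zz K u m2) (a := u) (c := n3) (mm _) (w_dot_z hK h _) (z_dot_z hK o2) (fun y => ?_) z2
    rw [hN, ins_e1]
    have : n2 ⬝ᵥ (y 0 • fw K b v ψ + y 1 • zz K u m2) = 0 := by
      rw [dotProduct_add, dotProduct_smul, dotProduct_smul, nw, nn_dot_z hK o2]; simp
    rw [this]
  · refine sec_eq hK N 2 (w := fw K b v (ψ+1)) (z := zz K u m3) (a := u) (c := n2) (mm _) (w_dot_z hK h _) (z_dot_z hK o3) (fun y => ?_) z3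
    rw [hN, ins_e2]
    have : n3 ⬝ᵥ (y 0 • fw K b v (ψ+1) + y 1 • zz K u m3) = 0 := by
      rw [dotProduct_add, dotProduct_smul, dotProduct_smul, nw, nn_dot_z hK o3]; simp
    rw [this]

theorem mahler_eq {K : Set V3} (hK : Body K) (hv : vp K ≤ 32/3) : Good K := by
  obtain ⟨e, he⟩ := exists_equi hK
  exact good_comap e (classify he (by rw [vp_comap]; exact hv))

end Mah

namespace Mah
open Topology

def sgb (b : Fin 3 → Bool) : V3 := fun i => if b i then 1 else -1

theorem sgb_sign (b : Fin 3 → Bool) : IsSign (sgb b) := fun i => by unfold sgb; split_ifs <;> simp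

def T0 : Set V3 := {x | (∀ i, 0 < x i) ∧ x 0 + x 1 + x 2 ≤ 1}

theorem T0_meas : MeasurableSet T0 := by
  have : T0 = oct 1 ∩ {x : V3 | x 0 + x 1 + x 2 ≤ 1} := by
    ext x; simp [T0, oct]
  rw [this]
  exact (oct_open _).measurableSet.inter (measurableSet_le (by fun_prop) measurable_const)

theorem T0_fin : volume T0 ≠ ⊤ := by
  refine ((measure_mono ?_).trans_lt (isCompact_Icc (a := (0 : V3)) (b := 1)).measure_lt_top).ne
  rintro x ⟨h, h'⟩
  have h0 := h 0; have h1 := h 1; have h2 := h 2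
  refine ⟨fun i => (h i).le, fun i => ?_⟩
  fin_cases i <;> simp <;> linarith

def Oc : Set V3 := {x | |x 0| + |x 1| + |x 2| ≤ 1}

theorem vol_Oc : vol Oc = 4/3 := by
  have h := MeasureTheory.volume_sum_rpow_le (ι := Fin 3) (p := 1) le_rfl 1
  have e : Oc = {x : Fin 3 → ℝ | (∑ i, |x i| ^ (1:ℝ)) ^ (1 / (1:ℝ)) ≤ 1} := by
    ext x; simp [Oc, Fin.sum_univ_three]
  unfold vol
  rw [e, h]
  simp
  have h2 : Real.Gamma (1+1) = 1 := by
    have := Real.Gamma_nat_eq_factorial 1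
    simpa using this
  have h3 : Real.Gamma (3+1) = 6 := by
    have := Real.Gamma_nat_eq_factorial 3
    norm_num [Nat.factorial] at this ⊢; try exact this
  rw [h2, h3]; rw [ENNReal.toReal_ofReal (by norm_num)]; norm_num

theorem dg_sign_vol {ε : V3} (hε : IsSign ε) (hd) (S : Set V3) : vol (dg ε hd ⁻¹' S) = vol S := by
  rw [vol_comap]
  have : LinearMap.det (dg ε hd : V3 →ₗ[ℝ] V3) = ε 0 * ε 1 * ε 2 := by
    have : (dg ε hd : V3 →ₗ[ℝ] V3) = Matrix.toLin' (Matrix.diagonal ε) := by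
      ext i j; simp [Matrix.diagonal_apply, Pi.single_apply, LinearMap.comp_apply]; split_ifs with h <;> simp [h]
    rw [this, LinearMap.det_toLin', Matrix.det_diagonal, Fin.prod_univ_three]
  rw [this]
  have : |ε 0 * ε 1 * ε 2| = 1 := by
    rcases hε 0 with h | h <;> rcases hε 1 with h' | h' <;> rcases hε 2 with h'' | h'' <;> simp [h, h', h'']
  rw [this]; simp

theorem IsSign.ne {ε : V3} (hε : IsSign ε) : ∀ i, ε i ≠ 0 := fun i => by
  rcases hε i with h | h <;> rw [h] <;> norm_num

theorem vol_T0 : 1/6 ≤ vol T0 := by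
  have hN : ∀ i : Fin 3, volume {x : V3 | x i = 0} = 0 := by
    intro i
    have := null_hyper (a := (Pi.single i 1 : V3)) (by simp)
    simpa using this
  have hsub : Oc ⊆ (⋃ i : Fin 3, {x : V3 | x i = 0}) ∪ ⋃ b : Fin 3 → Bool, dg (sgb b) (sgb_sign b).ne ⁻¹' T0 := by
    intro x hx
    by_cases h : ∃ i, x i = 0
    · left; simpa using h
    · right
      push Not at h
      rw [Set.mem_iUnion]
      refine ⟨fun i => decide (0 < x i), ?_⟩
      have e : ∀ i, dg (sgb fun i => decide (0 < x i)) (sgb_sign _).ne x i = |x i| := by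
        intro i
        rw [dg_apply, sgb]
        by_cases h' : 0 < x i
        · simp [h', abs_of_pos]
        · simp [h', abs_of_nonpos (not_lt.1 h')]
      refine ⟨fun i => ?_, ?_⟩
      · rw [e]; exact abs_pos.2 (h i)
      · rw [e, e, e]; exact hx
  have h1 := measure_mono (μ := volume) hsub
  have h2 : volume (⋃ i : Fin 3, {x : V3 | x i = 0}) = 0 := measure_iUnion_null hN
  have hv : ∀ b, volume (dg (sgb b) (sgb_sign b).ne ⁻¹' T0) = volume T0 := by
    intro b
    have := dg_sign_vol (sgb_sign b) (sgb_sign b).ne T0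
    unfold vol at this
    refine (ENNReal.toReal_eq_toReal_iff' ?_ T0_fin).1 this
    have hh := Measure.addHaar_preimage_linearMap (volume : Measure V3) (det_ne (dg (sgb b) (sgb_sign b).ne)) T0
    have h2 : (dg (sgb b) (sgb_sign b).ne ⁻¹' T0) = (⇑(dg (sgb b) (sgb_sign b).ne : V3 →ₗ[ℝ] V3) ⁻¹' T0) := rfl
    rw [h2, hh]; exact ENNReal.mul_ne_top (by simp) T0_fin
  have h3 : volume Oc ≤ 8 * volume T0 := by
    calc _ ≤ _ := h1
      _ ≤ _ := measure_union_le _ _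
      _ ≤ 0 + ∑ b : Fin 3 → Bool, volume (dg (sgb b) (sgb_sign b).ne ⁻¹' T0) := by
          rw [h2]; gcongr; exact measure_iUnion_fintype_le _ _
      _ = _ := by simp [hv]
  have h4 := ENNReal.toReal_mono (ENNReal.mul_ne_top (by simp) T0_fin) h3
  have h5 := vol_Oc
  unfold vol at *
  rw [h5, ENNReal.toReal_mul] at h4
  simp at h4; linarith

/-- near-vertex directions -/
noncomputable def uu (ε : V3) (i : Fin 3) : V3 := fun j => ε j * (if j = i then 24/25 else 1/50)

theorem simplex_map {ε t : V3} (hε : IsSign ε) (ht : ∀ i, 1 ≤ t i) :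
    ∃ m : V3 ≃ₗ[ℝ] V3, (∀ x, m x = ∑ i, x i • t i • uu ε i) ∧ vol (m.symm ⁻¹' T0) = (47/50)^2 * (t 0 * t 1 * t 2) * vol T0 := by
  have t0 := ht 0; have t1 := ht 1; have t2 := ht 2
  have hT : 0 < t 0 * t 1 * t 2 := by positivity
  let M : Matrix (Fin 3) (Fin 3) ℝ := fun j i => t i * uu ε i j
  have hd : M.det = (ε 0 * ε 1 * ε 2) * ((47/50)^2 * (t 0 * t 1 * t 2)) := by
    rw [Matrix.det_fin_three]; simp [M, uu]; ring
  have he : |ε 0 * ε 1 * ε 2| = 1 := by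
    rcases hε 0 with h | h <;> rcases hε 1 with h' | h' <;> rcases hε 2 with h'' | h'' <;> simp [h, h', h'']
  have ha : |M.det| = (47/50)^2 * (t 0 * t 1 * t 2) := by
    rw [hd, abs_mul, he, one_mul, abs_of_pos (by positivity)]
  have h0 : M.det ≠ 0 := by
    intro h; rw [h, abs_zero] at ha; have : (0:ℝ) < (47/50)^2 * (t 0 * t 1 * t 2) := by positivity
    linarith
  haveI : Invertible M := M.invertibleOfIsUnitDet (isUnit_iff_ne_zero.2 h0)
  let m := Matrix.toLinearEquiv' M this
  have hm : (m : V3 →ₗ[ℝ] V3) = Matrix.toLin' M := rfl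
  refine ⟨m, fun x => ?_, ?_⟩
  · have : m x = M.mulVec x := rfl
    rw [this]; ext j
    simp [Matrix.mulVec, dotProduct, M, Fin.sum_univ_three]; ring
  · rw [vol_comap]
    have h2 : LinearMap.det (m.symm : V3 →ₗ[ℝ] V3) * LinearMap.det (m : V3 →ₗ[ℝ] V3) = 1 := by
      rw [← LinearMap.det_comp]; simp
    have h3 : LinearMap.det (m : V3 →ₗ[ℝ] V3) = M.det := by rw [hm, LinearMap.det_toLin']
    rw [h3] at h2
    have : LinearMap.det (m.symm : V3 →ₗ[ℝ] V3) = (M.det)⁻¹ := eq_inv_of_mul_eq_one_left h2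
    rw [this, abs_inv, inv_inv, ha]

theorem oct_part {L : Set V3} (hL : Body L) {ε t : V3} (hε : IsSign ε) (ht : ∀ i, 1 ≤ t i) (hO : Oc ⊆ L)
    (hu : ∀ i, t i • uu ε i ∈ L) : vol T0 * (1 + (47/50)^2 * (t 0 * t 1 * t 2 - 1)) ≤ vol (L ∩ oct ε) := by
  obtain ⟨m, hm, hv⟩ := simplex_map hε ht
  obtain ⟨n, hn, hw⟩ := simplex_map (t := 1) hε (fun _ => le_rfl)
  set A := m.symm ⁻¹' T0
  set B := n.symm ⁻¹' T0
  set Q := dg ε hε.ne ⁻¹' T0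
  have hQ : vol Q = vol T0 := dg_sign_vol hε _ _
  have ee : ∀ i, ε i * ε i = 1 := fun i => by rcases hε i with h | h <;> simp [h]
  have e0 := ee 0; have e1 := ee 1; have e2 := ee 2
  have t0 := ht 0; have t1 := ht 1; have t2 := ht 2
  have hAm : MeasurableSet A := (cont_e m.symm).measurable T0_meas
  have hBm : MeasurableSet B := (cont_e n.symm).measurable T0_meas
  have hQm : MeasurableSet Q := (cont_e _).measurable T0_meas
  have co : ∀ (s x : V3) (j : Fin 3), ε j * (∑ i, x i • s i • uu ε i) j = ∑ i, x i * s i * (if j = i then 24/25 else 1/50) := by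
    intro s x j
    have := ee j
    simp only [Fin.sum_univ_three, uu, Pi.add_apply, Pi.smul_apply, smul_eq_mul]
    linear_combination (x 0 * s 0 * (if j = 0 then 24/25 else 1/50) + x 1 * s 1 * (if j = 1 then 24/25 else 1/50) + x 2 * s 2 * (if j = 2 then 24/25 else 1/50)) * this
  have hAo : A ⊆ oct ε := by
    intro x hx j
    obtain ⟨hp, _⟩ : m.symm x ∈ T0 := hx
    have q : x = m (m.symm x) := by simp
    rw [q, hm, co]
    refine Finset.sum_pos (fun i _ => ?_) ⟨0, by simp⟩
    have := hp i; have := ht i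
    split_ifs <;> positivity
  have hAL : A ⊆ L := by
    intro x hx
    obtain ⟨hp, hs⟩ : m.symm x ∈ T0 := hx
    have q : x = m (m.symm x) := by simp
    rw [q, hm]
    refine hL.mem_of fun l hl => ?_
    have l0 := hl _ (hu 0); have l1 := hl _ (hu 1); have l2 := hl _ (hu 2)
    rw [Fin.sum_univ_three, add_dotProduct, add_dotProduct, smul_dotProduct (m.symm x 0), smul_dotProduct (m.symm x 1), smul_dotProduct (m.symm x 2)]
    simp only [smul_eq_mul]
    have := hp 0; have := hp 1; have := hp 2
    nlinarith
  have hQs : Q ⊆ L ∩ oct ε := by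
    intro x hx
    obtain ⟨hp, hs⟩ : dg ε hε.ne x ∈ T0 := hx
    refine ⟨hO ?_, fun i => by simpa using hp i⟩
    have : ∀ i, |x i| = ε i * x i := by
      intro i; rw [sign_abs (hε i)]; have := hp i; simp at this; exact this.le
    simp only [Oc, Set.mem_setOf_eq, this]; simpa using hs
  have hBQ : B ⊆ Q := by
    intro x hx
    obtain ⟨hp, hs⟩ : n.symm x ∈ T0 := hx
    have q : x = n (n.symm x) := by simp
    rw [q, hn]
    have p0 := hp 0; have p1 := hp 1; have p2 := hp 2
    refine ⟨fun j => ?_, ?_⟩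
    · rw [dg_apply, co]
      refine Finset.sum_pos (fun i _ => ?_) ⟨0, by simp⟩
      have := hp i
      simp only [Pi.one_apply]
      split_ifs <;> positivity
    · rw [dg_apply, dg_apply, dg_apply, co, co, co]
      simp [Fin.sum_univ_three]; linarith
  have hdis : Disjoint A (Q \ B) := by
    rw [Set.disjoint_left]
    rintro x hx ⟨⟨hq, hq'⟩, hb⟩
    obtain ⟨hp, hs⟩ : m.symm x ∈ T0 := hx
    apply hb
    have p0 := hp 0; have p1 := hp 1; have p2 := hp 2
    set y := m.symm x with hy
    have q : x = m y := by simp [hy]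
    have q2 : x = n (fun i => y i * t i) := by
      rw [q, hm, hn]; simp [smul_smul]
    have q3 : n.symm x = fun i => y i * t i := by rw [q2]; simp
    show n.symm x ∈ T0
    rw [q3]
    refine ⟨fun i => ?_, ?_⟩
    · have := hp i; have := ht i; positivity
    · rw [q2, hn, dg_apply, dg_apply, dg_apply, co, co, co] at hq'
      simp [Fin.sum_univ_three] at hq'; simp only []; linarith
  have fin : volume (L ∩ oct ε) ≠ ⊤ := measure_ne_top_of_subset Set.inter_subset_left hL.vol_ne_top
  have hfQ := measure_ne_top_of_subset hQs fin
  have h1 : volume (A ∪ (Q \ B)) ≤ volume (L ∩ oct ε) := measure_mono (Set.union_subset (Set.subset_inter hAL hAo) (Set.diff_subset.trans hQs))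
  rw [measure_union hdis (hQm.diff hBm)] at h1
  have h2 : vol (Q \ B) = vol Q - vol B := by
    have := measureReal_diff (μ := volume) hBQ hBm hfQ
    exact this
  have h3 := ENNReal.toReal_mono fin h1
  rw [ENNReal.toReal_add (measure_ne_top_of_subset (Set.subset_inter hAL hAo) fin) (measure_ne_top_of_subset (Set.diff_subset.trans hQs) fin)] at h3
  have h4 : vol A + vol (Q \ B) ≤ vol (L ∩ oct ε) := h3
  rw [h2, hv, hw, hQ] at h4
  simp at h4
  nlinarith

theorem sgb_inj {b c : Fin 3 → Bool} (h : sgb b = sgb c) : b = c := by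
  ext i
  have := congrFun h i
  simp only [sgb] at this
  cases hb : b i <;> cases hc : c i <;> simp [hb, hc] at this ⊢ <;> norm_num at this

theorem vol_octs {L : Set V3} (hL : Body L) : ∑ b, vol (L ∩ oct (sgb b)) ≤ vol L := by
  have h1 : volume (⋃ b, L ∩ oct (sgb b)) = ∑ b, volume (L ∩ oct (sgb b)) := by
    rw [measure_iUnion, tsum_fintype]
    · intro b c hbc
      refine Set.disjoint_left.2 fun x h h' => hbc (sgb_inj (funext fun i => ?_))
      have h1 := h.2 i; have h2 := h'.2 i
      rcases sgb_sign b i with q | q <;> rcases sgb_sign c i with q' | q' <;> rw [q] at h1 ⊢ <;> rw [q'] at h2 ⊢ <;> linarith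
    · exact fun b => hL.meas.inter (oct_open _).measurableSet
  have h2 : volume (⋃ b, L ∩ oct (sgb b)) ≤ volume L := measure_mono (Set.iUnion_subset fun b => Set.inter_subset_left)
  rw [h1] at h2
  have h3 := ENNReal.toReal_mono hL.vol_ne_top h2
  rwa [ENNReal.toReal_sum] at h3
  exact fun b _ => measure_ne_top_of_subset Set.inter_subset_left hL.vol_ne_top

/-- polar side -/
theorem pol_side {L : Set V3} (hL : Body L) (hO : Oc ⊆ L) {s : (Fin 3 → Bool) → Fin 3 → ℝ}
    (hs0 : ∀ b i, 0 ≤ s b i) (hs1 : ∀ b i, s b i < 1) (hs : ∀ b i, gauge L (uu (sgb b) i) = 1 - s b i) :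
    4/3 + (1/6) * (47/50)^2 * ∑ b, ∑ i, s b i ≤ vol L := by
  refine le_trans ?_ (vol_octs hL)
  have key : ∀ b, 1/6 + (1/6) * (47/50)^2 * ∑ i, s b i ≤ vol (L ∩ oct (sgb b)) := by
    intro b
    have hp : ∀ i, 0 < 1 - s b i := fun i => by linarith [hs1 b i]
    have hge : ∀ i, 1 + s b i ≤ (1 - s b i)⁻¹ := by
      intro i
      rw [le_inv_comm₀ (by linarith [hs0 b i]) (hp i), inv_eq_one_div, le_div_iff₀ (by linarith [hs0 b i])]
      nlinarith [hs0 b i]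
    refine le_trans ?_ (oct_part hL (sgb_sign b) (t := fun i => (1 - s b i)⁻¹) (fun i => by linarith [hge i, hs0 b i]) hO fun i => ?_)
    · have h0 := hge 0; have h1 := hge 1; have h2 := hge 2
      have g0 := hs0 b 0; have g1 := hs0 b 1; have g2 := hs0 b 2
      have q : 1 + s b 0 + s b 1 + s b 2 ≤ (1 - s b 0)⁻¹ * (1 - s b 1)⁻¹ * (1 - s b 2)⁻¹ := by
        calc _ ≤ (1 + s b 0) * (1 + s b 1) * (1 + s b 2) := by
              nlinarith [mul_nonneg g0 g1, mul_nonneg g0 g2, mul_nonneg g1 g2, mul_nonneg (mul_nonneg g0 g1) g2]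
          _ ≤ _ := by
              have a0 := (inv_pos.2 (hp 0)).le; have a1 := (inv_pos.2 (hp 1)).le; have a2 := (inv_pos.2 (hp 2)).le
              gcongr
      have := vol_T0
      rw [Fin.sum_univ_three]
      refine le_trans (b := 1/6 * (1 + (47/50)^2 * ((1 - s b 0)⁻¹ * (1 - s b 1)⁻¹ * (1 - s b 2)⁻¹ - 1))) (by linarith) ?_
      refine mul_le_mul_of_nonneg_right this ?_
      nlinarith
    · rw [← hL.gauge_le_one, Body.gauge_smul' (inv_nonneg.2 (hp i).le), hs]
      rw [inv_mul_cancel₀ (hp i).ne']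
  calc _ = ∑ b : Fin 3 → Bool, (1/6 + (1/6) * (47/50)^2 * ∑ i, s b i) := by
        rw [Finset.sum_add_distrib, Finset.mul_sum]; simp; norm_num
    _ ≤ _ := Finset.sum_le_sum fun b _ => key b
end Mah

namespace Mah
open Topology

def sq (r : ℝ) : Set (Fin 2 → ℝ) := {y | |y 0| ≤ r ∧ |y 1| ≤ r}

theorem int_relu {r c : ℝ} (hc : |c| ≤ r) : ∫ x in (-r)..r, max (x + c) 0 = (r + c)^2/2 := by
  have h := abs_le.1 hc
  have hcont : Continuous fun x : ℝ => max (x + c) 0 := by fun_prop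
  rw [← intervalIntegral.integral_add_adjacent_intervals (b := -c) (hcont.intervalIntegrable _ _) (hcont.intervalIntegrable _ _)]
  have e1 : ∫ x in (-r)..(-c), max (x + c) 0 = 0 := by
    rw [intervalIntegral.integral_congr (g := fun _ => (0:ℝ))]
    · simp
    · intro x hx
      rw [Set.uIcc_of_le (by linarith)] at hx
      simp only []
      exact max_eq_right (by linarith [hx.2])
  have e2 : ∫ x in (-c)..r, max (x + c) 0 = ∫ x in (-c)..r, (x + c) := by
    refine intervalIntegral.integral_congr ?_
    intro x hx
    rw [Set.uIcc_of_le (by linarith)] at hx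
    exact max_eq_left (by linarith [hx.1])
  rw [e1, e2, intervalIntegral.integral_add (by simp) (by simp)]
  simp; ring

theorem int_relu' {r c a : ℝ} (ha : a = 1 ∨ a = -1) (hc : |c| ≤ r) : ∫ x in (-r)..r, max (a * x + c) 0 = (r + c)^2/2 := by
  rcases ha with rfl | rfl
  · simpa using int_relu hc
  · have := intervalIntegral.integral_comp_neg (a := -r) (b := r) (fun x => max (x + c) 0)
    rw [neg_neg, int_relu hc] at this
    simpa using this

theorem int_sq {r a b : ℝ} (hr : 0 < r) (ha : a = 1 ∨ a = -1) (hb : b = 1 ∨ b = -1) :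
    ∫ y in sq r, max (a * y 0 + b * y 1) 0 = 4/3 * r^3 := by
  have hmp := volume_preserving_finTwoArrow ℝ
  have e : sq r = MeasurableEquiv.finTwoArrow ⁻¹' (Set.Icc (-r) r ×ˢ Set.Icc (-r) r) := by
    ext y; simp [sq, abs_le, MeasurableEquiv.finTwoArrow]; tauto
  have hcont : Continuous fun p : ℝ × ℝ => max (a * p.1 + b * p.2) 0 := by fun_prop
  have h1 := hmp.setIntegral_preimage_emb MeasurableEquiv.finTwoArrow.measurableEmbedding (fun p : ℝ × ℝ => max (a * p.1 + b * p.2) 0) (Set.Icc (-r) r ×ˢ Set.Icc (-r) r)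
  rw [e]
  refine Eq.trans h1 ?_
  have h2 : ∫ p in Set.Icc (-r) r ×ˢ Set.Icc (-r) r, max (a * p.1 + b * p.2) 0 = ∫ y in Set.Icc (-r) r, ∫ x in Set.Icc (-r) r, max (b * x + a * y) 0 := by
    rw [Measure.volume_eq_prod, setIntegral_prod]
    · simp only [add_comm]
    · exact hcont.continuousOn.integrableOn_compact (isCompact_Icc.prod isCompact_Icc)
  rw [h2]
  have h3 : ∀ y ∈ Set.Icc (-r) r, ∫ x in Set.Icc (-r) r, max (b * x + a * y) 0 = (r + a * y)^2/2 := by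
    intro y hy
    rw [integral_Icc_eq_integral_Ioc, ← intervalIntegral.integral_of_le (by linarith), int_relu' hb]
    rcases ha with rfl | rfl <;> rw [abs_le] <;> constructor <;> linarith [hy.1, hy.2]
  rw [setIntegral_congr_fun measurableSet_Icc h3, integral_Icc_eq_integral_Ioc, ← intervalIntegral.integral_of_le (by linarith)]
  have : ∀ y, (r + a * y)^2/2 = r^2/2 + r * a * y + y^2 / 2 := by
    intro y
    have : a^2 = 1 := by rcases ha with rfl | rfl <;> norm_num
    linear_combination y^2/2 * this
  simp only [this]
  rw [intervalIntegral.integral_add, intervalIntegral.integral_add]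
  · rw [intervalIntegral.integral_const_mul]; simp; ring
  all_goals exact Continuous.intervalIntegrable (by fun_prop) _ _

noncomputable def psi (r c1 c2 c3 c4 : ℝ) (y : Fin 2 → ℝ) : ℝ :=
  (c1 * max (1 * y 0 + 1 * y 1) 0 + c2 * max (1 * y 0 + (-1) * y 1) 0 + c3 * max ((-1) * y 0 + 1 * y 1) 0 + c4 * max ((-1) * y 0 + (-1) * y 1) 0) / (2 * r)

theorem relu_id (p q : ℝ) : max (1*p+1*q) 0 - max ((-1)*p+(-1)*q) 0 = p + q ∧ max (1*p+(-1)*q) 0 - max ((-1)*p+1*q) 0 = p - q ∧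
    max (1*p+1*q) 0 + max ((-1)*p+(-1)*q) 0 = |p+q| ∧ max (1*p+(-1)*q) 0 + max ((-1)*p+1*q) 0 = |p - q| := by
  refine ⟨?_, ?_, ?_, ?_⟩
  · rcases le_total 0 (p+q) with h | h
    · rw [max_eq_left (by linarith), max_eq_right (by linarith)]; ring
    · rw [max_eq_right (by linarith), max_eq_left (by linarith)]; ring
  · rcases le_total 0 (p-q) with h | h
    · rw [max_eq_left (by linarith), max_eq_right (by linarith)]; ring
    · rw [max_eq_right (by linarith), max_eq_left (by linarith)]; ring
  · rcases le_total 0 (p+q) with h | h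
    · rw [max_eq_left (by linarith), max_eq_right (by linarith), abs_of_nonneg h]; ring
    · rw [max_eq_right (by linarith), max_eq_left (by linarith), abs_of_nonpos h]; ring
  · rcases le_total 0 (p-q) with h | h
    · rw [max_eq_left (by linarith), max_eq_right (by linarith), abs_of_nonneg h]; ring
    · rw [max_eq_right (by linarith), max_eq_left (by linarith), abs_of_nonpos h]; ring

theorem abs_sum_le {p q r : ℝ} (hp : |p| ≤ r) (hq : |q| ≤ r) : |p+q| + |p-q| ≤ 2*r := by
  rw [abs_le] at hp hq
  rcases abs_cases (p+q) with h | h <;> rcases abs_cases (p-q) with h' | h' <;> linarith [h.1, h'.1]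

theorem psi_le {r x c1 c2 c3 c4 : ℝ} (hr : 0 < r) (h1 : c1 ≤ x) (h2 : c2 ≤ x) (h3 : c3 ≤ x) (h4 : c4 ≤ x) (hx : 0 ≤ x) {y} (hy : y ∈ sq r) :
    psi r c1 c2 c3 c4 y ≤ x := by
  obtain ⟨_, _, e3, e4⟩ := relu_id (y 0) (y 1)
  have := abs_sum_le hy.1 hy.2
  unfold psi
  rw [div_le_iff₀ (by positivity)]
  have a1 := le_max_right (1 * y 0 + 1 * y 1) 0
  have a2 := le_max_right (1 * y 0 + (-1) * y 1) 0
  have a3 := le_max_right ((-1) * y 0 + 1 * y 1) 0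
  have a4 := le_max_right ((-1) * y 0 + (-1) * y 1) 0
  generalize max (1 * y 0 + 1 * y 1) 0 = m1 at *
  generalize max (1 * y 0 + (-1) * y 1) 0 = m2 at *
  generalize max ((-1) * y 0 + 1 * y 1) 0 = m3 at *
  generalize max ((-1) * y 0 + (-1) * y 1) 0 = m4 at *
  have b1 := mul_le_mul_of_nonneg_right h1 a1
  have b2 := mul_le_mul_of_nonneg_right h2 a2
  have b3 := mul_le_mul_of_nonneg_right h3 a3
  have b4 := mul_le_mul_of_nonneg_right h4 a4
  have : m1 + m2 + m3 + m4 ≤ 2*r := by linarith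
  have := mul_le_mul_of_nonneg_left this hx
  linarith

theorem sq_compact (r : ℝ) : IsCompact (sq r) := by
  have : sq r = Set.Icc (fun _ => -r) (fun _ => r) := by
    ext y; simp only [sq, Set.mem_setOf_eq, abs_le, Set.mem_Icc, Pi.le_def, Fin.forall_fin_two]; tauto
  rw [this]; exact isCompact_Icc

theorem vol_sq {r : ℝ} (hr : 0 < r) : vol (sq r) = 4 * r^2 := by
  have : sq r = Set.Icc (fun _ => -r) (fun _ => r) := by
    ext y; simp only [sq, Set.mem_setOf_eq, abs_le, Set.mem_Icc, Pi.le_def, Fin.forall_fin_two]; tauto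
  unfold vol
  rw [this, Real.volume_Icc_pi_toReal (fun _ => by simp; linarith)]
  simp; ring

theorem psi_cont (r c1 c2 c3 c4 : ℝ) : Continuous (psi r c1 c2 c3 c4) := by
  unfold psi; fun_prop

theorem int_psi {r c1 c2 c3 c4 : ℝ} (hr : 0 < r) : ∫ y in sq r, psi r c1 c2 c3 c4 y = 2/3 * r^2 * (c1+c2+c3+c4) := by
  have hI : ∀ f : (Fin 2 → ℝ) → ℝ, Continuous f → IntegrableOn f (sq r) := fun f hf => hf.continuousOn.integrableOn_compact (sq_compact r)
  unfold psi
  rw [integral_div, integral_add (hI _ (by fun_prop)) (hI _ (by fun_prop)), integral_add (hI _ (by fun_prop)) (hI _ (by fun_prop)), integral_add (hI _ (by fun_prop)) (hI _ (by fun_prop)),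
    integral_const_mul, integral_const_mul, integral_const_mul, integral_const_mul, int_sq hr (by simp) (by simp), int_sq hr (by simp) (by simp), int_sq hr (by simp) (by simp), int_sq hr (by simp) (by simp)]
  field_simp; ring

theorem face_vol (i : Fin 3) {r x c1 c2 c3 c4 : ℝ} (hr : 0 < r) (h1 : c1 ≤ x) (h2 : c2 ≤ x) (h3 : c3 ≤ x) (h4 : c4 ≤ x) (hx : 0 ≤ x) :
    ENNReal.ofReal (4 * r^2 * x - 2/3 * r^2 * (c1+c2+c3+c4)) ≤ volume {z : V3 | rem i z ∈ sq r ∧ 1 - x < z i ∧ z i ≤ 1 - psi r c1 c2 c3 c4 (rem i z)} := by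
  have hS : MeasurableSet {z : V3 | rem i z ∈ sq r ∧ 1 - x < z i ∧ z i ≤ 1 - psi r c1 c2 c3 c4 (rem i z)} := by
    have hc := cont_rem (n := 2) i
    refine ((sq_compact r).measurableSet.preimage hc.measurable).inter ((measurableSet_lt measurable_const (measurable_pi_apply i)).inter (measurableSet_le (measurable_pi_apply i) ?_))
    exact (continuous_const.sub ((psi_cont r c1 c2 c3 c4).comp hc)).measurable
  rw [volume_eq_prod i _ hS]
  have e : ∀ y : Fin 2 → ℝ, volume {t : ℝ | ins i t y ∈ {z : V3 | rem i z ∈ sq r ∧ 1 - x < z i ∧ z i ≤ 1 - psi r c1 c2 c3 c4 (rem i z)}} = (sq r).indicator (fun y => ENNReal.ofReal (x - psi r c1 c2 c3 c4 y)) y := by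
    intro y
    by_cases hy : y ∈ sq r
    · rw [Set.indicator_of_mem hy]
      have : {t : ℝ | ins i t y ∈ {z : V3 | rem i z ∈ sq r ∧ 1 - x < z i ∧ z i ≤ 1 - psi r c1 c2 c3 c4 (rem i z)}} = Set.Ioc (1 - x) (1 - psi r c1 c2 c3 c4 y) := by
        ext t; simp [hy]
      rw [this, Real.volume_Ioc]; congr 1; ring
    · rw [Set.indicator_of_notMem hy]
      have : {t : ℝ | ins i t y ∈ {z : V3 | rem i z ∈ sq r ∧ 1 - x < z i ∧ z i ≤ 1 - psi r c1 c2 c3 c4 (rem i z)}} = ∅ := by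
        ext t; simp [hy]
      rw [this, measure_empty]
  simp only [e]
  rw [lintegral_indicator (sq_compact r).measurableSet]
  have hI : IntegrableOn (fun y => x - psi r c1 c2 c3 c4 y) (sq r) :=
    (continuous_const.sub (psi_cont r c1 c2 c3 c4)).continuousOn.integrableOn_compact (sq_compact r)
  rw [← ofReal_integral_eq_lintegral_ofReal hI]
  · refine ENNReal.ofReal_le_ofReal (le_of_eq ?_)
    have hx' : IntegrableOn (fun _ : Fin 2 → ℝ => x) (sq r) := continuous_const.continuousOn.integrableOn_compact (sq_compact r)
    rw [integral_sub hx' ((psi_cont r c1 c2 c3 c4).continuousOn.integrableOn_compact (sq_compact r)), int_psi hr, setIntegral_const]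
    have := vol_sq hr
    unfold vol at this
    simp only [Measure.real, this, smul_eq_mul]
  · exact (ae_restrict_iff' (sq_compact r).measurableSet).2 (ae_of_all _ fun y hy => by simpa using psi_le hr h1 h2 h3 h4 hx hy)

/-- a face piece of `K` -/
theorem face_mem {K : Set V3} (hK : Body K) (i : Fin 3) {r x c1 c2 c3 c4 : ℝ} (hr : 0 < r) (hrx : r = 1 - x)
    (hC : ∀ z : V3, (∀ j, |z j| ≤ r) → z ∈ K) (he : ins i 1 0 ∈ K)
    (h1 : ins i (1 - c1) ![r, r] ∈ K) (h2 : ins i (1 - c2) ![r, -r] ∈ K) (h3 : ins i (1 - c3) ![-r, r] ∈ K) (h4 : ins i (1 - c4) ![-r, -r] ∈ K)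
    {z : V3} (hz : rem i z ∈ sq r) (hz1 : 1 - x < z i) (hz2 : z i ≤ 1 - psi r c1 c2 c3 c4 (rem i z)) : z ∈ K := by
  set y := rem i z with hy
  have ez : z = ins i (z i) y := by simp [hy]
  have htop : ins i (1 - psi r c1 c2 c3 c4 y) y ∈ K := by
    refine hK.mem_of fun l hl => ?_
    have l0 := hl _ he; have l1 := hl _ h1; have l2 := hl _ h2; have l3 := hl _ h3; have l4 := hl _ h4
    rw [dot_ins, dot2] at *
    simp only [Matrix.cons_val_zero, Matrix.cons_val_one, Pi.zero_apply] at l0 l1 l2 l3 l4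
    set a := rem i l 0; set b := rem i l 1; set w := l i
    obtain ⟨e1, e2, e3, e4⟩ := relu_id (y 0) (y 1)
    have hs := abs_sum_le hz.1 hz.2
    rw [← e3, ← e4] at hs
    unfold psi
    have a1 := le_max_right (1 * y 0 + 1 * y 1) 0
    have a2 := le_max_right (1 * y 0 + (-1) * y 1) 0
    have a3 := le_max_right ((-1) * y 0 + 1 * y 1) 0
    have a4 := le_max_right ((-1) * y 0 + (-1) * y 1) 0
    generalize max (1 * y 0 + 1 * y 1) 0 = m1 at *
    generalize max (1 * y 0 + (-1) * y 1) 0 = m2 at *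
    generalize max ((-1) * y 0 + 1 * y 1) 0 = m3 at *
    generalize max ((-1) * y 0 + (-1) * y 1) 0 = m4 at *
    have b1 := mul_le_mul_of_nonneg_left l1 a1
    have b2 := mul_le_mul_of_nonneg_left l2 a2
    have b3 := mul_le_mul_of_nonneg_left l3 a3
    have b4 := mul_le_mul_of_nonneg_left l4 a4
    have b0 := mul_le_mul_of_nonneg_left l0 (sub_nonneg.2 hs)
    have y0 : y 0 = (m1 + m2 - m3 - m4)/2 := by linarith
    have y1 : y 1 = (m1 - m2 + m3 - m4)/2 := by linarith
    rw [y0, y1]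
    have : (1 - (c1 * m1 + c2 * m2 + c3 * m3 + c4 * m4) / (2 * r)) * w + ((m1 + m2 - m3 - m4) / 2 * a + (m1 - m2 + m3 - m4) / 2 * b)
        = ((2*r - (c1 * m1 + c2 * m2 + c3 * m3 + c4 * m4)) * w + r * ((m1 + m2 - m3 - m4) * a + (m1 - m2 + m3 - m4) * b)) / (2*r) := by
      field_simp
    rw [this, div_le_one (by positivity)]
    linarith
  have hbot : ins i r y ∈ K := by
    refine hC _ fun j => ?_
    rcases Fin.eq_self_or_eq_succAbove i j with rfl | ⟨k, rfl⟩
    · simp [abs_of_pos hr]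
    · rw [ins_succ]
      fin_cases k
      · exact hz.1
      · exact hz.2
  rw [ez]
  refine hK.mem_of fun l hl => ?_
  have l0 := hl _ htop; have l1 := hl _ hbot
  rw [dot_ins] at *
  rcases le_total 0 (l i) with h | h
  · nlinarith
  · nlinarith

theorem vol_box3 {r : ℝ} (hr : 0 < r) : vol {x : V3 | ∀ j, |x j| ≤ r} = 8 * r^3 := by
  have : {x : V3 | ∀ j, |x j| ≤ r} = Set.Icc (fun _ => -r) (fun _ => r) := by
    ext y; simp only [Set.mem_setOf_eq, abs_le, Set.mem_Icc, Pi.le_def, forall_and]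
  unfold vol
  rw [this, Real.volume_Icc_pi_toReal (fun _ => by simp; linarith)]
  simp; ring

/-- body side -/
theorem body_side {K : Set V3} (hK : Body K) {r x : ℝ} (hr : 0 < r) (hx : 0 ≤ x) (hrx : r = 1 - x) (hC : ∀ z : V3, (∀ j, |z j| ≤ r) → z ∈ K)
    (he : ∀ i : Fin 3, ins i 1 0 ∈ K) {c1 c2 c3 c4 : Fin 3 → ℝ} (hc1 : ∀ i, c1 i ≤ x) (hc2 : ∀ i, c2 i ≤ x) (hc3 : ∀ i, c3 i ≤ x) (hc4 : ∀ i, c4 i ≤ x)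
    (h1 : ∀ i, ins i (1 - c1 i) ![r, r] ∈ K) (h2 : ∀ i, ins i (1 - c2 i) ![r, -r] ∈ K) (h3 : ∀ i, ins i (1 - c3 i) ![-r, r] ∈ K) (h4 : ∀ i, ins i (1 - c4 i) ![-r, -r] ∈ K) :
    8 * r^3 + 24 * r^2 * x - 4/3 * r^2 * ∑ i, (c1 i + c2 i + c3 i + c4 i) ≤ vol K := by
  let R : Fin 3 → Set V3 := fun i => {z | z ∈ K ∧ r < z i ∧ rem i z ∈ sq r}
  let A : Set V3 := {z : V3 | ∀ j, |z j| ≤ r}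
  have hRm : ∀ i, MeasurableSet (R i) := fun i => hK.meas.inter ((measurableSet_lt measurable_const (measurable_pi_apply i)).inter
    ((sq_compact r).measurableSet.preimage (cont_rem (n := 2) i).measurable))
  have hRv : ∀ i, 4 * r^2 * x - 2/3 * r^2 * (c1 i+c2 i+c3 i+c4 i) ≤ vol (R i) := by
    intro i
    have q : volume (R i) ≠ ⊤ := measure_ne_top_of_subset (fun z hz => hz.1) hK.vol_ne_top
    have h := (face_vol i hr (hc1 i) (hc2 i) (hc3 i) (hc4 i) hx).trans (measure_mono (t := R i) ?_)
    · exact (ENNReal.ofReal_le_iff_le_toReal q).1 h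
    · rintro z ⟨a, b, c⟩
      exact ⟨face_mem hK i hr hrx hC (he i) (h1 i) (h2 i) (h3 i) (h4 i) a b c, by rw [hrx]; exact b, a⟩
  have hRn : ∀ i, vol (-R i) = vol (R i) := fun i => by unfold vol; rw [Measure.measure_neg]
  let F : Option (Fin 3 × Bool) → Set V3 := fun o => match o with
    | none => A
    | some (i, true) => R i
    | some (i, false) => -R i
  have hAm : MeasurableSet A := by
    have : A = ⋂ j, {z : V3 | |z j| ≤ r} := by ext; simp [A]
    rw [this]
    exact MeasurableSet.iInter fun j => measurableSet_le (by fun_prop) measurable_const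
  have hFm : ∀ o, MeasurableSet (F o) := by
    rintro (_ | ⟨i, _ | _⟩)
    · exact hAm
    · exact (hRm i).neg
    · exact hRm i
  have hsub : ∀ o, F o ⊆ K := by
    rintro (_ | ⟨i, _ | _⟩)
    · exact fun z hz => hC z hz
    · exact fun z hz => by have := hK.symm _ hz.1; simpa using this
    · exact fun z hz => hz.1
  -- characterisation used for disjointness
  have hsq : ∀ (i j : Fin 3) (z : V3), rem i z ∈ sq r → j ≠ i → |z j| ≤ r := by
    intro i j z hz hj
    rcases Fin.eq_self_or_eq_succAbove i j with rfl | ⟨k, rfl⟩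
    · exact absurd rfl hj
    · fin_cases k
      · exact hz.1
      · exact hz.2
  have hdis : Pairwise fun a b => Disjoint (F a) (F b) := by
    have dA : ∀ o, Disjoint (F none) (F (some o)) := by
      rintro ⟨i, _ | _⟩ <;> refine Set.disjoint_left.2 fun z (hz : ∀ j, |z j| ≤ r) hz' => ?_
      · have a := hz'.2.1; have b := (abs_le.1 (hz i)).1
        simp at a; linarith
      · have a := hz'.2.1; have b := (abs_le.1 (hz i)).2
        linarith
    have dR : ∀ (o p : Fin 3 × Bool), o ≠ p → Disjoint (F (some o)) (F (some p)) := by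
      rintro ⟨i, s⟩ ⟨j, t⟩ hne
      refine Set.disjoint_left.2 fun z hz hz' => ?_
      have big : ∀ (i : Fin 3) (s : Bool), z ∈ F (some (i, s)) → r < |z i| ∧ (∀ k, k ≠ i → |z k| ≤ r) ∧ (s = true ↔ 0 < z i) := by
        rintro i (_ | _) hz
        · have a := hz.2.1
          simp at a
          refine ⟨by rw [abs_of_neg (by linarith)]; exact a, fun k hk => ?_, by simp; linarith⟩
          have := hsq i k _ hz.2.2 hk
          simpa using this
        · have a := hz.2.1
          exact ⟨by rw [abs_of_pos (by linarith)]; exact a, fun k hk => hsq i k _ hz.2.2 hk, by simp; linarith⟩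
      obtain ⟨a1, a2, a3⟩ := big i s hz
      obtain ⟨b1, b2, b3⟩ := big j t hz'
      by_cases hij : i = j
      · subst hij
        apply hne
        rw [Prod.mk.injEq]; exact ⟨rfl, Bool.eq_iff_iff.2 (a3.trans b3.symm)⟩
      · linarith [b2 i hij]
    rintro (_ | o) (_ | p) hne
    · exact absurd rfl hne
    · exact dA p
    · exact (dA o).symm
    · exact dR o p (by simpa using hne)
  have e1 : volume (⋃ o, F o) = ∑ o, volume (F o) := by rw [measure_iUnion hdis hFm, tsum_fintype]
  have e2 : volume (⋃ o, F o) ≤ volume K := measure_mono (Set.iUnion_subset hsub)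
  rw [e1] at e2
  have e3 := ENNReal.toReal_mono hK.vol_ne_top e2
  rw [ENNReal.toReal_sum (fun o _ => measure_ne_top_of_subset (hsub o) hK.vol_ne_top)] at e3
  have e4 : ∑ o, vol (F o) ≤ vol K := e3
  rw [Fintype.sum_option, Fintype.sum_prod_type] at e4
  have e5 : ∀ i : Fin 3, ∑ s : Bool, vol (F (some (i, s))) = 2 * vol (R i) := by
    intro i
    rw [Fintype.sum_bool]
    show vol (R i) + vol (-R i) = _
    rw [hRn]; ring
  simp only [e5] at e4
  have e6 : vol (F none) = 8 * r^3 := vol_box3 hr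
  rw [e6, Fin.sum_univ_three] at e4
  have := hRv 0; have := hRv 1; have := hRv 2
  rw [Fin.sum_univ_three]
  linarith
end Mah

namespace Mah
open Topology

theorem sum8 (f : (Fin 3 → Bool) → ℝ) : ∑ b, f b = f ![true,true,true] + f ![true,true,false] + f ![true,false,true] + f ![true,false,false]
    + f ![false,true,true] + f ![false,true,false] + f ![false,false,true] + f ![false,false,false] := by
  have : (Finset.univ : Finset (Fin 3 → Bool)) = {![true,true,true], ![true,true,false], ![true,false,true], ![true,false,false], ![false,true,true], ![false,true,false], ![false,false,true], ![false,false,false]} := by decide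
  rw [this]
  rw [Finset.sum_insert (by decide), Finset.sum_insert (by decide), Finset.sum_insert (by decide), Finset.sum_insert (by decide), Finset.sum_insert (by decide), Finset.sum_insert (by decide), Finset.sum_insert (by decide), Finset.sum_singleton]
  ring

def Bi (i : Fin 3) (a b : Bool) : Fin 3 → Bool := Fin.insertNth (α := fun _ => Bool) i true ![a, b]

theorem sum_Bi (s : (Fin 3 → Bool) → Fin 3 → ℝ) (hs : ∀ b i, s (fun j => !(b j)) i = s b i) :
    ∑ b, ∑ i, s b i = 2 * ∑ i, (s (Bi i true true) i + s (Bi i true false) i + s (Bi i false true) i + s (Bi i false false) i) := by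
  have e0 : ∀ a b, Bi 0 a b = ![true, a, b] := by decide
  have e1 : ∀ a b, Bi 1 a b = ![a, true, b] := by decide
  have e2 : ∀ a b, Bi 2 a b = ![a, b, true] := by decide
  have n : ∀ a b c i, s ![!a, !b, !c] i = s ![a, b, c] i := by
    intro a b c i
    rw [← hs]; congr 1; ext j; fin_cases j <;> simp
  rw [sum8]
  simp only [Fin.sum_univ_three, e0, e1, e2]
  have n1 := n true true true; have n2 := n true true false; have n3 := n true false true; have n4 := n true false false
  simp at n1 n2 n3 n4
  have a0 := n1 0; have a1 := n1 1; have a2 := n1 2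
  have b0 := n2 0; have b1 := n2 1; have b2 := n2 2
  have c0 := n3 0; have c1 := n3 1; have c2 := n3 2
  have d0 := n4 0; have d1 := n4 1; have d2 := n4 2
  linarith

theorem uu_not (b : Fin 3 → Bool) (i) : uu (sgb fun j => !(b j)) i = - uu (sgb b) i := by
  have h : ∀ j, sgb (fun j => !(b j)) j = - sgb b j := fun j => by
    simp only [sgb]; by_cases hb : b j = true <;> simp [hb]
  ext j; simp only [uu, Pi.neg_apply, h]; ring

theorem dot_uu (ε x : V3) (i : Fin 3) : x ⬝ᵥ uu ε i = 1/50 * (ε 0 * x 0 + ε 1 * x 1 + ε 2 * x 2) + 47/50 * (ε i * x i) := by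
  rw [dot3]; fin_cases i <;> simp [uu] <;> ring

theorem local_alg {S σ A B δ : ℝ} (hS : σ ≤ S) (hS2 : S ≤ 24 * σ) (h0 : 0 ≤ σ) (h1 : σ ≤ 1/10^7)
    (hA : 8 - 25/36 * S - 320000 * σ^2 ≤ A) (hB : 4/3 + (1/6) * (47/50)^2 * S ≤ B) (hv : A * B ≤ 32/3 * (1 + δ)) : 50 * σ ≤ 6000 * δ := by
  have hS0 : 0 ≤ S := h0.trans hS
  have q1 : σ^2 ≤ 1/10^7 * σ := by nlinarith
  have q2 : S^2 ≤ 24/10^7 * S := by nlinarith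
  have q3 : σ^2 * S ≤ 1/10^14 * S := by
    refine mul_le_mul_of_nonneg_right ?_ hS0; nlinarith
  have hp : 0 ≤ 8 - 25/36 * S - 320000 * σ^2 := by linarith
  have := mul_le_mul hA hB (by positivity) (hp.trans hA)
  nlinarith

theorem local_stab {K : Set V3} (hK : Body K) (h1 : ∀ x ∈ K, ∀ i, |x i| ≤ 1) (he : ∀ i : Fin 3, ins i 1 0 ∈ K)
    (hη : ∀ z : V3, (∀ j, |z j| ≤ 1 - 1/10^7) → z ∈ K) {δ : ℝ} (hδ : 0 ≤ δ) (hv : vp K ≤ 32/3 * (1 + δ)) {z : V3} (hz : ∀ j, |z j| ≤ 1 - 6000 * δ) : z ∈ K := by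
  set s : (Fin 3 → Bool) → Fin 3 → ℝ := fun b i => 1 - gauge (pol K) (uu (sgb b) i) with hs
  have hsx : ∀ b i, ∃ x ∈ K, (∀ j, 0 ≤ 1 - sgb b j * x j) ∧ 1/50 * ((1 - sgb b 0 * x 0) + (1 - sgb b 1 * x 1) + (1 - sgb b 2 * x 2)) + 47/50 * (1 - sgb b i * x i) = s b i := by
    intro b i
    obtain ⟨x, hx, e⟩ := hK.exists_supp (uu (sgb b) i)
    refine ⟨x, hx, fun j => ?_, ?_⟩
    · have := abs_le.1 (h1 x hx j)
      rcases sgb_sign b j with h | h <;> rw [h] <;> linarith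
    · simp only [hs]; rw [← e, dot_uu]; ring
  choose X hXK hXd hXs using hsx
  have hs0 : ∀ b i, 0 ≤ s b i := by
    intro b i
    have := hXd b i 0; have := hXd b i 1; have := hXd b i 2; have := hXd b i i
    rw [← hXs]; linarith
  have hs1 : ∀ b i, s b i ≤ 1/10^7 := by
    intro b i
    have hm : ((1 - 1/10^7 : ℝ) • sgb b) ∈ K := hη _ fun j => by
      rw [Pi.smul_apply, smul_eq_mul, abs_mul]
      rcases sgb_sign b j with h | h <;> rw [h] <;> norm_num
    have := hK.dot_le_supp (y := uu (sgb b) i) hm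
    rw [dot_uu] at this
    have q : ∀ j, sgb b j * ((1 - 1/10^7 : ℝ) • sgb b) j = 1 - 1/10^7 := by
      intro j; rw [Pi.smul_apply, smul_eq_mul]
      rcases sgb_sign b j with h | h <;> rw [h] <;> norm_num
    rw [q, q, q, q] at this
    simp only [hs]; linarith
  obtain ⟨⟨b0, i0⟩, hmax⟩ := Finite.exists_max fun p : (Fin 3 → Bool) × Fin 3 => s p.1 p.2
  set σ := s b0 i0 with hσ
  have hle : ∀ b i, s b i ≤ σ := fun b i => hmax (b, i)
  have σ0 : 0 ≤ σ := hs0 _ _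
  have σ1 : σ ≤ 1/10^7 := hs1 _ _
  have hXj : ∀ b i j, 1 - sgb b j * X b i j ≤ 50 * σ := by
    intro b i j
    have a0 := hXd b i 0; have a1 := hXd b i 1; have a2 := hXd b i 2; have ai := hXd b i i
    have := hXs b i; have := hle b i
    fin_cases j <;> simp only [Fin.zero_eta, Fin.mk_one, Fin.reduceFinMk] <;> linarith
  have hXi : ∀ b i, 1 - sgb b i * X b i i ≤ 25/24 * s b i := by
    intro b i
    have a0 := hXd b i 0; have a1 := hXd b i 1; have a2 := hXd b i 2; have ai := hXd b i i
    have q := hXs b i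
    fin_cases i <;> simp only [Fin.zero_eta, Fin.mk_one, Fin.reduceFinMk] at * <;> linarith
  have hC : ∀ z : V3, (∀ j, |z j| ≤ 1 - 50 * σ) → z ∈ K := by
    intro z hz
    refine hK.mem_of fun l hl => ?_
    set b : Fin 3 → Bool := fun j => decide (0 ≤ l j)
    have hb : ∀ j, 0 ≤ sgb b j * l j := by
      intro j
      by_cases h : 0 ≤ l j
      · simp [sgb, b, h]
      · simp [sgb, b, h]; linarith
    have hx := hl _ (hXK b 0)
    refine le_trans ?_ hx
    rw [dot3, dot3]
    have key : ∀ j, z j * l j ≤ X b 0 j * l j := by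
      intro j
      have h1 := hXj b 0 j; have h2 := hb j; have h3 := abs_le.1 (hz j)
      rcases sgb_sign b j with h | h <;> rw [h] at h1 h2 <;> nlinarith
    linarith [key 0, key 1, key 2]
  suffices h : 50 * σ ≤ 6000 * δ from hC z fun j => (hz j).trans (by linarith)
  rcases σ0.eq_or_lt with h0 | σp
  · rw [← h0]; linarith
  set x := 100 * σ with hx
  set r := 1 - x with hr
  have hx1 : x ≤ 1/10^5 := by linarith
  have hr0 : 0 < r := by linarith
  let c : (Fin 3 → Bool) → Fin 3 → ℝ := fun b i => (1 - x) * (1 - sgb b i * X b i i) + x * (50 * σ)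
  have hc0 : ∀ b i, 0 ≤ c b i := fun b i => by
    have := hXd b i i
    have : 0 ≤ (1 - x) * (1 - sgb b i * X b i i) := mul_nonneg (by linarith) this
    simp only [c]; positivity
  have hcle : ∀ b i, c b i ≤ 25/24 * s b i + 5000 * σ^2 := fun b i => by
    have := hXi b i; have := hXd b i i
    have : (1 - x) * (1 - sgb b i * X b i i) ≤ 1 - sgb b i * X b i i := by nlinarith
    have e : x * (50 * σ) = 5000 * σ^2 := by rw [hx]; ring
    simp only [c, e]; linarith
  have hcx : ∀ b i, c b i ≤ x := fun b i => by
    have := hcle b i; have := hle b i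
    nlinarith
  have hP : ∀ b i, (fun j => sgb b j * (if j = i then 1 - c b i else r)) ∈ K := by
    intro b i
    let w : V3 := fun j => sgb b j * (if j = i then 1 - 50 * σ else (1 - x)/x * (1 - sgb b j * X b i j))
    have hw : w ∈ K := by
      refine hC _ fun j => ?_
      have : |w j| = |if j = i then 1 - 50 * σ else (1 - x)/x * (1 - sgb b j * X b i j)| := by
        simp only [w]; rw [abs_mul]; rcases sgb_sign b j with h | h <;> rw [h] <;> simp
      rw [this]
      split_ifs with h
      · rw [abs_of_nonneg (by linarith)]
      · have a := hXd b i j; have a' := hXj b i j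
        have xp : 0 < x := by linarith
        rw [abs_of_nonneg (by have : 0 ≤ (1-x)/x := div_nonneg (by linarith) xp.le
                              positivity)]
        rw [div_mul_eq_mul_div, div_le_iff₀ xp]
        nlinarith
    have := hK.convex (hXK b i) hw (by linarith : 0 ≤ 1 - x) (by linarith : 0 ≤ x) (by ring)
    convert this using 1
    ext j
    have ee : sgb b j * sgb b j = 1 := by rcases sgb_sign b j with h | h <;> simp [h]
    have xn : x ≠ 0 := by linarith
    simp only [Pi.add_apply, Pi.smul_apply, smul_eq_mul, w, c]
    split_ifs with h
    · subst h; linear_combination (1 - x) * X b j j * ee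
    · have : x * (sgb b j * ((1 - x) / x * (1 - sgb b j * X b i j))) = (1-x) * (sgb b j * (1 - sgb b j * X b i j)) := by field_simp
      rw [this, hr]; linear_combination (1 - x) * X b i j * ee
  have hPi : ∀ (i : Fin 3) (a b : Bool), ins i (1 - c (Bi i a b) i) ![(if a then 1 else -1) * r, (if b then 1 else -1) * r] ∈ K := by
    intro i a b
    convert hP (Bi i a b) i using 1
    refine ext_succ i ?_ fun k => ?_
    · simp [sgb, Bi]
    · rw [ins_succ]
      simp only [Fin.succAbove_ne, if_false]
      have : Bi i a b (i.succAbove k) = ![a, b] k := by simp [Bi]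
      unfold sgb
      rw [this]
      cases a <;> cases b <;> fin_cases k <;> simp
  have hbody := body_side hK hr0 (x := x) (by linarith) rfl (fun z hz => hC z fun j => (hz j).trans (by linarith)) he
    (c1 := fun i => c (Bi i true true) i) (c2 := fun i => c (Bi i true false) i) (c3 := fun i => c (Bi i false true) i) (c4 := fun i => c (Bi i false false) i)
    (fun i => hcx _ _) (fun i => hcx _ _) (fun i => hcx _ _) (fun i => hcx _ _)
    (fun i => by simpa using hPi i true true) (fun i => by simpa using hPi i true false) (fun i => by simpa using hPi i false true) (fun i => by simpa using hPi i false false)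
  have hpol := pol_side hK.pol_body (s := s) (fun y hy => by
      intro w hw
      rw [dot3]
      have a0 := h1 w hw 0; have a1 := h1 w hw 1; have a2 := h1 w hw 2
      have q : ∀ j, w j * y j ≤ |y j| := fun j => by
        refine (le_abs_self _).trans ?_
        rw [abs_mul]; exact mul_le_of_le_one_left (abs_nonneg _) (h1 w hw j)
      have := q 0; have := q 1; have := q 2
      have hy' : |y 0| + |y 1| + |y 2| ≤ 1 := hy
      linarith) hs0 (fun b i => (hs1 b i).trans_lt (by norm_num)) (fun b i => by simp [hs])
  set S := ∑ b, ∑ i, s b i with hS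
  have hS1 : σ ≤ S := by
    rw [hσ, hS]
    exact (Finset.single_le_sum (f := fun i => s b0 i) (fun i _ => hs0 _ _) (Finset.mem_univ i0)).trans
      (Finset.single_le_sum (f := fun b => ∑ i, s b i) (fun b _ => Finset.sum_nonneg fun i _ => hs0 _ _) (Finset.mem_univ b0))
  have hS2 : S ≤ 24 * σ := by
    calc S ≤ ∑ b : Fin 3 → Bool, ∑ i : Fin 3, σ := Finset.sum_le_sum fun b _ => Finset.sum_le_sum fun i _ => hle _ _
      _ = _ := by simp; ring
  have hSB := sum_Bi s (fun b i => by
    simp only [hs]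
    rw [uu_not, hK.pol_body.gauge_neg])
  refine local_alg hS1 hS2 σ0 σ1 ?_ hpol hv
  refine le_trans ?_ hbody
  have t0 : 0 ≤ ∑ i, (c (Bi i true true) i + c (Bi i true false) i + c (Bi i false true) i + c (Bi i false false) i) :=
    Finset.sum_nonneg fun i _ => by linarith [hc0 (Bi i true true) i, hc0 (Bi i true false) i, hc0 (Bi i false true) i, hc0 (Bi i false false) i]
  have t1 : ∑ i, (c (Bi i true true) i + c (Bi i true false) i + c (Bi i false true) i + c (Bi i false false) i) ≤ 25/48 * S + 60000 * σ^2 := by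
    rw [← hS] at hSB
    rw [hSB]
    rw [Fin.sum_univ_three, Fin.sum_univ_three]
    have q := fun i => hcle (Bi i true true) i
    have q2 := fun i => hcle (Bi i true false) i
    have q3 := fun i => hcle (Bi i false true) i
    have q4 := fun i => hcle (Bi i false false) i
    linarith [q 0, q 1, q 2, q2 0, q2 1, q2 2, q3 0, q3 1, q3 2, q4 0, q4 1, q4 2]
  generalize ∑ i, (c (Bi i true true) i + c (Bi i true false) i + c (Bi i false true) i + c (Bi i false false) i) = Sc at *
  have t2 : r^2 * Sc ≤ Sc := by
    have : r^2 ≤ 1 := by nlinarith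
    nlinarith
  have t3 : 8 * r^3 + 24 * r^2 * x = 8 - 24 * x^2 + 16 * x^3 := by rw [hr]; ring
  have t4 : 0 ≤ x^3 := by positivity
  have t5 : x^2 = 10000 * σ^2 := by rw [hx]; ring
  rw [t3, t5]
  linarith
end Mah

namespace Mah
open Topology

/-- determinant position -/
def DP (K : Set V3) : Prop := (∀ x ∈ K, ∀ i, |x i| ≤ 1) ∧ ∀ Y : Matrix (Fin 3) (Fin 3) ℝ, (∀ i, Y i ∈ pol K) → Y.det ≤ 1

theorem ins10_dot (i : Fin 3) (l : V3) : ins i 1 0 ⬝ᵥ l = l i := by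
  rw [dot_ins]; simp

theorem DP.he {K : Set V3} (hK : Body K) (h : DP K) (i : Fin 3) : ins i 1 0 ∈ K := by
  refine hK.mem_of fun l hl => ?_
  rw [ins10_dot]
  have := h.2 ((1 : Matrix (Fin 3) (Fin 3) ℝ).updateRow i l) (fun j => ?_)
  · rw [Matrix.det_fin_three] at this
    fin_cases i <;> simp [Matrix.updateRow_apply, Matrix.one_apply] at this ⊢ <;> exact this
  · by_cases hj : j = i
    · subst hj; rw [Matrix.updateRow_self]; exact hl
    · rw [Matrix.updateRow_ne hj]
      intro x hx
      have := (abs_le.1 (h.1 x hx j)).2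
      rw [dot3]
      fin_cases j <;> simpa [Matrix.one_apply] using this

theorem exists_DP {K : Set V3} (hK : Body K) : ∃ e : V3 ≃ₗ[ℝ] V3, DP (e ⁻¹' K) := by
  have hL := hK.pol_body
  have hc : IsCompact (Set.pi Set.univ fun _ : Fin 3 => pol K) := isCompact_univ_pi fun _ => hL.compact
  have hcont : Continuous fun W : Fin 3 → V3 => (Matrix.of W).det := by
    simp only [Matrix.det_fin_three, Matrix.of_apply]; fun_prop
  obtain ⟨W, hW, hmax⟩ := hc.exists_isMaxOn ⟨fun _ => 0, fun _ _ => hL.zero_mem⟩ hcont.continuousOn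
  obtain ⟨r, hr, hball⟩ := hL.ball_sub
  have hpos : 0 < (Matrix.of W).det := by
    have : (fun j => r • (1 : Matrix (Fin 3) (Fin 3) ℝ) j) ∈ Set.pi Set.univ fun _ : Fin 3 => pol K := by
      intro j _
      refine hball ?_
      rw [mem_closedBall_zero_iff, pi_norm_le_iff_of_nonneg hr.le]
      intro k
      simp only [Pi.smul_apply, smul_eq_mul, Matrix.one_apply]
      split_ifs <;> simp [abs_of_pos hr, hr.le]
    have h2 := hmax this
    refine lt_of_lt_of_le ?_ h2
    have e : (Matrix.of fun j => r • (1 : Matrix (Fin 3) (Fin 3) ℝ) j) = r • (1 : Matrix (Fin 3) (Fin 3) ℝ) := rfl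
    show 0 < (Matrix.of fun j => r • (1 : Matrix (Fin 3) (Fin 3) ℝ) j).det
    rw [e, Matrix.det_smul]; simp; positivity
  set M := Matrix.of W
  haveI : Invertible M := M.invertibleOfIsUnitDet (isUnit_iff_ne_zero.2 hpos.ne')
  let m := Matrix.toLinearEquiv' M this
  have hm : ∀ x, m x = M.mulVec x := fun x => rfl
  have hmi : ∀ x i, m x i = x ⬝ᵥ W i := fun x i => by rw [hm, dotProduct_comm]; rfl
  refine ⟨m.symm, ?_, ?_⟩
  · intro x hx i
    have h1 : m.symm x ∈ K := hx
    have := abs_dot_le hK h1 (hW i trivial)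
    rwa [← hmi, LinearEquiv.apply_symm_apply] at this
  · intro Y hY
    have h2 : (Y * M).det ≤ M.det := by
      refine hmax (a := fun i => (Y * M) i) fun i _ => ?_
      intro x hx
      have := hY i (m x) (by show m.symm (m x) ∈ K; simpa using hx)
      have e : x ⬝ᵥ (Y * M) i = m x ⬝ᵥ Y i := by
        have := fun j => hmi x j
        rw [dot3, dot3, this, this, this, dot3, dot3, dot3]
        simp [Matrix.mul_apply, Fin.sum_univ_three, M]; ring
      show x ⬝ᵥ (Y * M) i ≤ 1
      rwa [e]
    rw [Matrix.det_mul] at h2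
    nlinarith

def Cb : Set V3 := {x | ∀ j, |x j| ≤ 1}

theorem Cb_body : Body Cb where
  compact := by
    have : Cb = Set.Icc (fun _ => -1) (fun _ => 1) := by
      ext y; simp only [Cb, Set.mem_setOf_eq, abs_le, Set.mem_Icc, Pi.le_def, forall_and]
    rw [this]; exact isCompact_Icc
  convex := by
    have : Cb = Set.Icc (fun _ => -1) (fun _ => 1) := by
      ext y; simp only [Cb, Set.mem_setOf_eq, abs_le, Set.mem_Icc, Pi.le_def, forall_and]
    rw [this]; exact convex_Icc _ _
  symm := fun x hx j => by simpa using hx j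
  nhds := by
    refine Filter.mem_of_superset (Metric.ball_mem_nhds 0 one_pos) fun x hx j => ?_
    rw [mem_ball_zero_iff] at hx
    exact (norm_le_pi_norm x j).trans hx.le

theorem vol_Cb : vol Cb = 8 := by
  show vol {x : V3 | ∀ j, |x j| ≤ 1} = 8
  rw [vol_box3 one_pos]; norm_num

theorem eq_of_vol {K M : Set V3} (hK : Body K) (hM : Body M) (h : K ⊆ M) (hv : vol M ≤ vol K) : M ⊆ K := by
  by_contra hne
  obtain ⟨z, hz, hzK⟩ := Set.not_subset.1 hne
  have hg : 1 < gauge K z := by by_contra! hh; exact hzK (hK.gauge_le_one.1 hh)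
  -- scale z slightly down
  set g := gauge K z
  let t := (1 + g⁻¹) / 2
  have g0 : 0 < g := by linarith
  have hg1 : g⁻¹ < 1 := inv_lt_one_of_one_lt₀ hg
  have hg2 : 0 < g⁻¹ := by positivity
  have ht0 : 0 < t := by simp only [t]; linarith
  have ht1 : t < 1 := by simp only [t]; linarith
  have htg : 1 < gauge K (t • z) := by
    rw [Body.gauge_smul' ht0.le]
    have : t * g = (g + 1)/2 := by simp only [t]; field_simp
    show 1 < t * g
    linarith
  let U := interior M ∩ {x | 1 < gauge K x}
  have hUo : IsOpen U := isOpen_interior.inter (isOpen_lt continuous_const hK.cont_gauge)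
  have htz : t • z ∈ interior M := by
    have h0 : (0 : V3) ∈ interior M := mem_interior_iff_mem_nhds.2 hM.nhds
    have := hM.convex.combo_self_interior_mem_interior hz h0 ht0.le (by linarith : 0 < 1 - t) (by ring)
    simpa using this
  have hUp : 0 < volume U := hUo.measure_pos _ ⟨_, htz, htg⟩
  have hd : Disjoint K U := Set.disjoint_left.2 fun x hx hx' => absurd (hK.gauge_le_one.2 hx) (not_le.2 hx'.2)
  have h1 : volume K + volume U ≤ volume M := by
    rw [← measure_union hd hUo.measurableSet]
    exact measure_mono (Set.union_subset h (Set.inter_subset_left.trans interior_subset))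
  have h2 : volume K = volume M := by
    refine le_antisymm (measure_mono h) ((ENNReal.toReal_le_toReal hM.vol_ne_top hK.vol_ne_top).1 hv)
  rw [h2] at h1
  have := ENNReal.add_lt_add_left hM.vol_ne_top hUp
  rw [add_zero] at this
  exact absurd h1 (not_le.2 this)

theorem cube_data {K : Set V3} (hK : Body K) {A : Matrix (Fin 3) (Fin 3) ℝ} (hA : ∀ x, x ∈ K ↔ ∀ i, |(A.mulVec x) i| ≤ 1) :
    A.det ≠ 0 ∧ vol K = |A.det|⁻¹ * 8 := by
  have h0 : A.det ≠ 0 := by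
    intro h
    obtain ⟨v, hv, hv0⟩ := Matrix.exists_mulVec_eq_zero_iff.2 h
    obtain ⟨R, hR, hb⟩ := hK.bdd
    have hp : 0 < ‖v‖ := norm_pos_iff.2 hv
    have := hb ((2 * R / ‖v‖) • v) ((hA _).2 fun i => by rw [Matrix.mulVec_smul, hv0]; simp)
    rw [norm_smul, Real.norm_of_nonneg (by positivity), div_mul_cancel₀ _ hp.ne'] at this
    linarith
  refine ⟨h0, ?_⟩
  haveI : Invertible A := A.invertibleOfIsUnitDet (isUnit_iff_ne_zero.2 h0)
  let m := Matrix.toLinearEquiv' A this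
  have e : K = m ⁻¹' Cb := by ext x; exact hA x
  have hm : LinearMap.det (m : V3 →ₗ[ℝ] V3) = A.det := by
    have : (m : V3 →ₗ[ℝ] V3) = Matrix.toLin' A := rfl
    rw [this, LinearMap.det_toLin']
  rw [e, vol_comap, hm, vol_Cb]

theorem DP_cube {K : Set V3} (hK : Body K) (h : DP K) (hc : IsCube K) : Cb ⊆ K := by
  obtain ⟨A, hA⟩ := hc
  obtain ⟨h0, hv⟩ := cube_data hK hA
  have hrow : ∀ i, A i ∈ pol K := fun i x hx => by
    have := (abs_le.1 ((hA x).1 hx i)).2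
    rw [dotProduct_comm]; exact this
  have hd : |A.det| ≤ 1 := by
    rw [abs_le]
    refine ⟨?_, h.2 A hrow⟩
    have := h.2 (-A) fun i => hK.pol_body.symm _ (hrow i)
    rw [Matrix.det_neg] at this
    simp at this; linarith
  refine eq_of_vol hK Cb_body (fun x hx => h.1 x hx) ?_
  rw [vol_Cb, hv]
  have := (one_le_inv₀ (abs_pos.2 h0)).2 hd
  linarith

def Nr (t : ℝ) (K M : Set V3) : Prop := ∀ x ∈ M, t⁻¹ • x ∈ K

theorem Nr.pol {t : ℝ} {K M : Set V3} (h : Nr t K M) : Nr t (pol M) (pol K) := fun y hy x hx => by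
  have := hy _ (h x hx)
  rwa [smul_dotProduct, ← dotProduct_smul] at this

theorem Nr.comap {t : ℝ} {K M : Set V3} (h : Nr t K M) (e : V3 ≃ₗ[ℝ] V3) : Nr t (e ⁻¹' K) (e ⁻¹' M) := fun x hx => by
  have := h _ hx
  rwa [← map_smul] at this

theorem Nr.vol {t : ℝ} (ht : 0 < t) {K M : Set V3} (hK : Body K) (h : Nr t K M) : vol M ≤ t^3 * vol K := by
  rw [← vol_smul K ht.le]
  refine vol_mono (fun x hx => ⟨t⁻¹ • x, h x hx, by simp [smul_smul, ht.ne']⟩) ?_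
  exact (hK.compact.smul t).measure_lt_top.ne

theorem Nr.vp {t : ℝ} (ht : 0 < t) {K M : Set V3} (hK : Body K) (h : Nr t K M) (h' : Nr t M K) : vp M ≤ t^6 * vp K := by
  unfold Mah.vp
  have h1 := h.vol ht hK
  have h2 := h'.pol.vol ht hK.pol_body
  have := mul_le_mul h1 h2 (vol_nonneg _) (by have := vol_nonneg K; positivity)
  calc _ ≤ _ := this
    _ = _ := by ring
end Mah

namespace Mah
open Topology

theorem DP.gauge_le {K : Set V3} (hK : Body K) (h : DP K) (x : V3) : gauge K x ≤ 3 * ‖x‖ := by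
  refine hK.gauge_le_of fun l hl => ?_
  have h1 : ∀ i, x i * l i ≤ ‖x‖ := fun i => by
    have hl' := abs_dot_le hK (h.he hK i) hl
    rw [ins10_dot] at hl'
    calc x i * l i ≤ |x i * l i| := le_abs_self _
      _ = |x i| * |l i| := abs_mul _ _
      _ ≤ ‖x‖ * 1 := mul_le_mul (norm_le_pi_norm x i) hl' (abs_nonneg _) (norm_nonneg _)
      _ = ‖x‖ := mul_one _
  rw [dot3]
  linarith [h1 0, h1 1, h1 2]

theorem DP.le_gauge {K : Set V3} (hK : Body K) (h : DP K) (x : V3) : ‖x‖ ≤ gauge K x := by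
  by_cases hx : x = 0
  · subst hx; simp
  have hp := hK.gauge_pos.2 hx
  have hm := (hK.gauge_le_iff hp (x := x)).1 le_rfl
  rw [pi_norm_le_iff_of_nonneg hp.le]
  intro i
  have := h.1 _ hm i
  rw [Pi.smul_apply, smul_eq_mul, abs_mul, abs_of_pos (inv_pos.2 hp), inv_mul_le_iff₀ hp, mul_one] at this
  exact this

theorem gauge_lip {K : Set V3} (hK : Body K) (h : DP K) (x y : V3) : gauge K x ≤ gauge K y + 3 * ‖x - y‖ := by
  have := hK.gauge_add y (x - y)
  rw [add_sub_cancel] at this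
  linarith [h.gauge_le hK (x - y)]

theorem exists_lim (K : ℕ → Set V3) (hK : ∀ n, Body (K n)) (hD : ∀ n, DP (K n)) :
    ∃ M : Set V3, Body M ∧ ∀ t : ℝ, 1 < t → ∃ᶠ n in Filter.atTop, Nr t (K n) M ∧ Nr t M (K n) := by
  let U : Ultrafilter ℕ := Filter.hyperfilter ℕ
  have hU : (U : Filter ℕ) ≤ Filter.atTop := by
    rw [← Nat.cofinite_eq_atTop]; exact Filter.hyperfilter_le_cofinite
  have hc : IsCompact (Set.pi Set.univ fun x : V3 => Set.Icc (0 : ℝ) (3 * ‖x‖)) := isCompact_univ_pi fun _ => isCompact_Icc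
  obtain ⟨g, -, hg⟩ := hc.ultrafilter_le_nhds (U.map fun n => gauge (K n)) (by
    rw [Filter.le_principal_iff, Ultrafilter.coe_map, Filter.mem_map]
    refine Filter.univ_mem' fun n x _ => ⟨gauge_nonneg _, (hD n).gauge_le (hK n) x⟩)
  have hg' : ∀ x, Filter.Tendsto (fun n => gauge (K n) x) U (𝓝 (g x)) := fun x =>
    (tendsto_pi_nhds.1 (show Filter.Tendsto (fun n => gauge (K n)) U (𝓝 g) from hg)) x
  have g1 : ∀ x, ‖x‖ ≤ g x := fun x => ge_of_tendsto' (hg' x) fun n => (hD n).le_gauge (hK n) x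
  have g3 : ∀ x, g x ≤ 3 * ‖x‖ := fun x => le_of_tendsto' (hg' x) fun n => (hD n).gauge_le (hK n) x
  have gl : ∀ x y, g x ≤ g y + 3 * ‖x - y‖ := fun x y =>
    le_of_tendsto_of_tendsto' (hg' x) ((hg' y).add_const _) fun n => gauge_lip (hK n) (hD n) x y
  have ga : ∀ x y, g (x + y) ≤ g x + g y := fun x y =>
    le_of_tendsto_of_tendsto' (hg' _) ((hg' x).add (hg' y)) fun n => (hK n).gauge_add x y
  have gs : ∀ (r : ℝ) x, 0 ≤ r → g (r • x) = r * g x := fun r x hr => by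
    refine tendsto_nhds_unique (hg' _) ?_
    have := (hg' x).const_mul r
    refine this.congr fun n => (Body.gauge_smul' hr x).symm
  have gn : ∀ x, g (-x) = g x := fun x => by
    refine tendsto_nhds_unique (hg' _) ?_
    exact (hg' x).congr fun n => ((hK n).gauge_neg x).symm
  have gc : Continuous g := by
    refine (LipschitzWith.of_le_add_mul 3 fun x y => ?_).continuous
    rw [dist_eq_norm]; exact gl x y
  have hM : Body {x | g x ≤ 1} := by
    refine ⟨?_, ?_, ?_, ?_⟩
    · refine Metric.isCompact_of_isClosed_isBounded (isClosed_le gc continuous_const) ?_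
      refine (Metric.isBounded_closedBall (x := (0 : V3)) (r := 1)).subset fun x hx => ?_
      rw [mem_closedBall_zero_iff]; exact (g1 x).trans hx
    · intro x hx y hy a b ha hb hab
      have := ga (a • x) (b • y)
      rw [gs a x ha, gs b y hb] at this
      have hx' : g x ≤ 1 := hx
      have hy' : g y ≤ 1 := hy
      show g _ ≤ 1
      nlinarith
    · intro x hx; show g (-x) ≤ 1; rw [gn]; exact hx
    · refine Filter.mem_of_superset (Metric.ball_mem_nhds 0 (show (0:ℝ) < 1/3 by norm_num)) fun x hx => ?_
      rw [mem_ball_zero_iff] at hx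
      show g x ≤ 1
      linarith [g3 x]
  refine ⟨_, hM, fun t ht => ?_⟩
  have key : ∀ᶠ n in (U : Filter ℕ), ∀ x, gauge (K n) x ≤ t * g x ∧ g x ≤ t * gauge (K n) x := by
    let ε := (t - 1) / 7
    have hε : 0 < ε := by simp only [ε]; linarith
    have hS : IsCompact (Metric.sphere (0 : V3) 1) := isCompact_sphere _ _
    obtain ⟨F, hFS, hF, hcov⟩ := hS.finite_cover_balls hε
    have hev : ∀ᶠ n in (U : Filter ℕ), ∀ y ∈ F, |gauge (K n) y - g y| < ε := by
      rw [Filter.eventually_all_finite hF]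
      intro y hy
      have := (Metric.tendsto_nhds.1 (hg' y)) ε hε
      simpa [Real.dist_eq] using this
    filter_upwards [hev] with n hn
    have hsph : ∀ x, ‖x‖ = 1 → gauge (K n) x ≤ t * g x ∧ g x ≤ t * gauge (K n) x := by
      intro x hx
      have hxm : x ∈ ⋃ y ∈ F, Metric.ball y ε := hcov (by simpa using hx)
      simp only [Set.mem_iUnion, Metric.mem_ball, dist_eq_norm] at hxm
      obtain ⟨y, hy, hxy⟩ := hxm
      have hxy' := hxy
      rw [norm_sub_rev] at hxy'
      have a1 := abs_lt.1 (hn y hy)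
      have b1 := gauge_lip (hK n) (hD n) x y
      have b2 := gauge_lip (hK n) (hD n) y x
      have b3 := gl x y
      have b4 := gl y x
      have c1 := g1 x
      have c2 := (hD n).le_gauge (hK n) x
      rw [hx] at c1 c2
      have he : t = 1 + 7 * ε := by simp only [ε]; ring
      rw [he]
      constructor <;> nlinarith
    intro x
    by_cases hx : x = 0
    · subst hx
      have : g 0 = 0 := by simpa using gs 0 0 le_rfl
      simp [this]
    have hp : 0 < ‖x‖ := norm_pos_iff.2 hx
    have hi : 0 ≤ ‖x‖⁻¹ := by positivity
    have := hsph (‖x‖⁻¹ • x) (by rw [norm_smul, norm_inv, norm_norm, inv_mul_cancel₀ hp.ne'])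
    rw [Body.gauge_smul' hi, gs _ _ hi] at this
    have h4 : ∀ a b : ℝ, ‖x‖⁻¹ * a ≤ t * (‖x‖⁻¹ * b) → a ≤ t * b := fun a b h => by
      have e : t * (‖x‖⁻¹ * b) = ‖x‖⁻¹ * (t * b) := by ring
      rw [e] at h
      exact le_of_mul_le_mul_left h (by positivity)
    exact ⟨h4 _ _ this.1, h4 _ _ this.2⟩
  have key2 : ∀ᶠ n in (U : Filter ℕ), Nr t (K n) {x | g x ≤ 1} ∧ Nr t {x | g x ≤ 1} (K n) := by
    filter_upwards [key] with n hn
    have t0 : 0 < t := by linarith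
    constructor
    · intro x hx
      have hx' : g x ≤ 1 := hx
      rw [← (hK n).gauge_le_one, Body.gauge_smul' (by positivity), inv_mul_le_iff₀ t0]
      exact (hn x).1.trans (mul_le_mul_of_nonneg_left hx' t0.le)
    · intro x hx
      show g _ ≤ 1
      rw [gs _ _ (by positivity), inv_mul_le_iff₀ t0]
      exact (hn x).2.trans (mul_le_mul_of_nonneg_left ((hK n).gauge_le_one.2 hx) t0.le)
  exact Filter.Frequently.filter_mono key2.frequently hU

theorem Nr.mono {s t : ℝ} (hs : 0 < s) (hst : s ≤ t) {K M : Set V3} (hK : Body K) (h : Nr s K M) : Nr t K M := fun x hx => by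
  have := hK.smul_sub (r := s / t) (by have := hs.trans_le hst; positivity) ((div_le_one (hs.trans_le hst)).2 hst) (h x hx)
  rw [smul_smul] at this
  have e : s / t * s⁻¹ = t⁻¹ := by field_simp
  rwa [e] at this

theorem pow_lim {a b : ℝ} (k : ℕ) (h : ∀ t : ℝ, 1 < t → a ≤ t ^ k * b) : a ≤ b := by
  have h1 : Filter.Tendsto (fun t : ℝ => t ^ k * b) (𝓝[>] 1) (𝓝 (1 ^ k * b)) :=
    ((by fun_prop : Continuous fun t : ℝ => t ^ k * b).tendsto 1).mono_left nhdsWithin_le_nhds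
  rw [one_pow, one_mul] at h1
  exact ge_of_tendsto h1 (eventually_nhdsWithin_of_forall fun t ht => h t ht)

theorem claim1 {t : ℝ} (ht : 1 < t) : ∃ δ₀ > (0:ℝ), ∀ K : Set V3, Body K → DP K → vp K ≤ 32/3 * (1 + δ₀) →
    (∀ z : V3, (∀ j, |z j| ≤ t⁻¹) → z ∈ K) ∨ ∃ M, Body M ∧ IsOct M ∧ Nr t K M ∧ Nr t M K := by
  by_contra hcon
  push Not at hcon
  have hn : ∀ n : ℕ, (0:ℝ) < 1 / ((n:ℝ) + 1) := fun n => by positivity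
  choose K hK hD hv hno1 hno2 using fun n : ℕ => hcon _ (hn n)
  obtain ⟨M, hM, hf⟩ := exists_lim K hK hD
  have hMD : DP M := by
    constructor
    · intro x hx i
      refine pow_lim 1 fun s hs => ?_
      obtain ⟨n, h1, h2⟩ := (hf s hs).exists
      have := (hD n).1 _ (h1 x hx) i
      have s0 : 0 < s := by linarith
      rwa [Pi.smul_apply, smul_eq_mul, abs_mul, abs_of_pos (inv_pos.2 s0), inv_mul_le_iff₀ s0, ← pow_one s] at this
    · intro Y hY
      refine pow_lim 3 fun s hs => ?_
      obtain ⟨n, h1, h2⟩ := (hf s hs).exists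
      have s0 : 0 < s := by linarith
      have := (hD n).2 (s⁻¹ • Y) fun i => h2.pol _ (hY i)
      rw [Matrix.det_smul] at this
      simp only [Fintype.card_fin, inv_pow] at this
      rwa [inv_mul_le_iff₀ (by positivity)] at this
  have hMv : vp M ≤ 32/3 := by
    refine pow_lim 7 fun s hs => ?_
    have s0 : 0 < s := by linarith
    have hlim : ∀ᶠ n : ℕ in Filter.atTop, 1 / ((n:ℝ) + 1) < s - 1 :=
      (tendsto_one_div_add_atTop_nhds_zero_nat).eventually_lt_const (by linarith)
    obtain ⟨n, ⟨h1, h2⟩, h3⟩ := ((hf s hs).and_eventually hlim).exists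
    have h4 := h1.vp s0 (hK n) h2
    have h5 : vp (K n) ≤ 32/3 * s := (hv n).trans (by nlinarith)
    calc vp M ≤ s^6 * vp (K n) := h4
      _ ≤ s^6 * (32/3 * s) := by gcongr
      _ = _ := by ring
  obtain ⟨n, h1, h2⟩ := (hf t ht).exists
  rcases mahler_eq hM hMv with h | h
  · obtain ⟨z, hz, hzn⟩ := hno1 n
    refine hzn ?_
    have t0 : 0 < t := by linarith
    have := h1 (t • z) (DP_cube hM hMD h fun j => by
      rw [Pi.smul_apply, smul_eq_mul, abs_mul, abs_of_pos t0]
      have := mul_le_mul_of_nonneg_left (hz j) t0.le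
      rwa [mul_inv_cancel₀ t0.ne'] at this)
    rwa [smul_smul, inv_mul_cancel₀ t0.ne', one_smul] at this
  · exact hno2 n M hM h h1 h2
end Mah

namespace Mah
open Topology

theorem dot_le_oc {x y : V3} {s : ℝ} (hx : ∀ j, |x j| ≤ s) : x ⬝ᵥ y ≤ s * (|y 0| + |y 1| + |y 2|) := by
  have h1 : ∀ i, x i * y i ≤ s * |y i| := fun i => by
    calc x i * y i ≤ |x i * y i| := le_abs_self _
      _ = |x i| * |y i| := abs_mul _ _
      _ ≤ _ := mul_le_mul_of_nonneg_right (hx i) (abs_nonneg _)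
  rw [dot3]
  linarith [h1 0, h1 1, h1 2]

/-- a body containing the cube of half-side `s` has polar inside a cross-polytope -/
theorem oc_of_pol {K : Set V3} {s : ℝ} (hs : 0 ≤ s) (h : ∀ z : V3, (∀ j, |z j| ≤ s) → z ∈ K) {y : V3} (hy : y ∈ pol K) :
    s • y ∈ Oc := by
  have hsg : ∀ r : ℝ, |(if 0 ≤ r then s else -s)| ≤ s := fun r => by
    split_ifs <;> simp [abs_of_nonneg hs]
  have hm : ∀ r : ℝ, (if 0 ≤ r then s else -s) * r = |s * r| := fun r => by
    rw [abs_mul, abs_of_nonneg hs]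
    split_ifs with h
    · rw [abs_of_nonneg h]
    · rw [abs_of_neg (not_le.1 h)]; ring
  have := hy _ (h (fun j => if 0 ≤ y j then s else -s) fun j => hsg _)
  rw [dot3, hm, hm, hm] at this
  exact this

theorem pol_Cb : pol Cb = Oc := by
  ext y
  constructor
  · intro hy
    have := oc_of_pol zero_le_one (fun z hz => hz) hy
    rwa [one_smul] at this
  · intro hy x hx
    have := dot_le_oc (y := y) hx
    rw [one_mul] at this
    exact this.trans hy

theorem Oc_body : Body Oc := by rw [← pol_Cb]; exact Cb_body.pol_body
theorem pol_Oc : pol Oc = Cb := by rw [← pol_Cb]; exact Cb_body.bipolar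

theorem oct_equiv {M : Set V3} (hM : Body M) (h : IsOct M) : ∃ a : V3 ≃ₗ[ℝ] V3, M = a ⁻¹' Oc := by
  obtain ⟨A, hA⟩ := h
  have h0 : A.det ≠ 0 := by
    intro h
    obtain ⟨v, hv, hv0⟩ := Matrix.exists_mulVec_eq_zero_iff.2 h
    obtain ⟨R, hR, hb⟩ := hM.bdd
    have hp : 0 < ‖v‖ := norm_pos_iff.2 hv
    have := hb ((2 * R / ‖v‖) • v) ((hA _).2 (by rw [Matrix.mulVec_smul, hv0]; simp))
    rw [norm_smul, Real.norm_of_nonneg (by positivity), div_mul_cancel₀ _ hp.ne'] at this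
    linarith
  haveI : Invertible A := A.invertibleOfIsUnitDet (isUnit_iff_ne_zero.2 h0)
  refine ⟨Matrix.toLinearEquiv' A this, ?_⟩
  ext x
  rw [hA, Fin.sum_univ_three]; rfl

theorem hadamard3 (a1 a2 a3 b1 b2 b3 c1 c2 c3 s : ℝ) (ha : a1^2+a2^2+a3^2 ≤ s) (hb : b1^2+b2^2+b3^2 ≤ s) (hc : c1^2+c2^2+c3^2 ≤ s) :
    (a1*(b2*c3-b3*c2) + a2*(b3*c1-b1*c3) + a3*(b1*c2-b2*c1))^2 ≤ s^3 := by
  have s0 : 0 ≤ s := le_trans (by positivity) ha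
  have h1 : (a1*(b2*c3-b3*c2) + a2*(b3*c1-b1*c3) + a3*(b1*c2-b2*c1))^2 ≤
      (a1^2+a2^2+a3^2) * ((b2*c3-b3*c2)^2 + (b3*c1-b1*c3)^2 + (b1*c2-b2*c1)^2) := by
    nlinarith [sq_nonneg (a1*(b3*c1-b1*c3) - a2*(b2*c3-b3*c2)), sq_nonneg (a1*(b1*c2-b2*c1) - a3*(b2*c3-b3*c2)),
      sq_nonneg (a2*(b1*c2-b2*c1) - a3*(b3*c1-b1*c3))]
  have h2 : (b2*c3-b3*c2)^2 + (b3*c1-b1*c3)^2 + (b1*c2-b2*c1)^2 ≤ (b1^2+b2^2+b3^2)*(c1^2+c2^2+c3^2) := by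
    nlinarith [sq_nonneg (b1*c1+b2*c2+b3*c3)]
  have h3 : (b1^2+b2^2+b3^2)*(c1^2+c2^2+c3^2) ≤ s * s := mul_le_mul hb hc (by positivity) s0
  calc _ ≤ _ := h1
    _ ≤ s * (s * s) := mul_le_mul ha (h2.trans h3) (by positivity) s0
    _ = s^3 := by ring

theorem claim2 {s : ℝ} (hs : 0 < s) (f : V3 ≃ₗ[ℝ] V3) (h1 : Nr s (f ⁻¹' Cb) Oc) (h2 : Nr s Oc (f ⁻¹' Cb)) : 36 ≤ 27 * s^12 := by
  have hv := h2.vol hs Oc_body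
  rw [vol_comap, vol_Cb, vol_Oc] at hv
  set D := LinearMap.det (f : V3 →ₗ[ℝ] V3) with hD
  have hD0 : 0 < |D| := abs_pos.2 (det_ne f)
  rw [inv_mul_le_iff₀ hD0] at hv
  let A := LinearMap.toMatrix' (f : V3 →ₗ[ℝ] V3)
  have hA : A.det = D := by rw [hD, ← LinearMap.det_toMatrix']
  have hent : ∀ i j, (A i j)^2 ≤ s^2 := fun i j => by
    have hj : (Pi.single j 1 : V3) ∈ Oc := by
      show |(Pi.single j 1 : V3) 0| + |(Pi.single j 1 : V3) 1| + |(Pi.single j 1 : V3) 2| ≤ 1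
      fin_cases j <;> simp [Pi.single_apply]
    have := h1 _ hj
    have h3 : |f (s⁻¹ • (Pi.single j 1 : V3)) i| ≤ 1 := this i
    rw [map_smul, Pi.smul_apply, smul_eq_mul, abs_mul, abs_of_pos (inv_pos.2 hs), inv_mul_le_iff₀ hs, mul_one] at h3
    have h4 : A i j = f (Pi.single j 1) i := by
      simp [A, LinearMap.toMatrix'_apply]
    rw [h4, ← sq_abs]
    gcongr
  have hh := hadamard3 (A 0 0) (A 0 1) (A 0 2) (A 1 0) (A 1 1) (A 1 2) (A 2 0) (A 2 1) (A 2 2) (3 * s^2)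
    (by linarith [hent 0 0, hent 0 1, hent 0 2]) (by linarith [hent 1 0, hent 1 1, hent 1 2]) (by linarith [hent 2 0, hent 2 1, hent 2 2])
  have hd : (A 0 0*(A 1 1*A 2 2-A 1 2*A 2 1) + A 0 1*(A 1 2*A 2 0-A 1 0*A 2 2) + A 0 2*(A 1 0*A 2 1-A 1 1*A 2 0)) = D := by
    rw [← hA, Matrix.det_fin_three]; ring
  rw [hd, ← sq_abs] at hh
  have h6 : 6 ≤ |D| * s^3 := by linarith
  have : (6:ℝ)^2 ≤ (|D| * s^3)^2 := by gcongr
  calc (36:ℝ) ≤ |D|^2 * s^6 := by linarith [this, (by ring : (|D| * s^3)^2 = |D|^2 * s^6)]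
    _ ≤ (3 * s^2)^3 * s^6 := by gcongr
    _ = _ := by ring

theorem Nr.trans {t : ℝ} {K M N : Set V3} (h : Nr t K M) (h' : Nr t M N) : Nr (t^2) K N := fun x hx => by
  have := h _ (h' x hx)
  rwa [smul_smul, ← mul_inv, ← pow_two] at this

theorem claim2' {t : ℝ} (ht : 0 < t) {K M M' : Set V3} (hM : Body M) (hM' : Body M') (hoM : IsOct M) (hoM' : IsOct M')
    (h1 : Nr t K M) (h2 : Nr t M K) (e : V3 ≃ₗ[ℝ] V3) (h3 : Nr t (e ⁻¹' pol K) M') (h4 : Nr t M' (e ⁻¹' pol K)) :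
    36 ≤ 27 * t^24 := by
  obtain ⟨a, rfl⟩ := oct_equiv hM hoM
  obtain ⟨b, rfl⟩ := oct_equiv hM' hoM'
  have p1 := (h1.pol.comap e).trans h3
  have p2 := h4.trans (h2.pol.comap e)
  rw [pol_comap, pol_Oc] at p1 p2
  have q1 := p1.comap b.symm
  have q2 := p2.comap b.symm
  have e1 : b.symm ⁻¹' (b ⁻¹' Oc) = Oc := by ext x; simp
  have e2 : b.symm ⁻¹' (e ⁻¹' (tr a.symm ⁻¹' Cb)) = ((b.symm.trans e).trans (tr a.symm)) ⁻¹' Cb := rfl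
  rw [e1, e2] at q1 q2
  have := claim2 (by positivity) _ q1 q2
  calc _ ≤ _ := this
    _ = _ := by ring

theorem stab3 : ∃ δ₀ > (0:ℝ), δ₀ ≤ 1/12000 ∧ ∀ K : Set V3, Body K → ∀ δ : ℝ, 0 < δ → δ < δ₀ → vp K ≤ 32/3 * (1 + δ) →
    (∃ e : V3 ≃ₗ[ℝ] V3, (∀ x ∈ Cb, e x ∈ K) ∧ ∀ x, e x ∈ K → (1 - 6000 * δ) • x ∈ Cb) ∨
    (∃ e : V3 ≃ₗ[ℝ] V3, (∀ x ∈ Oc, e x ∈ K) ∧ ∀ x, e x ∈ K → (1 - 6000 * δ) • x ∈ Oc) := by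
  let t : ℝ := (1 - 1/10^7)⁻¹
  have ht : 1 < t := by simp only [t]; norm_num
  have hti : t⁻¹ = 1 - 1/10^7 := inv_inv _
  obtain ⟨δ₀, hδ₀, hc⟩ := claim1 ht
  rw [hti] at hc
  refine ⟨min δ₀ (1/12000), lt_min hδ₀ (by norm_num), min_le_right _ _, fun K hK δ hδ hδ1 hv => ?_⟩
  have hd1 : δ < δ₀ := hδ1.trans_le (min_le_left _ _)
  have hd2 : δ < 1/12000 := hδ1.trans_le (min_le_right _ _)
  have hs : 0 < 1 - 6000 * δ := by linarith
  obtain ⟨e1, h1⟩ := exists_DP hK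
  have hB1 := hK.comap e1
  have hv1 : vp (e1 ⁻¹' K) ≤ 32/3 * (1 + δ) := by rwa [vp_comap]
  rcases hc _ hB1 h1 (hv1.trans (by linarith)) with hcu | ⟨M, hM, hoM, n1, n2⟩
  · left
    let sc : V3 ≃ₗ[ℝ] V3 := LinearEquiv.smulOfNeZero ℝ V3 _ hs.ne'
    refine ⟨sc.trans e1, fun x hx => ?_, fun x hx => h1.1 _ hx⟩
    refine local_stab hB1 h1.1 (h1.he hB1) hcu hδ.le hv1 (z := (1 - 6000 * δ) • x) fun j => ?_
    rw [Pi.smul_apply, smul_eq_mul, abs_mul, abs_of_pos hs]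
    exact mul_le_of_le_one_right hs.le (hx j)
  · right
    have hL := hK.pol_body
    obtain ⟨e2, h2⟩ := exists_DP hL
    have hB2 := hL.comap e2
    have hv2 : vp (e2 ⁻¹' pol K) ≤ 32/3 * (1 + δ) := by
      rw [vp_comap]
      unfold vp at hv ⊢
      rw [hK.bipolar, mul_comm]; exact hv
    have hpp : pol (e2 ⁻¹' pol K) = tr e2.symm ⁻¹' K := by rw [pol_comap, hK.bipolar]
    rcases hc _ hB2 h2 (hv2.trans (by linarith)) with hcu | ⟨M', hM', hoM', n3, n4⟩
    · refine ⟨tr e2.symm, fun x hx => ?_, fun x hx => ?_⟩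
      · have : x ∈ pol (e2 ⁻¹' pol K) := fun y hy => by
          have := dot_le_oc (y := x) (h2.1 y hy)
          rw [one_mul] at this
          exact this.trans hx
        rw [hpp] at this; exact this
      · have : x ∈ pol (e2 ⁻¹' pol K) := by rw [hpp]; exact hx
        refine oc_of_pol hs.le (fun z hz => ?_) this
        exact local_stab hB2 h2.1 (h2.he hB2) hcu hδ.le hv2 hz
    · exfalso
      have ee : (e2.trans (tr e1.symm).symm) ⁻¹' pol (e1 ⁻¹' K) = e2 ⁻¹' pol K := by
        rw [pol_comap]; ext x; simp
      have := claim2' (by linarith) hM hM' hoM hoM' n1 n2 (e2.trans (tr e1.symm).symm) (by rw [ee]; exact n3) (by rw [ee]; exact n4)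
      simp only [t] at this
      norm_num at this
end Mah

theorem dBM_le {K : Set (EuclideanSpace ℝ (Fin 3))} {L : Set (EuclideanSpace ℝ (Fin 3))} {K' L' : Set Mah.V3}
    (hKK : ∀ x, x ∈ K' ↔ WithLp.toLp 2 x ∈ K) (hLL : ∀ x, x ∈ L' ↔ WithLp.toLp 2 x ∈ L) {δ : ℝ} (hδ : 0 < δ) (hδ1 : δ ≤ 1/12000)
    (e : Mah.V3 ≃ₗ[ℝ] Mah.V3) (h1 : ∀ x ∈ L', e x ∈ K') (h2 : ∀ x, e x ∈ K' → (1 - 6000 * δ) • x ∈ L') :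
    dBM K L ≤ 1 + 12000 * δ := by
  have hs : 0 < 1 - 6000 * δ := by linarith
  have hle : (1 - 6000 * δ)⁻¹ ≤ 1 + 12000 * δ := by
    rw [inv_le_iff_one_le_mul₀ hs]; nlinarith
  refine le_trans ?_ hle
  refine csInf_le ⟨1, fun d hd => hd.1⟩ ⟨(one_le_inv₀ hs).2 (by linarith), ?_⟩
  let w := WithLp.linearEquiv 2 ℝ Mah.V3
  refine ⟨(w.trans e.symm).trans w.symm, ?_, ?_⟩
  · intro x hx
    have hx' : w x ∈ L' := (hLL _).2 hx
    refine ⟨w.symm (e (w x)), (hKK _).1 (h1 _ hx'), ?_⟩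
    simp
  · rintro _ ⟨x, hx, rfl⟩
    have hx' : w x ∈ K' := (hKK _).2 hx
    have := h2 (e.symm (w x)) (by simpa using hx')
    refine ⟨w.symm ((1 - 6000 * δ) • e.symm (w x)), (hLL _).1 this, ?_⟩
    simp [smul_smul, hs.ne']

/-- Stability of the three-dimensional Mahler inequality: there are absolute constants
`δ₀, C > 0` such that every symmetric convex body `K ⊂ ℝ³` with
`|K| |K°| ≤ (1+δ)(32/3)` for some `δ ∈ (0, δ₀)` satisfies
`min(d_BM(K, B∞³), d_BM(K, B₁³)) ≤ 1 + C δ`. -/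
theorem mahler_stability_dim3 :
    ∃ δ₀ > (0 : ℝ), ∃ C > (0 : ℝ),
      ∀ K : Set (EuclideanSpace ℝ (Fin 3)),
        IsCompact K → Convex ℝ K → K = -K → (interior K).Nonempty →
        ∀ δ : ℝ, 0 < δ → δ < δ₀ →
        (volume K).toReal *
            (volume {y : EuclideanSpace ℝ (Fin 3) | ∀ x ∈ K, ⟪x, y⟫ ≤ 1}).toReal ≤
          (1 + δ) * (32 / 3) →
        min (dBM K {x : EuclideanSpace ℝ (Fin 3) | ∀ i, |x i| ≤ 1})
            (dBM K {x : EuclideanSpace ℝ (Fin 3) | ∑ i, |x i| ≤ 1}) ≤ 1 + C * δ := by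
  obtain ⟨δ₀, hδ₀, hδ₁, hst⟩ := Mah.stab3
  refine ⟨δ₀, hδ₀, 12000, by norm_num, fun K hc hconv hsym hintr δ hδ hδ2 hv => ?_⟩
  let K' : Set Mah.V3 := {x | WithLp.toLp 2 x ∈ K}
  have hcont : Continuous (fun x : Mah.V3 => (WithLp.toLp 2 x : EuclideanSpace ℝ (Fin 3))) := PiLp.continuous_toLp 2 _
  have hneg : ∀ x ∈ K, -x ∈ K := fun x hx => by rw [hsym] at hx; exact hx
  have h0 : (0 : EuclideanSpace ℝ (Fin 3)) ∈ interior K := by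
    obtain ⟨x, hx⟩ := hintr
    have hx' : -x ∈ K := hneg x (interior_subset hx)
    have := hconv.combo_interior_self_mem_interior hx hx' (by norm_num : (0:ℝ) < 1/2) (by norm_num : (0:ℝ) ≤ 1/2) (by norm_num)
    simpa using this
  have hB : Mah.Body K' := by
    refine ⟨?_, ?_, ?_, ?_⟩
    · have : K' = WithLp.ofLp '' K := by
        ext x
        exact ⟨fun h => ⟨_, h, rfl⟩, by rintro ⟨y, hy, rfl⟩; exact hy⟩
      rw [this]
      exact hc.image (PiLp.continuous_ofLp 2 _)
    · exact hconv.linear_preimage (WithLp.linearEquiv 2 ℝ Mah.V3).symm.toLinearMap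
    · intro x hx; exact hneg _ hx
    · refine hcont.continuousAt.preimage_mem_nhds ?_
      exact mem_interior_iff_mem_nhds.1 h0
  have hvol : ∀ S : Set (EuclideanSpace ℝ (Fin 3)), MeasurableSet S → Mah.vol {x : Mah.V3 | WithLp.toLp 2 x ∈ S} = (volume S).toReal := by
    intro S hS
    have := (PiLp.volume_preserving_toLp (Fin 3)).measure_preimage hS.nullMeasurableSet
    unfold Mah.vol
    rw [← this]; rfl
  have hv' : Mah.vp K' ≤ 32/3 * (1 + δ) := by
    have hp : Mah.pol K' = {y : Mah.V3 | WithLp.toLp 2 y ∈ {y : EuclideanSpace ℝ (Fin 3) | ∀ x ∈ K, ⟪x, y⟫ ≤ 1}} := by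
      ext y
      have hi : ∀ x : EuclideanSpace ℝ (Fin 3), ⟪x, (WithLp.toLp 2 y : EuclideanSpace ℝ (Fin 3))⟫ = x.ofLp ⬝ᵥ y := fun x => by
        rw [EuclideanSpace.inner_eq_star_dotProduct]; simp [dotProduct_comm]
      constructor
      · intro h x hx
        rw [hi]; exact h _ hx
      · intro h x hx
        have := h _ hx
        rwa [hi] at this
    have hm : MeasurableSet {y : EuclideanSpace ℝ (Fin 3) | ∀ x ∈ K, ⟪x, y⟫ ≤ 1} := by
      refine IsClosed.measurableSet ?_
      simp only [Set.setOf_forall]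
      exact isClosed_iInter fun x => isClosed_iInter fun _ => isClosed_le (by fun_prop) continuous_const
    unfold Mah.vp
    rw [hp, hvol _ hm, hvol K hc.isClosed.measurableSet]
    linarith
  rcases hst K' hB δ hδ hδ2 hv' with ⟨e, h1, h2⟩ | ⟨e, h1, h2⟩
  · exact (min_le_left _ _).trans (dBM_le (fun x => Iff.rfl) (fun x => Iff.rfl) hδ (hδ2.le.trans hδ₁) e h1 h2)
  · refine (min_le_right _ _).trans (dBM_le (fun x => Iff.rfl) (fun x => ?_) hδ (hδ2.le.trans hδ₁) e h1 h2)
    simp only [Mah.Oc, Set.mem_setOf_eq, Fin.sum_univ_three]
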